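/- Assume d ≥ 2, k ∈ {1,…,⌊d/2⌋}, 2 < p < 2_⋆^k, and let (g_ε) be (s,γ)-admissible for some s > d/(d+1) and γ > 1. Then there exists ε₀ = ε₀(p,d,k,s,γ, admissibility constants) > 0 such that for all 0 < ε < ε₀: max(R^∘_ε(p), R^1_ε(p)) < R^2_ε(p) < R^3_ε(p) < ⋯ < R^k_ε(p); moreover R^k_ε(p) < R^j_ε(p) for every j with k < j ≤ ⌊d/2⌋; R^j_ε(p) ≤ R^rad_ε(p) for every j with k < j ≤ ⌊d/2⌋; R^k_ε(p) < R^rad_ε(p); and R^rad_ε(p) < ∞. In addition, for each such ε the infima R^∘_ε(p), R^rad_ε(p), and R^j_ε(p) for every j ∈ {2,…,⌊d/2⌋}, are attained at some nonzero function in the respective class. -/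

import Mathlib

open MeasureTheory Real Filter
open scoped ENNReal FourierTransform RealInnerProductSpace Topology

noncomputable section

/-- Euclidean space `ℝ^d`. -/
abbrev Rd (d : ℕ) : Type := EuclideanSpace ℝ (Fin d)

/-- `U` is the (distributional, hence `L²`-) Fourier transform of `u`:
it pairs against Schwartz functions the way the Fourier transform of `u` must. -/
def IsFT {d : ℕ} (U u : Rd d → ℂ) : Prop :=
  ∀ φ : SchwartzMap (Rd d) ℂ, ∫ ξ, U ξ * φ ξ = ∫ x, u x * 𝓕 (⇑φ) x

/-- An element of `H^s(ℝ^d)`: an `L²` function `toFun` together with its Fourier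
transform `ft`, satisfying the `H^s` integrability condition. -/
structure HsFn (d : ℕ) (s : ℝ) where
  toFun : Rd d → ℂ
  ft : Rd d → ℂ
  memL2 : MemLp toFun 2 volume
  ft_memL2 : MemLp ft 2 volume
  isFT : IsFT ft toFun
  memHs : Integrable (fun ξ : Rd d => ‖ft ξ‖ ^ 2 * (1 + ‖ξ‖ ^ 2) ^ s) volume

/-- The quadratic form `q_ε(u) = ∫ |û(ξ)|² g(|ξ|) dξ` (for a fixed symbol `g`). -/
def qeps {d : ℕ} {s : ℝ} (g : ℝ → ℝ) (u : HsFn d s) : ℝ :=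
  ∫ ξ : Rd d, ‖u.ft ξ‖ ^ 2 * g ‖ξ‖

/-- The `L^p` norm (as a real number). -/
def LpN {d : ℕ} (p : ℝ) (f : Rd d → ℂ) : ℝ :=
  (eLpNorm f (ENNReal.ofReal p) volume).toReal

/-- The set of values of the Rayleigh quotient `q_ε(u)/‖u‖_p²` over nonzero
`u ∈ H^s` satisfying the symmetry constraint `P`. -/
def RayleighSet (d : ℕ) (s p : ℝ) (g : ℝ → ℝ) (P : (Rd d → ℂ) → Prop) : Set ℝ :=
  {t | ∃ u : HsFn d s, P u.toFun ∧ ¬ u.toFun =ᵐ[volume] (fun _ => (0 : ℂ)) ∧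
      MemLp u.toFun (ENNReal.ofReal p) volume ∧
      t = qeps g u / LpN p u.toFun ^ 2}

/-- The Rayleigh quotient infimum. -/
def Rayleigh (d : ℕ) (s p : ℝ) (g : ℝ → ℝ) (P : (Rd d → ℂ) → Prop) : ℝ :=
  sInf (RayleighSet d s p g P)

/-- The Rayleigh quotient infimum is attained. -/
def Attained (d : ℕ) (s p : ℝ) (g : ℝ → ℝ) (P : (Rd d → ℂ) → Prop) : Prop :=
  ∃ u : HsFn d s, P u.toFun ∧ ¬ u.toFun =ᵐ[volume] (fun _ => (0 : ℂ)) ∧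
      MemLp u.toFun (ENNReal.ofReal p) volume ∧
      qeps g u / LpN p u.toFun ^ 2 = Rayleigh d s p g P

/-- A radial function. -/
def Radial {d : ℕ} (f : Rd d → ℂ) : Prop := ∀ x y : Rd d, ‖x‖ = ‖y‖ → f x = f y

/-- The squared norm of the first block of coordinates (the first `d - k` ones),
under the identification `ℝ^d = ℝ^{d-k} × ℝ^k`. -/
def blockSq (d k : ℕ) (x : Rd d) : ℝ := ∑ i : Fin d, if (i : ℕ) < d - k then x i ^ 2 else 0

/-- A `G_k = O(d-k) × O(k)`-symmetric function: it depends only on the norms of the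
two blocks of coordinates. -/
def GkSymmetric (d k : ℕ) (f : Rd d → ℂ) : Prop :=
  ∀ x y : Rd d, blockSq d k x = blockSq d k y → ‖x‖ = ‖y‖ → f x = f y

/-- An `(s,γ)`-admissible family of symbols, with admissibility constants `c, C`. -/
def IsAdmissible (s γ c C : ℝ) (g : ℝ → ℝ → ℝ) : Prop :=
  (∀ ε ∈ Set.Ioo (0:ℝ) 1, Measurable (g ε)) ∧
  (∀ ε ∈ Set.Ioo (0:ℝ) 1, ∀ r : ℝ, 0 < g ε r) ∧
  (∀ ε ∈ Set.Ioo (0:ℝ) 1, ∀ r : ℝ, 1/2 ≤ |r - 1| →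
      c * (1 + |r| ^ (2*s)) ≤ g ε r ∧ g ε r ≤ C * (1 + |r| ^ (2*s))) ∧
  (∀ ε ∈ Set.Ioo (0:ℝ) 1, ∀ r : ℝ, |r - 1| ≤ 1/2 →
      c * (ε + |r - 1| ^ γ) ≤ g ε r ∧ g ε r ≤ C * (ε + |r - 1| ^ γ))

/-- The `G_k`-symmetric Stein–Tomas exponent `2_⋆^k`. -/
def twoStarK (d k : ℕ) : ℝ :=
  2 * ((d : ℝ) + (min k (d - k) : ℕ)) / ((d : ℝ) - 2 + (min k (d - k) : ℕ))

/-- The interpolation parameter `α_k`. -/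
def alphaK (d k : ℕ) (p : ℝ) : ℝ := (1/2 - 1/p) / (1/2 - 1/twoStarK d k)

/-- The spherical shell `A_{ε,δ}` around the unit sphere (with `I_{ε,δ}` scale `ε^{1/γ}`). -/
def Aset (d : ℕ) (γ ε δ : ℝ) : Set (Rd d) :=
  {ξ | δ * ε ^ (1/γ) ≤ |‖ξ‖ - 1| ∧ |‖ξ‖ - 1| ≤ δ⁻¹ * ε ^ (1/γ)}

section FourierBasics

variable {E : Type*} [NormedAddCommGroup E] [InnerProductSpace ℝ E] [FiniteDimensional ℝ E]
  [MeasurableSpace E] [BorelSpace E]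

open Classical in
/-- `L²` inverse Fourier transform, as a function. -/
def IF (U : E → ℂ) : E → ℂ :=
  if h : MemLp U 2 volume then ⇑(𝓕⁻ (h.toLp U) : Lp ℂ 2 (volume : Measure E)) else 0

theorem IF_def {U : E → ℂ} (h : MemLp U 2 volume) :
    IF U = ⇑(𝓕⁻ (h.toLp U) : Lp ℂ 2 (volume : Measure E)) := by
  simp [IF, h]

theorem IF_memLp {U : E → ℂ} (h : MemLp U 2 volume) : MemLp (IF U) 2 volume := by
  rw [IF_def h]; exact Lp.memLp _

theorem IF_norm {U : E → ℂ} (h : MemLp U 2 volume) :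
    eLpNorm (IF U) 2 volume = eLpNorm U 2 volume := by
  rw [IF_def h]
  have h1 : ‖(𝓕⁻ (h.toLp U) : Lp ℂ 2 (volume : Measure E))‖ = ‖h.toLp U‖ := by
    rw [← Lp.norm_fourier_eq (𝓕⁻ (h.toLp U) : Lp ℂ 2 (volume : Measure E)),
      FourierTransform.fourier_fourierInv_eq]
  rw [Lp.norm_def, Lp.norm_def] at h1
  rw [(ENNReal.toReal_eq_toReal_iff' (Lp.eLpNorm_ne_top _) (Lp.eLpNorm_ne_top _)).1 h1]
  exact eLpNorm_congr_ae h.coeFn_toLp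

theorem IF_pair {U : E → ℂ} (h : MemLp U 2 volume) (φ : SchwartzMap E ℂ) :
    ∫ ξ, U ξ * φ ξ = ∫ x, IF U x * 𝓕 (⇑φ) x := by
  have h1 := Lp.fourier_toTemperedDistribution_eq (𝓕⁻ (h.toLp U) : Lp ℂ 2 (volume : Measure E))
  rw [FourierTransform.fourier_fourierInv_eq] at h1
  have h2 := congrArg (fun T => T φ) h1
  simp only [TemperedDistribution.fourier_apply, Lp.toTemperedDistribution_apply] at h2
  rw [IF_def h]
  calc ∫ ξ, U ξ * φ ξ = ∫ x, φ x • (h.toLp U) x := by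
        apply integral_congr_ae
        filter_upwards [h.coeFn_toLp] with x hx
        rw [hx, smul_eq_mul, mul_comm]
    _ = _ := h2.symm
    _ = _ := by
        congr 1; ext x; rw [smul_eq_mul, mul_comm, SchwartzMap.fourier_coe]

theorem L2_unique {f g : E → ℂ} (hf : LocallyIntegrable f volume)
    (hg : LocallyIntegrable g volume)
    (h : ∀ φ : SchwartzMap E ℂ, ∫ x, f x * φ x = ∫ x, g x * φ x) : f =ᵐ[volume] g := by
  apply ae_eq_of_integral_contDiff_smul_eq hf hg
  intro φ φ_smooth φ_cpt
  have hg₁ : HasCompactSupport (Complex.ofRealCLM ∘ φ) := φ_cpt.comp_left rfl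
  have hg₂ : ContDiff ℝ (↑(⊤ : ℕ∞)) (Complex.ofRealCLM ∘ φ) := by fun_prop
  have := h (hg₁.toSchwartzMap hg₂)
  simpa [mul_comm] using this

theorem IF_unique {U u : E → ℂ} (hU : MemLp U 2 volume) (hu : MemLp u 2 volume)
    (h : ∀ φ : SchwartzMap E ℂ, ∫ ξ, U ξ * φ ξ = ∫ x, u x * 𝓕 (⇑φ) x) : u =ᵐ[volume] IF U := by
  apply L2_unique (hu.locallyIntegrable (by norm_num)) ((IF_memLp hU).locallyIntegrable (by norm_num))
  intro φ
  have h1 := h (𝓕⁻ φ)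
  have h2 := IF_pair hU (𝓕⁻ φ)
  rw [← SchwartzMap.fourier_coe, FourierTransform.fourier_fourierInv_eq] at h1 h2
  rw [← h1, ← h2]

theorem IF_unique' {U V u : E → ℂ} (hU : MemLp U 2 volume) (hV : MemLp V 2 volume)
    (h : ∀ φ : SchwartzMap E ℂ, ∫ ξ, U ξ * φ ξ = ∫ x, u x * 𝓕 (⇑φ) x)
    (h' : ∀ φ : SchwartzMap E ℂ, ∫ ξ, V ξ * φ ξ = ∫ x, u x * 𝓕 (⇑φ) x) : U =ᵐ[volume] V := by
  apply L2_unique (hU.locallyIntegrable (by norm_num)) (hV.locallyIntegrable (by norm_num))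
  intro φ
  rw [h, h']

theorem IF_eq_integral {U : E → ℂ} (h : MemLp U 2 volume) (hi : Integrable U volume) :
    IF U =ᵐ[volume] 𝓕⁻ U := by
  have hcont : Continuous (𝓕⁻ U) := by
    rw [Real.fourierInv_eq_fourier_comp_neg]
    exact VectorFourier.fourierIntegral_continuous Real.continuous_fourierChar
      (by exact continuous_inner) hi.comp_neg
  apply L2_unique ((IF_memLp h).locallyIntegrable (by norm_num)) hcont.locallyIntegrable
  intro φ
  have h2 := IF_pair h (𝓕⁻ φ)
  rw [← SchwartzMap.fourier_coe, FourierTransform.fourier_fourierInv_eq] at h2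
  rw [← h2]
  have h3 := VectorFourier.integral_fourierIntegral_smul_eq_flip (μ := (volume : Measure E))
    (ν := (volume : Measure E)) (f := fun x => U (-x)) (g := ⇑φ) (L := innerₗ E)
    Real.continuous_fourierChar (by exact continuous_inner) hi.comp_neg φ.integrable
  have h4 : VectorFourier.fourierIntegral 𝐞 volume (innerₗ E) (fun x => U (-x)) = 𝓕⁻ U := by
    rw [Real.fourierInv_eq_fourier_comp_neg]; rfl
  rw [h4, flip_innerₗ] at h3
  simp only [smul_eq_mul] at h3
  rw [h3, ← integral_neg_eq_self]
  congr 1; ext x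
  congr 1
  rw [SchwartzMap.fourierInv_coe, Real.fourierInv_eq_fourier_neg, neg_neg]
  rfl

theorem fourierInv_continuous {U : E → ℂ} (hi : Integrable U volume) : Continuous (𝓕⁻ U) := by
  rw [Real.fourierInv_eq_fourier_comp_neg]
  exact VectorFourier.fourierIntegral_continuous Real.continuous_fourierChar
    (by exact continuous_inner) hi.comp_neg

theorem IF_congr {U V : E → ℂ} (h : U =ᵐ[volume] V) : IF U =ᵐ[volume] IF V := by
  by_cases hU : MemLp U 2 volume
  · have hV : MemLp V 2 volume := (memLp_congr_ae h).1 hU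
    rw [IF_def hU, IF_def hV, (MemLp.toLp_eq_toLp_iff hU hV).2 h]
  · have hV : ¬ MemLp V 2 volume := fun hV => hU ((memLp_congr_ae h).2 hV)
    simp [IF, hU, hV]

theorem IF_add {U V : E → ℂ} (hU : MemLp U 2 volume) (hV : MemLp V 2 volume) :
    IF (U + V) =ᵐ[volume] IF U + IF V := by
  rw [IF_def hU, IF_def hV, IF_def (hU.add hV), MemLp.toLp_add, FourierTransform.fourierInv_add]
  exact Lp.coeFn_add _ _

theorem IF_smul {U : E → ℂ} (hU : MemLp U 2 volume) (c : ℂ) :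
    IF (c • U) =ᵐ[volume] c • IF U := by
  rw [IF_def hU, IF_def (hU.const_smul c), MemLp.toLp_const_smul, FourierTransform.fourierInv_smul]
  exact Lp.coeFn_smul _ _

theorem IF_sub {U V : E → ℂ} (hU : MemLp U 2 volume) (hV : MemLp V 2 volume) :
    IF (U - V) =ᵐ[volume] IF U - IF V := by
  have h1 : U - V = U + (-1 : ℂ) • V := by ext x; simp [sub_eq_add_neg]
  rw [h1]
  filter_upwards [IF_add hU (hV.const_smul (-1 : ℂ)), IF_smul hV (-1)] with x h1 h2
  rw [h1, Pi.add_apply, h2]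
  simp [sub_eq_add_neg]

theorem IF_sum {ι : Type*} (s : Finset ι) (U : ι → E → ℂ) (h : ∀ i, MemLp (U i) 2 volume) :
    IF (∑ i ∈ s, U i) =ᵐ[volume] ∑ i ∈ s, IF (U i) := by
  classical
  induction s using Finset.induction_on with
  | empty =>
    simp only [Finset.sum_empty]
    have : IF ((0 : ℂ) • (0 : E → ℂ)) =ᵐ[volume] (0 : ℂ) • IF (0 : E → ℂ) :=
      IF_smul (MemLp.zero) 0
    simpa using this
  | insert a s ha ih =>
    rw [Finset.sum_insert ha, Finset.sum_insert ha]
    have := IF_add (h a) (memLp_finsetSum' s (fun i _ => h i))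
    filter_upwards [this, ih] with x h1 h2
    rw [h1, Pi.add_apply, Pi.add_apply, h2]

theorem MemLp.comp_isometry {U : E → ℂ} {q : ℝ≥0∞} (hU : MemLp U q volume) (g : E ≃ₗᵢ[ℝ] E) :
    MemLp (U ∘ g) q volume := hU.comp_measurePreserving g.measurePreserving

/-- Compatibility with isometries. -/
theorem IF_comp {U : E → ℂ} (hU : MemLp U 2 volume) (g : E ≃ₗᵢ[ℝ] E) :
    IF (U ∘ g) =ᵐ[volume] IF U ∘ g := by
  symm
  apply IF_unique (MemLp.comp_isometry hU g) (MemLp.comp_isometry (IF_memLp hU) g)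
  intro φ
  have key := IF_pair hU (SchwartzMap.compCLMOfContinuousLinearEquiv ℂ
    g.symm.toContinuousLinearEquiv φ)
  have e1 : ∀ F : E → ℂ, ∫ x, F (g x) = ∫ x, F x := fun F =>
    g.measurePreserving.integral_comp g.toHomeomorph.measurableEmbedding F
  rw [← e1, ← e1 (fun x => IF U x * _)] at key
  have hc : ⇑(SchwartzMap.compCLMOfContinuousLinearEquiv ℂ
    g.symm.toContinuousLinearEquiv φ) = ⇑φ ∘ g.symm := by
    ext x; simp
  rw [hc] at key
  simp only [Function.comp_apply, g.symm_apply_apply] at key ⊢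
  rw [key]
  congr 1; ext x
  congr 1
  rw [Real.fourier_comp_linearIsometry]
  simp

/-- Bernstein-type sup bound. -/
theorem sup_bound {U : E → ℂ} (hU : MemLp U 2 volume) {S : Set E} (hSm : MeasurableSet S)
    (hS : volume S ≠ ∞) (h0 : ∀ ξ, ξ ∉ S → U ξ = 0) :
    Integrable U volume ∧ ∀ x, ‖𝓕⁻ U x‖ₑ ≤ volume S ^ (1/2 : ℝ) * eLpNorm U 2 volume := by
  have h1 : eLpNorm U 1 volume ≤ volume S ^ (1/2 : ℝ) * eLpNorm U 2 volume := by
    have e1 : eLpNorm U 1 volume = eLpNorm U 1 (volume.restrict S) := by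
      rw [← eLpNorm_indicator_eq_eLpNorm_restrict hSm]
      congr 1; symm
      rw [Set.indicator_eq_self]
      intro x hx; by_contra hh; exact hx (h0 x hh)
    rw [e1, mul_comm]
    refine (eLpNorm_le_eLpNorm_mul_rpow_measure_univ (p := 1) (q := 2) (by norm_num)
      hU.1.restrict).trans ?_
    gcongr
    · exact Measure.restrict_le_self
    · apply le_of_eq; rw [Measure.restrict_apply_univ]; norm_num
  have hi : Integrable U volume := by
    rw [← memLp_one_iff_integrable]
    refine ⟨hU.1, h1.trans_lt ?_⟩
    exact ENNReal.mul_lt_top (ENNReal.rpow_lt_top_of_nonneg (by norm_num) hS) hU.2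
  refine ⟨hi, fun x => le_trans ?_ h1⟩
  rw [eLpNorm_one_eq_lintegral_enorm, Real.fourierInv_eq]
  refine (enorm_integral_le_lintegral_enorm _).trans (le_of_eq ?_)
  congr 1; ext v
  rw [Circle.smul_def, smul_eq_mul, enorm_mul]
  have : ‖((𝐞 ⟪v, x⟫ : Circle) : ℂ)‖ₑ = 1 := by
    rw [← ofReal_norm, Circle.norm_coe]; simp
  rw [this, one_mul]

/-- `L^p` interpolation from a pointwise bound. -/
theorem interp_bound {X : Type*} [MeasurableSpace X] {μ : Measure X} {f : X → ℂ} {p : ℝ}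
    (hp : 2 < p) {A : ℝ≥0∞} (hA : A ≠ ∞)
    (h : ∀ᵐ x ∂μ, ‖f x‖ₑ ≤ A) :
    eLpNorm f (ENNReal.ofReal p) μ ≤ A ^ (1 - 2/p) * eLpNorm f 2 μ ^ (2/p) := by
  have hp0 : 0 < p := by linarith
  have hpn : ENNReal.ofReal p ≠ 0 := by simpa using hp0
  rw [eLpNorm_eq_lintegral_rpow_enorm_toReal hpn ENNReal.ofReal_ne_top,
    eLpNorm_eq_lintegral_rpow_enorm_toReal (by norm_num) (by norm_num),
    ENNReal.toReal_ofReal hp0.le]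
  have h1 : ∫⁻ x, ‖f x‖ₑ ^ p ∂μ ≤ A ^ (p - 2) * ∫⁻ x, ‖f x‖ₑ ^ (2 : ℝ≥0∞).toReal ∂μ := by
    calc _ ≤ ∫⁻ x, A ^ (p - 2) * ‖f x‖ₑ ^ (2 : ℝ) ∂μ := by
          apply lintegral_mono_ae
          filter_upwards [h] with x hx
          have : p = (p - 2) + 2 := by ring
          conv_lhs => rw [this]
          rw [ENNReal.rpow_add_of_nonneg _ _ (by linarith) (by norm_num)]
          gcongr
      _ ≤ _ := by
          rw [lintegral_const_mul']
          · simp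
          · exact ENNReal.rpow_ne_top_of_nonneg (by linarith) hA
  refine (ENNReal.rpow_le_rpow h1 (by positivity)).trans (le_of_eq ?_)
  rw [ENNReal.mul_rpow_of_nonneg _ _ (by positivity), ← ENNReal.rpow_mul, ← ENNReal.rpow_mul]
  congr 2
  · field_simp
  · simp; field_simp

theorem bern_Lp {U : E → ℂ} (hU : MemLp U 2 volume) {S : Set E} (hSm : MeasurableSet S)
    (hS : volume S ≠ ∞) (h0 : ∀ ξ, ξ ∉ S → U ξ = 0) {p : ℝ} (hp : 2 < p) :
    eLpNorm (IF U) (ENNReal.ofReal p) volume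
      ≤ volume S ^ (1/2 - 1/p) * eLpNorm U 2 volume := by
  obtain ⟨hi, hb⟩ := sup_bound hU hSm hS h0
  have hA : volume S ^ (1/2 : ℝ) * eLpNorm U 2 volume ≠ ∞ :=
    (ENNReal.mul_lt_top (ENNReal.rpow_lt_top_of_nonneg (by norm_num) hS) hU.2).ne
  have h1 := interp_bound (μ := volume) (f := IF U) hp hA (by
    filter_upwards [IF_eq_integral hU hi] with x hx
    rw [hx]; exact hb x)
  refine h1.trans (le_of_eq ?_)
  have hp1 : 0 ≤ 1 - 2/p := by
    rw [sub_nonneg, div_le_one (by linarith)]; linarith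
  rw [IF_norm hU, ENNReal.mul_rpow_of_nonneg _ _ hp1, ← ENNReal.rpow_mul, mul_assoc,
    ← ENNReal.rpow_add_of_nonneg _ _ hp1 (by positivity)]
  congr 2
  · field_simp
  · simp

end FourierBasics

section Sobolev

variable {E : Type*} [NormedAddCommGroup E] [InnerProductSpace ℝ E] [FiniteDimensional ℝ E]
  [MeasurableSpace E] [BorelSpace E]

/-- Fourier side Bessel weight. -/
def wt (s : ℝ) (U : E → ℂ) : E → ℂ := fun ξ => ((1 + ‖ξ‖ ^ 2) ^ (s / 2) : ℝ) • U ξ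

/-- Restriction of a function to a set. -/
theorem trunc_tendsto {U : E → ℂ} (hU : MemLp U 2 volume) :
    Tendsto (fun n : ℕ => eLpNorm ((Metric.ball (0 : E) n).indicator U - U) 2 volume)
      atTop (𝓝 0) := by
  have h1 : Tendsto (fun n : ℕ => ∫⁻ x, ‖((Metric.ball (0 : E) n).indicator U - U) x‖ₑ ^ (2 : ℝ))
      atTop (𝓝 (∫⁻ x : E, 0)) := by
    have hae : AEMeasurable (fun x => ‖U x‖ₑ ^ (2 : ℝ)) := hU.1.enorm.pow_const _
    apply tendsto_lintegral_of_dominated_convergence' (fun x => ‖U x‖ₑ ^ (2 : ℝ))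
    · intro n
      exact (((hU.1.indicator Metric.isOpen_ball.measurableSet).sub hU.1).enorm).pow_const _
    · intro n
      refine Eventually.of_forall fun x => ?_
      apply ENNReal.rpow_le_rpow _ (by norm_num)
      by_cases hx : x ∈ Metric.ball (0 : E) n <;> simp [hx]
    · have := hU.2
      rw [eLpNorm_lt_top_iff_lintegral_rpow_enorm_lt_top (by norm_num) (by norm_num)] at this
      simpa using this.ne
    · refine Eventually.of_forall fun x => ?_
      obtain ⟨N, hN⟩ := exists_nat_gt ‖x‖
      apply tendsto_const_nhds.congr'
      filter_upwards [eventually_ge_atTop N] with n hn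
      have : x ∈ Metric.ball (0 : E) n := by
        simp only [mem_ball_zero_iff]
        exact hN.trans_le (by exact_mod_cast hn)
      simp [this]
  simp only [lintegral_zero] at h1
  have h2 := (ENNReal.continuous_rpow_const (y := 1/2)).tendsto 0 |>.comp h1
  simp only [ENNReal.zero_rpow_of_pos (show (0:ℝ) < 1/2 by norm_num)] at h2
  refine h2.congr fun n => ?_
  rw [eLpNorm_eq_lintegral_rpow_enorm_toReal (by norm_num) (by norm_num)]
  simp

/-- a.e. convergence of truncated inverse transforms along a subsequence -/
theorem trunc_ae {U : E → ℂ} (hU : MemLp U 2 volume) :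
    ∃ ns : ℕ → ℕ, StrictMono ns ∧ ∀ᵐ x, Tendsto (fun i =>
      IF ((Metric.ball (0 : E) (ns i)).indicator U) x) atTop (𝓝 (IF U x)) := by
  have hm : ∀ n : ℕ, MemLp ((Metric.ball (0 : E) n).indicator U) 2 volume := fun n =>
    hU.indicator Metric.isOpen_ball.measurableSet
  have h1 : TendstoInMeasure volume (fun n : ℕ => IF ((Metric.ball (0 : E) n).indicator U))
      atTop (IF U) := by
    apply tendstoInMeasure_of_tendsto_eLpNorm (p := 2) (by norm_num)
      (fun n => (IF_memLp (hm n)).1) (IF_memLp hU).1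
    refine (trunc_tendsto hU).congr fun n => ?_
    rw [← IF_norm ((hm n).sub hU)]
    exact eLpNorm_congr_ae (IF_sub (hm n) hU)
  exact h1.exists_seq_tendsto_ae

theorem dyadic_bound {U : E → ℂ} (hU : MemLp U 2 volume) {p s : ℝ} (hp : 2 < p) (hs : 0 ≤ s)
    (i : ℕ) {S : Set E} (hSm : MeasurableSet S) (hS : S ⊆ Metric.ball (0 : E) (2 ^ i))
    (hS2 : ∀ ξ ∈ S, (2 : ℝ) ^ i ≤ 2 * (1 + ‖ξ‖ ^ 2) ^ (1/2 : ℝ)) :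
    eLpNorm (IF (S.indicator U)) (ENNReal.ofReal p) volume ≤
      ENNReal.ofReal (2 ^ s * ((2:ℝ) ^ ((Module.finrank ℝ E : ℝ) * (1/2 - 1/p) - s)) ^ i)
        * volume (Metric.ball (0 : E) 1) ^ (1/2 - 1/p) * eLpNorm (wt s U) 2 volume := by
  have hp1 : 0 ≤ 1/2 - 1/p := by
    rw [sub_nonneg]; apply one_div_le_one_div_of_le <;> linarith
  have h1 := bern_Lp (hU.indicator hSm) hSm
    ((measure_mono hS).trans_lt measure_ball_lt_top).ne (fun ξ hξ => by simp [hξ]) hp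
  have h2 : volume S ^ (1/2 - 1/p) ≤ ENNReal.ofReal (((2:ℝ) ^ i) ^ Module.finrank ℝ E) ^ (1/2 - 1/p)
      * volume (Metric.ball (0 : E) 1) ^ (1/2 - 1/p) := by
    rw [← ENNReal.mul_rpow_of_nonneg _ _ hp1, ← Measure.addHaar_ball_of_pos _ _ (by positivity)]
    exact ENNReal.rpow_le_rpow (measure_mono hS) hp1
  have h3 : eLpNorm (S.indicator U) 2 volume
      ≤ ENNReal.ofReal (2 ^ s * (((2:ℝ) ^ i) ^ (-s))) * eLpNorm (wt s U) 2 volume := by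
    apply eLpNorm_le_mul_eLpNorm_of_ae_le_mul
    refine Eventually.of_forall fun ξ => ?_
    by_cases hξ : ξ ∈ S
    · simp only [hξ, Set.indicator_of_mem, wt, norm_smul]
      have h4 := hS2 ξ hξ
      have h5 : (0:ℝ) < 1 + ‖ξ‖ ^ 2 := by positivity
      rw [Real.norm_of_nonneg (by positivity), ← mul_assoc]
      have h6 : ((2:ℝ) ^ i) ^ s ≤ 2 ^ s * (1 + ‖ξ‖ ^ 2) ^ (s/2) := by
        calc ((2:ℝ) ^ i) ^ s ≤ (2 * (1 + ‖ξ‖ ^ 2) ^ (1/2 : ℝ)) ^ s := by gcongr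
          _ = _ := by
            rw [Real.mul_rpow (by norm_num) (by positivity), ← Real.rpow_mul h5.le]; ring_nf
      have h7 : 1 ≤ 2 ^ s * ((2:ℝ) ^ i) ^ (-s) * (1 + ‖ξ‖ ^ 2) ^ (s/2) := by
        rw [Real.rpow_neg (by positivity)]
        rw [show (2:ℝ) ^ s * (((2:ℝ) ^ i) ^ s)⁻¹ * (1 + ‖ξ‖ ^ 2) ^ (s/2)
          = (2 ^ s * (1 + ‖ξ‖ ^ 2) ^ (s/2)) / (((2:ℝ) ^ i) ^ s) by ring]
        rw [le_div_iff₀ (by positivity), one_mul]; exact h6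
      exact le_mul_of_one_le_left (norm_nonneg _) h7
    · simp only [hξ, not_false_eq_true, Set.indicator_of_notMem, norm_zero]; positivity
  refine (h1.trans (mul_le_mul' h2 h3)).trans (le_of_eq ?_)
  rw [ENNReal.ofReal_rpow_of_nonneg (by positivity) hp1]
  have e : ∀ a b c d : ℝ≥0∞, a * b * (c * d) = (a * c) * b * d := by intros; ring
  rw [e, ← ENNReal.ofReal_mul (by positivity)]
  congr 3
  rw [← Real.rpow_natCast, ← Real.rpow_natCast, ← Real.rpow_natCast, ← Real.rpow_mul (by norm_num),
    ← Real.rpow_mul (by norm_num), ← Real.rpow_mul (by norm_num), ← Real.rpow_mul (by norm_num),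
    ← Real.rpow_add (by norm_num), mul_comm, ← Real.rpow_add (by norm_num), ← Real.rpow_add (by norm_num)]
  ring_nf

theorem sobolev (E : Type*) [NormedAddCommGroup E] [InnerProductSpace ℝ E] [FiniteDimensional ℝ E]
    [MeasurableSpace E] [BorelSpace E] {p s : ℝ} (hp : 2 < p)
    (hs : (Module.finrank ℝ E : ℝ) * (1/2 - 1/p) < s) :
    ∃ C : ℝ, 0 < C ∧ ∀ U : E → ℂ, MemLp U 2 volume →
      eLpNorm (IF U) (ENNReal.ofReal p) volume ≤ ENNReal.ofReal C * eLpNorm (wt s U) 2 volume := by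
  have hp1 : 0 ≤ 1/2 - 1/p := by
    rw [sub_nonneg]; apply one_div_le_one_div_of_le <;> linarith
  have hs0 : 0 ≤ s := le_trans (by positivity) hs.le
  set r : ℝ := (2:ℝ) ^ ((Module.finrank ℝ E : ℝ) * (1/2 - 1/p) - s) with hr
  have hr0 : 0 < r := by positivity
  have hr1 : r < 1 := Real.rpow_lt_one_of_one_lt_of_neg (by norm_num) (by linarith)
  set K := (volume (Metric.ball (0 : E) 1) ^ (1/2 - 1/p)) with hK
  have hKt : K ≠ ∞ := (ENNReal.rpow_lt_top_of_nonneg hp1 measure_ball_lt_top.ne).ne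
  refine ⟨2 ^ s * (1 - r)⁻¹ * K.toReal + 1, by
    have : 0 < 1 - r := by linarith
    positivity, fun U hU => ?_⟩
  set T : ℕ → Set E := fun i => Metric.ball (0 : E) (2 ^ i) with hT
  have hTm : ∀ i, MeasurableSet (T i) := fun i => Metric.isOpen_ball.measurableSet
  have hTmono : Monotone T := fun i j hij => Metric.ball_subset_ball (by gcongr; norm_num)
  set D : ℕ → Set E := fun i => if i = 0 then T 0 else T i \ T (i-1) with hD
  have hd : ∀ i, MeasurableSet (D i) := fun i => by
    simp only [hD]; split_ifs
    exacts [hTm _, (hTm _).diff (hTm _)]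
  have hDs : ∀ i, D i ⊆ T i := fun i => by
    simp only [hD]; split_ifs with h
    · rw [h]
    · exact Set.diff_subset
  have hb : ∀ i, eLpNorm (IF ((D i).indicator U)) (ENNReal.ofReal p) volume ≤
      ENNReal.ofReal (2 ^ s * r ^ i) * K * eLpNorm (wt s U) 2 volume := by
    intro i
    apply dyadic_bound hU hp hs0 i (hd i) (hDs i)
    intro ξ hξ
    have h5 : 1 ≤ (1 + ‖ξ‖ ^ 2) ^ (1/2 : ℝ) :=
      Real.one_le_rpow (by nlinarith [norm_nonneg ξ]) (by norm_num)
    rcases i with _ | i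
    · simp; linarith [h5]
    · have h6 : ξ ∉ T i := by
        simp only [hD, Nat.add_eq_zero_iff, one_ne_zero, and_false, if_false, Nat.add_sub_cancel] at hξ
        exact hξ.2
      simp only [hT, mem_ball_zero_iff, not_lt] at h6
      have h7 : ‖ξ‖ ≤ (1 + ‖ξ‖ ^ 2) ^ (1/2 : ℝ) := by
        rw [← Real.sqrt_eq_rpow]
        apply Real.le_sqrt_of_sq_le; linarith
      rw [pow_succ]; linarith
  have hsum : ∀ n, (T n).indicator U = ∑ i ∈ Finset.range (n+1), (D i).indicator U := by
    intro n
    induction n with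
    | zero => simp [hD]
    | succ n ih =>
      rw [Finset.sum_range_succ, ← ih]
      have e : T (n+1) = T n ∪ D (n+1) := by
        simp only [hD, Nat.add_eq_zero_iff, one_ne_zero, and_false, if_false, Nat.add_sub_cancel]
        rw [Set.union_diff_cancel (hTmono (Nat.le_succ n))]
      rw [e, Set.indicator_union_of_disjoint]
      · rfl
      · simp only [hD, Nat.add_eq_zero_iff, one_ne_zero, and_false, if_false, Nat.add_sub_cancel]
        exact Set.disjoint_sdiff_right
  have hpart : ∀ n, eLpNorm (IF ((T n).indicator U)) (ENNReal.ofReal p) volume ≤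
      ENNReal.ofReal (2 ^ s * (1 - r)⁻¹ * K.toReal + 1) * eLpNorm (wt s U) 2 volume := by
    intro n
    rw [hsum, eLpNorm_congr_ae (IF_sum _ _ (fun i => hU.indicator (hd i)))]
    refine (eLpNorm_sum_le (fun i _ => (IF_memLp (hU.indicator (hd i))).1) ?_).trans ?_
    · rw [← ENNReal.ofReal_one]; exact ENNReal.ofReal_le_ofReal (by linarith)
    refine (Finset.sum_le_sum (fun i _ => hb i)).trans ?_
    rw [← Finset.sum_mul, ← Finset.sum_mul, ← ENNReal.ofReal_sum_of_nonneg (fun i _ => by positivity)]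
    gcongr
    have e : K = ENNReal.ofReal K.toReal := (ENNReal.ofReal_toReal hKt).symm
    conv_lhs => rw [e]
    rw [← ENNReal.ofReal_mul (Finset.sum_nonneg (fun i _ => by positivity))]
    apply ENNReal.ofReal_le_ofReal
    rw [← Finset.mul_sum]
    have hg : ∑ i ∈ Finset.range (n+1), r ^ i ≤ (1 - r)⁻¹ := by
      rw [← tsum_geometric_of_lt_one hr0.le hr1]
      exact (summable_geometric_of_lt_one hr0.le hr1).sum_le_tsum _ (fun i _ => by positivity)
    have : 2 ^ s * (∑ i ∈ Finset.range (n+1), r ^ i) * K.toReal ≤ 2 ^ s * (1 - r)⁻¹ * K.toReal := by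
      gcongr
    linarith
  -- limit
  have hm : ∀ n : ℕ, MemLp ((T n).indicator U) 2 volume := fun n => hU.indicator (hTm n)
  have h1 : TendstoInMeasure volume (fun n : ℕ => IF ((T n).indicator U)) atTop (IF U) := by
    apply tendstoInMeasure_of_tendsto_eLpNorm (p := 2) (by norm_num)
      (fun n => (IF_memLp (hm n)).1) (IF_memLp hU).1
    have h2 := (trunc_tendsto hU).comp (tendsto_pow_atTop_atTop_of_one_lt (r := 2) (by norm_num))
    refine h2.congr fun n => ?_
    rw [← eLpNorm_congr_ae (IF_sub (hm n) hU), IF_norm ((hm n).sub hU)]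
    simp [hT]
  obtain ⟨ns, -, hns⟩ := h1.exists_seq_tendsto_ae
  refine (Lp.eLpNorm_lim_le_liminf_eLpNorm (fun i => (IF_memLp (hm (ns i))).1) _ hns).trans ?_
  refine liminf_le_of_le (by isBoundedDefault) fun b hb => ?_
  obtain ⟨n, hn⟩ := hb.exists
  exact hn.trans (hpart _)

end Sobolev

section Kernel

variable {E : Type*} [NormedAddCommGroup E] [InnerProductSpace ℝ E] [FiniteDimensional ℝ E]
  [MeasurableSpace E] [BorelSpace E]

/-- An isometry-invariant finite measure on the unit sphere. -/
def sphM (E : Type*) [NormedAddCommGroup E] [InnerProductSpace ℝ E] [FiniteDimensional ℝ E]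
    [MeasurableSpace E] [BorelSpace E] : Measure E :=
  (volume.restrict (Metric.ball (0 : E) 1)).map (fun v => ‖v‖⁻¹ • v)

theorem sphM_meas : Measurable (fun v : E => ‖v‖⁻¹ • v) :=
  (measurable_norm.inv).smul measurable_id

instance : IsFiniteMeasure (sphM E) := by
  have : IsFiniteMeasure (volume.restrict (Metric.ball (0 : E) 1)) :=
    ⟨by simpa using measure_ball_lt_top⟩
  exact Measure.isFiniteMeasure_map _ _

theorem sphM_univ_pos : 0 < (sphM E) Set.univ := by
  rw [sphM, Measure.map_apply sphM_meas MeasurableSet.univ]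
  simpa using Metric.measure_ball_pos volume (0 : E) one_pos

theorem sphM_norm_le : ∀ᵐ ω ∂(sphM E), ‖ω‖ ≤ 1 := by
  rw [sphM, ae_map_iff sphM_meas.aemeasurable (measurableSet_le measurable_norm measurable_const)]
  refine Eventually.of_forall fun v => ?_
  rw [norm_smul, norm_inv, norm_norm]
  exact inv_mul_le_one

theorem sphM_norm [Nontrivial E] : ∀ᵐ ω ∂(sphM E), ‖ω‖ = 1 := by
  rw [sphM, ae_map_iff sphM_meas.aemeasurable (measurableSet_eq_fun measurable_norm measurable_const)]
  apply ae_restrict_of_ae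
  have : ∀ᵐ v : E, v ≠ 0 := by
    rw [ae_iff]; simp
  filter_upwards [this] with v hv
  rw [norm_smul, norm_inv, norm_norm]
  exact inv_mul_cancel₀ (norm_ne_zero_iff.2 hv)

theorem sphM_inv (g : E ≃ₗᵢ[ℝ] E) : MeasurePreserving g (sphM E) (sphM E) := by
  refine ⟨g.continuous.measurable, ?_⟩
  rw [sphM, Measure.map_map g.continuous.measurable sphM_meas]
  have h1 : (g ∘ fun v : E => ‖v‖⁻¹ • v) = (fun v : E => ‖v‖⁻¹ • v) ∘ g := by
    ext v; simp
  rw [h1, ← Measure.map_map sphM_meas g.continuous.measurable]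
  congr 1
  have := (g.measurePreserving.restrict_preimage (s := Metric.ball (0 : E) 1)
    Metric.isOpen_ball.measurableSet).map_eq
  have h2 : g ⁻¹' (Metric.ball (0 : E) 1) = Metric.ball (0 : E) 1 := by
    ext v; simp
  rwa [h2] at this

/-- The spherical kernel. -/
def sphK (x : E) : ℝ := ∫ ω, Real.cos ⟪x, ω⟫ ∂(sphM E)

theorem sphK_radial {x y : E} (h : ‖x‖ = ‖y‖) : sphK x = sphK y := by
  set g := (ℝ ∙ (x - y))ᗮ.reflection with hg
  have h1 : g x = y := Submodule.reflection_sub h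
  unfold sphK
  rw [← h1, ← (sphM_inv g).integral_comp g.toHomeomorph.measurableEmbedding
    (fun ω => Real.cos ⟪g x, ω⟫)]
  congr 1; ext ω
  rw [LinearIsometryEquiv.inner_map_map]

theorem integrable_sphM {f : E → ℝ} (hf : Continuous f) : Integrable f (sphM E) := by
  obtain ⟨C, hC⟩ := (isCompact_closedBall (0 : E) 1).exists_bound_of_continuousOn hf.continuousOn
  refine Integrable.of_bound hf.aestronglyMeasurable C ?_
  filter_upwards [sphM_norm_le] with ω hω
  exact hC ω (by simpa using hω)

theorem hasDerivAt_sphM {F F' : ℝ → E → ℝ} (hF : ∀ a, Continuous (F a)) (hF' : ∀ a, Continuous (F' a))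
    (hd : ∀ a ω, HasDerivAt (fun b => F b ω) (F' a ω) a) {C : ℝ} (a : ℝ)
    (hb : ∀ b ∈ Metric.ball a 1, ∀ ω : E, ‖ω‖ ≤ 1 → |F' b ω| ≤ C) :
    HasDerivAt (fun b => ∫ ω, F b ω ∂(sphM E)) (∫ ω, F' a ω ∂(sphM E)) a := by
  refine (hasDerivAt_integral_of_dominated_loc_of_deriv_le (bound := fun _ => C)
    (Metric.ball_mem_nhds a one_pos)
    (Eventually.of_forall fun b => (hF b).aestronglyMeasurable) (integrable_sphM (hF a))
    (hF' a).aestronglyMeasurable ?_ (integrable_const C) ?_).2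
  · filter_upwards [sphM_norm_le] with ω hω b hb'
    exact hb b hb' ω hω
  · exact Eventually.of_forall fun ω b _ => hd b ω

theorem inner_bd {e ω : E} (he : ‖e‖ = 1) (hω : ‖ω‖ ≤ 1) : |⟪e, ω⟫| ≤ 1 := by
  have := abs_real_inner_le_norm e ω
  rw [he] at this; linarith

theorem sphK_d1 {e : E} (he : ‖e‖ = 1) (t : ℝ) :
    HasDerivAt (fun t : ℝ => ∫ ω, Real.cos (t * ⟪e, ω⟫) ∂(sphM E))
      (∫ ω, - Real.sin (t * ⟪e, ω⟫) * ⟪e, ω⟫ ∂(sphM E)) t := by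
  apply hasDerivAt_sphM (F := fun t ω => Real.cos (t * ⟪e, ω⟫))
    (F' := fun t ω => - Real.sin (t * ⟪e, ω⟫) * ⟪e, ω⟫) (C := 1)
  · intro a; fun_prop
  · intro a; fun_prop
  · intro a ω
    have := ((hasDerivAt_id a).mul_const ⟪e, ω⟫).cos
    simpa using this
  · intro b _ ω hω
    rw [abs_mul, abs_neg]
    exact mul_le_one₀ (Real.abs_sin_le_one _) (abs_nonneg _) (inner_bd he hω)

theorem sphK_d2 {e : E} (he : ‖e‖ = 1) (t : ℝ) :
    HasDerivAt (fun t : ℝ => ∫ ω, - Real.sin (t * ⟪e, ω⟫) * ⟪e, ω⟫ ∂(sphM E))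
      (∫ ω, - Real.cos (t * ⟪e, ω⟫) * ⟪e, ω⟫ ^ 2 ∂(sphM E)) t := by
  apply hasDerivAt_sphM (F := fun t ω => - Real.sin (t * ⟪e, ω⟫) * ⟪e, ω⟫)
    (F' := fun t ω => - Real.cos (t * ⟪e, ω⟫) * ⟪e, ω⟫ ^ 2) (C := 1)
  · intro a; fun_prop
  · intro a; fun_prop
  · intro a ω
    have := (((hasDerivAt_id a).mul_const ⟪e, ω⟫).sin.neg).mul_const ⟪e, ω⟫
    refine this.congr_deriv ?_
    simp; ring
  · intro b _ ω hω
    rw [abs_mul, abs_neg, abs_pow]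
    exact mul_le_one₀ (Real.abs_cos_le_one _) (by positivity) (pow_le_one₀ (abs_nonneg _) (inner_bd he hω))

theorem sphK_rot {e f : E} (he : ‖e‖ = 1) (hf : ‖f‖ = 1) (hef : ⟪e, f⟫ = 0) (t : ℝ) (ht : 0 < t) :
    t * ∫ ω, ⟪f, ω⟫ ^ 2 * Real.cos (t * ⟪e, ω⟫) ∂(sphM E)
      = ∫ ω, Real.sin (t * ⟪e, ω⟫) * ⟪e, ω⟫ ∂(sphM E) := by
  set x : ℝ → E := fun α => Real.cos α • e + Real.sin α • f with hx
  set x' : ℝ → E := fun α => -Real.sin α • e + Real.cos α • f with hx'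
  have hn : ∀ α, ‖x α‖ = 1 := by
    intro α
    have : ‖x α‖ ^ 2 = 1 := by
      rw [hx, norm_add_sq_real, norm_smul, norm_smul, he, hf, inner_smul_left, inner_smul_right, hef]
      simp
    nlinarith [norm_nonneg (x α)]
  have hn' : ∀ α, ‖x' α‖ = 1 := by
    intro α
    have : ‖x' α‖ ^ 2 = 1 := by
      rw [hx', norm_add_sq_real, norm_smul, norm_smul, he, hf, inner_smul_left, inner_smul_right, hef]
      simp
    nlinarith [norm_nonneg (x' α)]
  have dx : ∀ α ω, HasDerivAt (fun α => ⟪x α, ω⟫) ⟪x' α, ω⟫ α := by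
    intro α ω
    simp only [hx, hx', inner_add_left, inner_smul_left]
    exact ((Real.hasDerivAt_cos α).mul_const _).add ((Real.hasDerivAt_sin α).mul_const _)
  have dx' : ∀ α ω, HasDerivAt (fun α => ⟪x' α, ω⟫) (-⟪x α, ω⟫) α := by
    intro α ω
    simp only [hx, hx', inner_add_left, inner_smul_left]
    have := ((Real.hasDerivAt_sin α).neg.mul_const ⟪e, ω⟫).add ((Real.hasDerivAt_cos α).mul_const ⟪f, ω⟫)
    refine this.congr_deriv ?_
    simp; ring
  have A1 : ∀ α, HasDerivAt (fun α => ∫ ω, Real.cos (t * ⟪x α, ω⟫) ∂(sphM E))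
      (∫ ω, - Real.sin (t * ⟪x α, ω⟫) * (t * ⟪x' α, ω⟫) ∂(sphM E)) α := by
    intro α
    apply hasDerivAt_sphM (F := fun α ω => Real.cos (t * ⟪x α, ω⟫))
      (F' := fun α ω => - Real.sin (t * ⟪x α, ω⟫) * (t * ⟪x' α, ω⟫)) (C := t)
    · intro a; fun_prop
    · intro a; fun_prop
    · intro a ω
      exact ((dx a ω).const_mul t).cos
    · intro b _ ω hω
      rw [abs_mul, abs_neg, abs_mul, abs_of_pos ht]
      have h1 := Real.abs_sin_le_one (t * ⟪x b, ω⟫)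
      have h2 := inner_bd (hn' b) hω
      calc _ ≤ 1 * (t * 1) := by gcongr
        _ = t := by ring
  have hconst : ∀ α, ∫ ω, Real.cos (t * ⟪x α, ω⟫) ∂(sphM E) = sphK (t • e) := by
    intro α
    have : sphK (t • x α) = sphK (t • e) := sphK_radial (by rw [norm_smul, norm_smul, hn, he])
    rw [← this]; simp [sphK, inner_smul_left]
  have A1' : ∀ α, ∫ ω, - Real.sin (t * ⟪x α, ω⟫) * (t * ⟪x' α, ω⟫) ∂(sphM E) = 0 := by
    intro α
    have h1 := A1 α
    simp only [hconst] at h1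
    exact h1.unique (hasDerivAt_const _ _)
  have A2 : HasDerivAt (fun α => ∫ ω, - Real.sin (t * ⟪x α, ω⟫) * (t * ⟪x' α, ω⟫) ∂(sphM E))
      (∫ ω, (- Real.cos (t * ⟪x 0, ω⟫) * (t * ⟪x' 0, ω⟫) * (t * ⟪x' 0, ω⟫)
        + - Real.sin (t * ⟪x 0, ω⟫) * (t * -⟪x 0, ω⟫)) ∂(sphM E)) 0 := by
    apply hasDerivAt_sphM (F := fun α ω => - Real.sin (t * ⟪x α, ω⟫) * (t * ⟪x' α, ω⟫))
      (F' := fun α ω => (- Real.cos (t * ⟪x α, ω⟫) * (t * ⟪x' α, ω⟫) * (t * ⟪x' α, ω⟫)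
        + - Real.sin (t * ⟪x α, ω⟫) * (t * -⟪x α, ω⟫))) (C := t * t + t)
    · intro a; fun_prop
    · intro a; fun_prop
    · intro a ω
      have := ((dx a ω).const_mul t).sin.neg.mul ((dx' a ω).const_mul t)
      refine this.congr_deriv ?_
      simp
    · intro b _ ω hω
      refine (abs_add_le _ _).trans ?_
      simp only [abs_mul, abs_neg, abs_of_pos ht]
      have h1 := Real.abs_sin_le_one (t * ⟪x b, ω⟫)
      have h1' := Real.abs_cos_le_one (t * ⟪x b, ω⟫)
      have h2 := inner_bd (hn' b) hω
      have h3 := inner_bd (hn b) hω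
      calc _ ≤ 1 * (t * 1) * (t * 1) + 1 * (t * 1) := by gcongr
        _ = _ := by ring
  simp only [A1'] at A2
  have A3 := A2.unique (hasDerivAt_const _ _)
  have e0 : x 0 = e := by simp [hx]
  have e1 : x' 0 = f := by simp [hx']
  rw [e0, e1, integral_add (integrable_sphM (by fun_prop)) (integrable_sphM (by fun_prop))] at A3
  have B1 : ∫ ω, - Real.cos (t * ⟪e, ω⟫) * (t * ⟪f, ω⟫) * (t * ⟪f, ω⟫) ∂(sphM E)
      = - (t * (t * ∫ ω, ⟪f, ω⟫ ^ 2 * Real.cos (t * ⟪e, ω⟫) ∂(sphM E))) := by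
    rw [← integral_const_mul, ← integral_const_mul, ← integral_neg]
    congr 1; ext ω; ring
  have B2 : ∫ ω, - Real.sin (t * ⟪e, ω⟫) * (t * -⟪e, ω⟫) ∂(sphM E)
      = t * ∫ ω, Real.sin (t * ⟪e, ω⟫) * ⟪e, ω⟫ ∂(sphM E) := by
    rw [← integral_const_mul]
    congr 1; ext ω; ring
  rw [B1, B2] at A3
  apply mul_left_cancel₀ ht.ne'
  linarith

theorem sphK_ode [Nontrivial E] {n : ℕ} (hn : Module.finrank ℝ E = n + 1) :
    ∃ e : E, ‖e‖ = 1 ∧ ∀ t : ℝ, 0 < t →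
      t * ((∫ ω, Real.cos (t * ⟪e, ω⟫) ∂(sphM E)) +
        ∫ ω, - Real.cos (t * ⟪e, ω⟫) * ⟪e, ω⟫ ^ 2 ∂(sphM E))
      = - n * ∫ ω, - Real.sin (t * ⟪e, ω⟫) * ⟪e, ω⟫ ∂(sphM E) := by
  set b := (stdOrthonormalBasis ℝ E).reindex (finCongr hn) with hb
  refine ⟨b 0, b.norm_eq_one 0, fun t ht => ?_⟩
  have h1 : ∀ i : Fin n, t * ∫ ω, ⟪b i.succ, ω⟫ ^ 2 * Real.cos (t * ⟪b 0, ω⟫) ∂(sphM E)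
      = ∫ ω, Real.sin (t * ⟪b 0, ω⟫) * ⟪b 0, ω⟫ ∂(sphM E) := fun i =>
    sphK_rot (b.norm_eq_one 0) (b.norm_eq_one _)
      (b.inner_eq_zero (Fin.succ_ne_zero i).symm) t ht
  have h2 : (∫ ω, Real.cos (t * ⟪b 0, ω⟫) ∂(sphM E)) +
        ∫ ω, - Real.cos (t * ⟪b 0, ω⟫) * ⟪b 0, ω⟫ ^ 2 ∂(sphM E)
        = ∑ i : Fin n, ∫ ω, ⟪b i.succ, ω⟫ ^ 2 * Real.cos (t * ⟪b 0, ω⟫) ∂(sphM E) := by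
    rw [← integral_finsetSum _ (fun i _ => integrable_sphM (by fun_prop)),
      ← integral_add (integrable_sphM (by fun_prop)) (integrable_sphM (by fun_prop))]
    apply integral_congr_ae
    filter_upwards [sphM_norm] with ω hω
    have h3 := b.sum_sq_inner_right ω
    rw [Fin.sum_univ_succ, hω] at h3
    rw [← Finset.sum_mul]
    have h4 : ∑ i : Fin n, ⟪b i.succ, ω⟫ ^ 2 = 1 - ⟪b 0, ω⟫ ^ 2 := by linarith
    rw [h4]; ring
  rw [h2, Finset.mul_sum, Finset.sum_congr rfl (fun i _ => h1 i), Finset.sum_const]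
  simp only [neg_mul, integral_neg, Finset.card_univ, Fintype.card_fin, nsmul_eq_mul]
  ring

/-- abstract ODE decay -/
theorem ode_decay {K K1 K2 : ℝ → ℝ} {n : ℕ} (d1 : ∀ t, HasDerivAt K (K1 t) t)
    (d2 : ∀ t, HasDerivAt K1 (K2 t) t) (ode : ∀ t, 0 < t → t * (K t + K2 t) = - n * K1 t) :
    ∃ C : ℝ, ∀ t, 1 ≤ t → t ^ n * K t ^ 2 ≤ C := by
  set a : ℝ := n / 2 with ha
  set b : ℝ := |a ^ 2 - a| with hb
  set h : ℝ → ℝ := fun t => K1 t + a * t⁻¹ * K t with hh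
  set G : ℝ → ℝ := fun t => t ^ n * (h t ^ 2 + K t ^ 2) with hG
  have dh : ∀ t, 0 < t → HasDerivAt h (- K t - a * t⁻¹ * h t + (a ^ 2 - a) * K t / t ^ 2) t := by
    intro t ht
    have h1 := (d2 t).add ((((hasDerivAt_inv ht.ne').const_mul a)).mul (d1 t))
    refine h1.congr_deriv ?_
    symm
    have h2 : K2 t = - K t - n * K1 t / t := by
      have := ode t ht
      field_simp
      linarith
    rw [h2]
    simp only [hh]
    have : (n : ℝ) = 2 * a := by rw [ha]; ring
    rw [this]
    field_simp
    ring
  have dG : ∀ t, 0 < t → HasDerivAt G (t ^ n * (2 * (a ^ 2 - a) * h t * K t / t ^ 2)) t := by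
    intro t ht
    have h1 := (hasDerivAt_pow n t).mul (((dh t ht).pow 2).add ((d1 t).pow 2))
    refine h1.congr_deriv ?_
    symm
    have hK1 : K1 t = h t - a * t⁻¹ * K t := by simp [hh]
    have h3 : (n : ℝ) * t ^ (n - 1) = 2 * a * t⁻¹ * t ^ n := by
      rcases n with _ | n
      · simp [ha]
      · simp only [ha, Nat.add_sub_cancel, pow_succ]; field_simp
    rw [h3, hK1]
    simp only [Pi.pow_apply, Pi.add_apply]
    field_simp
    push_cast
    ring
  have anti : AntitoneOn (fun t => G t * Real.exp (b / t)) (Set.Ici 1) := by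
    have dd : ∀ t, 0 < t → HasDerivAt (fun t => G t * Real.exp (b / t))
        (t ^ n * (2 * (a ^ 2 - a) * h t * K t / t ^ 2) * Real.exp (b / t)
          + G t * (Real.exp (b / t) * (-b / t ^ 2))) t := by
      intro t ht
      have e1 : HasDerivAt (fun t : ℝ => b / t) (-b / t ^ 2) t := by
        have := (hasDerivAt_inv ht.ne').const_mul b
        exact this.congr_deriv (by ring)
      exact (dG t ht).mul e1.exp
    apply antitoneOn_of_deriv_nonpos (convex_Ici 1)
    · intro t ht
      exact (dd t (lt_of_lt_of_le one_pos ht)).continuousAt.continuousWithinAt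
    · intro t ht
      rw [interior_Ici] at ht
      exact (dd t (lt_trans one_pos ht)).differentiableAt.differentiableWithinAt
    · intro t ht
      rw [interior_Ici] at ht
      have ht0 : 0 < t := lt_trans one_pos ht
      rw [(dd t ht0).deriv]
      have e : t ^ n * (2 * (a ^ 2 - a) * h t * K t / t ^ 2) * Real.exp (b / t)
          + G t * (Real.exp (b / t) * (-b / t ^ 2))
          = (t ^ n / t ^ 2 * Real.exp (b / t)) * (2 * (a ^ 2 - a) * h t * K t
            - b * (h t ^ 2 + K t ^ 2)) := by
        simp only [hG]; ring
      rw [e]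
      apply mul_nonpos_of_nonneg_of_nonpos (by positivity)
      have h5 : (a ^ 2 - a) * (2 * h t * K t) ≤ b * (h t ^ 2 + K t ^ 2) := by
        calc (a ^ 2 - a) * (2 * h t * K t) ≤ |(a ^ 2 - a) * (2 * h t * K t)| := le_abs_self _
          _ = b * |2 * h t * K t| := by rw [abs_mul]
          _ ≤ b * (h t ^ 2 + K t ^ 2) := by
            gcongr
            rw [abs_le]; constructor <;> nlinarith [sq_nonneg (h t - K t), sq_nonneg (h t + K t)]
      linarith
  refine ⟨G 1 * Real.exp (b / 1), fun t ht => ?_⟩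
  have h1 := anti (Set.mem_Ici.2 le_rfl) (Set.mem_Ici.2 ht) ht
  have h2 : 1 ≤ Real.exp (b / t) := Real.one_le_exp (by positivity)
  have h3 : 0 ≤ G t := by positivity
  calc t ^ n * K t ^ 2 ≤ G t := by
        simp only [hG]; gcongr; nlinarith [sq_nonneg (h t)]
    _ ≤ G t * Real.exp (b / t) := le_mul_of_one_le_right h3 h2
    _ ≤ _ := h1

theorem sphK_decay (E : Type*) [NormedAddCommGroup E] [InnerProductSpace ℝ E] [FiniteDimensional ℝ E]
    [MeasurableSpace E] [BorelSpace E] [Nontrivial E] :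
    ∃ C : ℝ, 0 < C ∧ ∀ τ : ℝ, 0 ≤ τ → τ ≤ (Module.finrank ℝ E : ℝ) - 1 → ∀ x : E, x ≠ 0 →
      sphK x ^ 2 ≤ C * ‖x‖ ^ (-τ) := by
  obtain ⟨n, hn⟩ : ∃ n, Module.finrank ℝ E = n + 1 :=
    Nat.exists_eq_succ_of_ne_zero (Module.finrank_pos).ne'
  obtain ⟨e, he, hode⟩ := sphK_ode hn
  obtain ⟨C, hC⟩ := ode_decay (sphK_d1 he) (sphK_d2 he) hode
  set M := (sphM E).real Set.univ with hM
  have hK1 : ∀ x : E, sphK x ^ 2 ≤ M ^ 2 := by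
    intro x
    have : |sphK x| ≤ M := by
      have := norm_integral_le_of_norm_le_const (μ := sphM E) (f := fun ω => Real.cos ⟪x, ω⟫) (C := 1)
        (Eventually.of_forall fun ω => Real.abs_cos_le_one _)
      simpa [sphK, hM] using this
    exact sq_le_sq' (by linarith [neg_abs_le (sphK x)]) ((le_abs_self _).trans this)
  refine ⟨max C (M ^ 2) + 1, by positivity, fun τ h0 h1 x hx => ?_⟩
  have hx0 : 0 < ‖x‖ := norm_pos_iff.2 hx
  rw [hn] at h1; push_cast at h1
  rcases le_total 1 ‖x‖ with h | h
  · have h2 : sphK x = ∫ ω, Real.cos (‖x‖ * ⟪e, ω⟫) ∂(sphM E) := by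
      rw [sphK_radial (x := x) (y := ‖x‖ • e) (by rw [norm_smul, he]; simp)]
      simp [sphK, inner_smul_left]
    have h3 := hC ‖x‖ h
    rw [← h2] at h3
    calc sphK x ^ 2 ≤ C * (‖x‖ ^ n)⁻¹ := by
          rw [← div_eq_mul_inv, le_div_iff₀ (by positivity)]; linarith
      _ ≤ (max C (M ^ 2) + 1) * ‖x‖ ^ (-τ) := by
          have hC0 : 0 ≤ C := le_trans (by positivity) h3
          rw [← Real.rpow_natCast, ← Real.rpow_neg hx0.le]
          apply mul_le_mul _ _ (by positivity) (by positivity)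
          · linarith [le_max_left C (M ^ 2)]
          · apply Real.rpow_le_rpow_of_exponent_le h; linarith
  · have h4 : 1 ≤ ‖x‖ ^ (-τ) := Real.one_le_rpow_of_pos_of_le_one_of_nonpos hx0 h (by linarith)
    calc sphK x ^ 2 ≤ max C (M ^ 2) + 1 := by linarith [hK1 x, le_max_right C (M ^ 2)]
      _ ≤ _ := le_mul_of_one_le_right (by positivity) h4

end Kernel

section Polar

variable {E : Type*} [NormedAddCommGroup E] [InnerProductSpace ℝ E] [FiniteDimensional ℝ E]
  [MeasurableSpace E] [BorelSpace E]

theorem lintegral_norm_polar [Nontrivial E] (f : ℝ → ℝ≥0∞) (hf : Measurable f) :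
    ∫⁻ x : E, f ‖x‖ = (volume : Measure E).toSphere Set.univ *
      ∫⁻ r in Set.Ioi (0:ℝ), ENNReal.ofReal (r ^ (Module.finrank ℝ E - 1)) * f r := by
  calc ∫⁻ x : E, f ‖x‖ = ∫⁻ x : ({(0 : E)}ᶜ : Set E), f ‖x.1‖ ∂((volume : Measure E).comap Subtype.val) := by
        rw [lintegral_subtype_comap (measurableSet_singleton _).compl (fun x : E => f ‖x‖),
          restrict_compl_singleton]
    _ = ∫⁻ x : Metric.sphere (0 : E) 1 × Set.Ioi (0:ℝ), f x.2.1 ∂((volume : Measure E).toSphere.prod (.volumeIoiPow (Module.finrank ℝ E - 1))) := by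
        have := (volume : Measure E).measurePreserving_homeomorphUnitSphereProd.lintegral_comp_emb
          (Homeomorph.measurableEmbedding _) (fun x => f x.2.1)
        simpa using this
    _ = (volume : Measure E).toSphere Set.univ *
          ∫⁻ x : Set.Ioi (0:ℝ), f x ∂(.volumeIoiPow (Module.finrank ℝ E - 1)) := by
        rw [lintegral_prod _ (by fun_prop)]
        simp [mul_comm]
    _ = _ := by
        congr 1
        rw [Measure.volumeIoiPow, lintegral_withDensity_eq_lintegral_mul _ (by fun_prop) (by fun_prop)]
        simp only [Pi.mul_apply]
        rw [lintegral_subtype_comap measurableSet_Ioi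
          (fun r : ℝ => ENNReal.ofReal (r ^ (Module.finrank ℝ E - 1)) * f r)]

theorem polar_annulus (E : Type*) [NormedAddCommGroup E] [InnerProductSpace ℝ E] [FiniteDimensional ℝ E]
    [MeasurableSpace E] [BorelSpace E] [Nontrivial E] :
    ∃ C : ℝ, 0 < C ∧ ∀ I : Set ℝ, MeasurableSet I →
      ∫⁻ x in {x : E | ‖x‖ ∈ I}, ‖x‖ₑ ^ (-((Module.finrank ℝ E : ℝ) - 1)) ≤ ENNReal.ofReal C * volume I := by
  have hn : 1 ≤ Module.finrank ℝ E := Module.finrank_pos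
  refine ⟨((volume : Measure E).toSphere Set.univ).toReal + 1, by positivity, fun I hI => ?_⟩
  have h1 := lintegral_norm_polar (E := E) (fun r => I.indicator (fun r => ‖r‖ₑ ^ (-((Module.finrank ℝ E : ℝ) - 1))) r)
    (Measurable.indicator (by fun_prop) hI)
  rw [← lintegral_indicator (show MeasurableSet {x : E | ‖x‖ ∈ I} from measurable_norm hI)]
  calc _ = ∫⁻ x : E, I.indicator (fun r => ‖r‖ₑ ^ (-((Module.finrank ℝ E : ℝ) - 1))) ‖x‖ := by
        congr 1; ext x
        by_cases hx : ‖x‖ ∈ I <;> simp [Set.indicator, hx]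
    _ = _ := h1
    _ ≤ _ := by
      gcongr
      · rw [ENNReal.ofReal_add (by positivity) (by norm_num), ENNReal.ofReal_toReal (measure_ne_top _ _)]
        exact le_self_add
      · calc _ ≤ ∫⁻ r in Set.Ioi (0:ℝ), I.indicator 1 r := by
              apply setLIntegral_mono (measurable_one.indicator hI)
              intro r hr
              have hr : (0:ℝ) < r := hr
              by_cases hrI : r ∈ I
              · simp only [hrI, Set.indicator_of_mem, Pi.one_apply]
                rw [Real.enorm_eq_ofReal hr.le, ENNReal.ofReal_rpow_of_pos hr, ← ENNReal.ofReal_mul (by positivity),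
                  ← Real.rpow_natCast, ← Real.rpow_add hr, Nat.cast_sub hn]
                simp
              · simp [hrI]
          _ ≤ ∫⁻ r, I.indicator 1 r := setLIntegral_le_lintegral _ _
          _ = volume I := by rw [lintegral_indicator_one hI]

theorem polar_ball (E : Type*) [NormedAddCommGroup E] [InnerProductSpace ℝ E] [FiniteDimensional ℝ E]
    [MeasurableSpace E] [BorelSpace E] {σ : ℝ} (h0 : 0 ≤ σ)
    (h1 : σ < Module.finrank ℝ E ∨ σ = 0) :
    ∃ C : ℝ, 0 < C ∧ ∀ a : ℝ, 0 < a →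
      ∫⁻ x in Metric.closedBall (0 : E) a, ‖x‖ₑ ^ (-σ) ≤
        ENNReal.ofReal (C * a ^ ((Module.finrank ℝ E : ℝ) - σ)) := by
  by_cases hσ : σ = 0
  · refine ⟨(volume (Metric.ball (0 : E) 1)).toReal + 1, by positivity, fun a ha => ?_⟩
    subst hσ
    simp only [neg_zero, ENNReal.rpow_zero, sub_zero, setLIntegral_const, one_mul, Real.rpow_natCast]
    rw [Measure.addHaar_closedBall _ _ ha.le, mul_comm, ENNReal.ofReal_mul (by positivity)]
    gcongr
    rw [ENNReal.ofReal_add (by positivity) (by norm_num), ENNReal.ofReal_toReal measure_ball_lt_top.ne]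
    exact le_self_add
  · have h2 : σ < Module.finrank ℝ E := by tauto
    have hpos : 0 < Module.finrank ℝ E := by
      have : (0:ℝ) < Module.finrank ℝ E := lt_of_le_of_lt h0 h2
      exact_mod_cast this
    have hn : 1 ≤ Module.finrank ℝ E := hpos
    have : Nontrivial E := Module.finrank_pos_iff.1 hpos
    set n := Module.finrank ℝ E with hnn
    have hne : 0 < (n : ℝ) - σ := by linarith
    refine ⟨(((volume : Measure E).toSphere Set.univ).toReal + 1) * ((n:ℝ) - σ)⁻¹, by positivity, fun a ha => ?_⟩
    have h3 := lintegral_norm_polar (E := E) (fun r => (Set.Iic a).indicator (fun r => ‖r‖ₑ ^ (-σ)) r)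
      (Measurable.indicator (by fun_prop) measurableSet_Iic)
    rw [← lintegral_indicator Metric.isClosed_closedBall.measurableSet]
    calc _ = ∫⁻ x : E, (Set.Iic a).indicator (fun r => ‖r‖ₑ ^ (-σ)) ‖x‖ := by
          congr 1; ext x
          by_cases hx : ‖x‖ ≤ a <;> simp [Set.indicator, hx]
      _ = _ := h3
      _ ≤ _ := by
        rw [mul_assoc, ENNReal.ofReal_mul (by positivity)]
        gcongr
        · rw [ENNReal.ofReal_add (by positivity) (by norm_num), ENNReal.ofReal_toReal (measure_ne_top _ _)]
          exact le_self_add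
        · calc _ = ∫⁻ r in Set.Ioi (0:ℝ), (Set.Iic a).indicator (fun r => ENNReal.ofReal (r ^ ((n:ℝ) - 1 - σ))) r := by
                apply setLIntegral_congr_fun measurableSet_Ioi
                intro r hr
                have hr : (0:ℝ) < r := hr
                by_cases hra : r ≤ a
                · simp only [Set.mem_Iic, hra, Set.indicator_of_mem]
                  rw [Real.enorm_eq_ofReal hr.le, ENNReal.ofReal_rpow_of_pos hr, ← ENNReal.ofReal_mul (by positivity),
                    ← Real.rpow_natCast, ← Real.rpow_add hr, ← hnn, Nat.cast_sub hn]
                  simp only [Nat.cast_one]; congr 2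
                · simp [hra]
            _ = ∫⁻ r in Set.Ioc (0:ℝ) a, ENNReal.ofReal (r ^ ((n:ℝ) - 1 - σ)) := by
                rw [setLIntegral_indicator measurableSet_Iic, Set.inter_comm, Set.Ioi_inter_Iic]
            _ = ENNReal.ofReal (∫ r in Set.Ioc (0:ℝ) a, r ^ ((n:ℝ) - 1 - σ)) := by
                rw [ofReal_integral_eq_lintegral_ofReal]
                · have := (intervalIntegral.intervalIntegrable_rpow' (a := 0) (b := a)
                    (r := (n:ℝ) - 1 - σ) (by linarith)).1
                  exact this
                · refine (ae_restrict_iff' measurableSet_Ioc).2 (Eventually.of_forall fun r hr => ?_)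
                  exact Real.rpow_nonneg hr.1.le _
            _ ≤ _ := by
                apply ENNReal.ofReal_le_ofReal
                rw [← intervalIntegral.integral_of_le ha.le, integral_rpow (Or.inl (by linarith))]
                rw [show (n:ℝ) - 1 - σ + 1 = n - σ by ring, Real.zero_rpow hne.ne']
                rw [sub_zero, div_eq_inv_mul]

/-- ENNReal form of the kernel decay. -/
theorem sphK_decay_enn (E : Type*) [NormedAddCommGroup E] [InnerProductSpace ℝ E] [FiniteDimensional ℝ E]
    [MeasurableSpace E] [BorelSpace E] {σ : ℝ} (h0 : 0 ≤ σ)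
    (h1 : σ ≤ (Module.finrank ℝ E : ℝ) - 1 ∨ σ = 0) :
    ∃ C : ℝ, 0 < C ∧ ∀ x : E, ‖sphK x‖ₑ ^ 2 ≤ ENNReal.ofReal C * ‖x‖ₑ ^ (-σ) := by
  have conv : ∀ x : E, ‖sphK x‖ₑ ^ 2 = ENNReal.ofReal (sphK x ^ 2) := by
    intro x
    rw [← enorm_pow, Real.enorm_eq_ofReal (by positivity)]
  by_cases hσ : σ = 0
  · refine ⟨((sphM E).real Set.univ) ^ 2 + 1, by positivity, fun x => ?_⟩
    subst hσ
    simp only [neg_zero, ENNReal.rpow_zero, mul_one]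
    rw [conv]
    apply ENNReal.ofReal_le_ofReal
    have : |sphK x| ≤ (sphM E).real Set.univ := by
      have := norm_integral_le_of_norm_le_const (μ := sphM E) (f := fun ω => Real.cos ⟪x, ω⟫) (C := 1)
        (Eventually.of_forall fun ω => Real.abs_cos_le_one _)
      simpa [sphK] using this
    have := sq_le_sq' (by linarith [neg_abs_le (sphK x)]) ((le_abs_self _).trans this)
    linarith
  · have h2 : σ ≤ (Module.finrank ℝ E : ℝ) - 1 := by tauto
    have hσ0 : 0 < σ := lt_of_le_of_ne h0 (Ne.symm hσ)
    have hpos : 0 < Module.finrank ℝ E := by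
      have : (0:ℝ) < Module.finrank ℝ E := by linarith
      exact_mod_cast this
    have : Nontrivial E := Module.finrank_pos_iff.1 hpos
    obtain ⟨C, hC, h⟩ := sphK_decay E
    refine ⟨C, hC, fun x => ?_⟩
    by_cases hx : x = 0
    · subst hx
      simp [ENNReal.zero_rpow_of_neg (show -σ < 0 by linarith), ENNReal.mul_top, hC]
    · rw [conv, ← ofReal_norm, ENNReal.ofReal_rpow_of_pos (norm_pos_iff.2 hx),
        ← ENNReal.ofReal_mul hC.le]
      exact ENNReal.ofReal_le_ofReal (h σ h0 h2 x hx)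

end Polar

section ProductEst

/-- The character. -/
def ch (t : ℝ) : ℂ := Complex.exp (((2 * π * t : ℝ) : ℂ) * Complex.I)

theorem ch_norm (t : ℝ) : ‖ch t‖ = 1 := Complex.norm_exp_ofReal_mul_I _

theorem ch_enorm (t : ℝ) : ‖ch t‖ₑ = 1 := by rw [← ofReal_norm, ch_norm]; simp

theorem ch_add (s t : ℝ) : ch (s + t) = ch s * ch t := by
  unfold ch; rw [← Complex.exp_add]; congr 1; push_cast; ring

theorem ch_cont : Continuous ch := by unfold ch; fun_prop

theorem fourierInv_ch {E : Type*} [NormedAddCommGroup E] [InnerProductSpace ℝ E] [FiniteDimensional ℝ E]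
    [MeasurableSpace E] [BorelSpace E] (U : E → ℂ) (x : E) :
    𝓕⁻ U x = ∫ ξ, ch ⟪ξ, x⟫ * U ξ := by
  rw [Real.fourierInv_eq']
  congr 1

section avg
variable {E : Type*} [NormedAddCommGroup E] [InnerProductSpace ℝ E] [FiniteDimensional ℝ E]
  [MeasurableSpace E] [BorelSpace E]

theorem sphK_cont : Continuous (sphK : E → ℝ) := by
  unfold sphK
  apply continuous_of_dominated (bound := fun _ => 1)
  · intro x; exact (by fun_prop : Continuous fun ω : E => Real.cos ⟪x, ω⟫).aestronglyMeasurable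
  · intro x; exact Eventually.of_forall fun ω => Real.abs_cos_le_one _
  · exact integrable_const _
  · exact Eventually.of_forall fun ω => by fun_prop

theorem sphK_cexp (x : E) :
    ∫ ω, Complex.exp (((⟪x, ω⟫ : ℝ) : ℂ) * Complex.I) ∂(sphM E) = (sphK x : ℂ) := by
  have h1 : ∫ ω, Real.sin ⟪x, ω⟫ ∂(sphM E) = 0 := by
    have := (sphM_inv (LinearIsometryEquiv.neg ℝ (E := E))).integral_comp
      (LinearIsometryEquiv.neg ℝ (E := E)).toHomeomorph.measurableEmbedding (fun ω => Real.sin ⟪x, ω⟫)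
    simp only [LinearIsometryEquiv.coe_neg, inner_neg_right, Real.sin_neg, integral_neg] at this
    linarith
  have h2 : ∀ ω : E, Complex.exp (((⟪x, ω⟫ : ℝ) : ℂ) * Complex.I)
      = ((Real.cos ⟪x, ω⟫ : ℝ) : ℂ) + ((Real.sin ⟪x, ω⟫ : ℝ) : ℂ) * Complex.I := by
    intro ω; rw [Complex.exp_mul_I]; push_cast; rfl
  simp only [h2]
  rw [integral_add, integral_mul_const, integral_complex_ofReal, integral_complex_ofReal, h1]
  · simp [sphK]
  · exact (integrable_sphM (by fun_prop : Continuous fun ω : E => Real.cos ⟪x, ω⟫)).ofReal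
  · exact ((integrable_sphM (by fun_prop : Continuous fun ω : E => Real.sin ⟪x, ω⟫)).ofReal).mul_const _

theorem avg_lemma {X : Type*} [MeasurableSpace X] {ν : Measure X} [SFinite ν] {f : X → ℂ}
    (hf : Integrable f ν) {η : X → E} (hη : Measurable η) (y : E)
    (hsym : ∀ y', ‖y'‖ = ‖y‖ → ∫ x, ch ⟪η x, y'⟫ * f x ∂ν = ∫ x, ch ⟪η x, y⟫ * f x ∂ν) :
    ((sphM E).real Set.univ : ℂ) * ∫ x, ch ⟪η x, y⟫ * f x ∂ν
      = ∫ x, (sphK ((2 * π * ‖y‖) • η x) : ℂ) * f x ∂ν := by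
  have h1 : ((sphM E).real Set.univ : ℂ) * ∫ x, ch ⟪η x, y⟫ * f x ∂ν
      = ∫ ω, (∫ x, ch ⟪η x, ‖y‖ • ω⟫ * f x ∂ν) ∂(sphM E) := by
    have h2 : ∫ ω, (∫ x, ch ⟪η x, ‖y‖ • ω⟫ * f x ∂ν) ∂(sphM E)
        = ∫ ω, (∫ x, ch ⟪η x, y⟫ * f x ∂ν) ∂(sphM E) := by
      apply integral_congr_ae
      have h3 : ∀ᵐ ω ∂(sphM E), ‖(‖y‖ • ω)‖ = ‖y‖ := by
        rcases subsingleton_or_nontrivial E with hE | hE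
        · exact Eventually.of_forall fun ω => by rw [Subsingleton.elim (‖y‖ • ω) y]
        · filter_upwards [sphM_norm] with ω hω
          rw [norm_smul, hω]; simp
      filter_upwards [h3] with ω hω
      exact hsym _ hω
    rw [h2, integral_const]; simp
  rw [h1, integral_integral_swap]
  · congr 1; ext x
    rw [integral_mul_const]
    congr 1
    rw [← sphK_cexp]
    congr 1; ext ω
    simp only [ch, inner_smul_left, inner_smul_right]
    congr 3
    simp; ring
  · have hm : AEStronglyMeasurable (Function.uncurry fun (ω : E) (x : X) => ch ⟪η x, ‖y‖ • ω⟫ * f x)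
        ((sphM E).prod ν) := by
      apply AEStronglyMeasurable.mul
      · apply Measurable.aestronglyMeasurable
        apply ch_cont.measurable.comp
        exact (hη.comp measurable_snd).inner ((measurable_fst).const_smul ‖y‖)
      · exact hf.1.comp_snd
    refine Integrable.mono' ((integrable_const (1:ℝ)).mul_prod hf.norm) hm ?_
    refine Eventually.of_forall fun ⟨ω, x⟩ => ?_
    simp [ch_norm]

theorem cs_enn {X : Type*} [MeasurableSpace X] {ν : Measure X} {f g : X → ℝ≥0∞}
    (hf : AEMeasurable f ν) (hg : AEMeasurable g ν) :
    (∫⁻ x, f x * g x ∂ν) ^ 2 ≤ (∫⁻ x, f x ^ 2 ∂ν) * (∫⁻ x, g x ^ 2 ∂ν) := by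
  have h := ENNReal.lintegral_mul_le_Lp_mul_Lq ν Real.HolderConjugate.two_two hf hg
  calc (∫⁻ x, f x * g x ∂ν) ^ 2 ≤ ((∫⁻ x, f x ^ (2:ℝ) ∂ν) ^ (1/2:ℝ) * (∫⁻ x, g x ^ (2:ℝ) ∂ν) ^ (1/2:ℝ)) ^ 2 := by
        gcongr; exact h
    _ = _ := by
      rw [mul_pow, ← ENNReal.rpow_natCast, ← ENNReal.rpow_natCast, ← ENNReal.rpow_mul, ← ENNReal.rpow_mul]
      simp

theorem eLpNorm_two_sq {X : Type*} [MeasurableSpace X] {ν : Measure X} (f : X → ℂ) :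
    eLpNorm f 2 ν ^ 2 = ∫⁻ x, ‖f x‖ₑ ^ 2 ∂ν := by
  rw [eLpNorm_eq_lintegral_rpow_enorm_toReal (by norm_num) (by norm_num), ← ENNReal.rpow_natCast,
    ← ENNReal.rpow_mul]
  simp

end avg

variable {E1 E2 : Type*} [NormedAddCommGroup E1] [InnerProductSpace ℝ E1] [FiniteDimensional ℝ E1]
  [MeasurableSpace E1] [BorelSpace E1] [NormedAddCommGroup E2] [InnerProductSpace ℝ E2]
  [FiniteDimensional ℝ E2] [MeasurableSpace E2] [BorelSpace E2]

/-- Product inverse Fourier integral. -/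
def PF (U : E1 × E2 → ℂ) (y : E1) (z : E2) : ℂ := ∫ p : E1 × E2, ch (⟪p.1, y⟫ + ⟪p.2, z⟫) * U p

theorem PF_swap (U : E1 × E2 → ℂ) (y : E1) (z : E2) : PF (U ∘ Prod.swap) z y = PF U y z := by
  unfold PF
  have := (Measure.measurePreserving_swap (μ := (volume : Measure E2)) (ν := (volume : Measure E1))).integral_comp
    MeasurableEquiv.prodComm.measurableEmbedding (fun p : E1 × E2 => ch (⟪p.1, y⟫ + ⟪p.2, z⟫) * U p)
  rw [← Measure.volume_eq_prod, ← Measure.volume_eq_prod] at this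
  rw [← this]
  congr 1; ext p; simp [add_comm]

theorem PF_eq (U : E1 × E2 → ℂ) (y : E1) (z : E2) :
    PF U y z = 𝓕⁻ (U ∘ (WithLp.ofLp : WithLp 2 (E1 × E2) → E1 × E2)) (WithLp.toLp 2 (y, z)) := by
  rw [fourierInv_ch]
  unfold PF
  rw [← (WithLp.volume_preserving_ofLp E1 E2).integral_comp
    (MeasurableEquiv.toLp 2 (E1 × E2)).symm.measurableEmbedding]
  congr 1

theorem PF_plancherel {U : E1 × E2 → ℂ} (hU : MemLp U 2 volume) (hi : Integrable U volume) :
    ∫⁻ p : E1 × E2, ‖PF U p.1 p.2‖ₑ ^ 2 = ∫⁻ p : E1 × E2, ‖U p‖ₑ ^ 2 := by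
  have mp := WithLp.volume_preserving_ofLp E1 E2
  have mp' := WithLp.volume_preserving_toLp E1 E2
  have hU' : MemLp (U ∘ (WithLp.ofLp : WithLp 2 (E1 × E2) → E1 × E2)) 2 volume :=
    hU.comp_measurePreserving mp
  have hi' : Integrable (U ∘ (WithLp.ofLp : WithLp 2 (E1 × E2) → E1 × E2)) volume :=
    mp.integrable_comp_of_integrable hi
  have h1 := eLpNorm_congr_ae (p := 2) (IF_eq_integral hU' hi')
  rw [IF_norm hU', eLpNorm_comp_measurePreserving hU.1 mp] at h1
  have h2 := congrArg (· ^ 2) h1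
  simp only [eLpNorm_two_sq] at h2
  rw [h2, ← mp'.lintegral_comp_emb (MeasurableEquiv.toLp 2 (E1 × E2)).measurableEmbedding]
  simp only [PF_eq]

end ProductEst

section ProductEst2

variable {E1 E2 : Type*} [NormedAddCommGroup E1] [InnerProductSpace ℝ E1] [FiniteDimensional ℝ E1]
  [MeasurableSpace E1] [BorelSpace E1] [NormedAddCommGroup E2] [InnerProductSpace ℝ E2]
  [FiniteDimensional ℝ E2] [MeasurableSpace E2] [BorelSpace E2]

theorem PF_avg1 {U : E1 × E2 → ℂ} (hi : Integrable U volume)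
    (hsym : ∀ y y' z, ‖y'‖ = ‖y‖ → PF U y' z = PF U y z) (y : E1) (z : E2) :
    ((sphM E1).real Set.univ : ℂ) * PF U y z
      = ∫ p : E1 × E2, ch ⟪p.2, z⟫ * ((sphK ((2 * π * ‖y‖) • p.1) : ℂ) * U p) := by
  have hf : Integrable (fun p : E1 × E2 => ch ⟪p.2, z⟫ * U p) volume := by
    apply hi.bdd_mul (c := 1)
    · apply Continuous.aestronglyMeasurable
      exact ch_cont.comp (by fun_prop)
    · exact Eventually.of_forall fun p => (ch_norm _).le
  have e : ∀ y', PF U y' z = ∫ p : E1 × E2, ch ⟪p.1, y'⟫ * (ch ⟪p.2, z⟫ * U p) := by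
    intro y'; unfold PF; congr 1; ext p; rw [ch_add]; ring
  have h := avg_lemma (ν := (volume : Measure (E1 × E2))) hf measurable_fst y
    (fun y' hy' => by rw [← e, ← e]; exact hsym y y' z hy')
  rw [e, h]
  congr 1; ext p; ring

theorem sphK_U_integrable {U : E1 × E2 → ℂ} (hi : Integrable U volume) (c : ℝ) :
    Integrable (fun p : E1 × E2 => (sphK (c • p.1) : ℂ) * U p) volume := by
  apply hi.bdd_mul (c := (sphM E1).real Set.univ)
  · apply Continuous.aestronglyMeasurable
    exact Complex.continuous_ofReal.comp (sphK_cont.comp (by fun_prop))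
  · refine Eventually.of_forall fun p => ?_
    have := norm_integral_le_of_norm_le_const (μ := sphM E1) (f := fun ω => Real.cos ⟪c • p.1, ω⟫) (C := 1)
        (Eventually.of_forall fun ω => Real.abs_cos_le_one _)
    rw [Complex.norm_real]
    simpa [sphK] using this

theorem PF_avg12 {U : E1 × E2 → ℂ} (hi : Integrable U volume)
    (hsym : ∀ y y' z, ‖y'‖ = ‖y‖ → PF U y' z = PF U y z)
    (hsym2 : ∀ y z z', ‖z'‖ = ‖z‖ → PF U y z' = PF U y z) (y : E1) (z : E2) :
    ((sphM E2).real Set.univ : ℂ) * (((sphM E1).real Set.univ : ℂ) * PF U y z)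
      = ∫ p : E1 × E2, (sphK ((2 * π * ‖z‖) • p.2) : ℂ) * ((sphK ((2 * π * ‖y‖) • p.1) : ℂ) * U p) := by
  rw [PF_avg1 hi hsym]
  apply avg_lemma (ν := (volume : Measure (E1 × E2))) (sphK_U_integrable hi _) measurable_snd z
  intro z' hz'
  rw [← PF_avg1 hi hsym, ← PF_avg1 hi hsym, hsym2 y z z' hz']

theorem slice_bound {U : E1 × E2 → ℂ} (hUm : Measurable U) (hU : MemLp U 2 volume)
    (hi : Integrable U volume)
    (hsym : ∀ y y' z, ‖y'‖ = ‖y‖ → PF U y' z = PF U y z) {S : Set (E1 × E2)} (hS : MeasurableSet S)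
    (h0 : ∀ p, p ∉ S → U p = 0) (y : E1) {B : ℝ≥0∞} (hBt : B ≠ ∞)
    (hB : ∀ ζ : E2, ∫⁻ η in {η : E1 | (η, ζ) ∈ S}, ‖sphK ((2 * π * ‖y‖) • η)‖ₑ ^ 2 ≤ B) :
    (sphM E1 Set.univ) ^ 2 * ∫⁻ z : E2, ‖PF U y z‖ₑ ^ 2 ≤ B * ∫⁻ p, ‖U p‖ₑ ^ 2 := by
  set k : E1 → ℝ := fun η => sphK ((2 * π * ‖y‖) • η) with hk
  have hkm : Measurable k := (sphK_cont.comp (by fun_prop : Continuous fun η : E1 => (2 * π * ‖y‖) • η)).measurable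
  set G : E2 → ℂ := fun ζ => ∫ η : E1, (k η : ℂ) * U (η, ζ) with hG
  have hki := sphK_U_integrable hi (2 * π * ‖y‖)
  have hGi : Integrable G volume := by
    rw [Measure.volume_eq_prod] at hki
    exact hki.integral_prod_right
  have hGb : ∀ ζ, ‖G ζ‖ₑ ^ 2 ≤ B * ∫⁻ η : E1, ‖U (η, ζ)‖ₑ ^ 2 := by
    intro ζ
    have hSζ : MeasurableSet {η : E1 | (η, ζ) ∈ S} := measurable_prodMk_right hS
    have h1 : ‖G ζ‖ₑ ≤ ∫⁻ η in {η : E1 | (η, ζ) ∈ S}, ‖k η‖ₑ * ‖U (η, ζ)‖ₑ := by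
      refine (enorm_integral_le_lintegral_enorm _).trans ?_
      rw [← lintegral_indicator hSζ]
      apply lintegral_mono
      intro η
      by_cases hη : (η, ζ) ∈ S
      · have e : ‖((k η : ℝ) : ℂ)‖ₑ = ‖k η‖ₑ := by rw [← ofReal_norm, ← ofReal_norm, Complex.norm_real]
        simp [Set.indicator, hη, e]
      · simp [h0 _ hη]
    calc ‖G ζ‖ₑ ^ 2 ≤ (∫⁻ η in {η : E1 | (η, ζ) ∈ S}, ‖k η‖ₑ * ‖U (η, ζ)‖ₑ) ^ 2 := by gcongr
      _ ≤ _ := cs_enn hkm.enorm.aemeasurable (hUm.comp measurable_prodMk_right).enorm.aemeasurable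
      _ ≤ _ := by
        gcongr
        · exact hB ζ
        · exact Measure.restrict_le_self
  have hGs : ∫⁻ ζ, ‖G ζ‖ₑ ^ 2 ≤ B * ∫⁻ p, ‖U p‖ₑ ^ 2 := by
    refine (lintegral_mono hGb).trans ?_
    rw [lintegral_const_mul _ (Measurable.lintegral_prod_left' (f := fun p : E1 × E2 => ‖U p‖ₑ ^ 2)
      (hUm.enorm.pow_const 2))]
    rw [Measure.volume_eq_prod, lintegral_prod_symm _ (hUm.enorm.pow_const 2).aemeasurable]
  have hG2 : MemLp G 2 volume := by
    refine ⟨hGi.1, ?_⟩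
    have h2 : eLpNorm G 2 volume ^ 2 < ∞ := by
      rw [eLpNorm_two_sq]
      refine hGs.trans_lt ?_
      rw [← eLpNorm_two_sq]
      exact ENNReal.mul_lt_top hBt.lt_top (ENNReal.pow_lt_top hU.2)
    by_contra h
    rw [not_lt, top_le_iff] at h
    rw [h] at h2; simp at h2
  have hPF : ∀ z, ((sphM E1).real Set.univ : ℂ) * PF U y z = 𝓕⁻ G z := by
    intro z
    rw [PF_avg1 hi hsym, fourierInv_ch, Measure.volume_eq_prod, integral_prod_symm]
    · congr 1; ext ζ
      simp only [hG, hk]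
      rw [← integral_const_mul]
    · rw [← Measure.volume_eq_prod]
      apply hki.bdd_mul (c := 1)
      · apply Continuous.aestronglyMeasurable
        exact ch_cont.comp (by fun_prop)
      · exact Eventually.of_forall fun p => (ch_norm _).le
  have hM : ‖((sphM E1).real Set.univ : ℂ)‖ₑ = sphM E1 Set.univ := by
    rw [← ofReal_norm, Complex.norm_real, Real.norm_of_nonneg (by positivity), Measure.real,
      ENNReal.ofReal_toReal (measure_ne_top _ _)]
  calc (sphM E1 Set.univ) ^ 2 * ∫⁻ z : E2, ‖PF U y z‖ₑ ^ 2
      = ∫⁻ z : E2, ‖𝓕⁻ G z‖ₑ ^ 2 := by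
        rw [← lintegral_const_mul' _ _ (ENNReal.pow_lt_top (measure_lt_top _ _)).ne]
        congr 1; ext z
        rw [← hPF, enorm_mul, mul_pow, hM]
    _ = ∫⁻ ζ, ‖G ζ‖ₑ ^ 2 := by
        rw [← eLpNorm_two_sq, ← eLpNorm_two_sq, ← eLpNorm_congr_ae (IF_eq_integral hG2 hGi), IF_norm hG2]
    _ ≤ _ := hGs

theorem PF_cont {U : E1 × E2 → ℂ} (hi : Integrable U volume) :
    Continuous (fun p : E1 × E2 => PF U p.1 p.2) := by
  have hi' : Integrable (U ∘ (WithLp.ofLp : WithLp 2 (E1 × E2) → E1 × E2)) volume :=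
    (WithLp.volume_preserving_ofLp E1 E2).integrable_comp_of_integrable hi
  simp only [PF_eq]
  exact (fourierInv_continuous hi').comp (WithLp.prod_continuous_toLp 2 E1 E2)

theorem slices (E1 E2 : Type*) [NormedAddCommGroup E1] [InnerProductSpace ℝ E1] [FiniteDimensional ℝ E1]
    [MeasurableSpace E1] [BorelSpace E1] [NormedAddCommGroup E2] [InnerProductSpace ℝ E2]
    [FiniteDimensional ℝ E2] [MeasurableSpace E2] [BorelSpace E2] [Nontrivial E1] :
    ∃ C : ℝ, 0 < C ∧ ∀ (U : E1 × E2 → ℂ) (w : ℝ) (I : E2 → Set ℝ), 0 < w → (∀ ζ, MeasurableSet (I ζ)) →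
      (∀ ζ, volume (I ζ) ≤ ENNReal.ofReal w) → Measurable U → MemLp U 2 volume →
      Integrable U volume → (∀ y y' z, ‖y'‖ = ‖y‖ → PF U y' z = PF U y z) →
      ∀ S : Set (E1 × E2), MeasurableSet S → (∀ p, p ∉ S → U p = 0) → (∀ p ∈ S, ‖p.1‖ ∈ I p.2) →
      ∀ y : E1, ∫⁻ z, ‖PF U y z‖ₑ ^ 2
        ≤ ENNReal.ofReal (C * w) * ‖y‖ₑ ^ (-((Module.finrank ℝ E1 : ℝ)-1)) * ∫⁻ p, ‖U p‖ₑ ^ 2 := by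
  have hn1 : 1 ≤ Module.finrank ℝ E1 := Module.finrank_pos
  have hn1' : (1:ℝ) ≤ Module.finrank ℝ E1 := by exact_mod_cast hn1
  set n : ℝ := (Module.finrank ℝ E1 : ℝ) with hn
  obtain ⟨C1, hC1, hk⟩ := sphK_decay_enn E1 (σ := n - 1) (by linarith) (Or.inl le_rfl)
  obtain ⟨C2, hC2, ha⟩ := polar_annulus E1
  set M := (sphM E1).real Set.univ with hM
  have hM0 : 0 < M := ENNReal.toReal_pos sphM_univ_pos.ne' (measure_ne_top _ _)
  have hMe : sphM E1 Set.univ = ENNReal.ofReal M := (ENNReal.ofReal_toReal (measure_ne_top _ _)).symm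
  set C4 : ℝ := C1 * (2 * π) ^ (-(n-1)) * C2 * (M ^ 2)⁻¹ with hC4
  have hC40 : 0 < C4 := by positivity
  refine ⟨C4, hC40, fun U w I hw hIm hIw hUm hU hi hsym S hSm hS0 hSI => ?_⟩
  set N := ∫⁻ p, ‖U p‖ₑ ^ 2 with hN
  intro y
  by_cases hy : y = 0 ∧ 1 < n
  · obtain ⟨hy, hn1⟩ := hy
    subst hy
    by_cases hN0 : N = 0
    · have : U =ᵐ[volume] 0 := by
        have h1 := (lintegral_eq_zero_iff (hUm.enorm.pow_const 2)).1 hN0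
        filter_upwards [h1] with p hp
        simpa using hp
      have h2 : ∀ y z, PF U y z = 0 := by
        intro y z
        unfold PF
        rw [integral_eq_zero_of_ae]
        filter_upwards [this] with p hp
        simp [hp]
      simp [h2]
    · rw [enorm_zero, ENNReal.zero_rpow_of_neg (by linarith), ENNReal.mul_top, ENNReal.top_mul hN0]
      · exact le_top
      · simpa using by positivity
  have hfin : ‖y‖ₑ ^ (-(n-1)) ≠ ∞ := by
    rw [not_and_or] at hy
    rcases hy with hy | hy
    · apply ENNReal.rpow_ne_top_of_ne_zero <;> simp [hy]
    · have : n = 1 := by linarith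
      simp [this]
  have h2pi : ENNReal.ofReal (2 * π) ^ (-(n-1)) = ENNReal.ofReal ((2 * π) ^ (-(n-1))) :=
    ENNReal.ofReal_rpow_of_pos (by positivity)
  have h := slice_bound hUm hU hi hsym hSm hS0 y
    (B := ENNReal.ofReal (C1 * (2 * π) ^ (-(n-1)) * C2 * w) * ‖y‖ₑ ^ (-(n-1)))
    (ENNReal.mul_ne_top ENNReal.ofReal_ne_top hfin) (by
      intro ζ
      calc ∫⁻ η in {η : E1 | (η, ζ) ∈ S}, ‖sphK ((2 * π * ‖y‖) • η)‖ₑ ^ 2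
          ≤ ∫⁻ η in {η : E1 | ‖η‖ ∈ I ζ}, ‖sphK ((2 * π * ‖y‖) • η)‖ₑ ^ 2 :=
            lintegral_mono_set (fun η hη => hSI _ hη)
        _ ≤ ∫⁻ η in {η : E1 | ‖η‖ ∈ I ζ}, (ENNReal.ofReal (C1 * (2 * π) ^ (-(n-1))) * ‖y‖ₑ ^ (-(n-1)))
              * ‖η‖ₑ ^ (-(n-1)) := by
            apply lintegral_mono
            intro η
            refine (hk _).trans (le_of_eq ?_)
            rw [enorm_smul, enorm_mul, enorm_norm,
              ENNReal.mul_rpow_of_ne_top (by finiteness) (by finiteness),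
              ENNReal.mul_rpow_of_ne_top (by finiteness) (by finiteness),
              Real.enorm_eq_ofReal (by positivity), h2pi, ENNReal.ofReal_mul hC1.le]
            ring
        _ = (ENNReal.ofReal (C1 * (2 * π) ^ (-(n-1))) * ‖y‖ₑ ^ (-(n-1)))
              * ∫⁻ η in {η : E1 | ‖η‖ ∈ I ζ}, ‖η‖ₑ ^ (-(n-1)) := by
            rw [lintegral_const_mul]; fun_prop
        _ ≤ (ENNReal.ofReal (C1 * (2 * π) ^ (-(n-1))) * ‖y‖ₑ ^ (-(n-1)))
              * (ENNReal.ofReal C2 * ENNReal.ofReal w) := by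
            gcongr
            exact (ha _ (hIm ζ)).trans (by gcongr; exact hIw ζ)
        _ = _ := by
            rw [ENNReal.ofReal_mul (by positivity : 0 ≤ C1 * (2 * π) ^ (-(n-1)) * C2),
              ENNReal.ofReal_mul (by positivity : 0 ≤ C1 * (2 * π) ^ (-(n-1)))]
            ring)
  rw [hMe, ← ENNReal.ofReal_pow hM0.le] at h
  have hMp : (0:ℝ) < M ^ 2 := by positivity
  rw [mul_comm, ← ENNReal.le_div_iff_mul_le (Or.inl (by simpa using hM0.ne')) (Or.inl (by finiteness))] at h
  refine h.trans (le_of_eq ?_)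
  rw [div_eq_mul_inv, ← ENNReal.ofReal_inv_of_pos hMp]
  have : C4 * w = C1 * (2 * π) ^ (-(n-1)) * C2 * w * (M ^ 2)⁻¹ := by rw [hC4]; ring
  rw [this, ENNReal.ofReal_mul (by positivity : 0 ≤ C1 * (2 * π) ^ (-(n-1)) * C2 * w)]
  ring


theorem weighted_aux {E1 : Type*} [NormedAddCommGroup E1] [InnerProductSpace ℝ E1] [FiniteDimensional ℝ E1]
    [MeasurableSpace E1] [BorelSpace E1] [Nontrivial E1] {τ n w C4 C3 : ℝ} (hτ0 : 0 ≤ τ) (hw : 0 < w)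
    (hC40 : 0 < C4) (hC3 : 0 < C3) {N : ℝ≥0∞}
    {F : E1 → ℝ≥0∞} (hF : Measurable F) (htot : ∫⁻ y, F y = N)
    (hslice : ∀ y, F y ≤ ENNReal.ofReal (C4 * w) * ‖y‖ₑ ^ (-(n - 1)) * N)
    (hb : ∀ a : ℝ, 0 < a → ∫⁻ x in Metric.closedBall (0 : E1) a, ‖x‖ₑ ^ (-(n - 1 + τ)) ≤
        ENNReal.ofReal (C3 * a ^ (n - (n - 1 + τ)))) :
    ∫⁻ y : E1, F y * (ENNReal.ofReal w * ‖y‖ₑ) ^ (-τ) ≤ ENNReal.ofReal (C4 * C3 + 1) * N := by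
  have A1 : ∫⁻ y in Metric.closedBall (0 : E1) w⁻¹, F y * (ENNReal.ofReal w * ‖y‖ₑ) ^ (-τ)
      ≤ ENNReal.ofReal (C4 * C3) * N := by
    calc ∫⁻ y in Metric.closedBall (0 : E1) w⁻¹, F y * (ENNReal.ofReal w * ‖y‖ₑ) ^ (-τ)
        ≤ ∫⁻ y in Metric.closedBall (0 : E1) w⁻¹,
          (ENNReal.ofReal (C4 * w) * N * ENNReal.ofReal (w ^ (-τ))) * ‖y‖ₑ ^ (-(n - 1 + τ)) := by
          apply lintegral_mono_ae
          have hae : ∀ᵐ y : E1, y ≠ 0 := by rw [ae_iff]; simp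
          filter_upwards [ae_restrict_of_ae hae] with y hy
          refine (mul_le_mul_left (hslice y) _).trans (le_of_eq ?_)
          rw [ENNReal.mul_rpow_of_ne_top (by finiteness) (by finiteness), ENNReal.ofReal_rpow_of_pos hw]
          rw [show -(n - 1 + τ) = -(n-1) + -τ by ring, ENNReal.rpow_add _ _ (by simpa using hy) (by finiteness)]
          ring
      _ = (ENNReal.ofReal (C4 * w) * N * ENNReal.ofReal (w ^ (-τ))) *
            ∫⁻ y in Metric.closedBall (0 : E1) w⁻¹, ‖y‖ₑ ^ (-(n - 1 + τ)) := by
          rw [lintegral_const_mul]; fun_prop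
      _ ≤ (ENNReal.ofReal (C4 * w) * N * ENNReal.ofReal (w ^ (-τ))) *
            ENNReal.ofReal (C3 * w⁻¹ ^ (n - (n - 1 + τ))) := by
          gcongr
          exact hb w⁻¹ (by positivity)
      _ = ENNReal.ofReal (C4 * w * w ^ (-τ) * (C3 * w⁻¹ ^ (n - (n - 1 + τ)))) * N := by
          rw [ENNReal.ofReal_mul (by positivity : 0 ≤ C4 * w * w ^ (-τ)), ENNReal.ofReal_mul (by positivity : 0 ≤ C4 * w)]; ring
      _ = _ := by
          congr 2
          have : w⁻¹ ^ (n - (n - 1 + τ)) = w⁻¹ * w ^ τ := by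
            rw [show n - (n - 1 + τ) = 1 - τ by ring, Real.inv_rpow hw.le, Real.rpow_sub hw, Real.rpow_one]
            field_simp
          rw [this, Real.rpow_neg hw.le]
          have : w ^ τ ≠ 0 := by positivity
          field_simp
  have A2 : ∫⁻ y in (Metric.closedBall (0 : E1) w⁻¹)ᶜ, F y * (ENNReal.ofReal w * ‖y‖ₑ) ^ (-τ)
      ≤ N := by
    rw [← htot]
    calc ∫⁻ y in (Metric.closedBall (0 : E1) w⁻¹)ᶜ, F y * (ENNReal.ofReal w * ‖y‖ₑ) ^ (-τ) ≤ ∫⁻ y in (Metric.closedBall (0 : E1) w⁻¹)ᶜ, F y := by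
          apply setLIntegral_mono hF
          intro y hy
          simp only [Set.mem_compl_iff, Metric.mem_closedBall, dist_zero_right, not_le] at hy
          have h1 : 1 ≤ ENNReal.ofReal w * ‖y‖ₑ := by
            rw [← ofReal_norm, ← ENNReal.ofReal_mul hw.le, ENNReal.one_le_ofReal]
            rw [inv_lt_iff_one_lt_mul₀ hw] at hy
            linarith
          calc _ ≤ F y * 1 := by
                gcongr
                rw [ENNReal.rpow_neg, ENNReal.inv_le_one]
                exact (ENNReal.one_rpow τ).symm.le.trans (ENNReal.rpow_le_rpow h1 hτ0)
            _ = _ := mul_one _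
      _ ≤ _ := setLIntegral_le_lintegral _ _

  rw [← lintegral_add_compl _ (Metric.isClosed_closedBall.measurableSet :
    MeasurableSet (Metric.closedBall (0 : E1) w⁻¹))]
  rw [ENNReal.ofReal_add (by positivity) (by norm_num), add_mul, ENNReal.ofReal_one, one_mul]
  exact add_le_add A1 A2

theorem fubini_aux {E1 E2 : Type*} [NormedAddCommGroup E1] [InnerProductSpace ℝ E1] [FiniteDimensional ℝ E1]
    [MeasurableSpace E1] [BorelSpace E1] [NormedAddCommGroup E2] [InnerProductSpace ℝ E2]
    [FiniteDimensional ℝ E2] [MeasurableSpace E2] [BorelSpace E2] {H : E1 × E2 → ℝ≥0∞} (hH : Measurable H)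
    {W : E1 → ℝ≥0∞} (hwm : Measurable W) :
    Measurable (fun y => ∫⁻ z, H (y, z)) ∧ ∫⁻ y, ∫⁻ z, H (y, z) = ∫⁻ p, H p ∧
    ∫⁻ p, H p * W p.1 = ∫⁻ y, (∫⁻ z, H (y, z)) * W y := by
  refine ⟨Measurable.lintegral_prod_right' hH, ?_, ?_⟩
  · rw [Measure.volume_eq_prod, lintegral_prod _ hH.aemeasurable]
  · rw [Measure.volume_eq_prod, lintegral_prod (fun p : E1 × E2 => H p * W p.1) (hH.mul (hwm.comp measurable_fst)).aemeasurable]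
    congr 1; ext y
    dsimp only
    rw [lintegral_mul_const]
    exact hH.comp measurable_prodMk_left

set_option maxHeartbeats 400000 in
theorem weighted (E1 E2 : Type*) [NormedAddCommGroup E1] [InnerProductSpace ℝ E1] [FiniteDimensional ℝ E1]
    [MeasurableSpace E1] [BorelSpace E1] [NormedAddCommGroup E2] [InnerProductSpace ℝ E2]
    [FiniteDimensional ℝ E2] [MeasurableSpace E2] [BorelSpace E2] [Nontrivial E1] {τ : ℝ}
    (hτ0 : 0 ≤ τ) (hτ1 : τ < 1) :
    ∃ C : ℝ, 0 < C ∧ ∀ (U : E1 × E2 → ℂ) (w : ℝ) (I : E2 → Set ℝ), 0 < w → (∀ ζ, MeasurableSet (I ζ)) →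
      (∀ ζ, volume (I ζ) ≤ ENNReal.ofReal w) → Measurable U → MemLp U 2 volume →
      Integrable U volume → (∀ y y' z, ‖y'‖ = ‖y‖ → PF U y' z = PF U y z) →
      ∀ S : Set (E1 × E2), MeasurableSet S → (∀ p, p ∉ S → U p = 0) → (∀ p ∈ S, ‖p.1‖ ∈ I p.2) →
      ∫⁻ p : E1 × E2, ‖PF U p.1 p.2‖ₑ ^ 2 * (ENNReal.ofReal w * ‖p.1‖ₑ) ^ (-τ)
        ≤ ENNReal.ofReal C * ∫⁻ p, ‖U p‖ₑ ^ 2 := by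
  have hn1 : 1 ≤ Module.finrank ℝ E1 := Module.finrank_pos
  have hn1' : (1:ℝ) ≤ Module.finrank ℝ E1 := by exact_mod_cast hn1
  obtain ⟨C4, hC40, hsl⟩ := slices E1 E2
  obtain ⟨C3, hC3, hb⟩ := polar_ball E1 (σ := (Module.finrank ℝ E1 : ℝ) - 1 + τ) (by linarith) (Or.inl (by linarith))
  refine ⟨C4 * C3 + 1, by positivity, fun U w I hw hIm hIw hUm hU hi hsym S hSm hS0 hSI => ?_⟩
  have hslice := hsl U w I hw hIm hIw hUm hU hi hsym S hSm hS0 hSI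
  clear hsl

  -- total
  have hmeas : Measurable (fun p : E1 × E2 => ‖PF U p.1 p.2‖ₑ ^ 2) :=
    ((PF_cont hi).measurable.enorm.pow_const 2)
  obtain ⟨hm1, htot, e1⟩ := fubini_aux hmeas (hwm := (by fun_prop : Measurable (fun y : E1 => (ENNReal.ofReal w * ‖y‖ₑ) ^ (-τ))))
  rw [PF_plancherel hU hi] at htot
  dsimp only at e1 hm1 htot
  rw [e1]
  exact weighted_aux hτ0 hw hC40 hC3 hm1 htot hslice hb

end ProductEst2

section Piece

theorem strip_bound (E2 : Type*) [NormedAddCommGroup E2] [InnerProductSpace ℝ E2]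
    [FiniteDimensional ℝ E2] [MeasurableSpace E2] [BorelSpace E2] [Nontrivial E2] :
    ∃ C : ℝ, 0 < C ∧ ∀ (J : Set ℝ) (w : ℝ), MeasurableSet J → volume J ≤ ENNReal.ofReal w →
      volume {ζ : E2 | ‖ζ‖ ∈ J ∧ ‖ζ‖ ≤ 2} ≤ ENNReal.ofReal C * ENNReal.ofReal w := by
  obtain ⟨C, hC, h⟩ := polar_annulus E2
  have hn1 : 1 ≤ Module.finrank ℝ E2 := Module.finrank_pos
  have hn1' : (1:ℝ) ≤ Module.finrank ℝ E2 := by exact_mod_cast hn1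
  generalize (Module.finrank ℝ E2 : ℝ) = n at *
  refine ⟨2 ^ (n-1) * C, by positivity, fun J w hJ hw => ?_⟩
  have hm : MeasurableSet {ζ : E2 | ‖ζ‖ ∈ J ∧ ‖ζ‖ ≤ 2} := by
    apply MeasurableSet.inter (measurable_norm hJ) (measurableSet_le measurable_norm measurable_const)
  calc volume {ζ : E2 | ‖ζ‖ ∈ J ∧ ‖ζ‖ ≤ 2} = ∫⁻ ζ in {ζ : E2 | ‖ζ‖ ∈ J ∧ ‖ζ‖ ≤ 2}, 1 := by simp
    _ ≤ ∫⁻ ζ in {ζ : E2 | ‖ζ‖ ∈ J ∧ ‖ζ‖ ≤ 2}, ENNReal.ofReal (2 ^ (n-1)) * ‖ζ‖ₑ ^ (-(n-1)) := by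
        apply setLIntegral_mono (by fun_prop)
        intro ζ hζ
        have h2 : ‖ζ‖ₑ ≤ ENNReal.ofReal 2 := by
          rw [← ofReal_norm]; exact ENNReal.ofReal_le_ofReal hζ.2
        rw [← ENNReal.ofReal_rpow_of_pos (by norm_num), ENNReal.rpow_neg]
        rw [← div_eq_mul_inv]
        by_cases h0 : ‖ζ‖ₑ ^ (n-1) = 0
        · rw [h0, ENNReal.div_zero]; exact le_top
          · refine (ENNReal.rpow_pos ?_ ?_).ne' <;> simp
        rw [ENNReal.le_div_iff_mul_le (Or.inl h0) (Or.inl (ENNReal.rpow_ne_top_of_nonneg (by linarith) (by simp))), one_mul]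
        exact ENNReal.rpow_le_rpow h2 (by linarith)
    _ = ENNReal.ofReal (2 ^ (n-1)) * ∫⁻ ζ in {ζ : E2 | ‖ζ‖ ∈ J ∧ ‖ζ‖ ≤ 2}, ‖ζ‖ₑ ^ (-(n-1)) := by
        rw [lintegral_const_mul]; fun_prop
    _ ≤ ENNReal.ofReal (2 ^ (n-1)) * (ENNReal.ofReal C * ENNReal.ofReal w) := by
        apply mul_le_mul_right
        refine (lintegral_mono_set (fun ζ hζ => hζ.1)).trans ((h J hJ).trans ?_)
        gcongr
    _ = _ := by rw [ENNReal.ofReal_mul (by positivity)]; ring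

theorem ptw (E1 E2 : Type*) [NormedAddCommGroup E1] [InnerProductSpace ℝ E1] [FiniteDimensional ℝ E1]
    [MeasurableSpace E1] [BorelSpace E1] [NormedAddCommGroup E2] [InnerProductSpace ℝ E2]
    [FiniteDimensional ℝ E2] [MeasurableSpace E2] [BorelSpace E2] [Nontrivial E2] {σ1 σ2 : ℝ}
    (h10 : 0 ≤ σ1) (h11 : σ1 ≤ (Module.finrank ℝ E1 : ℝ) - 1 ∨ σ1 = 0)
    (h20 : 0 ≤ σ2) (h21 : σ2 ≤ (Module.finrank ℝ E2 : ℝ) - 1) :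
    ∃ C : ℝ, 0 < C ∧ ∀ (U : E1 × E2 → ℂ) (a w2 : ℝ) (J : E1 → Set ℝ), 0 < a → 0 < w2 →
      (∀ η, MeasurableSet (J η)) →
      (∀ η, volume (J η) ≤ ENNReal.ofReal w2) → Measurable U → Integrable U volume →
      (∀ y y' z, ‖y'‖ = ‖y‖ → PF U y' z = PF U y z) →
      (∀ y z z', ‖z'‖ = ‖z‖ → PF U y z' = PF U y z) →
      ∀ S : Set (E1 × E2), MeasurableSet S → (∀ p, p ∉ S → U p = 0) →
      (∀ p ∈ S, ‖p.1‖ ≤ a ∧ 1/3 ≤ ‖p.2‖ ∧ ‖p.2‖ ≤ 2 ∧ ‖p.2‖ ∈ J p.1) →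
      ∀ y z, ‖PF U y z‖ₑ ^ 2 ≤ ENNReal.ofReal (C * (w2 * a ^ ((Module.finrank ℝ E1 : ℝ) - σ1)))
        * ‖y‖ₑ ^ (-σ1) * ‖z‖ₑ ^ (-σ2) * ∫⁻ p, ‖U p‖ₑ ^ 2 := by
  obtain ⟨C1, hC1, hk1⟩ := sphK_decay_enn E1 h10 h11
  obtain ⟨C2, hC2, hk2⟩ := sphK_decay_enn E2 h20 (Or.inl h21)
  obtain ⟨C3, hC3, hb⟩ := polar_ball E1 (σ := σ1) h10 (by
    rcases h11 with h | h
    · left; linarith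
    · right; exact h)
  obtain ⟨C4, hC4, hs⟩ := strip_bound E2
  obtain ⟨M1, hM1⟩ : ∃ M, M = (sphM E1).real Set.univ := ⟨_, rfl⟩
  obtain ⟨M2, hM2⟩ : ∃ M, M = (sphM E2).real Set.univ := ⟨_, rfl⟩
  have hM10 : 0 < M1 := by rw [hM1]; exact ENNReal.toReal_pos sphM_univ_pos.ne' (measure_ne_top _ _)
  have hM20 : 0 < M2 := by rw [hM2]; exact ENNReal.toReal_pos sphM_univ_pos.ne' (measure_ne_top _ _)
  obtain ⟨K, hK⟩ : ∃ K, K = C1 * (2 * π) ^ (-σ1) * (C2 * (2 * π / 3) ^ (-σ2)) := ⟨_, rfl⟩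
  have hK0 : 0 < K := by rw [hK]; positivity
  refine ⟨((M2 * M1) ^ 2)⁻¹ * K * (C4 * C3), by positivity, ?_⟩
  intro U a w2 J ha hw2 hJm hJ hUm hi hsym hsym2 S hSm hS0 hS y z
  have key := PF_avg12 hi hsym hsym2 y z
  rw [← hM1, ← hM2] at key
  set k1 : E1 → ℝ := fun η => sphK ((2 * π * ‖y‖) • η) with hkk1
  set k2 : E2 → ℝ := fun η => sphK ((2 * π * ‖z‖) • η) with hkk2
  have hk1m : Measurable k1 := (sphK_cont.comp (by fun_prop : Continuous fun η : E1 => (2 * π * ‖y‖) • η)).measurable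
  have hk2m : Measurable k2 := (sphK_cont.comp (by fun_prop : Continuous fun η : E2 => (2 * π * ‖z‖) • η)).measurable
  have ereal : ∀ t : ℝ, ‖(t : ℂ)‖ₑ = ‖t‖ₑ := fun t => by rw [← ofReal_norm, ← ofReal_norm, Complex.norm_real]
  have h1 : ENNReal.ofReal (M2 * M1) * ‖PF U y z‖ₑ ≤ ∫⁻ p in S, (‖k2 p.2‖ₑ * ‖k1 p.1‖ₑ) * ‖U p‖ₑ := by
    have : ENNReal.ofReal (M2 * M1) * ‖PF U y z‖ₑ = ‖(M2 : ℂ) * ((M1 : ℂ) * PF U y z)‖ₑ := by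
      rw [enorm_mul, enorm_mul, ereal, ereal, Real.enorm_eq_ofReal hM10.le, Real.enorm_eq_ofReal hM20.le,
        ENNReal.ofReal_mul hM20.le, mul_assoc]
    rw [this, key]
    refine (enorm_integral_le_lintegral_enorm _).trans ?_
    rw [← lintegral_indicator hSm]
    apply lintegral_mono
    intro p
    by_cases hp : p ∈ S
    · simp only [hp, Set.indicator_of_mem, enorm_mul, ereal]
      exact (mul_assoc _ _ _).symm.le
    · simp [hS0 _ hp]
  have h2 : ENNReal.ofReal ((M2 * M1) ^ 2) * ‖PF U y z‖ₑ ^ 2 ≤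
      (∫⁻ p in S, (‖k2 p.2‖ₑ * ‖k1 p.1‖ₑ) ^ 2) * ∫⁻ p, ‖U p‖ₑ ^ 2 := by
    rw [ENNReal.ofReal_pow (by positivity), ← mul_pow]
    calc _ ≤ _ := pow_le_pow_left' h1 2
      _ ≤ _ := cs_enn (((hk2m.comp measurable_snd).enorm.mul (hk1m.comp measurable_fst).enorm).aemeasurable)
          hUm.enorm.aemeasurable
      _ ≤ _ := by
        gcongr
        exact Measure.restrict_le_self
  have h3 : ∫⁻ p in S, (‖k2 p.2‖ₑ * ‖k1 p.1‖ₑ) ^ 2 ≤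
      ENNReal.ofReal K * ‖y‖ₑ ^ (-σ1) * ‖z‖ₑ ^ (-σ2) * ∫⁻ p in S, ‖p.1‖ₑ ^ (-σ1) := by
    rw [← lintegral_const_mul _ (by fun_prop)]
    apply setLIntegral_mono (by fun_prop)
    intro p hp
    rw [mul_pow]
    have e1 : ‖k1 p.1‖ₑ ^ 2 ≤ ENNReal.ofReal (C1 * (2 * π) ^ (-σ1)) * ‖y‖ₑ ^ (-σ1) * ‖p.1‖ₑ ^ (-σ1) := by
      refine (hk1 _).trans (le_of_eq ?_)
      rw [enorm_smul, enorm_mul, enorm_norm,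
                ENNReal.mul_rpow_of_ne_top (by finiteness) (by finiteness),
                ENNReal.mul_rpow_of_ne_top (by finiteness) (by finiteness),
                Real.enorm_eq_ofReal (by positivity), ENNReal.ofReal_rpow_of_pos (by positivity), ENNReal.ofReal_mul hC1.le]
      ring
    have e2 : ‖k2 p.2‖ₑ ^ 2 ≤ ENNReal.ofReal (C2 * (2 * π / 3) ^ (-σ2)) * ‖z‖ₑ ^ (-σ2) := by
      refine (hk2 _).trans ?_
      rw [enorm_smul, enorm_mul, enorm_norm,
                Real.enorm_eq_ofReal (by positivity), ENNReal.ofReal_mul hC2.le, mul_assoc (ENNReal.ofReal C2),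
                ← ENNReal.ofReal_rpow_of_pos (by positivity), ← ENNReal.mul_rpow_of_ne_top (by finiteness) (by finiteness)]
      apply mul_le_mul_right
      rw [ENNReal.rpow_neg, ENNReal.rpow_neg, ENNReal.inv_le_inv]
      apply ENNReal.rpow_le_rpow _ h20
      have : ENNReal.ofReal (2 * π / 3) = ENNReal.ofReal (2 * π) * ENNReal.ofReal (1/3) := by
        rw [← ENNReal.ofReal_mul (by positivity)]; ring_nf
      rw [this, mul_assoc, mul_assoc]
      apply mul_le_mul_right
      rw [mul_comm]
      apply mul_le_mul_right (a := ‖z‖ₑ)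
      rw [← ofReal_norm]
      exact ENNReal.ofReal_le_ofReal (hS p hp).2.1
    calc _ ≤ _ := mul_le_mul' e2 e1
      _ = _ := by
        rw [hK, ENNReal.ofReal_mul (by positivity : 0 ≤ C1 * (2 * π) ^ (-σ1))]; ring
  have h4 : ∫⁻ p in S, ‖p.1‖ₑ ^ (-σ1) ≤ ENNReal.ofReal (C4 * w2) * ENNReal.ofReal (C3 * a ^ ((Module.finrank ℝ E1 : ℝ) - σ1)) := by
    rw [← lintegral_indicator hSm, Measure.volume_eq_prod, lintegral_prod]
    · calc _ ≤ ∫⁻ η : E1, (Metric.closedBall (0 : E1) a).indicator (fun η => ENNReal.ofReal (C4 * w2) * ‖η‖ₑ ^ (-σ1)) η := by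
            apply lintegral_mono
            intro η
            by_cases hη : η ∈ Metric.closedBall (0 : E1) a
            · rw [Set.indicator_of_mem hη]
              have hm : MeasurableSet {ζ : E2 | ‖ζ‖ ∈ J η ∧ ‖ζ‖ ≤ 2} := by
                apply MeasurableSet.inter (measurable_norm (hJm η)) (measurableSet_le measurable_norm measurable_const)
              calc _ ≤ ∫⁻ ζ : E2, ({ζ : E2 | ‖ζ‖ ∈ J η ∧ ‖ζ‖ ≤ 2}).indicator (fun _ => ‖η‖ₑ ^ (-σ1)) ζ := by
                    apply lintegral_mono
                    intro ζ
                    by_cases hp : (η, ζ) ∈ S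
                    · have : ζ ∈ {ζ : E2 | ‖ζ‖ ∈ J η ∧ ‖ζ‖ ≤ 2} := ⟨(hS _ hp).2.2.2, (hS _ hp).2.2.1⟩
                      simp only [hp, this, Set.indicator_of_mem, le_refl]
                    · simp only [hp, Set.indicator_of_notMem, not_false_eq_true, zero_le]
                _ = ‖η‖ₑ ^ (-σ1) * volume {ζ : E2 | ‖ζ‖ ∈ J η ∧ ‖ζ‖ ≤ 2} := by
                    rw [lintegral_indicator hm]; simp
                _ ≤ ‖η‖ₑ ^ (-σ1) * (ENNReal.ofReal C4 * ENNReal.ofReal w2) := by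
                    apply mul_le_mul_right
                    exact hs _ _ (hJm η) (hJ η)
                _ = _ := by rw [ENNReal.ofReal_mul hC4.le]; ring
            · rw [Set.indicator_of_notMem hη]
              apply le_of_eq
              rw [lintegral_eq_zero_iff' ]
              · refine Eventually.of_forall (fun ζ => ?_)
                show S.indicator (fun p => ‖p.1‖ₑ ^ (-σ1)) (η, ζ) = 0
                apply Set.indicator_of_notMem
                intro hp
                exact hη (by simpa using (hS _ hp).1)
              · apply Measurable.aemeasurable
                exact (Measurable.indicator (by fun_prop : Measurable fun p : E1 × E2 => ‖p.1‖ₑ ^ (-σ1)) hSm).comp measurable_prodMk_left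
        _ = ENNReal.ofReal (C4 * w2) * ∫⁻ η in Metric.closedBall (0 : E1) a, ‖η‖ₑ ^ (-σ1) := by
            rw [lintegral_indicator Metric.isClosed_closedBall.measurableSet, lintegral_const_mul]
            fun_prop
        _ ≤ _ := by
            apply mul_le_mul_right
            exact hb a ha
    · exact (Measurable.indicator (by fun_prop) hSm).aemeasurable
  have hMM : (0:ℝ) < (M2 * M1) ^ 2 := by positivity
  have h5 := h2.trans (mul_le_mul_left (h3.trans (mul_le_mul_right h4 _)) _)
  have h6 : ENNReal.ofReal ((M2 * M1) ^ 2)⁻¹ * (ENNReal.ofReal ((M2 * M1) ^ 2) * ‖PF U y z‖ₑ ^ 2) = ‖PF U y z‖ₑ ^ 2 := by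
    rw [← mul_assoc, ← ENNReal.ofReal_mul (by positivity), inv_mul_cancel₀ hMM.ne', ENNReal.ofReal_one, one_mul]
  rw [← h6]
  refine (mul_le_mul_right h5 _).trans (le_of_eq ?_)
  rw [show ((M2 * M1) ^ 2)⁻¹ * K * (C4 * C3) * (w2 * a ^ ((Module.finrank ℝ E1 : ℝ) - σ1))
    = ((M2 * M1) ^ 2)⁻¹ * K * ((C4 * w2) * (C3 * a ^ ((Module.finrank ℝ E1 : ℝ) - σ1))) by ring]
  rw [ENNReal.ofReal_mul (by positivity : 0 ≤ ((M2 * M1) ^ 2)⁻¹ * K), ENNReal.ofReal_mul (by positivity : 0 ≤ ((M2 * M1) ^ 2)⁻¹),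
    ENNReal.ofReal_mul (by positivity : 0 ≤ C4 * w2)]
  ring

end Piece

section Piece2

theorem wt_split {A B : ℝ≥0∞} {r1 r2 : ℝ} (h1 : 0 ≤ r1) (h2 : 0 ≤ r2) :
    A ^ (-r1) * B ^ (-r2) ≤ A ^ (-(r1 + r2)) + B ^ (-(r1 + r2)) := by
  have hanti : ∀ {x y : ℝ≥0∞} {r : ℝ}, 0 ≤ r → x ≤ y → y ^ (-r) ≤ x ^ (-r) := by
    intro x y r hr hxy
    rw [ENNReal.rpow_neg, ENNReal.rpow_neg, ENNReal.inv_le_inv]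
    exact ENNReal.rpow_le_rpow hxy hr
  have hadd : ∀ x : ℝ≥0∞, x ^ (-r1) * x ^ (-r2) = x ^ (-(r1 + r2)) := by
    intro x
    rw [ENNReal.rpow_neg, ENNReal.rpow_neg, ENNReal.rpow_neg, ← ENNReal.inv_rpow, ← ENNReal.inv_rpow,
      ← ENNReal.inv_rpow, ENNReal.rpow_add_of_nonneg _ _ h1 h2]
  rcases le_total A B with h | h
  · calc A ^ (-r1) * B ^ (-r2) ≤ A ^ (-r1) * A ^ (-r2) := mul_le_mul_right (hanti h2 h) _
      _ = A ^ (-(r1 + r2)) := hadd A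
      _ ≤ _ := le_self_add
  · calc A ^ (-r1) * B ^ (-r2) ≤ B ^ (-r1) * B ^ (-r2) := mul_le_mul_left (hanti h1 h) _
      _ = B ^ (-(r1 + r2)) := hadd B
      _ ≤ _ := le_add_self

theorem weighted2 (E1 E2 : Type*) [NormedAddCommGroup E1] [InnerProductSpace ℝ E1] [FiniteDimensional ℝ E1]
    [MeasurableSpace E1] [BorelSpace E1] [NormedAddCommGroup E2] [InnerProductSpace ℝ E2]
    [FiniteDimensional ℝ E2] [MeasurableSpace E2] [BorelSpace E2] [Nontrivial E2] {τ : ℝ}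
    (hτ0 : 0 ≤ τ) (hτ1 : τ < 1) :
    ∃ C : ℝ, 0 < C ∧ ∀ (U : E1 × E2 → ℂ) (w : ℝ) (J : E1 → Set ℝ), 0 < w → (∀ η, MeasurableSet (J η)) →
      (∀ η, volume (J η) ≤ ENNReal.ofReal w) → Measurable U → MemLp U 2 volume →
      Integrable U volume → (∀ y z z', ‖z'‖ = ‖z‖ → PF U y z' = PF U y z) →
      ∀ S : Set (E1 × E2), MeasurableSet S → (∀ p, p ∉ S → U p = 0) → (∀ p ∈ S, ‖p.2‖ ∈ J p.1) →
      ∫⁻ p : E1 × E2, ‖PF U p.1 p.2‖ₑ ^ 2 * (ENNReal.ofReal w * ‖p.2‖ₑ) ^ (-τ)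
        ≤ ENNReal.ofReal C * ∫⁻ p, ‖U p‖ₑ ^ 2 := by
  obtain ⟨C, hC, h⟩ := weighted E2 E1 hτ0 hτ1
  refine ⟨C, hC, fun U w J hw hJm hJ hUm hU hi hsym S hSm hS0 hSJ => ?_⟩
  have mp : MeasurePreserving (Prod.swap : E2 × E1 → E1 × E2) volume volume := Measure.measurePreserving_swap
  have hemb : MeasurableEmbedding (Prod.swap : E2 × E1 → E1 × E2) := MeasurableEquiv.prodComm.measurableEmbedding
  have := h (U ∘ Prod.swap) w J hw hJm hJ (hUm.comp measurable_swap) (hU.comp_measurePreserving mp)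
    (mp.integrable_comp_of_integrable hi) (fun z z' y hz => by rw [PF_swap, PF_swap]; exact hsym y z z' hz)
    (Prod.swap ⁻¹' S) (measurable_swap hSm) (fun p hp => hS0 _ hp) (fun p hp => hSJ _ hp)
  simp only [PF_swap] at this
  rw [← mp.lintegral_comp_emb hemb (fun p => ‖U p‖ₑ ^ 2), ← mp.lintegral_comp_emb hemb]
  exact this

theorem piece (E1 E2 : Type*) [NormedAddCommGroup E1] [InnerProductSpace ℝ E1] [FiniteDimensional ℝ E1]
    [MeasurableSpace E1] [BorelSpace E1] [NormedAddCommGroup E2] [InnerProductSpace ℝ E2]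
    [FiniteDimensional ℝ E2] [MeasurableSpace E2] [BorelSpace E2] [Nontrivial E2] {σ1 σ2 q : ℝ}
    (h10 : 0 ≤ σ1) (h11 : σ1 ≤ (Module.finrank ℝ E1 : ℝ) - 1 ∨ σ1 = 0)
    (h20 : 0 ≤ σ2) (h21 : σ2 ≤ (Module.finrank ℝ E2 : ℝ) - 1) (hq : 0 < q) (hτ : (σ1 + σ2) * q < 1) :
    ∃ C : ℝ, 0 < C ∧ ∀ (U : E1 × E2 → ℂ) (a w1 w2 : ℝ) (I : E2 → Set ℝ) (J : E1 → Set ℝ), 0 < a →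
      0 < w1 → 0 < w2 → (∀ η, MeasurableSet (I η)) → (∀ η, MeasurableSet (J η)) →
      (∀ η, volume (I η) ≤ ENNReal.ofReal w1) →
      (∀ η, volume (J η) ≤ ENNReal.ofReal w2) → Measurable U → MemLp U 2 volume → Integrable U volume →
      (∀ y y' z, ‖y'‖ = ‖y‖ → PF U y' z = PF U y z) →
      (∀ y z z', ‖z'‖ = ‖z‖ → PF U y z' = PF U y z) →
      ∀ S : Set (E1 × E2), MeasurableSet S → (∀ p, p ∉ S → U p = 0) →
      (∀ p ∈ S, ‖p.1‖ ≤ a ∧ 1/3 ≤ ‖p.2‖ ∧ ‖p.2‖ ≤ 2 ∧ ‖p.1‖ ∈ I p.2 ∧ ‖p.2‖ ∈ J p.1) →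
      ∫⁻ p : E1 × E2, ‖PF U p.1 p.2‖ₑ ^ (2 * (1 + q)) ≤
        ENNReal.ofReal (C * ((w2 * a ^ ((Module.finrank ℝ E1 : ℝ) - σ1)) ^ q * w1 ^ (σ1 * q) * w2 ^ (σ2 * q)))
        * (∫⁻ p, ‖U p‖ₑ ^ 2) ^ (1 + q) := by
  obtain ⟨C0, hC0, hpt⟩ := ptw E1 E2 h10 h11 h20 h21
  have hr1 : 0 ≤ σ1 * q := by positivity
  have hr2 : 0 ≤ σ2 * q := by positivity
  obtain ⟨C2, hC2, hW2⟩ := weighted2 E1 E2 (τ := σ1 * q + σ2 * q) (by positivity) (by linarith)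
  have hW1 : ∃ C1 : ℝ, 0 < C1 ∧ ∀ (U : E1 × E2 → ℂ) (w1 w2 : ℝ) (I : E2 → Set ℝ) (J : E1 → Set ℝ),
      0 < w1 → 0 < w2 → (∀ η, MeasurableSet (I η)) → (∀ η, MeasurableSet (J η)) →
      (∀ η, volume (I η) ≤ ENNReal.ofReal w1) →
      (∀ η, volume (J η) ≤ ENNReal.ofReal w2) → Measurable U → MemLp U 2 volume → Integrable U volume →
      (∀ y y' z, ‖y'‖ = ‖y‖ → PF U y' z = PF U y z) →
      (∀ y z z', ‖z'‖ = ‖z‖ → PF U y z' = PF U y z) →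
      ∀ S : Set (E1 × E2), MeasurableSet S → (∀ p, p ∉ S → U p = 0) →
      (∀ p ∈ S, ‖p.1‖ ∈ I p.2 ∧ ‖p.2‖ ∈ J p.1) →
      ∫⁻ p : E1 × E2, ‖PF U p.1 p.2‖ₑ ^ 2 * ((ENNReal.ofReal w1 * ‖p.1‖ₑ) ^ (-(σ1 * q)) *
        (ENNReal.ofReal w2 * ‖p.2‖ₑ) ^ (-(σ2 * q)))
        ≤ ENNReal.ofReal C1 * ∫⁻ p, ‖U p‖ₑ ^ 2 := by
    by_cases hs : σ1 = 0
    · refine ⟨C2, hC2, fun U w1 w2 I J hw1 hw2 hIm hJm hI hJ hUm hU hi hsym hsym2 S hSm hS0 hS => ?_⟩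
      have := hW2 U w2 J hw2 hJm hJ hUm hU hi hsym2 S hSm hS0 (fun p hp => (hS p hp).2)
      simpa [hs] using this
    · have hnt : Nontrivial E1 := by
        have : 0 < σ1 := lt_of_le_of_ne h10 (Ne.symm hs)
        have h2 : (0:ℝ) < Module.finrank ℝ E1 := by rcases h11 with h | h; · linarith
                                                    · exact absurd h hs
        exact Module.nontrivial_of_finrank_pos (R := ℝ) (by exact_mod_cast h2)
      obtain ⟨C1, hC1, hW1⟩ := weighted E1 E2 (τ := σ1 * q + σ2 * q) (by positivity) (by linarith)
      refine ⟨C1 + C2, by positivity, fun U w1 w2 I J hw1 hw2 hIm hJm hI hJ hUm hU hi hsym hsym2 S hSm hS0 hS => ?_⟩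
      have e1 := hW1 U w1 I hw1 hIm hI hUm hU hi hsym S hSm hS0 (fun p hp => (hS p hp).1)
      have e2 := hW2 U w2 J hw2 hJm hJ hUm hU hi hsym2 S hSm hS0 (fun p hp => (hS p hp).2)
      rw [ENNReal.ofReal_add hC1.le hC2.le, add_mul]
      refine le_trans ?_ (add_le_add e1 e2)
      have hmeas : Measurable (fun p : E1 × E2 => ‖PF U p.1 p.2‖ₑ ^ 2) :=
        ((PF_cont hi).measurable.enorm.pow_const 2)
      have hm2 : Measurable (fun p : E1 × E2 => ‖PF U p.1 p.2‖ₑ ^ 2 *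
          (ENNReal.ofReal w1 * ‖p.1‖ₑ) ^ (-(σ1 * q + σ2 * q))) :=
        hmeas.mul (by fun_prop : Measurable fun p : E1 × E2 => (ENNReal.ofReal w1 * ‖p.1‖ₑ) ^ (-(σ1 * q + σ2 * q)))
      rw [← lintegral_add_left hm2]
      apply lintegral_mono
      intro p
      simp only []
      rw [← mul_add]
      exact mul_le_mul_right (wt_split hr1 hr2) _
  obtain ⟨C1, hC1, hW⟩ := hW1
  refine ⟨C0 ^ q * C1, by positivity, ?_⟩
  intro U a w1 w2 I J ha hw1 hw2 hIm hJm hI hJ hUm hU hi hsym hsym2 S hSm hS0 hS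
  have hp := hpt U a w2 J ha hw2 hJm hJ hUm hi hsym hsym2 S hSm hS0
    (fun p hp => ⟨(hS p hp).1, (hS p hp).2.1, (hS p hp).2.2.1, (hS p hp).2.2.2.2⟩)
  have hw := hW U w1 w2 I J hw1 hw2 hIm hJm hI hJ hUm hU hi hsym hsym2 S hSm hS0
    (fun p hp => (hS p hp).2.2.2)
  clear hpt hW hW2 hS0 hS hI hJ
  generalize hN : ∫⁻ p, ‖U p‖ₑ ^ 2 = N at *
  generalize hD : w2 * a ^ ((Module.finrank ℝ E1 : ℝ) - σ1) = D at *
  have hD0 : 0 < D := by rw [← hD]; positivity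
  have hNtop : N ≠ ∞ := by
    rw [← hN]
    have := hU.2
    rw [← eLpNorm_two_sq]
    exact ENNReal.pow_ne_top this.ne
  have hwmul : ∀ (w r : ℝ) (x : ℝ≥0∞), 0 < w → x ≠ ∞ → x ^ (-r) = ENNReal.ofReal (w ^ r) * (ENNReal.ofReal w * x) ^ (-r) := by
    intro w r x hw hx
    rw [ENNReal.mul_rpow_of_ne_top (by finiteness) hx, ENNReal.ofReal_rpow_of_pos hw, ← mul_assoc,
      ← ENNReal.ofReal_mul (by positivity), ← Real.rpow_add hw]
    simp
  have key : ∀ p : E1 × E2, ‖PF U p.1 p.2‖ₑ ^ (2 * (1 + q)) ≤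
      (ENNReal.ofReal ((C0 * D) ^ q * (w1 ^ (σ1 * q) * w2 ^ (σ2 * q))) * N ^ q) *
      (‖PF U p.1 p.2‖ₑ ^ 2 * ((ENNReal.ofReal w1 * ‖p.1‖ₑ) ^ (-(σ1 * q)) *
        (ENNReal.ofReal w2 * ‖p.2‖ₑ) ^ (-(σ2 * q)))) := by
    intro p
    have e1 : ‖PF U p.1 p.2‖ₑ ^ (2 * (1 + q)) = ‖PF U p.1 p.2‖ₑ ^ 2 * (‖PF U p.1 p.2‖ₑ ^ 2) ^ q := by
      rw [show 2 * (1 + q) = (2:ℝ) + 2 * q by ring, ENNReal.rpow_add_of_nonneg _ _ (by norm_num) (by positivity),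
        ENNReal.rpow_mul, ENNReal.rpow_two]
    rw [e1]
    have e2 : (‖PF U p.1 p.2‖ₑ ^ 2) ^ q ≤ (ENNReal.ofReal (C0 * D) * ‖p.1‖ₑ ^ (-σ1) * ‖p.2‖ₑ ^ (-σ2) * N) ^ q :=
      ENNReal.rpow_le_rpow (hp p.1 p.2) hq.le
    refine (mul_le_mul_right e2 _).trans (le_of_eq ?_)
    rw [ENNReal.mul_rpow_of_nonneg _ _ hq.le, ENNReal.mul_rpow_of_nonneg _ _ hq.le, ENNReal.mul_rpow_of_nonneg _ _ hq.le,
      ← ENNReal.rpow_mul, ← ENNReal.rpow_mul, ENNReal.ofReal_rpow_of_pos (by positivity),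
      neg_mul, neg_mul, hwmul w1 (σ1 * q) _ hw1 (by finiteness), hwmul w2 (σ2 * q) _ hw2 (by finiteness),
      ENNReal.ofReal_mul (by positivity : 0 ≤ (C0 * D) ^ q), ENNReal.ofReal_mul (by positivity : 0 ≤ w1 ^ (σ1 * q))]
    ring
  calc _ ≤ _ := lintegral_mono key
    _ = (ENNReal.ofReal ((C0 * D) ^ q * (w1 ^ (σ1 * q) * w2 ^ (σ2 * q))) * N ^ q) *
      ∫⁻ p : E1 × E2, (‖PF U p.1 p.2‖ₑ ^ 2 * ((ENNReal.ofReal w1 * ‖p.1‖ₑ) ^ (-(σ1 * q)) *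
        (ENNReal.ofReal w2 * ‖p.2‖ₑ) ^ (-(σ2 * q)))) := by
        rw [lintegral_const_mul' _ _ (by finiteness)]
    _ ≤ _ := mul_le_mul_right hw _
    _ = _ := by
      rw [show C0 ^ q * C1 * (D ^ q * w1 ^ (σ1 * q) * w2 ^ (σ2 * q)) =
        (C0 * D) ^ q * (w1 ^ (σ1 * q) * w2 ^ (σ2 * q)) * C1 by rw [Real.mul_rpow hC0.le hD0.le]; ring,
        ENNReal.ofReal_mul (by positivity : 0 ≤ (C0 * D) ^ q * (w1 ^ (σ1 * q) * w2 ^ (σ2 * q))),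
        ENNReal.rpow_add_of_nonneg _ _ (by norm_num) hq.le, ENNReal.rpow_one]
      ring

end Piece2

section Region

variable {E1 E2 : Type*} [NormedAddCommGroup E1] [InnerProductSpace ℝ E1] [FiniteDimensional ℝ E1]
  [MeasurableSpace E1] [BorelSpace E1] [NormedAddCommGroup E2] [InnerProductSpace ℝ E2]
  [FiniteDimensional ℝ E2] [MeasurableSpace E2] [BorelSpace E2]

theorem norm_of_lint {α β : Type*} [MeasurableSpace α] [MeasurableSpace β] {μ : Measure α} {ν : Measure β}
    {f : α → ℂ} {U : β → ℂ} {q A : ℝ} (hq : 0 < q) (hA : 0 ≤ A)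
    (h : ∫⁻ p, ‖f p‖ₑ ^ (2 * (1 + q)) ∂μ ≤ ENNReal.ofReal A * (∫⁻ p, ‖U p‖ₑ ^ 2 ∂ν) ^ (1 + q)) :
    eLpNorm f (ENNReal.ofReal (2 * (1 + q))) μ ≤ ENNReal.ofReal (A ^ (1 / (2 * (1 + q)))) * eLpNorm U 2 ν := by
  have hp : 0 < 2 * (1 + q) := by positivity
  rw [eLpNorm_eq_lintegral_rpow_enorm_toReal (by simpa using hp) ENNReal.ofReal_ne_top, ENNReal.toReal_ofReal hp.le]
  refine (ENNReal.rpow_le_rpow h (by positivity)).trans (le_of_eq ?_)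
  rw [ENNReal.mul_rpow_of_nonneg _ _ (by positivity), ENNReal.ofReal_rpow_of_nonneg hA (by positivity)]
  congr 1
  rw [← eLpNorm_two_sq, ← ENNReal.rpow_natCast, ← ENNReal.rpow_mul, ← ENNReal.rpow_mul]
  have : ((2:ℕ):ℝ) * ((1 + q) * (1 / (2 * (1 + q)))) = 1 := by push_cast; field_simp
  rw [this, ENNReal.rpow_one]

/-- one-dimensional annulus slice -/
def slc (l A c : ℝ) : Set ℝ := {t | A ≤ t ∧ (1 - l) ^ 2 ≤ t ^ 2 + c ∧ t ^ 2 + c ≤ (1 + l) ^ 2}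

theorem slc_meas (l A c : ℝ) : MeasurableSet (slc l A c) := by
  apply IsClosed.measurableSet
  apply IsClosed.inter
  · exact isClosed_le continuous_const continuous_id
  · apply IsClosed.inter
    · exact isClosed_le continuous_const (by fun_prop : Continuous fun t : ℝ => t ^ 2 + c)
    · exact isClosed_le (by fun_prop : Continuous fun t : ℝ => t ^ 2 + c) continuous_const

theorem slc_vol {l A c : ℝ} (hA : 0 < A) : volume (slc l A c) ≤ ENNReal.ofReal (2 * l / A) := by
  refine (Real.volume_le_diam _).trans ?_
  apply Metric.ediam_le
  intro x hx y hy
  rw [edist_dist]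
  apply ENNReal.ofReal_le_ofReal
  rw [Real.dist_eq, le_div_iff₀ hA]
  obtain ⟨h1, h2, h3⟩ := hx
  obtain ⟨g1, g2, g3⟩ := hy
  rcases abs_cases (x - y) with ⟨h, h'⟩ | ⟨h, h'⟩ <;> rw [h] <;> nlinarith

theorem PF_sum {ι : Type*} (s : Finset ι) (U : ι → E1 × E2 → ℂ) (h : ∀ i ∈ s, Integrable (U i) volume) (y : E1) (z : E2) :
    PF (fun p => ∑ i ∈ s, U i p) y z = ∑ i ∈ s, PF (U i) y z := by
  unfold PF
  simp only [Finset.mul_sum]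
  apply integral_finsetSum
  intro i hi
  apply (h i hi).bdd_mul (c := 1)
  · apply Continuous.aestronglyMeasurable
    exact ch_cont.comp (by fun_prop)
  · exact Eventually.of_forall fun p => (ch_norm _).le

/-- block `A < ‖η‖ ≤ B` -/
def blk (E1 E2 : Type*) [NormedAddCommGroup E1] (A B : ℝ) : Set (E1 × E2) := {p | A < ‖p.1‖ ∧ ‖p.1‖ ≤ B}

theorem blk_meas (A B : ℝ) : MeasurableSet (blk E1 E2 A B) := by
  apply MeasurableSet.inter
  · exact measurableSet_lt measurable_const (by fun_prop : Measurable fun p : E1 × E2 => ‖p.1‖)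
  · exact measurableSet_le (by fun_prop : Measurable fun p : E1 × E2 => ‖p.1‖) measurable_const

theorem region_piece (E1 E2 : Type*) [NormedAddCommGroup E1] [InnerProductSpace ℝ E1] [FiniteDimensional ℝ E1]
    [MeasurableSpace E1] [BorelSpace E1] [NormedAddCommGroup E2] [InnerProductSpace ℝ E2]
    [FiniteDimensional ℝ E2] [MeasurableSpace E2] [BorelSpace E2] [Nontrivial E2] {σ1 σ2 q : ℝ}
    (h10 : 0 ≤ σ1) (h11 : σ1 ≤ (Module.finrank ℝ E1 : ℝ) - 1 ∨ σ1 = 0) (h12 : 2 * σ1 ≤ Module.finrank ℝ E1)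
    (h20 : 0 ≤ σ2) (h21 : σ2 ≤ (Module.finrank ℝ E2 : ℝ) - 1) (hq : 0 < q) (hτ : (σ1 + σ2) * q < 1) :
    ∃ C : ℝ, 0 < C ∧ ∀ (U : E1 × E2 → ℂ) (l a b A : ℝ), 0 < l → l ≤ 1/2 → 0 < a → a ≤ 2 → 0 < b → b ≤ 1 →
      Measurable U → MemLp U 2 volume → Integrable U volume →
      (∀ p, U p ≠ 0 → ‖p.1‖ ≤ ‖p.2‖ ∧ (1 - l) ^ 2 ≤ ‖p.1‖ ^ 2 + ‖p.2‖ ^ 2 ∧ ‖p.1‖ ^ 2 + ‖p.2‖ ^ 2 ≤ (1 + l) ^ 2) →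
      (∀ p, U p ≠ 0 → A < ‖p.1‖ ∧ ‖p.1‖ ≤ a) → (a * b ≤ A ∨ a ^ 2 ≤ 4 * l) →
      (∀ y y' z, ‖y'‖ = ‖y‖ → PF U y' z = PF U y z) →
      (∀ y z z', ‖z'‖ = ‖z‖ → PF U y z' = PF U y z) →
      eLpNorm (fun p : E1 × E2 => PF U p.1 p.2) (ENNReal.ofReal (2 * (1 + q))) volume ≤
        ENNReal.ofReal ((C * (l ^ (q * (1 + σ1 + σ2)) * b ^ (-(σ1 * q)))) ^ (1 / (2 * (1 + q)))) * eLpNorm U 2 volume := by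
  obtain ⟨C, hC, h⟩ := piece E1 E2 h10 h11 h20 h21 hq hτ
  generalize hn : (Module.finrank ℝ E1 : ℝ) = n at *
  refine ⟨C * (6 ^ q * 4 ^ (σ1 * q) * 6 ^ (σ2 * q) * 2 ^ ((n - 2 * σ1) * q)), by positivity, ?_⟩
  intro U l a b A hl hl2 ha ha2 hb hb2 hUm hU hi hsupp hblk hcase hsym hsym2
  have hw1 : 0 < 4 * l / (a * b) := by positivity
  have hw2 : 0 < 6 * l := by positivity
  have hIex : ∃ I : E2 → Set ℝ, (∀ ζ, MeasurableSet (I ζ)) ∧ (∀ ζ, volume (I ζ) ≤ ENNReal.ofReal (4 * l / (a * b))) ∧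
      ∀ p, U p ≠ 0 → ‖p.1‖ ∈ I p.2 := by
    rcases hcase with hc | hc
    · refine ⟨fun ζ => slc l (a * b) (‖ζ‖ ^ 2), fun ζ => slc_meas _ _ _, fun ζ => (slc_vol (by positivity)).trans ?_, ?_⟩
      · apply ENNReal.ofReal_le_ofReal; gcongr; norm_num
      · intro p hp
        exact ⟨hc.trans (hblk p hp).1.le, (hsupp p hp).2⟩
    · refine ⟨fun ζ => Set.Icc 0 a, fun ζ => measurableSet_Icc, fun ζ => ?_, ?_⟩
      · rw [Real.volume_Icc]
        apply ENNReal.ofReal_le_ofReal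
        rw [le_div_iff₀ (by positivity)]
        nlinarith [mul_pos ha ha]
      · intro p hp
        exact ⟨norm_nonneg _, (hblk p hp).2⟩
  obtain ⟨I, hIm, hIv, hI⟩ := hIex
  have hn0 : 0 ≤ n - 2 * σ1 := by linarith
  have hmain := h U a (4 * l / (a * b)) (6 * l) I (fun η => slc l (1/3) (‖η‖ ^ 2)) ha hw1 hw2 hIm (fun η => slc_meas _ _ _)
    hIv (fun η => (slc_vol (by norm_num)).trans (by apply ENNReal.ofReal_le_ofReal; linarith)) hUm hU hi hsym hsym2
    {p | U p ≠ 0} (hUm (measurableSet_singleton 0).compl) (by intro p hp; simpa using hp) (by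
      intro p hp
      obtain ⟨s1, s2, s3⟩ := hsupp p hp
      have k1 : 1/3 ≤ ‖p.2‖ := by
        by_contra hcon
        push Not at hcon
        nlinarith [norm_nonneg p.1, norm_nonneg p.2]
      refine ⟨(hblk p hp).2, k1, ?_, hI p hp, k1, by linarith, by linarith⟩
      nlinarith [norm_nonneg p.1, norm_nonneg p.2])
  refine (norm_of_lint hq (by positivity) hmain).trans ?_
  apply mul_le_mul_left
  apply ENNReal.ofReal_le_ofReal
  apply Real.rpow_le_rpow (by positivity) _ (by positivity)
  rw [mul_assoc C (_ * _ * _ * _)]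
  apply mul_le_mul_of_nonneg_left _ hC.le
  have e1 : (6 * l * a ^ (n - σ1)) ^ q = 6 ^ q * l ^ q * a ^ ((n - σ1) * q) := by
    rw [Real.mul_rpow (by positivity) (by positivity), Real.mul_rpow (by positivity) (by positivity), ← Real.rpow_mul ha.le]
  have e2 : (4 * l / (a * b)) ^ (σ1 * q) = 4 ^ (σ1 * q) * l ^ (σ1 * q) * a ^ (-(σ1 * q)) * b ^ (-(σ1 * q)) := by
    rw [Real.div_rpow (by positivity) (by positivity), Real.mul_rpow (by positivity) (by positivity), Real.mul_rpow ha.le hb.le,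
      Real.rpow_neg ha.le, Real.rpow_neg hb.le]
    field_simp
  have e3 : (6 * l) ^ (σ2 * q) = 6 ^ (σ2 * q) * l ^ (σ2 * q) := by
    rw [Real.mul_rpow (by positivity) (by positivity)]
  have e4 : a ^ ((n - σ1) * q) * a ^ (-(σ1 * q)) = a ^ ((n - 2 * σ1) * q) := by
    rw [← Real.rpow_add ha]; ring_nf
  have e5 : l ^ q * l ^ (σ1 * q) * l ^ (σ2 * q) = l ^ (q * (1 + σ1 + σ2)) := by
    rw [← Real.rpow_add hl, ← Real.rpow_add hl]; ring_nf
  calc _ = (6 ^ q * 4 ^ (σ1 * q) * 6 ^ (σ2 * q)) * (a ^ ((n - σ1) * q) * a ^ (-(σ1 * q))) * ((l ^ q * l ^ (σ1 * q) * l ^ (σ2 * q)) * b ^ (-(σ1 * q))) := by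
        rw [e1, e2, e3]; ring
    _ = (6 ^ q * 4 ^ (σ1 * q) * 6 ^ (σ2 * q)) * a ^ ((n - 2 * σ1) * q) * (l ^ (q * (1 + σ1 + σ2)) * b ^ (-(σ1 * q))) := by
        rw [e4, e5]
    _ ≤ (6 ^ q * 4 ^ (σ1 * q) * 6 ^ (σ2 * q)) * 2 ^ ((n - 2 * σ1) * q) * (l ^ (q * (1 + σ1 + σ2)) * b ^ (-(σ1 * q))) := by
        gcongr

theorem region (E1 E2 : Type*) [NormedAddCommGroup E1] [InnerProductSpace ℝ E1] [FiniteDimensional ℝ E1]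
    [MeasurableSpace E1] [BorelSpace E1] [NormedAddCommGroup E2] [InnerProductSpace ℝ E2]
    [FiniteDimensional ℝ E2] [MeasurableSpace E2] [BorelSpace E2] [Nontrivial E2] {σ1 σ2 q κ : ℝ}
    (h10 : 0 ≤ σ1) (h11 : σ1 ≤ (Module.finrank ℝ E1 : ℝ) - 1 ∨ σ1 = 0) (h12 : 2 * σ1 ≤ Module.finrank ℝ E1)
    (h20 : 0 ≤ σ2) (h21 : σ2 ≤ (Module.finrank ℝ E2 : ℝ) - 1) (hq : 0 < q) (hτ : (σ1 + σ2) * q < 1) (hκ : 0 < κ) :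
    ∃ C : ℝ, 0 < C ∧ ∀ (U : E1 × E2 → ℂ) (l : ℝ), 0 < l → l ≤ 1/2 →
      Measurable U → MemLp U 2 volume → Integrable U volume →
      (∀ p, U p ≠ 0 → ‖p.1‖ ≤ ‖p.2‖ ∧ (1 - l) ^ 2 ≤ ‖p.1‖ ^ 2 + ‖p.2‖ ^ 2 ∧ ‖p.1‖ ^ 2 + ‖p.2‖ ^ 2 ≤ (1 + l) ^ 2) →
      (∀ A B y y' z, ‖y'‖ = ‖y‖ → PF ((blk E1 E2 A B).indicator U) y' z = PF ((blk E1 E2 A B).indicator U) y z) →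
      (∀ A B y z z', ‖z'‖ = ‖z‖ → PF ((blk E1 E2 A B).indicator U) y z' = PF ((blk E1 E2 A B).indicator U) y z) →
      eLpNorm (fun p : E1 × E2 => PF U p.1 p.2) (ENNReal.ofReal (2 * (1 + q))) volume ≤
        ENNReal.ofReal (C * l ^ (q / (2 * (1 + q)) * (1 + σ1 + σ2) - κ)) * eLpNorm U 2 volume := by
  obtain ⟨C, hC, h⟩ := region_piece E1 E2 h10 h11 h12 h20 h21 hq hτ
  obtain ⟨K, hK⟩ := exists_nat_gt (σ1 * q / κ + 1)
  have hK1 : (1:ℝ) < K := by have : 0 ≤ σ1 * q / κ := by positivity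
                             linarith
  have hK0 : (0:ℝ) < K := by linarith
  obtain ⟨P, hP⟩ : ∃ P, P = 1 / (2 * (1 + q)) := ⟨_, rfl⟩
  have hP0 : 0 < P := by rw [hP]; positivity
  have hP1 : P ≤ 1 := by rw [hP, div_le_one (by positivity)]; linarith
  refine ⟨(K + 1) * C ^ P, by positivity, ?_⟩
  intro U l hl hl2 hUm hU hi hsupp hsym hsym2
  obtain ⟨b, hb⟩ : ∃ b, b = l ^ (1 / (2 * K) : ℝ) := ⟨_, rfl⟩
  have hb0 : 0 < b := by rw [hb]; positivity
  have hb1 : b ≤ 1 := by rw [hb]; exact Real.rpow_le_one hl.le (by linarith) (by positivity)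
  have hbK : b ^ K = l ^ (1/2 : ℝ) := by
    rw [hb, ← Real.rpow_natCast, ← Real.rpow_mul hl.le]; congr 1; field_simp
  let A : ℕ → ℝ := fun i => if i < K then 2 * b ^ (i + 1) else -1
  let V : ℕ → E1 × E2 → ℂ := fun i => (blk E1 E2 (A i) (2 * b ^ i)).indicator U
  have hsum : U = fun p => ∑ i ∈ Finset.range (K + 1), V i p := by
    have hmono : ∀ p : E1 × E2, ∀ N : ℕ, N ≤ K → ∑ i ∈ Finset.range N, V i p =
        (blk E1 E2 (2 * b ^ N) 2).indicator U p := by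
      intro p N
      induction N with
      | zero =>
        intro _
        simp only [Finset.range_zero, Finset.sum_empty, pow_zero, mul_one]
        rw [Set.indicator_of_notMem]
        intro hp; have h1 := hp.1; have h2 := hp.2; linarith
      | succ N ih =>
        intro hN
        rw [Finset.sum_range_succ, ih (by omega)]
        have hA : A N = 2 * b ^ (N + 1) := by simp only [A]; rw [if_pos (by omega)]
        simp only [V]
        rw [hA]
        have hbb : b ^ (N + 1) ≤ b ^ N := pow_le_pow_of_le_one hb0.le hb1 (by omega)
        have hbN : b ^ N ≤ 1 := pow_le_one₀ hb0.le hb1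
        simp only [Set.indicator, blk, Set.mem_ofPred_eq]
        clear hb hbK
        generalize b ^ (N + 1) = B' at *
        generalize b ^ N = B at *
        grind
    ext p
    rw [Finset.sum_range_succ, hmono p K le_rfl]
    simp only [V, A, lt_irrefl, if_false]
    by_cases hp : U p = 0
    · simp [Set.indicator, hp]
    · obtain ⟨s1, s2, s3⟩ := hsupp p hp
      have h2 : ‖p.1‖ ≤ 2 := by nlinarith [norm_nonneg p.1, norm_nonneg p.2]
      have h0 : -1 < ‖p.1‖ := by linarith [norm_nonneg p.1]
      simp only [Set.indicator, blk, Set.mem_ofPred_eq]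
      clear hb hbK hmono
      generalize b ^ K = B' at *
      grind
  have hVi : ∀ i, Integrable (V i) volume := fun i => hi.indicator (blk_meas _ _)
  have hVm : ∀ i, Measurable (V i) := fun i => hUm.indicator (blk_meas _ _)
  have hVL : ∀ i, MemLp (V i) 2 volume := fun i => hU.indicator (blk_meas _ _)
  have hVne : ∀ i p, V i p ≠ 0 → p ∈ blk E1 E2 (A i) (2 * b ^ i) ∧ U p ≠ 0 := by
    intro i p hp
    have := Set.mem_of_indicator_ne_zero hp
    refine ⟨this, ?_⟩
    simp only [V] at hp
    rwa [Set.indicator_of_mem this] at hp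
  have hpc : ∀ i ∈ Finset.range (K + 1), eLpNorm (fun p : E1 × E2 => PF (V i) p.1 p.2) (ENNReal.ofReal (2 * (1 + q))) volume
      ≤ ENNReal.ofReal (C ^ P * l ^ (q / (2 * (1 + q)) * (1 + σ1 + σ2) - κ)) * eLpNorm U 2 volume := by
    intro i hiK
    have hiK' : i ≤ K := by simpa [Nat.lt_succ_iff] using hiK
    refine (h (V i) l (2 * b ^ i) b (A i) hl hl2 (by positivity) (by have := pow_le_one₀ (n := i) hb0.le hb1; linarith) hb0 hb1
      (hVm i) (hVL i) (hVi i) (fun p hp => hsupp p (hVne i p hp).2) (fun p hp => (hVne i p hp).1) ?_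
      (hsym _ _) (hsym2 _ _)).trans ?_
    · by_cases hlt : i < K
      · left; simp only [A]; rw [if_pos hlt, pow_succ]; linarith
      · right
        have : i = K := by omega
        rw [this, hbK, mul_pow, ← Real.rpow_natCast, ← Real.rpow_natCast, ← Real.rpow_mul hl.le]
        norm_num
    · apply mul_le_mul' _ (eLpNorm_indicator_le _)
      apply ENNReal.ofReal_le_ofReal
      rw [← hP, Real.mul_rpow hC.le (by positivity)]
      apply mul_le_mul_of_nonneg_left _ (by positivity)
      rw [Real.mul_rpow (by positivity) (by positivity), hb, ← Real.rpow_mul hl.le, ← Real.rpow_mul hl.le, ← Real.rpow_mul hl.le,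
        ← Real.rpow_add hl]
      apply Real.rpow_le_rpow_of_exponent_ge hl (by linarith)
      have e : q / (2 * (1 + q)) * (1 + σ1 + σ2) = q * (1 + σ1 + σ2) * P := by rw [hP]; ring
      rw [e]
      have : 1 / (2 * K) * (σ1 * q) * P ≤ κ := by
        have h1 : σ1 * q < K * κ := by
          have : σ1 * q / κ < K := by linarith
          rwa [div_lt_iff₀ hκ] at this
        have h2 : 1 / (2 * K) * (σ1 * q) ≤ κ := by
          rw [div_mul_eq_mul_div, one_mul, div_le_iff₀ (by positivity)]
          nlinarith
        calc _ ≤ κ * 1 := mul_le_mul h2 hP1 hP0.le hκ.le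
          _ = κ := mul_one _
      linarith
  have hpf : (fun p : E1 × E2 => PF U p.1 p.2) = ∑ i ∈ Finset.range (K + 1), fun p : E1 × E2 => PF (V i) p.1 p.2 := by
    ext p
    conv_lhs => rw [hsum]
    rw [PF_sum _ _ (fun i _ => hVi i)]
    simp
  rw [hpf]
  refine (eLpNorm_sum_le (fun i _ => (PF_cont (hVi i)).aestronglyMeasurable) (by
    rw [ENNReal.one_le_ofReal]; linarith)).trans ?_
  refine (Finset.sum_le_sum hpc).trans ?_
  rw [Finset.sum_const, Finset.card_range, nsmul_eq_mul, ← mul_assoc, mul_assoc ((K:ℝ) + 1), ENNReal.ofReal_mul (by positivity : 0 ≤ (K:ℝ) + 1)]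
  apply le_of_eq
  congr 2
  rw [ENNReal.ofReal_add (by positivity) (by norm_num)]
  simp

end Region

section Sym

/-- First block. -/
abbrev F1 (d m : ℕ) : Type := EuclideanSpace ℝ {i : Fin d // (i : ℕ) < d - m}
/-- Second block. -/
abbrev F2 (d m : ℕ) : Type := EuclideanSpace ℝ {i : Fin d // ¬ (i : ℕ) < d - m}

/-- The splitting isometry. -/
def spl (d m : ℕ) : Rd d ≃ₗᵢ[ℝ] WithLp 2 (F1 d m × F2 d m) :=
  (LinearIsometryEquiv.piLpCongrLeft 2 ℝ ℝ
    (Equiv.sumCompl (fun i : Fin d => (i : ℕ) < d - m)).symm).trans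
    (PiLp.sumPiLpEquivProdLpPiLp (𝕜 := ℝ) 2 (fun _ => ℝ))

theorem spl_fst_apply (d m : ℕ) (x : Rd d) (i : {i : Fin d // (i : ℕ) < d - m}) :
    (spl d m x).fst i = x i := by
  rfl

theorem spl_snd_apply (d m : ℕ) (x : Rd d) (i : {i : Fin d // ¬ (i : ℕ) < d - m}) :
    (spl d m x).snd i = x i := by
  rfl

theorem spl_fst_sq (d m : ℕ) (x : Rd d) : ‖(spl d m x).fst‖ ^ 2 = blockSq d m x := by
  rw [EuclideanSpace.norm_sq_eq]
  simp only [spl_fst_apply, Real.norm_eq_abs, sq_abs]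
  unfold blockSq
  rw [← Finset.sum_filter]
  exact (Finset.sum_subtype _ (by simp) (fun i => x i ^ 2)).symm

theorem spl_snd_sq (d m : ℕ) (x : Rd d) : ‖(spl d m x).fst‖ ^ 2 + ‖(spl d m x).snd‖ ^ 2 = ‖x‖ ^ 2 := by
  rw [← WithLp.prod_norm_sq_eq_of_L2, LinearIsometryEquiv.norm_map]

theorem finrank_F1 (d m : ℕ) : Module.finrank ℝ (F1 d m) = d - m := by
  rw [finrank_euclideanSpace, Fintype.card_subtype]
  rw [Fin.card_filter_val_lt]
  omega

theorem finrank_F2 {d m : ℕ} (h : m ≤ d) : Module.finrank ℝ (F2 d m) = m := by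
  have h1 := (spl d m).toLinearEquiv.finrank_eq
  have h2 : Module.finrank ℝ (WithLp 2 (F1 d m × F2 d m)) = Module.finrank ℝ (F1 d m × F2 d m) :=
    (WithLp.linearEquiv 2 ℝ _).finrank_eq
  rw [h2, Module.finrank_prod, finrank_F1] at h1
  simp only [finrank_euclideanSpace, Fintype.card_fin] at h1 ⊢
  omega

theorem exists_refl {E : Type*} [NormedAddCommGroup E] [InnerProductSpace ℝ E] 
    {v w : E} (h : ‖v‖ = ‖w‖) : ∃ a : E ≃ₗᵢ[ℝ] E, a v = w :=
  ⟨_, Submodule.reflection_sub h⟩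

/-- The symmetry group. -/
def Gm (d m : ℕ) : Set (Rd d ≃ₗᵢ[ℝ] Rd d) := {g | ∀ v, blockSq d m (g v) = blockSq d m v}

/-- block-diagonal isometry -/
def bd {d : ℕ} {E1 E2 : Type*} [NormedAddCommGroup E1] [InnerProductSpace ℝ E1] [NormedAddCommGroup E2] [InnerProductSpace ℝ E2]
    (e : Rd d ≃ₗᵢ[ℝ] WithLp 2 (E1 × E2)) (a : E1 ≃ₗᵢ[ℝ] E1) (b : E2 ≃ₗᵢ[ℝ] E2) : Rd d ≃ₗᵢ[ℝ] Rd d :=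
  (e.trans (LinearIsometryEquiv.withLpProdCongr 2 a b)).trans e.symm

theorem bd_apply {d : ℕ} {E1 E2 : Type*} [NormedAddCommGroup E1] [InnerProductSpace ℝ E1] [NormedAddCommGroup E2] [InnerProductSpace ℝ E2]
    (e : Rd d ≃ₗᵢ[ℝ] WithLp 2 (E1 × E2)) (a : E1 ≃ₗᵢ[ℝ] E1) (b : E2 ≃ₗᵢ[ℝ] E2) (x : Rd d) :
    e (bd e a b x) = WithLp.toLp 2 (a (e x).fst, b (e x).snd) := by
  simp [bd]

theorem bd_mem (d m : ℕ) (a : F1 d m ≃ₗᵢ[ℝ] F1 d m) (b : F2 d m ≃ₗᵢ[ℝ] F2 d m) : bd (spl d m) a b ∈ Gm d m := by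
  intro v
  rw [← spl_fst_sq, ← spl_fst_sq, bd_apply]
  simp

theorem gk_orbit {d m : ℕ} {x y : Rd d} (h1 : blockSq d m x = blockSq d m y) (h2 : ‖x‖ = ‖y‖) :
    ∃ g ∈ Gm d m, g x = y := by
  have e1 : ‖(spl d m x).fst‖ = ‖(spl d m y).fst‖ := by
    rw [← sq_eq_sq₀ (norm_nonneg _) (norm_nonneg _), spl_fst_sq, spl_fst_sq, h1]
  have e2 : ‖(spl d m x).snd‖ = ‖(spl d m y).snd‖ := by
    have a1 := spl_snd_sq d m x
    have a2 := spl_snd_sq d m y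
    rw [← sq_eq_sq₀ (norm_nonneg _) (norm_nonneg _)]
    rw [h2, ← a2, e1] at a1
    linarith
  obtain ⟨a, ha⟩ := exists_refl e1
  obtain ⟨b, hb⟩ := exists_refl e2
  refine ⟨_, bd_mem d m a b, ?_⟩
  apply (spl d m).injective
  rw [bd_apply, ha, hb]
  rfl

/-- exact invariance -/
def InvG {d : ℕ} (G : Set (Rd d ≃ₗᵢ[ℝ] Rd d)) (f : Rd d → ℂ) : Prop := ∀ g ∈ G, ∀ x, f (g x) = f x

/-- a.e. invariance -/
def SymF {d : ℕ} (G : Set (Rd d ≃ₗᵢ[ℝ] Rd d)) (f : Rd d → ℂ) : Prop := ∀ g ∈ G, f ∘ g =ᵐ[volume] f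

theorem gk_iff {d m : ℕ} (f : Rd d → ℂ) : GkSymmetric d m f ↔ InvG (Gm d m) f := by
  constructor
  · intro h g hg x
    exact h _ _ (hg x) (g.norm_map x)
  · intro h x y h1 h2
    obtain ⟨g, hg, e⟩ := gk_orbit h1 h2
    rw [← e, h g hg]

theorem blockSq_zero (d : ℕ) (x : Rd d) : blockSq d 0 x = ‖x‖ ^ 2 := by
  rw [EuclideanSpace.norm_sq_eq]
  unfold blockSq
  simp

theorem radial_iff {d : ℕ} (f : Rd d → ℂ) : Radial f ↔ GkSymmetric d 0 f := by
  constructor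
  · intro h x y _ h2; exact h x y h2
  · intro h x y h2; refine h x y ?_ h2
    rw [blockSq_zero, blockSq_zero, h2]

theorem symF_of {d : ℕ} {G : Set (Rd d ≃ₗᵢ[ℝ] Rd d)} {U u : Rd d → ℂ} (hU : MemLp U 2 volume)
    (hu : u =ᵐ[volume] IF U) (h : InvG G u) : SymF G U := by
  intro g hg
  have h1 : IF (U ∘ g) =ᵐ[volume] IF U := by
    refine (IF_comp hU g).trans ?_
    have h2 : u ∘ g =ᵐ[volume] IF U ∘ g := g.measurePreserving.quasiMeasurePreserving.ae_eq_comp hu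
    refine h2.symm.trans ?_
    have : u ∘ g = u := by ext x; exact h g hg x
    rw [this]; exact hu
  refine IF_unique' (u := IF U) (MemLp.comp_isometry hU g) hU ?_ (IF_pair hU)
  intro φ
  rw [IF_pair (MemLp.comp_isometry hU g)]
  apply integral_congr_ae
  filter_upwards [h1] with x hx
  rw [hx]

theorem symF_inv {d : ℕ} {G : Set (Rd d ≃ₗᵢ[ℝ] Rd d)} {U : Rd d → ℂ} (h : SymF G U) : InvG G (𝓕⁻ U) := by
  intro g hg x
  rw [← Real.fourierInv_comp_linearIsometry]
  rw [Real.fourierInv_eq, Real.fourierInv_eq]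
  apply integral_congr_ae
  filter_upwards [h g hg] with y hy
  rw [hy]

theorem SymF.congr {d : ℕ} {G : Set (Rd d ≃ₗᵢ[ℝ] Rd d)} {U V : Rd d → ℂ} (h : SymF G U) (e : U =ᵐ[volume] V) :
    SymF G V := by
  intro g hg
  have := g.measurePreserving.quasiMeasurePreserving.ae_eq_comp e
  exact this.symm.trans ((h g hg).trans e)

theorem SymF.mul {d : ℕ} {G : Set (Rd d ≃ₗᵢ[ℝ] Rd d)} {U : Rd d → ℂ} (h : SymF G U) {w : Rd d → ℂ}
    (hw : ∀ g ∈ G, ∀ x, w (g x) = w x) : SymF G (fun x => w x * U x) := by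
  intro g hg
  filter_upwards [h g hg] with x hx
  simp only [Function.comp_apply] at hx ⊢
  rw [hx, hw g hg]

theorem SymF.indicator {d : ℕ} {G : Set (Rd d ≃ₗᵢ[ℝ] Rd d)} {U : Rd d → ℂ} (h : SymF G U) {S : Set (Rd d)}
    (hS : ∀ g ∈ G, ∀ x, g x ∈ S ↔ x ∈ S) : SymF G (S.indicator U) := by
  intro g hg
  filter_upwards [h g hg] with x hx
  simp only [Function.comp_apply] at hx ⊢
  by_cases hh : x ∈ S
  · rw [Set.indicator_of_mem hh, Set.indicator_of_mem ((hS g hg x).2 hh), hx]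
  · rw [Set.indicator_of_notMem hh, Set.indicator_of_notMem (fun h' => hh ((hS g hg x).1 h'))]

end Sym

section Shell

theorem regionRd {d : ℕ} (E1 E2 : Type*) [NormedAddCommGroup E1] [InnerProductSpace ℝ E1] [FiniteDimensional ℝ E1]
    [MeasurableSpace E1] [BorelSpace E1] [NormedAddCommGroup E2] [InnerProductSpace ℝ E2]
    [FiniteDimensional ℝ E2] [MeasurableSpace E2] [BorelSpace E2] [Nontrivial E2]
    (e : Rd d ≃ₗᵢ[ℝ] WithLp 2 (E1 × E2)) (G : Set (Rd d ≃ₗᵢ[ℝ] Rd d)) (hG : ∀ a b, bd e a b ∈ G) {σ1 σ2 q κ : ℝ}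
    (h10 : 0 ≤ σ1) (h11 : σ1 ≤ (Module.finrank ℝ E1 : ℝ) - 1 ∨ σ1 = 0) (h12 : 2 * σ1 ≤ Module.finrank ℝ E1)
    (h20 : 0 ≤ σ2) (h21 : σ2 ≤ (Module.finrank ℝ E2 : ℝ) - 1) (hq : 0 < q) (hτ : (σ1 + σ2) * q < 1) (hκ : 0 < κ) :
    ∃ C : ℝ, 0 < C ∧ ∀ (U : Rd d → ℂ) (l : ℝ), 0 < l → l ≤ 1/2 →
      Measurable U → MemLp U 2 volume → SymF G U → 
      (∀ ξ, U ξ ≠ 0 → ‖(e ξ).fst‖ ≤ ‖(e ξ).snd‖ ∧ |‖ξ‖ - 1| ≤ l) →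
      eLpNorm (IF U) (ENNReal.ofReal (2 * (1 + q))) volume ≤
        ENNReal.ofReal (C * l ^ (q / (2 * (1 + q)) * (1 + σ1 + σ2) - κ)) * eLpNorm U 2 volume := by
  obtain ⟨C, hC, h⟩ := region E1 E2 h10 h11 h12 h20 h21 hq hτ hκ
  refine ⟨C, hC, ?_⟩
  intro U l hl hl2 hUm hU hS hsupp
  have hi : Integrable U volume := (sup_bound hU (S := Metric.closedBall 0 2) measurableSet_closedBall
    measure_closedBall_lt_top.ne (by
      intro ξ hξ
      by_contra h0
      have := (abs_le.1 (hsupp ξ h0).2).2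
      simp at hξ; linarith)).1
  -- the map
  have hmp1 : MeasurePreserving (fun p : E1 × E2 => e.symm (WithLp.toLp 2 p)) volume volume :=
    e.symm.measurePreserving.comp (WithLp.volume_preserving_toLp E1 E2)
  have hemb : MeasurableEmbedding (fun p : E1 × E2 => e.symm (WithLp.toLp 2 p)) := by
    exact (e.symm.toHomeomorph.measurableEmbedding).comp (MeasurableEquiv.toLp 2 (E1 × E2)).measurableEmbedding
  obtain ⟨V, hV⟩ : ∃ V : E1 × E2 → ℂ, V = fun p => U (e.symm (WithLp.toLp 2 p)) := ⟨_, rfl⟩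
  have hVU : V = U ∘ (fun p : E1 × E2 => e.symm (WithLp.toLp 2 p)) := by rw [hV]; rfl
  have hPF : ∀ (T : Rd d → ℂ) (y : E1) (z : E2), PF (T ∘ (fun p : E1 × E2 => e.symm (WithLp.toLp 2 p))) y z = 𝓕⁻ T (e.symm (WithLp.toLp 2 (y, z))) := by
    intro T y z
    rw [PF_eq, ← Real.fourierInv_comp_linearIsometry]
    rfl
  have hblk : ∀ A B, (blk E1 E2 A B).indicator V = ({ξ : Rd d | A < ‖(e ξ).fst‖ ∧ ‖(e ξ).fst‖ ≤ B}.indicator U) ∘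
      (fun p : E1 × E2 => e.symm (WithLp.toLp 2 p)) := by
    intro A B
    ext p
    rw [hV]
    simp only [Set.indicator, blk, Set.mem_ofPred_eq, Function.comp_apply, LinearIsometryEquiv.apply_symm_apply]
    congr 1
  have hinv : ∀ A B, ∀ a b, ∀ x, 𝓕⁻ ({ξ : Rd d | A < ‖(e ξ).fst‖ ∧ ‖(e ξ).fst‖ ≤ B}.indicator U) (bd e a b x) =
      𝓕⁻ ({ξ : Rd d | A < ‖(e ξ).fst‖ ∧ ‖(e ξ).fst‖ ≤ B}.indicator U) x := by
    intro A B a b x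
    have hS' : SymF (Set.range fun w : (E1 ≃ₗᵢ[ℝ] E1) × (E2 ≃ₗᵢ[ℝ] E2) => bd e w.1 w.2) U := by
      rintro g ⟨w, rfl⟩
      exact hS _ (hG _ _)
    refine symF_inv (SymF.indicator hS' ?_) _ ⟨(a, b), rfl⟩ x
    rintro g ⟨w, rfl⟩ x
    simp only [Set.mem_ofPred_eq, bd_apply]
    rw [show (WithLp.toLp 2 (w.1 (e x).fst, w.2 (e x).snd)).fst = w.1 (e x).fst from rfl, LinearIsometryEquiv.norm_map]
  have key := h V l hl hl2 (by rw [hVU]; exact hUm.comp hmp1.measurable)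
    (by rw [hVU]; exact hU.comp_measurePreserving hmp1)
    (by rw [hVU]; exact (hmp1.integrable_comp_emb hemb).2 hi)
    (by
      intro p hp
      have h1 := hsupp (e.symm (WithLp.toLp 2 p)) (by rw [hV] at hp; exact hp)
      rw [LinearIsometryEquiv.apply_symm_apply, LinearIsometryEquiv.norm_map, abs_le] at h1
      have h2 := WithLp.prod_norm_sq_eq_of_L2 (WithLp.toLp 2 p)
      refine ⟨h1.1, ?_, ?_⟩
      · change _ ≤ ‖(WithLp.toLp 2 p).fst‖ ^ 2 + ‖(WithLp.toLp 2 p).snd‖ ^ 2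
        rw [← h2]
        apply pow_le_pow_left₀ <;> linarith [h1.2.1]
      · change ‖(WithLp.toLp 2 p).fst‖ ^ 2 + ‖(WithLp.toLp 2 p).snd‖ ^ 2 ≤ _
        rw [← h2]
        apply pow_le_pow_left₀ (norm_nonneg _); linarith [h1.2.2])
    (by
      intro A B y y' z hy
      obtain ⟨a, ha⟩ := exists_refl hy.symm
      rw [hblk, hPF, hPF, ← hinv A B a (LinearIsometryEquiv.refl ℝ E2) (e.symm (WithLp.toLp 2 (y, z)))]
      refine congrArg _ ?_
      apply e.injective
      rw [bd_apply]
      simp [ha])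
    (by
      intro A B y z z' hy
      obtain ⟨a, ha⟩ := exists_refl hy.symm
      rw [hblk, hPF, hPF, ← hinv A B (LinearIsometryEquiv.refl ℝ E1) a (e.symm (WithLp.toLp 2 (y, z)))]
      refine congrArg _ ?_
      apply e.injective
      rw [bd_apply]
      simp [ha])
  have e1 : eLpNorm V 2 volume = eLpNorm U 2 volume := by
    rw [hVU]; exact eLpNorm_comp_measurePreserving hU.1 hmp1
  have e2 : eLpNorm (fun p : E1 × E2 => PF V p.1 p.2) (ENNReal.ofReal (2 * (1 + q))) volume =
      eLpNorm (IF U) (ENNReal.ofReal (2 * (1 + q))) volume := by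
    rw [eLpNorm_congr_ae (IF_eq_integral hU hi),
      ← eLpNorm_comp_measurePreserving (fourierInv_continuous hi).aestronglyMeasurable hmp1]
    congr 1
    ext p
    rw [hVU, hPF]
    rfl
  rw [e1, e2] at key
  exact key

end Shell

section Shell2

/-- Shell bound with exponent `b`. -/
def ShellBd (d : ℕ) (G : Set (Rd d ≃ₗᵢ[ℝ] Rd d)) (p b : ℝ) : Prop :=
  ∃ C : ℝ, 0 < C ∧ ∀ (U : Rd d → ℂ) (l : ℝ), 0 < l → l ≤ 1/2 → MemLp U 2 volume → SymF G U →
    (∀ ξ, U ξ ≠ 0 → |‖ξ‖ - 1| ≤ l) →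
    eLpNorm (IF U) (ENNReal.ofReal p) volume ≤ ENNReal.ofReal (C * l ^ b) * eLpNorm U 2 volume

theorem shell_meas {d : ℕ} {U : Rd d → ℂ} {l : ℝ} (hU : MemLp U 2 volume) (hsupp : ∀ ξ, U ξ ≠ 0 → |‖ξ‖ - 1| ≤ l) :
    ∃ V : Rd d → ℂ, Measurable V ∧ U =ᵐ[volume] V ∧ ∀ ξ, V ξ ≠ 0 → |‖ξ‖ - 1| ≤ l := by
  have hm : MeasurableSet {ξ : Rd d | |‖ξ‖ - 1| ≤ l} := measurableSet_le (by fun_prop) measurable_const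
  refine ⟨{ξ : Rd d | |‖ξ‖ - 1| ≤ l}.indicator (hU.1.mk U), hU.1.stronglyMeasurable_mk.measurable.indicator hm, ?_, ?_⟩
  · filter_upwards [hU.1.ae_eq_mk] with ξ hξ
    by_cases h : ξ ∈ {ξ : Rd d | |‖ξ‖ - 1| ≤ l}
    · rw [Set.indicator_of_mem h, hξ]
    · rw [Set.indicator_of_notMem h]
      by_contra h0
      exact h (hsupp ξ h0)
  · intro ξ hξ
    by_contra h
    exact hξ (Set.indicator_of_notMem (s := {ξ : Rd d | |‖ξ‖ - 1| ≤ l}) h _)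

theorem shell_of_meas {d : ℕ} {G : Set (Rd d ≃ₗᵢ[ℝ] Rd d)} {p b : ℝ}
    (H : ∃ C : ℝ, 0 < C ∧ ∀ (U : Rd d → ℂ) (l : ℝ), 0 < l → l ≤ 1/2 → Measurable U → MemLp U 2 volume → SymF G U →
    (∀ ξ, U ξ ≠ 0 → |‖ξ‖ - 1| ≤ l) →
    eLpNorm (IF U) (ENNReal.ofReal p) volume ≤ ENNReal.ofReal (C * l ^ b) * eLpNorm U 2 volume) : ShellBd d G p b := by
  obtain ⟨C, hC, h⟩ := H
  refine ⟨C, hC, fun U l hl hl2 hU hS hsupp => ?_⟩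
  obtain ⟨V, hVm, hUV, hVs⟩ := shell_meas hU hsupp
  have := h V l hl hl2 hVm (hU.ae_eq hUV) (hS.congr hUV) hVs
  rwa [← eLpNorm_congr_ae (IF_congr hUV), ← eLpNorm_congr_ae hUV] at this

theorem spl_snd_inv {d m : ℕ} {g : Rd d ≃ₗᵢ[ℝ] Rd d} (hg : g ∈ Gm d m) (x : Rd d) :
    ‖(spl d m (g x)).fst‖ = ‖(spl d m x).fst‖ ∧ ‖(spl d m (g x)).snd‖ = ‖(spl d m x).snd‖ := by
  have h1 : ‖(spl d m (g x)).fst‖ = ‖(spl d m x).fst‖ := by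
    rw [← sq_eq_sq₀ (norm_nonneg _) (norm_nonneg _), spl_fst_sq, spl_fst_sq, hg x]
  refine ⟨h1, ?_⟩
  have a1 := spl_snd_sq d m x
  have a2 := spl_snd_sq d m (g x)
  rw [← sq_eq_sq₀ (norm_nonneg _) (norm_nonneg _)]
  rw [g.norm_map, ← a1, h1] at a2
  linarith

/-- swapped splitting -/
def splS (d m : ℕ) : Rd d ≃ₗᵢ[ℝ] WithLp 2 (F2 d m × F1 d m) :=
  (spl d m).trans (LinearIsometryEquiv.withLpProdComm 2 ℝ _ _)

theorem splS_fst (d m : ℕ) (x : Rd d) : (splS d m x).fst = (spl d m x).snd := rfl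
theorem splS_snd (d m : ℕ) (x : Rd d) : (splS d m x).snd = (spl d m x).fst := rfl

theorem bdS_mem (d m : ℕ) (b : F2 d m ≃ₗᵢ[ℝ] F2 d m) (a : F1 d m ≃ₗᵢ[ℝ] F1 d m) : bd (splS d m) b a ∈ Gm d m := by
  intro v
  rw [← spl_fst_sq, ← spl_fst_sq, ← splS_snd, ← splS_snd, bd_apply]
  rw [show (WithLp.toLp 2 (b (splS d m v).fst, a (splS d m v).snd)).snd = a (splS d m v).snd from rfl, LinearIsometryEquiv.norm_map]

theorem shell_rad {d : ℕ} (hd : 2 ≤ d) {σ q κ : ℝ} (hσ0 : 0 ≤ σ) (hσ : σ ≤ d - 1) (hq : 0 < q) (hσq : σ * q < 1) (hκ : 0 < κ) :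
    ShellBd d (Gm d 0) (2 * (1 + q)) (q / (2 * (1 + q)) * (1 + σ) - κ) := by
  apply shell_of_meas
  have hn1 : Module.finrank ℝ (F1 d 0) = d := finrank_F1 d 0
  have hn2 : Module.finrank ℝ (F2 d 0) = 0 := finrank_F2 (by omega)
  have : Nontrivial (F1 d 0) := Module.nontrivial_of_finrank_pos (R := ℝ) (by omega)
  have : Subsingleton (F2 d 0) := Module.finrank_zero_iff.1 hn2
  obtain ⟨C, hC, h⟩ := regionRd (F2 d 0) (F1 d 0) (splS d 0) (Gm d 0) (bdS_mem d 0) (σ1 := 0) (σ2 := σ) (q := q) (κ := κ) le_rfl (Or.inr rfl)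
    (by rw [hn2]; simp) hσ0 (by rw [hn1]; exact hσ) hq (by simpa using hσq) hκ
  refine ⟨C, hC, fun U l hl hl2 hUm hU hS hsupp => ?_⟩
  have := h U l hl hl2 hUm hU hS (fun ξ hξ => ⟨by
    rw [Subsingleton.elim ((splS d 0 ξ).fst) 0, norm_zero]; exact norm_nonneg _, hsupp ξ hξ⟩)
  rwa [add_zero] at this

theorem shell_G {d m : ℕ} (hm : 2 ≤ m) (hmd : m ≤ d / 2) {σ q κ : ℝ} (hσ0 : 0 ≤ σ) (hσ : σ ≤ ((d:ℝ) + m) / 2 - 1) (hq : 0 < q)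
    (hσq : σ * q < 1) (hκ : 0 < κ) :
    ShellBd d (Gm d m) (2 * (1 + q)) (q / (2 * (1 + q)) * (1 + σ) - κ) := by
  apply shell_of_meas
  have hmd2 : 2 * m ≤ d := by omega
  have hmdR : 2 * (m:ℝ) ≤ d := by exact_mod_cast hmd2
  have hmR : (2:ℝ) ≤ m := by exact_mod_cast hm
  have hn1 : Module.finrank ℝ (F1 d m) = d - m := finrank_F1 d m
  have hn2 : Module.finrank ℝ (F2 d m) = m := finrank_F2 (by omega)
  have hn1R : (Module.finrank ℝ (F1 d m) : ℝ) = d - m := by rw [hn1]; push_cast [show m ≤ d by omega]; ring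
  have hn2R : (Module.finrank ℝ (F2 d m) : ℝ) = m := by rw [hn2]
  have : Nontrivial (F1 d m) := Module.nontrivial_of_finrank_pos (R := ℝ) (by omega)
  have : Nontrivial (F2 d m) := Module.nontrivial_of_finrank_pos (R := ℝ) (by omega)
  obtain ⟨C, hC, h⟩ := regionRd (F1 d m) (F2 d m) (spl d m) (Gm d m) (bd_mem d m) (σ1 := min σ ((d - m) / 2)) (σ2 := σ - min σ ((d - m) / 2)) (q := q) (κ := κ)
    (by apply le_min hσ0; linarith) (Or.inl (by rw [hn1R]; refine (min_le_right _ _).trans ?_; linarith))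
    (by rw [hn1R]; linarith [min_le_right σ (((d:ℝ)-m)/2)]) (by linarith [min_le_left σ (((d:ℝ)-m)/2)])
    (by rw [hn2R]; rcases min_cases σ (((d:ℝ)-m)/2) with h | h <;> linarith [h.1]) hq (by simpa using hσq) hκ
  obtain ⟨C', hC', h'⟩ := regionRd (F2 d m) (F1 d m) (splS d m) (Gm d m) (bdS_mem d m) (σ1 := min σ (m / 2)) (σ2 := σ - min σ (m / 2)) (q := q) (κ := κ)
    (by apply le_min hσ0; linarith) (Or.inl (by rw [hn2R]; refine (min_le_right _ _).trans ?_; linarith))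
    (by rw [hn2R]; linarith [min_le_right σ ((m:ℝ)/2)]) (by linarith [min_le_left σ ((m:ℝ)/2)])
    (by rw [hn1R]; rcases min_cases σ ((m:ℝ)/2) with h | h <;> linarith [h.1]) hq (by simpa using hσq) hκ
  refine ⟨C + C', by positivity, fun U l hl hl2 hUm hU hS hsupp => ?_⟩
  rw [show 1 + min σ ((d - m) / 2) + (σ - min σ ((d - m) / 2)) = 1 + σ by ring] at h
  rw [show 1 + min σ ((m:ℝ) / 2) + (σ - min σ ((m:ℝ) / 2)) = 1 + σ by ring] at h'
  obtain ⟨b, hb⟩ : ∃ b, b = q / (2 * (1 + q)) * (1 + σ) - κ := ⟨_, rfl⟩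
  rw [← hb] at h h' ⊢
  have hc1 : Continuous fun ξ : Rd d => (spl d m ξ).fst := (WithLp.continuous_fst 2 _ _).comp (spl d m).continuous
  have hc2 : Continuous fun ξ : Rd d => (spl d m ξ).snd := (WithLp.continuous_snd 2 _ _).comp (spl d m).continuous
  obtain ⟨S, hSd⟩ : ∃ S : Set (Rd d), S = {ξ : Rd d | ‖(spl d m ξ).fst‖ ≤ ‖(spl d m ξ).snd‖} := ⟨_, rfl⟩
  have hSm : MeasurableSet S := by
    rw [hSd]; exact (isClosed_le hc1.norm hc2.norm).measurableSet
  have hSi : ∀ g ∈ Gm d m, ∀ x, g x ∈ S ↔ x ∈ S := by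
    intro g hg x
    rw [hSd, Set.mem_ofPred_eq, Set.mem_ofPred_eq, (spl_snd_inv hg x).1, (spl_snd_inv hg x).2]
  have k1 := h (S.indicator U) l hl hl2 (hUm.indicator hSm) (hU.indicator hSm) (hS.indicator hSi) (by
    intro ξ hξ
    have h1 : ξ ∈ S := Set.mem_of_indicator_ne_zero hξ
    rw [Set.indicator_of_mem h1] at hξ
    rw [hSd] at h1
    exact ⟨h1, hsupp ξ hξ⟩)
  have k2 := h' (Sᶜ.indicator U) l hl hl2 (hUm.indicator hSm.compl) (hU.indicator hSm.compl) (hS.indicator (by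
      intro g hg x; rw [Set.mem_compl_iff, Set.mem_compl_iff, hSi g hg])) (by
    intro ξ hξ
    have h1 : ξ ∈ Sᶜ := Set.mem_of_indicator_ne_zero hξ
    rw [Set.indicator_of_mem h1] at hξ
    rw [hSd, Set.mem_compl_iff, Set.mem_ofPred_eq, not_le] at h1
    exact ⟨h1.le, hsupp ξ hξ⟩)
  have hsum : IF U =ᵐ[volume] IF (S.indicator U) + IF (Sᶜ.indicator U) := by
    have := IF_add (hU.indicator hSm) (hU.indicator hSm.compl)
    rwa [Set.indicator_self_add_compl] at this
  rw [eLpNorm_congr_ae hsum]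
  have hp1 : 1 ≤ ENNReal.ofReal (2 * (1 + q)) := by
    rw [ENNReal.one_le_ofReal]; linarith
  refine (eLpNorm_add_le (IF_memLp (hU.indicator hSm)).1 (IF_memLp (hU.indicator hSm.compl)).1 hp1).trans ?_
  have hl0 : 0 ≤ l ^ b := by positivity
  rw [add_mul, ENNReal.ofReal_add (by positivity) (by positivity), add_mul]
  apply add_le_add
  · exact k1.trans (mul_le_mul_right (eLpNorm_indicator_le _) _)
  · exact k2.trans (mul_le_mul_right (eLpNorm_indicator_le _) _)

end Shell2

section Lower

/-- the quadratic form as a lower integral -/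
def QL {d : ℕ} (g : ℝ → ℝ) (U : Rd d → ℂ) : ℝ≥0∞ := ∫⁻ ξ, ‖U ξ‖ₑ ^ 2 * ENNReal.ofReal (g ‖ξ‖)

theorem piece_le {d : ℕ} {g : ℝ → ℝ} {U : Rd d → ℂ} {S : Set (Rd d)} (hS : MeasurableSet S) {a : ℝ} (ha : 0 < a)
    (h : ∀ ξ ∈ S, a ≤ g ‖ξ‖) : eLpNorm (S.indicator U) 2 volume ≤ ENNReal.ofReal (a ^ (-(1/2) : ℝ)) * QL g U ^ (1/2 : ℝ) := by
  have h1 : eLpNorm (S.indicator U) 2 volume ^ 2 ≤ ENNReal.ofReal a⁻¹ * QL g U := by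
    rw [eLpNorm_two_sq, QL, ← lintegral_const_mul' _ _ ENNReal.ofReal_ne_top]
    apply lintegral_mono
    intro ξ
    beta_reduce
    by_cases hξ : ξ ∈ S
    · rw [Set.indicator_of_mem hξ]
      have : (1 : ℝ≥0∞) ≤ ENNReal.ofReal a⁻¹ * ENNReal.ofReal (g ‖ξ‖) := by
        rw [← ENNReal.ofReal_mul (by positivity), ENNReal.one_le_ofReal, ← div_eq_inv_mul, le_div_iff₀ ha]
        simpa using h ξ hξ
      calc ‖U ξ‖ₑ ^ 2 = ‖U ξ‖ₑ ^ 2 * 1 := by rw [mul_one]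
        _ ≤ ‖U ξ‖ₑ ^ 2 * (ENNReal.ofReal a⁻¹ * ENNReal.ofReal (g ‖ξ‖)) := mul_le_mul_right this _
        _ = _ := by ring
    · rw [Set.indicator_of_notMem hξ]; simp
  have h2 := ENNReal.rpow_le_rpow h1 (show (0:ℝ) ≤ 1/2 by norm_num)
  rw [ENNReal.mul_rpow_of_nonneg _ _ (by norm_num), ← ENNReal.rpow_natCast, ← ENNReal.rpow_mul] at h2
  rw [ENNReal.ofReal_rpow_of_nonneg (by positivity) (by norm_num)] at h2
  have e : (a⁻¹ ^ (1/2:ℝ)) = a ^ (-(1/2):ℝ) := by rw [Real.rpow_neg ha.le, Real.inv_rpow ha.le]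
  rw [e] at h2
  simpa using h2

theorem wt_piece_le {d : ℕ} {g : ℝ → ℝ} {U : Rd d → ℂ} {S : Set (Rd d)} {s : ℝ} {a : ℝ} (ha : 0 < a)
    (h : ∀ ξ ∈ S, a * (1 + ‖ξ‖ ^ 2) ^ s ≤ g ‖ξ‖) :
    eLpNorm (wt s (S.indicator U)) 2 volume ≤ ENNReal.ofReal (a ^ (-(1/2) : ℝ)) * QL g U ^ (1/2 : ℝ) := by
  have h1 : eLpNorm (wt s (S.indicator U)) 2 volume ^ 2 ≤ ENNReal.ofReal a⁻¹ * QL g U := by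
    rw [eLpNorm_two_sq, QL, ← lintegral_const_mul' _ _ ENNReal.ofReal_ne_top]
    apply lintegral_mono
    intro ξ
    simp only [wt]
    by_cases hξ : ξ ∈ S
    · rw [Set.indicator_of_mem hξ, enorm_smul, mul_pow]
      have hpos : (0:ℝ) < 1 + ‖ξ‖ ^ 2 := by positivity
      have e0 : ‖((1 + ‖ξ‖ ^ 2) ^ (s/2) : ℝ)‖ₑ ^ 2 = ENNReal.ofReal ((1 + ‖ξ‖ ^ 2) ^ s) := by
        rw [Real.enorm_of_nonneg (by positivity), ← ENNReal.ofReal_pow (by positivity), ← Real.rpow_natCast, ← Real.rpow_mul hpos.le]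
        congr 2; push_cast; ring
      rw [e0]
      have : ENNReal.ofReal ((1 + ‖ξ‖ ^ 2) ^ s) ≤ ENNReal.ofReal a⁻¹ * ENNReal.ofReal (g ‖ξ‖) := by
        rw [← ENNReal.ofReal_mul (by positivity)]
        apply ENNReal.ofReal_le_ofReal
        rw [← div_eq_inv_mul, le_div_iff₀ ha, mul_comm]
        exact h ξ hξ
      calc _ ≤ ENNReal.ofReal a⁻¹ * ENNReal.ofReal (g ‖ξ‖) * ‖U ξ‖ₑ ^ 2 := mul_le_mul_left this _
        _ = _ := by ring
    · rw [Set.indicator_of_notMem hξ]; simp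
  have h2 := ENNReal.rpow_le_rpow h1 (show (0:ℝ) ≤ 1/2 by norm_num)
  rw [ENNReal.mul_rpow_of_nonneg _ _ (by norm_num), ← ENNReal.rpow_natCast, ← ENNReal.rpow_mul] at h2
  rw [ENNReal.ofReal_rpow_of_nonneg (by positivity) (by norm_num)] at h2
  have e : (a⁻¹ ^ (1/2:ℝ)) = a ^ (-(1/2):ℝ) := by rw [Real.rpow_neg ha.le, Real.inv_rpow ha.le]
  rw [e] at h2
  simpa using h2

/-- comparing the two weights -/
theorem weight_cmp (s : ℝ) (hs : 0 < s) (r : ℝ) (hr : 0 ≤ r) : (1 + r ^ 2) ^ s ≤ 2 ^ s * (1 + |r| ^ (2 * s)) := by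
  rw [abs_of_nonneg hr]
  rcases le_total r 1 with h | h
  · calc (1 + r ^ 2) ^ s ≤ (2:ℝ) ^ s := by
          apply Real.rpow_le_rpow (by positivity) _ hs.le
          nlinarith
      _ ≤ _ := by
          have : 0 ≤ r ^ (2 * s) := by positivity
          have h2 : (0:ℝ) < 2 ^ s := by positivity
          nlinarith
  · calc (1 + r ^ 2) ^ s ≤ (2 * r ^ 2) ^ s := by
          apply Real.rpow_le_rpow (by positivity) _ hs.le
          nlinarith
      _ = 2 ^ s * r ^ (2 * s) := by
          rw [Real.mul_rpow (by norm_num) (by positivity), Real.rpow_mul hr]; norm_num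
      _ ≤ _ := by
          have h2 : (0:ℝ) < 2 ^ s := by positivity
          nlinarith

theorem weight_cmp' (s : ℝ) (hs : 0 < s) (r : ℝ) (hr : 0 ≤ r) : 1 + |r| ^ (2 * s) ≤ 2 * (1 + r ^ 2) ^ s := by
  rw [abs_of_nonneg hr]
  have h1 : (1:ℝ) ≤ (1 + r ^ 2) ^ s := Real.one_le_rpow (by nlinarith) hs.le
  have h2 : r ^ (2 * s) ≤ (1 + r ^ 2) ^ s := by
    rw [Real.rpow_mul hr]
    apply Real.rpow_le_rpow (by positivity) _ hs.le
    norm_num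
  linarith

/-- the off-shell part -/
theorem off_shell {d : ℕ} {p s c : ℝ} (hp : 2 < p) (hs : (d : ℝ) * (1/2 - 1/p) < s) (hc : 0 < c) :
    ∃ D : ℝ, 0 < D ∧ ∀ (g : ℝ → ℝ) (U : Rd d → ℂ), MemLp U 2 volume → (∀ r, 1/2 ≤ |r - 1| → c * (1 + |r| ^ (2*s)) ≤ g r) →
      eLpNorm (IF ({ξ : Rd d | |‖ξ‖ - 1| ≤ 1/2}ᶜ.indicator U)) (ENNReal.ofReal p) volume ≤ ENNReal.ofReal D * QL g U ^ (1/2 : ℝ) := by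
  have hp1 : 0 ≤ 1/2 - 1/p := by
    rw [sub_nonneg]; apply one_div_le_one_div_of_le <;> linarith
  have hs0 : 0 < s := lt_of_le_of_lt (by positivity) hs
  obtain ⟨C, hC, h⟩ := sobolev (Rd d) hp (s := s) (by simpa using hs)
  have hm : MeasurableSet {ξ : Rd d | |‖ξ‖ - 1| ≤ 1/2} := measurableSet_le (by fun_prop) measurable_const
  refine ⟨C * (c / 2 ^ s) ^ (-(1/2) : ℝ), by positivity, fun g U hU hg => ?_⟩
  refine (h _ (hU.indicator hm.compl)).trans ?_
  rw [ENNReal.ofReal_mul hC.le, mul_assoc]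
  apply mul_le_mul_right
  apply wt_piece_le (by positivity)
  intro ξ hξ
  rw [Set.mem_compl_iff, Set.mem_ofPred_eq, not_le] at hξ
  refine le_trans ?_ (hg _ hξ.le)
  have := weight_cmp s hs0 ‖ξ‖ (norm_nonneg _)
  have h2 : (0:ℝ) < 2 ^ s := by positivity
  calc c / 2 ^ s * (1 + ‖ξ‖ ^ 2) ^ s ≤ c / 2 ^ s * (2 ^ s * (1 + |‖ξ‖| ^ (2 * s))) := by gcongr
    _ = _ := by field_simp

end Lower

section Lower2

theorem pow_bd {δ b b' γ K : ℝ} {i : ℝ} (hδ : 0 < δ) (hδ1 : δ ≤ 1) (hb : 0 < b) (hbγ : 2 * b ≤ γ) (hK : 0 < K) (hKb : b / K ≤ b - b')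
    (hi : 0 ≤ i) (hiK : i + 1 ≤ K) {c : ℝ} (hc : 0 < c) :
    ((1/2) * δ ^ (i / K)) ^ b * (c * ((1/2) * δ ^ ((i + 1) / K)) ^ γ) ^ (-(1/2) : ℝ) ≤ c ^ (-(1/2) : ℝ) * 2 ^ (γ/2) * δ ^ (b' - γ/2) := by
  have e1 : ((1/2) * δ ^ (i / K)) ^ b = (1/2) ^ b * δ ^ (i / K * b) := by
    rw [Real.mul_rpow (by norm_num) (by positivity), ← Real.rpow_mul hδ.le]
  have e2 : (c * ((1/2) * δ ^ ((i + 1) / K)) ^ γ) ^ (-(1/2) : ℝ) = c ^ (-(1/2) : ℝ) * (2 ^ (γ/2) * δ ^ ((i + 1) / K * (-(γ/2)))) := by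
    rw [Real.mul_rpow hc.le (by positivity), ← Real.rpow_mul (by positivity), Real.mul_rpow (by norm_num) (by positivity), ← Real.rpow_mul hδ.le]
    congr 2
    · rw [one_div, Real.inv_rpow (by norm_num), ← Real.rpow_neg (by norm_num)]; congr 1; ring
    · congr 1; ring
  rw [e1, e2]
  have h1 : (1/2 : ℝ) ^ b ≤ 1 := Real.rpow_le_one (by norm_num) (by norm_num) hb.le
  have h2 : δ ^ (i / K * b) * δ ^ ((i + 1) / K * (-(γ/2))) ≤ δ ^ (b' - γ/2) := by
    rw [← Real.rpow_add hδ]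
    apply Real.rpow_le_rpow_of_exponent_ge hδ hδ1
    have : i / K * b + (i + 1) / K * (-(γ/2)) - (b' - γ/2) = (b - b' - b / K) + (γ/2 - b) * ((K - (i + 1)) / K) := by
      field_simp; ring
    have h3 : 0 ≤ (γ/2 - b) * ((K - (i + 1)) / K) := mul_nonneg (by linarith) (div_nonneg (by linarith) hK.le)
    linarith
  calc _ = (1/2) ^ b * (c ^ (-(1/2) : ℝ) * 2 ^ (γ/2) * (δ ^ (i / K * b) * δ ^ ((i + 1) / K * (-(γ/2))))) := by ring
    _ ≤ 1 * (c ^ (-(1/2) : ℝ) * 2 ^ (γ/2) * δ ^ (b' - γ/2)) := by gcongr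
    _ = _ := by ring

theorem symF_shell {d : ℕ} {G : Set (Rd d ≃ₗᵢ[ℝ] Rd d)} {U : Rd d → ℂ} (h : SymF G U) (T : Set ℝ) :
    SymF G ({ξ : Rd d | ‖ξ‖ ∈ T}.indicator U) := by
  apply h.indicator
  intro g _ x
  simp

theorem lower_abs {d : ℕ} {G : Set (Rd d ≃ₗᵢ[ℝ] Rd d)} {p b b' s c γ : ℝ} (hSh : ShellBd d G p b) (hb : 0 < b) (hbγ : 2 * b ≤ γ)
    (hb' : b' < b) (hp : 2 < p) (hs : (d : ℝ) * (1/2 - 1/p) < s) (hc : 0 < c) :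
    ∃ D : ℝ, 0 < D ∧ ∀ (g : ℝ → ℝ) (ε : ℝ) (U : Rd d → ℂ), 0 < ε → ε < 1 → MemLp U 2 volume → SymF G U →
      (∀ r, 1/2 ≤ |r - 1| → c * (1 + |r| ^ (2*s)) ≤ g r) → (∀ r, |r - 1| ≤ 1/2 → c * (ε + |r - 1| ^ γ) ≤ g r) →
      eLpNorm (IF U) (ENNReal.ofReal p) volume ≤ ENNReal.ofReal (D * ε ^ (b' / γ - 1/2)) * QL g U ^ (1/2 : ℝ) := by
  have hγ : 0 < γ := by linarith
  have hp1 : 1 ≤ ENNReal.ofReal p := by rw [ENNReal.one_le_ofReal]; linarith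
  obtain ⟨C, hC, h⟩ := hSh
  obtain ⟨D0, hD0, h0⟩ := off_shell (d := d) hp hs hc
  obtain ⟨K, hK⟩ := exists_nat_gt (b / (b - b'))
  have hbb : 0 < b - b' := by linarith
  have hK0 : (0:ℝ) < K := lt_of_le_of_lt (by positivity) hK
  have hKb : b / K ≤ b - b' := by
    rw [div_le_iff₀ hK0]; rw [div_lt_iff₀ hbb] at hK; linarith
  obtain ⟨A, hA⟩ : ∃ A, A = C * (c ^ (-(1/2) : ℝ) * 2 ^ (γ/2)) := ⟨_, rfl⟩
  have hA0 : 0 < A := by rw [hA]; positivity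
  refine ⟨(K + 1) * A + D0, by positivity, fun g ε U hε hε1 hU hS hoff hnear => ?_⟩
  obtain ⟨δ, hδ⟩ : ∃ δ, δ = ε ^ (1/γ) := ⟨_, rfl⟩
  have hδ0 : 0 < δ := by rw [hδ]; positivity
  have hδ1 : δ ≤ 1 := by rw [hδ]; exact Real.rpow_le_one hε.le hε1.le (by positivity)
  have hδγ : δ ^ γ = ε := by rw [hδ, ← Real.rpow_mul hε.le]; field_simp; simp
  have hδe : δ ^ (b' - γ/2) = ε ^ (b' / γ - 1/2) := by
    rw [hδ, ← Real.rpow_mul hε.le]; congr 1; field_simp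
  rw [← hδe]
  obtain ⟨M, hM⟩ : ∃ M, M = δ ^ (b' - γ/2) := ⟨_, rfl⟩
  have hM1 : 1 ≤ M := by
    rw [hM]; apply Real.one_le_rpow_of_pos_of_le_one_of_nonpos hδ0 hδ1; linarith
  rw [← hM]
  let T : ℝ → Set (Rd d) := fun l => {ξ : Rd d | ‖ξ‖ ∈ {r : ℝ | |r - 1| ≤ l}}
  have hT : ∀ l, MeasurableSet (T l) := fun l => measurableSet_le (by fun_prop : Measurable fun ξ : Rd d => |‖ξ‖ - 1|) measurable_const
  let lam : ℕ → ℝ := fun i => (1/2) * δ ^ ((i:ℝ) / K)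
  have hlam0 : ∀ i, 0 < lam i := fun i => by positivity
  have hlam1 : ∀ i, lam i ≤ 1/2 := fun i => by
    have : δ ^ ((i:ℝ) / K) ≤ 1 := Real.rpow_le_one hδ0.le hδ1 (by positivity)
    simp only [lam]; linarith
  have hlams : ∀ i, lam (i+1) ≤ lam i := fun i => by
    have : δ ^ (((i+1 : ℕ):ℝ) / K) ≤ δ ^ ((i:ℝ) / K) := by
      apply Real.rpow_le_rpow_of_exponent_ge hδ0 hδ1
      push_cast; gcongr; linarith
    simp only [lam]; linarith
  obtain ⟨Q, hQ⟩ : ∃ Q, Q = QL g U ^ (1/2 : ℝ) := ⟨_, rfl⟩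
  rw [← hQ]
  -- pieces
  have hpc : ∀ i : ℕ, i + 1 ≤ K → eLpNorm (IF ((T (lam i) \ T (lam (i+1))).indicator U)) (ENNReal.ofReal p) volume ≤ ENNReal.ofReal (A * M) * Q := by
    intro i hi
    have hmeas := (hT (lam i)).diff (hT (lam (i+1)))
    have k1 := h ((T (lam i) \ T (lam (i+1))).indicator U) (lam i) (hlam0 i) (hlam1 i) (hU.indicator hmeas)
      (by
        exact symF_shell hS ({r : ℝ | |r - 1| ≤ lam i} \ {r : ℝ | |r - 1| ≤ lam (i+1)})) (by
        intro ξ hξ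
        exact (Set.mem_of_indicator_ne_zero hξ).1)
    have k2 := piece_le (g := g) (U := U) hmeas (a := c * lam (i+1) ^ γ) (by have := hlam0 (i+1); positivity) (by
      intro ξ hξ
      have h1 : |‖ξ‖ - 1| ≤ lam i := hξ.1
      have h2 : lam (i+1) < |‖ξ‖ - 1| := not_le.1 hξ.2
      refine le_trans ?_ (hnear _ (h1.trans (hlam1 i)))
      apply mul_le_mul_of_nonneg_left _ hc.le
      have := Real.rpow_le_rpow (hlam0 (i+1)).le h2.le hγ.le
      linarith)
    refine k1.trans ((mul_le_mul_right k2 _).trans ?_)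
    rw [← hQ, ← mul_assoc, ← ENNReal.ofReal_mul (by have := hlam0 i; positivity)]
    apply mul_le_mul_left
    apply ENNReal.ofReal_le_ofReal
    have k3 := pow_bd (i := (i:ℝ)) hδ0 hδ1 hb hbγ hK0 hKb (Nat.cast_nonneg i) (by exact_mod_cast hi) hc
    rw [hA, hM, mul_assoc, mul_assoc C]
    apply mul_le_mul_of_nonneg_left _ hC.le
    simpa [lam] using k3
  have hlast : eLpNorm (IF ((T (lam K)).indicator U)) (ENNReal.ofReal p) volume ≤ ENNReal.ofReal (A * M) * Q := by
    have k1 := h ((T (lam K)).indicator U) (lam K) (hlam0 K) (hlam1 K) (hU.indicator (hT _))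
      (symF_shell hS ({r : ℝ | |r - 1| ≤ lam K})) (by
        intro ξ hξ
        have : ξ ∈ T (lam K) := Set.mem_of_indicator_ne_zero hξ
        exact this)
    have k2 := piece_le (g := g) (U := U) (hT (lam K)) (a := c * ε) (by positivity) (by
      intro ξ hξ
      have h1 : |‖ξ‖ - 1| ≤ lam K := hξ
      refine le_trans ?_ (hnear _ (h1.trans (hlam1 K)))
      apply mul_le_mul_of_nonneg_left _ hc.le
      have : 0 ≤ |‖ξ‖ - 1| ^ γ := by positivity
      linarith)
    refine k1.trans ((mul_le_mul_right k2 _).trans ?_)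
    rw [← hQ, ← mul_assoc, ← ENNReal.ofReal_mul (by have := hlam0 K; positivity)]
    apply mul_le_mul_left
    apply ENNReal.ofReal_le_ofReal
    have hlK : lam K = 1/2 * δ := by
      simp only [lam]; rw [div_self hK0.ne', Real.rpow_one]
    rw [hA, hM, mul_assoc, mul_assoc C]
    apply mul_le_mul_of_nonneg_left _ hC.le
    rw [hlK, ← hδγ, Real.mul_rpow (by norm_num) hδ0.le, Real.mul_rpow hc.le (by positivity), ← Real.rpow_mul hδ0.le]
    have j1 : (1/2 : ℝ) ^ b ≤ 1 := Real.rpow_le_one (by norm_num) (by norm_num) hb.le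
    have j2 : (1 : ℝ) ≤ 2 ^ (γ/2) := Real.one_le_rpow (by norm_num) (by positivity)
    have j3 : δ ^ b * δ ^ (γ * -(1/2)) ≤ δ ^ (b' - γ/2) := by
      rw [← Real.rpow_add hδ0]
      apply Real.rpow_le_rpow_of_exponent_ge hδ0 hδ1
      linarith
    calc _ = (1/2) ^ b * (c ^ (-(1/2) : ℝ) * 1 * (δ ^ b * δ ^ (γ * -(1/2)))) := by ring
      _ ≤ 1 * (c ^ (-(1/2) : ℝ) * 2 ^ (γ/2) * δ ^ (b' - γ/2)) := by gcongr
      _ = _ := by ring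
  have hind : ∀ N : ℕ, N ≤ K → eLpNorm (IF ((T (lam 0)).indicator U)) (ENNReal.ofReal p) volume ≤
      N * (ENNReal.ofReal (A * M) * Q) + eLpNorm (IF ((T (lam N)).indicator U)) (ENNReal.ofReal p) volume := by
    intro N
    induction N with
    | zero => intro _; simp
    | succ N ih =>
      intro hN
      refine (ih (by omega)).trans ?_
      have hmeas := (hT (lam N)).diff (hT (lam (N+1)))
      have e1 : (T (lam N)).indicator U = (T (lam N) \ T (lam (N+1))).indicator U + (T (lam (N+1))).indicator U := by
        have hsub : T (lam (N+1)) ⊆ T (lam N) := fun ξ hξ => le_trans (show |‖ξ‖ - 1| ≤ lam (N+1) from hξ) (hlams N)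
        have h3 := Set.indicator_union_of_disjoint (f := U) (disjoint_sdiff_self_left : Disjoint (T (lam N) \ T (lam (N+1))) (T (lam (N+1))))
        rw [Set.diff_union_of_subset hsub] at h3
        exact h3
      have e2 := IF_add (hU.indicator hmeas) (hU.indicator (hT (lam (N+1))))
      rw [← e1] at e2
      rw [eLpNorm_congr_ae e2]
      refine (add_le_add le_rfl (eLpNorm_add_le (IF_memLp (hU.indicator hmeas)).1 (IF_memLp (hU.indicator (hT _))).1 hp1)).trans ?_
      rw [← add_assoc]
      apply add_le_add _ le_rfl
      refine (add_le_add le_rfl (hpc N hN)).trans (le_of_eq ?_)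
      push_cast; ring
  have hl0 : T (lam 0) = {ξ : Rd d | |‖ξ‖ - 1| ≤ 1/2} := by
    simp [T, lam]
  have hfin : eLpNorm (IF ((T (lam 0)).indicator U)) (ENNReal.ofReal p) volume ≤ (K + 1) * (ENNReal.ofReal (A * M) * Q) := by
    refine (hind K le_rfl).trans ((add_le_add le_rfl hlast).trans (le_of_eq ?_))
    ring
  have hoff' := h0 g U hU hoff
  rw [← hl0, ← hQ] at hoff'
  have e2 := IF_add (hU.indicator (hT (lam 0))) (hU.indicator (hT (lam 0)).compl)
  rw [Set.indicator_self_add_compl] at e2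
  rw [eLpNorm_congr_ae e2]
  refine (eLpNorm_add_le (IF_memLp (hU.indicator (hT _))).1 (IF_memLp (hU.indicator (hT _).compl)).1 hp1).trans ?_
  refine (add_le_add hfin hoff').trans ?_
  rw [← mul_assoc, ← add_mul]
  apply mul_le_mul_left
  rw [show ((K + 1) * A + D0) * M = (K + 1) * A * M + D0 * M by ring, ENNReal.ofReal_add (by positivity) (by positivity)]
  apply add_le_add
  · rw [mul_assoc, ENNReal.ofReal_mul (by positivity : (0:ℝ) ≤ K + 1)]
    apply le_of_eq; congr 1
    rw [ENNReal.ofReal_add (by positivity) (by positivity)]; simp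
  · apply ENNReal.ofReal_le_ofReal; nlinarith

end Lower2

section Lower3

/-- lower bound property with exponent `b`. -/
def LowerBd (d : ℕ) (G : Set (Rd d ≃ₗᵢ[ℝ] Rd d)) (p s c γ b : ℝ) : Prop :=
    ∃ D : ℝ, 0 < D ∧ ∀ (g : ℝ → ℝ) (ε : ℝ) (U : Rd d → ℂ), 0 < ε → ε < 1 → MemLp U 2 volume → SymF G U →
      (∀ r, 1/2 ≤ |r - 1| → c * (1 + |r| ^ (2*s)) ≤ g r) → (∀ r, |r - 1| ≤ 1/2 → c * (ε + |r - 1| ^ γ) ≤ g r) →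
      eLpNorm (IF U) (ENNReal.ofReal p) volume ≤ ENNReal.ofReal (D * ε ^ (b / γ - 1/2)) * QL g U ^ (1/2 : ℝ)

theorem lower_sig {d : ℕ} {G : Set (Rd d ≃ₗᵢ[ℝ] Rd d)} {p s c γ σ a : ℝ} (hp : 2 < p) (hσ : 0 ≤ σ) (hσq : σ * (p/2 - 1) < 1)
    (hSh : ∀ κ, 0 < κ → ShellBd d G (2 * (1 + (p/2 - 1))) ((p/2 - 1) / (2 * (1 + (p/2 - 1))) * (1 + σ) - κ))
    (ha0 : 0 < a) (ha : a < 1 + σ) (hγ : 1 < γ) (hs : (d : ℝ) * (1/2 - 1/p) < s) (hc : 0 < c) :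
    ∃ b, (1/2 - 1/p) * a < b ∧ LowerBd d G p s c γ b := by
  have hθ : (p/2 - 1) / (2 * (1 + (p/2 - 1))) = 1/2 - 1/p := by
    have hp0 : p ≠ 0 := by linarith
    rw [show 2 * (1 + (p/2 - 1)) = p by ring]; field_simp
  rw [hθ, show 2 * (1 + (p/2 - 1)) = p by ring] at hSh
  have hp1 : 0 < 1/2 - 1/p := by
    rw [sub_pos]; apply one_div_lt_one_div_of_lt <;> linarith
  obtain ⟨θ, hθd⟩ : ∃ θ, θ = 1/2 - 1/p := ⟨_, rfl⟩
  rw [← hθd] at hSh hp1 hs ⊢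
  have hgap : 0 < θ * (1 + σ - a) := by apply mul_pos hp1; linarith
  have hlt : 2 * (θ * (1 + σ)) < 1 := by
    rw [hθd]
    have : (0:ℝ) < p := by linarith
    rw [show 2 * ((1/2 - 1/p) * (1 + σ)) = (p - 2) * (1 + σ) / p by field_simp, div_lt_one this]
    nlinarith
  refine ⟨θ * (1 + σ) - θ * (1 + σ - a) / 2, by nlinarith, ?_⟩
  have h := hSh (θ * (1 + σ - a) / 4) (by positivity)
  have h1 : 0 < θ * a := by positivity
  exact lower_abs h (by nlinarith) (by nlinarith) (by nlinarith) hp (by rw [← hθd]; exact hs) hc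

theorem exps {d k : ℕ} (hd : 2 ≤ d) (hk1 : 1 ≤ k) (hk2 : k ≤ d / 2) {p : ℝ} (hp : 2 < p) (hpk : p < twoStarK d k) :
    (((d:ℝ) + k) / 2 - 1) * (p/2 - 1) < 1 ∧ (1/2 - 1/p) * (d + k) < 1 := by
  have hmin : min k (d - k) = k := by omega
  have hdR : (2:ℝ) ≤ d := by exact_mod_cast hd
  have hkR : (1:ℝ) ≤ k := by exact_mod_cast hk1
  unfold twoStarK at hpk
  rw [hmin, lt_div_iff₀ (by linarith)] at hpk
  constructor
  · nlinarith
  · have : (0:ℝ) < p := by linarith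
    rw [show (1/2 - 1/p) * ((d:ℝ) + k) = (p - 2) * (d + k) / (2 * p) by field_simp, div_lt_one (by positivity)]
    nlinarith

theorem sob_ok {d k : ℕ} (hd : 2 ≤ d) (hk1 : 1 ≤ k) (hk2 : k ≤ d / 2) {p s : ℝ} (hp : 2 < p) (hpk : p < twoStarK d k)
    (hs : (d : ℝ) / ((d : ℝ) + 1) < s) : (d : ℝ) * (1/2 - 1/p) < s := by
  have hdR : (2:ℝ) ≤ d := by exact_mod_cast hd
  have hkR : (1:ℝ) ≤ k := by exact_mod_cast hk1
  refine lt_of_le_of_lt ?_ hs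
  rw [le_div_iff₀ (by linarith)]
  have h2 := (exps hd hk1 hk2 hp hpk).2
  have hp1 : 0 < 1/2 - 1/p := by
    rw [sub_pos]; apply one_div_lt_one_div_of_lt <;> linarith
  have h3 : (1/2 - 1/p) * ((d:ℝ) + 1) ≤ 1 := by nlinarith
  nlinarith

theorem lower_G {d k j m : ℕ} (hd : 2 ≤ d) (hk1 : 1 ≤ k) (hk2 : k ≤ d / 2) {p s c γ : ℝ} (hp : 2 < p) (hpk : p < twoStarK d k)
    (hs : (d : ℝ) / ((d : ℝ) + 1) < s) (hγ : 1 < γ) (hc : 0 < c) (hj : 1 ≤ j) (hjk : j ≤ k) (hjm : j < m) (hm : m ≤ d / 2) :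
    ∃ b, (1/2 - 1/p) * (((d:ℝ) + j) / 2) < b ∧ LowerBd d (Gm d m) p s c γ b := by
  have hdR : (2:ℝ) ≤ d := by exact_mod_cast hd
  have hjR : (1:ℝ) ≤ j := by exact_mod_cast hj
  have hjkR : (j:ℝ) ≤ k := by exact_mod_cast hjk
  have hjmR : (j:ℝ) < m := by exact_mod_cast hjm
  have h1 := (exps hd hk1 hk2 hp hpk).1
  have hq : 0 < p/2 - 1 := by linarith
  have h2 : ((d:ℝ) + j) / 2 - 1 < min (((d:ℝ) + m) / 2 - 1) (1 / (p/2 - 1)) := by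
    apply lt_min
    · linarith
    · rw [lt_div_iff₀ hq]; nlinarith
  obtain ⟨σ, hσ1, hσ2⟩ := exists_between h2
  have hσ3 := hσ2.trans_le (min_le_left _ _)
  have hσ4 := hσ2.trans_le (min_le_right _ _)
  rw [lt_div_iff₀ hq] at hσ4
  exact lower_sig hp (σ := σ) (by linarith) hσ4 (fun κ hκ => shell_G (by omega) hm (by linarith) hσ3.le hq hσ4 hκ)
    (by positivity) (by linarith) hγ (sob_ok hd hk1 hk2 hp hpk hs) hc

theorem lower_rad {d k : ℕ} (hd : 2 ≤ d) (hk1 : 1 ≤ k) (hk2 : k ≤ d / 2) {p s c γ : ℝ} (hp : 2 < p) (hpk : p < twoStarK d k)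
    (hs : (d : ℝ) / ((d : ℝ) + 1) < s) (hγ : 1 < γ) (hc : 0 < c) :
    ∃ b, (1/2 - 1/p) * (((d:ℝ) + k) / 2) < b ∧ LowerBd d (Gm d 0) p s c γ b := by
  have hdR : (2:ℝ) ≤ d := by exact_mod_cast hd
  have hkR : (1:ℝ) ≤ k := by exact_mod_cast hk1
  have hkd : 2 * (k:ℝ) ≤ d := by exact_mod_cast (by omega : 2 * k ≤ d)
  have h1 := (exps hd hk1 hk2 hp hpk).1
  have hq : 0 < p/2 - 1 := by linarith
  have h2 : ((d:ℝ) + k) / 2 - 1 < min ((d:ℝ) - 1) (1 / (p/2 - 1)) := by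
    apply lt_min
    · linarith
    · rw [lt_div_iff₀ hq]; nlinarith
  obtain ⟨σ, hσ1, hσ2⟩ := exists_between h2
  have hσ3 := hσ2.trans_le (min_le_left _ _)
  have hσ4 := hσ2.trans_le (min_le_right _ _)
  rw [lt_div_iff₀ hq] at hσ4
  exact lower_sig hp (σ := σ) (by linarith) hσ4 (fun κ hκ => shell_rad hd (by linarith) hσ3.le hq hσ4 hκ)
    (by positivity) (by linarith) hγ (sob_ok hd hk1 hk2 hp hpk hs) hc

end Lower3

section Gauss
variable {E : Type*} [NormedAddCommGroup E] [InnerProductSpace ℝ E] [FiniteDimensional ℝ E]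
  [MeasurableSpace E] [BorelSpace E]

theorem gauss1 {b : ℝ} (hb : 0 < b) (w : E) :
    ∫ v : E, ch ⟪w, v⟫ * ((Real.exp (-(π * b) * ‖v‖ ^ 2) : ℝ) : ℂ) =
      ((b ^ (-((Module.finrank ℝ E : ℝ) / 2)) * Real.exp (-π * ‖w‖ ^ 2 / b) : ℝ) : ℂ) := by
  have h := GaussianFourier.integral_cexp_neg_mul_sq_norm_add (V := E) (b := ((π * b : ℝ) : ℂ))
    (by simpa using mul_pos pi_pos hb) (2 * π * Complex.I) w
  have e1 : ∀ v : E, ch ⟪w, v⟫ * ((Real.exp (-(π * b) * ‖v‖ ^ 2) : ℝ) : ℂ) =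
      Complex.exp (-((π * b : ℝ) : ℂ) * ‖v‖ ^ 2 + 2 * π * Complex.I * ⟪w, v⟫) := by
    intro v
    unfold ch
    rw [Complex.ofReal_exp, ← Complex.exp_add]
    congr 1
    push_cast
    ring
  simp_rw [e1]
  rw [h]
  have hpi : (π : ℂ) ≠ 0 := by exact_mod_cast pi_ne_zero
  have hb' : (b : ℂ) ≠ 0 := by exact_mod_cast hb.ne'
  rw [Complex.ofReal_mul (b ^ (-((Module.finrank ℝ E : ℝ) / 2))), Complex.ofReal_exp, Real.rpow_neg hb.le, ← Real.inv_rpow hb.le,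
    Complex.ofReal_cpow (by positivity)]
  congr 1
  · push_cast
    rw [show (π : ℂ) / (π * b) = (b : ℂ)⁻¹ by field_simp]
  · congr 1
    push_cast
    rw [show (2 * π * Complex.I : ℂ) ^ 2 = - (4 * π ^ 2) by rw [mul_pow, Complex.I_sq]; ring]
    field_simp

theorem gauss_integrable {b : ℝ} (hb : 0 < b) :
    Integrable (fun v : E => Real.exp (-(π * b) * ‖v‖ ^ 2)) volume := by
  have h := GaussianFourier.integrable_cexp_neg_mul_sq_norm_add (V := E) (b := ((π * b : ℝ) : ℂ))
    (by simpa using mul_pos pi_pos hb) 0 0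
  refine h.norm.congr (Eventually.of_forall fun v => ?_)
  simp only [Complex.norm_exp]
  congr 1
  rw [zero_mul, add_zero, show -((π * b : ℝ) : ℂ) * (‖v‖ : ℂ) ^ 2 = ((-(π * b) * ‖v‖ ^ 2 : ℝ) : ℂ) by push_cast; ring]
  rw [Complex.ofReal_re]

theorem gauss_integral {b : ℝ} (hb : 0 < b) :
    ∫ v : E, Real.exp (-(π * b) * ‖v‖ ^ 2) = b ^ (-((Module.finrank ℝ E : ℝ) / 2)) := by
  have h := gauss1 (E := E) hb 0
  simp only [inner_zero_left, norm_zero] at h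
  have : ch 0 = 1 := by simp [ch]
  rw [this] at h
  simp only [one_mul] at h
  rw [integral_complex_ofReal] at h
  have h2 := Complex.ofReal_injective h
  simpa using h2

theorem fourierInv_ind {S : Set E} (hS : MeasurableSet S) (x : E) :
    𝓕⁻ (S.indicator (fun _ => (1 : ℂ))) x = ∫ ξ in S, ch ⟪ξ, x⟫ := by
  rw [fourierInv_ch, ← integral_indicator hS]
  congr 1
  ext ξ
  by_cases h : ξ ∈ S <;> simp [h]

theorem ch_neg_conj (t : ℝ) : ch (-t) = (starRingEnd ℂ) (ch t) := by
  unfold ch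
  rw [← Complex.exp_conj, map_mul, Complex.conj_I, Complex.conj_ofReal]
  congr 1
  push_cast
  ring

theorem gram {S : Set E} (hS : MeasurableSet S) (hfin : volume S ≠ ∞) {h : E → ℝ} (hi : Integrable h volume)
    {K : E → ℝ} (hK : ∀ ζ, ∫ x, ch ⟪ζ, x⟫ * (h x : ℂ) = (K ζ : ℂ)) :
    ∫ x, ‖𝓕⁻ (S.indicator (fun _ => (1 : ℂ))) x‖ ^ 2 * h x =
      ∫ p in S ×ˢ S, K (p.1 - p.2) := by
  have hfm : IsFiniteMeasure (volume.restrict S) := ⟨by simpa using hfin.lt_top⟩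
  apply Complex.ofReal_injective
  rw [← integral_complex_ofReal, ← integral_complex_ofReal]
  have e1 : ∀ x : E, ((‖𝓕⁻ (S.indicator (fun _ => (1 : ℂ))) x‖ ^ 2 * h x : ℝ) : ℂ) =
      ∫ p, ch ⟪p.1 - p.2, x⟫ * (h x : ℂ) ∂((volume.restrict S).prod (volume.restrict S)) := by
    intro x
    rw [integral_mul_const]
    push_cast
    congr 1
    rw [← Complex.mul_conj', fourierInv_ind hS, ← integral_conj, ← integral_prod_mul]
    congr 1
    ext p
    rw [inner_sub_left, sub_eq_add_neg, ch_add, ch_neg_conj]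
  simp_rw [e1]
  rw [integral_integral_swap]
  · rw [Measure.volume_eq_prod, ← Measure.prod_restrict]
    congr 1
    ext p
    rw [hK]
  · have h1 : Integrable (fun z : E × (E × E) => (h z.1 : ℂ) * 1) (volume.prod ((volume.restrict S).prod (volume.restrict S))) :=
      (hi.ofReal (𝕜 := ℂ)).mul_prod (integrable_const (1 : ℂ))
    refine (h1.bdd_mul (c := 1) (f := fun z : E × (E × E) => ch ⟪z.2.1 - z.2.2, z.1⟫) ?_ ?_).congr ?_
    · have : Continuous fun z : E × (E × E) => ch ⟪z.2.1 - z.2.2, z.1⟫ := ch_cont.comp (by fun_prop)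
      exact this.aestronglyMeasurable
    · exact Eventually.of_forall fun z => (ch_norm _).le
    · exact Eventually.of_forall fun z => by simp [Function.uncurry]

theorem gram_lower {S S0 T : Set E} (hS : MeasurableSet S) (hfin : volume S ≠ ∞) {h : E → ℝ}
    (hS0 : MeasurableSet S0) (hT : MeasurableSet T) (h0 : ∀ x, 0 ≤ h x)
    (hi : Integrable h volume)
    {K : E → ℝ} (hKc : Continuous K) (hK0 : ∀ ζ, 0 ≤ K ζ)
    (hK : ∀ ζ, ∫ x, ch ⟪ζ, x⟫ * (h x : ℂ) = (K ζ : ℂ))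
    {κ : ℝ} (hκ : ∀ ζ ∈ T, κ ≤ K ζ) (hsub : ∀ ξ ∈ S0, ∀ ζ ∈ T, ξ - ζ ∈ S) (hsub' : S0 ⊆ S) :
    ENNReal.ofReal κ * volume S0 * volume T ≤
      ∫⁻ x, ‖𝓕⁻ (S.indicator (fun _ => (1 : ℂ))) x‖ₑ ^ 2 * ENNReal.ofReal (h x) := by
  have hfm : IsFiniteMeasure (volume.restrict S) := ⟨by simpa using hfin.lt_top⟩
  have hu2 : MemLp (S.indicator (fun _ => (1 : ℂ))) 2 volume := memLp_indicator_const 2 hS 1 (Or.inr hfin)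
  have hu1 : Integrable (S.indicator (fun _ => (1 : ℂ))) volume := (integrable_indicator_iff hS).2 (integrableOn_const hfin)
  have g := gram hS hfin hi hK
  have hKb : ∀ ζ, K ζ ≤ ∫ x, h x := by
    intro ζ
    have : ‖(K ζ : ℂ)‖ ≤ ∫ x, h x := by
      rw [← hK]
      refine (norm_integral_le_integral_norm _).trans (le_of_eq ?_)
      congr 1
      ext x
      rw [norm_mul, ch_norm, one_mul, Complex.norm_real, Real.norm_of_nonneg (h0 x)]
    rw [Complex.norm_real, Real.norm_of_nonneg (hK0 ζ)] at this
    exact this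
  have hKi : Integrable (fun p : E × E => K (p.1 - p.2)) ((volume.restrict S).prod (volume.restrict S)) := by
    refine Integrable.of_bound (C := ∫ x, h x) (hKc.comp (by fun_prop)).aestronglyMeasurable (Eventually.of_forall fun p => ?_)
    rw [Real.norm_of_nonneg (hK0 _)]
    exact hKb _
  have hcu := fourierInv_continuous hu1
  have hhi : Integrable (fun x => ‖𝓕⁻ (S.indicator (fun _ => (1 : ℂ))) x‖ ^ 2 * h x) volume := by
    refine hi.bdd_mul (c := (volume S).toReal ^ 2) (by fun_prop) (Eventually.of_forall fun x => ?_)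
    rw [norm_pow, norm_norm]
    gcongr
    rw [fourierInv_ind hS]
    refine (norm_integral_le_integral_norm _).trans (le_of_eq ?_)
    simp [ch_norm, Measure.real]
  have e1 : ∫⁻ x, ‖𝓕⁻ (S.indicator (fun _ => (1 : ℂ))) x‖ₑ ^ 2 * ENNReal.ofReal (h x) =
      ENNReal.ofReal (∫ x, ‖𝓕⁻ (S.indicator (fun _ => (1 : ℂ))) x‖ ^ 2 * h x) := by
    rw [ofReal_integral_eq_lintegral_ofReal hhi (Eventually.of_forall fun x => mul_nonneg (by positivity) (h0 x))]
    congr 1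
    ext x
    rw [ENNReal.ofReal_mul (by positivity), ENNReal.ofReal_pow (norm_nonneg _), ofReal_norm]
  rw [e1, g, Measure.volume_eq_prod, ← Measure.prod_restrict, ofReal_integral_eq_lintegral_ofReal hKi (Eventually.of_forall fun x => hK0 _)]
  have hmeas : Measurable fun p : E × E => ENNReal.ofReal (K (p.1 - p.2)) := by
    have : Continuous fun p : E × E => K (p.1 - p.2) := hKc.comp (by fun_prop)
    exact this.measurable.ennreal_ofReal
  rw [lintegral_prod _ hmeas.aemeasurable]
  calc ENNReal.ofReal κ * volume S0 * volume T = ∫⁻ _ in S0, ENNReal.ofReal κ * volume T := by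
        rw [setLIntegral_const]; ring
    _ ≤ ∫⁻ ξ in S0, ∫⁻ η in S, ENNReal.ofReal (K (ξ - η)) := by
        refine setLIntegral_mono' hS0 fun ξ hξ => ?_
        have hpre : volume ((fun η => ξ - η) ⁻¹' T) = volume T :=
          (Measure.measurePreserving_sub_left volume ξ).measure_preimage hT.nullMeasurableSet
        rw [← hpre, ← setLIntegral_const]
        calc _ ≤ ∫⁻ η in ((fun η => ξ - η) ⁻¹' T), ENNReal.ofReal (K (ξ - η)) := by
              refine setLIntegral_mono' ((by fun_prop : Measurable fun η : E => ξ - η) hT) fun η hη => ?_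
              exact ENNReal.ofReal_le_ofReal (hκ _ hη)
          _ ≤ _ := by
              refine lintegral_mono_set fun η hη => ?_
              have := hsub ξ hξ _ hη
              simpa using this
    _ ≤ _ := lintegral_mono_set hsub'

end Gauss

theorem annulus_vol {E : Type*} [NormedAddCommGroup E] [InnerProductSpace ℝ E] [FiniteDimensional ℝ E]
    [MeasurableSpace E] [BorelSpace E] {r : ℝ} (h0 : 0 < r) (h1 : r < 1) :
    volume {z : E | |‖z‖ - 1| ≤ r} =
      ENNReal.ofReal ((1 + r) ^ Module.finrank ℝ E - (1 - r) ^ Module.finrank ℝ E) * volume (Metric.ball (0 : E) 1) := by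
  have e : {z : E | |‖z‖ - 1| ≤ r} = Metric.closedBall 0 (1 + r) \ Metric.ball 0 (1 - r) := by
    ext z
    simp only [Set.mem_ofPred_eq, Set.mem_sdiff, Metric.mem_closedBall, Metric.mem_ball, dist_zero_right, abs_le]
    constructor
    · intro h; constructor <;> linarith
    · intro h; constructor <;> linarith
  rw [e, measure_sdiff _ measurableSet_ball.nullMeasurableSet measure_ball_lt_top.ne,
    Measure.addHaar_closedBall _ _ (by linarith), Measure.addHaar_ball_of_pos _ (0 : E) (by linarith : 0 < 1 - r),
    ENNReal.ofReal_sub _ (by have : 0 ≤ 1 - r := by linarith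
                             positivity), ENNReal.sub_mul]
  · intro _ _; exact measure_ball_lt_top.ne
  · intro z hz
    simp only [Metric.mem_closedBall, Metric.mem_ball, dist_zero_right] at *
    linarith

theorem pow_diff_lower (j : ℕ) (hj : 1 ≤ j) {r : ℝ} (h0 : 0 < r) (h1 : r < 1) :
    2 * r ≤ (1 + r) ^ j - (1 - r) ^ j := by
  obtain ⟨m, rfl⟩ : ∃ m, j = m + 1 := ⟨j - 1, by omega⟩
  have a1 : 1 + r ≤ (1 + r) ^ (m + 1) := le_self_pow₀ (by linarith) (by omega)
  have a2 : (1 - r) ^ (m + 1) ≤ 1 - r := by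
    rw [pow_succ]
    have := pow_le_one₀ (n := m) (by linarith : 0 ≤ 1 - r) (by linarith)
    nlinarith
  linarith

theorem pow_diff_upper (j : ℕ) {r : ℝ} (h0 : 0 < r) (h1 : r < 1) :
    (1 + r) ^ j - (1 - r) ^ j ≤ 2 * r * (j * 2 ^ j) := by
  induction j with
  | zero => simp
  | succ j ih =>
    have a1 : (1 - r) ^ j ≤ 1 := pow_le_one₀ (by linarith) (by linarith)
    have a2 : (1:ℝ) ≤ 2 ^ j := one_le_pow₀ (by norm_num)
    have a3 : (1 + r) ^ j ≤ 2 ^ j := pow_le_pow_left₀ (by linarith) (by linarith) _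
    have a5 : 0 ≤ (1 - r) ^ j := pow_nonneg (by linarith) _
    have e : (1 + r) ^ (j + 1) - (1 - r) ^ (j + 1) = ((1 + r) ^ j - (1 - r) ^ j) + r * ((1 + r) ^ j + (1 - r) ^ j) := by ring
    rw [e]
    push_cast
    rw [pow_succ]
    have a4 : 0 ≤ (j : ℝ) := by positivity
    have : 0 ≤ r * j * 2 ^ j := by positivity
    nlinarith [mul_le_mul_of_nonneg_left (by linarith : (1 + r) ^ j + (1 - r) ^ j ≤ 2 * 2 ^ j) h0.le, mul_pos h0 (by linarith : (0:ℝ) < 2 ^ j)]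

theorem pm_spl (d m : ℕ) : MeasurePreserving (fun p : F1 d m × F2 d m => (spl d m).symm (WithLp.toLp 2 p)) volume volume :=
  (spl d m).symm.measurePreserving.comp (WithLp.volume_preserving_toLp _ _)

theorem emb_spl (d m : ℕ) : MeasurableEmbedding (fun p : F1 d m × F2 d m => (spl d m).symm (WithLp.toLp 2 p)) :=
  ((spl d m).symm.toHomeomorph.measurableEmbedding).comp (MeasurableEquiv.toLp 2 (F1 d m × F2 d m)).measurableEmbedding

theorem cont_fst (d m : ℕ) : Continuous fun x : Rd d => (spl d m x).fst := by
  have := (spl d m).continuous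
  fun_prop

theorem cont_snd (d m : ℕ) : Continuous fun x : Rd d => (spl d m x).snd := by
  have := (spl d m).continuous
  fun_prop

theorem prodvol (d m : ℕ) {A : Set (F1 d m)} {B : Set (F2 d m)} (hA : MeasurableSet A) (hB : MeasurableSet B) :
    volume {x : Rd d | (spl d m x).fst ∈ A ∧ (spl d m x).snd ∈ B} = volume A * volume B := by
  rw [← (pm_spl d m).measure_preimage_emb (emb_spl d m)]
  have : (fun p : F1 d m × F2 d m => (spl d m).symm (WithLp.toLp 2 p)) ⁻¹' {x : Rd d | (spl d m x).fst ∈ A ∧ (spl d m x).snd ∈ B} = A ×ˢ B := by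
    ext p
    simp
  rw [this, Measure.volume_eq_prod, Measure.prod_prod]

/-- anisotropic Gaussian -/
def gh (d m : ℕ) (a b : ℝ) (x : Rd d) : ℝ :=
  Real.exp (-(π * a) * ‖(spl d m x).fst‖ ^ 2) * Real.exp (-(π * b) * ‖(spl d m x).snd‖ ^ 2)

theorem gh_integrable (d m : ℕ) {a b : ℝ} (ha : 0 < a) (hb : 0 < b) : Integrable (gh d m a b) volume := by
  rw [← (pm_spl d m).integrable_comp_emb (emb_spl d m)]
  have := (gauss_integrable (E := F1 d m) ha).mul_prod (gauss_integrable (E := F2 d m) hb)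
  refine this.congr (Eventually.of_forall fun p => ?_)
  simp [gh]

theorem gh_integral {d m : ℕ} (hm : m ≤ d) {a b : ℝ} (ha : 0 < a) (hb : 0 < b) :
    ∫ x, gh d m a b x = a ^ (-(((d : ℝ) - m) / 2)) * b ^ (-((m : ℝ) / 2)) := by
  rw [← (pm_spl d m).integral_comp (emb_spl d m)]
  have := integral_prod_mul (μ := volume) (ν := volume) (fun v : F1 d m => Real.exp (-(π * a) * ‖v‖ ^ 2)) (fun v : F2 d m => Real.exp (-(π * b) * ‖v‖ ^ 2))
  rw [gauss_integral ha, gauss_integral hb, finrank_F1, finrank_F2 hm] at this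
  rw [Nat.cast_sub hm] at this
  rw [← this]
  simp [gh, Measure.volume_eq_prod]

theorem gh_fourier {d m : ℕ} (hm : m ≤ d) {a b : ℝ} (ha : 0 < a) (hb : 0 < b) (ζ : Rd d) :
    ∫ x, ch ⟪ζ, x⟫ * (gh d m a b x : ℂ) =
     ((a ^ (-(((d : ℝ) - m) / 2)) * Real.exp (-π * ‖(spl d m ζ).fst‖ ^ 2 / a)
      * (b ^ (-((m : ℝ) / 2)) * Real.exp (-π * ‖(spl d m ζ).snd‖ ^ 2 / b)) : ℝ) : ℂ) := by
  rw [← (pm_spl d m).integral_comp (emb_spl d m)]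
  have := integral_prod_mul (μ := volume) (ν := volume) (fun v : F1 d m => ch ⟪(spl d m ζ).fst, v⟫ * ((Real.exp (-(π * a) * ‖v‖ ^ 2) : ℝ) : ℂ))
    (fun v : F2 d m => ch ⟪(spl d m ζ).snd, v⟫ * ((Real.exp (-(π * b) * ‖v‖ ^ 2) : ℝ) : ℂ))
  rw [gauss1 ha, gauss1 hb, finrank_F1, finrank_F2 hm, Nat.cast_sub hm] at this
  rw [Complex.ofReal_mul, ← this, Measure.volume_eq_prod]
  congr 1
  ext p
  have e1 : ⟪ζ, (spl d m).symm (WithLp.toLp 2 p)⟫ = ⟪(spl d m ζ).fst, p.1⟫ + ⟪(spl d m ζ).snd, p.2⟫ := by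
    rw [← (spl d m).inner_map_map, LinearIsometryEquiv.apply_symm_apply, WithLp.prod_inner_apply]
    rfl
  rw [e1, ch_add]
  simp only [gh, LinearIsometryEquiv.apply_symm_apply]
  rw [show (WithLp.toLp 2 p).fst = p.1 from rfl, show (WithLp.toLp 2 p).snd = p.2 from rfl]
  push_cast
  ring

theorem holder_gh {X : Type*} [MeasurableSpace X] {μ : Measure X} {u : X → ℂ} (hu : AEStronglyMeasurable u μ) {h : X → ℝ≥0∞} (hh : AEMeasurable h μ)
    {p : ℝ} (hp : 2 < p) :
    ∫⁻ x, ‖u x‖ₑ ^ 2 * h x ∂μ ≤ eLpNorm u (ENNReal.ofReal p) μ ^ 2 *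
      (∫⁻ x, h x ^ (p / (p - 2)) ∂μ) ^ (1 - 2 / p) := by
  have hc : Real.HolderConjugate (p / 2) (p / (p - 2)) := by
    rw [Real.holderConjugate_iff]
    have : p - 2 ≠ 0 := by linarith
    refine ⟨by linarith, by field_simp; ring⟩
  have h1 := ENNReal.lintegral_mul_le_Lp_mul_Lq μ hc (f := fun x => ‖u x‖ₑ ^ 2) (g := h) (hu.enorm.pow_const 2) hh
  refine h1.trans (le_of_eq ?_)
  rw [eLpNorm_eq_lintegral_rpow_enorm_toReal (by simp; linarith) (by simp), ENNReal.toReal_ofReal (by linarith),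
    ← ENNReal.rpow_natCast, ← ENNReal.rpow_mul]
  congr 1
  · have : ∀ x, (‖u x‖ₑ ^ 2) ^ (p / 2) = ‖u x‖ₑ ^ p := by
      intro x
      rw [← ENNReal.rpow_natCast, ← ENNReal.rpow_mul]; congr 1; push_cast; ring
    simp_rw [this]
    congr 1
    push_cast; field_simp
  · congr 1
    have : p - 2 ≠ 0 := by linarith
    field_simp

theorem gh_rpow (d m : ℕ) (a b q : ℝ) (x : Rd d) : gh d m a b x ^ q = gh d m (q * a) (q * b) x := by
  unfold gh
  rw [← Real.exp_add, ← Real.exp_mul, ← Real.exp_add]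
  congr 1
  ring

theorem gh_pos (d m : ℕ) (a b : ℝ) (x : Rd d) : 0 < gh d m a b x := by unfold gh; positivity

theorem gh_cont (d m : ℕ) (a b : ℝ) : Continuous (gh d m a b) := by
  unfold gh
  have := cont_fst d m
  have := cont_snd d m
  fun_prop

/-- the anisotropic sets -/
def capS (d j : ℕ) (t r : ℝ) : Set (Rd d) := {x | (spl d j x).fst ∈ Metric.closedBall 0 t ∧ (spl d j x).snd ∈ {z | |‖z‖ - 1| ≤ r}}

theorem ann_meas {E : Type*} [NormedAddCommGroup E] [MeasurableSpace E] [BorelSpace E] (r : ℝ) :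
    MeasurableSet {z : E | |‖z‖ - 1| ≤ r} :=
  (isClosed_le (by fun_prop) (by fun_prop)).measurableSet

theorem capS_meas (d j : ℕ) (t r : ℝ) : MeasurableSet (capS d j t r) :=
  ((cont_fst d j).measurable measurableSet_closedBall).inter ((cont_snd d j).measurable (ann_meas r))

theorem capS_vol {d j : ℕ} (hj : j ≤ d) {t r : ℝ} (ht : 0 ≤ t) (h0 : 0 < r) (h1 : r < 1) :
    volume (capS d j t r) = ENNReal.ofReal (t ^ (d - j) * ((1 + r) ^ j - (1 - r) ^ j)) *
      (volume (Metric.ball (0 : F1 d j) 1) * volume (Metric.ball (0 : F2 d j) 1)) := by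
  unfold capS
  rw [prodvol d j measurableSet_closedBall (ann_meas r), annulus_vol h0 h1, Measure.addHaar_closedBall _ _ ht,
    finrank_F1, finrank_F2 hj, ENNReal.ofReal_mul (by positivity)]
  ring

theorem cap_ratio {d j : ℕ} (hj1 : 1 ≤ j) {t r : ℝ} (ht : 0 ≤ t) (h0 : 0 < r) (h1 : r < 1 / 2) :
    (2 * t) ^ (d - j) * ((1 + 2 * r) ^ j - (1 - 2 * r) ^ j) ≤ (2 ^ (d - j) * (2 * (j * 2 ^ j))) * (t ^ (d - j) * ((1 + r) ^ j - (1 - r) ^ j)) := by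
  have a1 := pow_diff_lower j hj1 h0 (by linarith)
  have a2 := pow_diff_upper j (r := 2 * r) (by linarith) (by linarith)
  rw [mul_pow]
  have a3 : (0:ℝ) ≤ j * 2 ^ j := by positivity
  calc 2 ^ (d - j) * t ^ (d - j) * ((1 + 2 * r) ^ j - (1 - 2 * r) ^ j)
      ≤ 2 ^ (d - j) * t ^ (d - j) * (2 * (j * 2 ^ j) * ((1 + r) ^ j - (1 - r) ^ j)) := by
        apply mul_le_mul_of_nonneg_left _ (by positivity)
        nlinarith
    _ = _ := by ring

theorem upper_test {d j : ℕ} (hj1 : 1 ≤ j) (hj : j ≤ d) {p : ℝ} (hp : 2 < p) :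
    ∃ D : ℝ, 0 < D ∧ ∀ δ : ℝ, 0 < δ → δ ≤ 1 / 24 → ∃ S : Set (Rd d), MeasurableSet S ∧ volume S ≠ ∞ ∧ volume S ≠ 0 ∧
      (∀ g ∈ Gm d j, ∀ x, g x ∈ S ↔ x ∈ S) ∧ (∀ ξ ∈ S, |‖ξ‖ - 1| ≤ 12 * δ) ∧
      volume S ≤ ENNReal.ofReal (D * δ ^ (-((d + j) * (1 / 2 - 1 / p)))) *
        eLpNorm (𝓕⁻ (S.indicator (fun _ => (1 : ℂ)))) (ENNReal.ofReal p) volume ^ 2 := by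
  obtain ⟨ω, hω⟩ : ∃ ω : ℝ≥0∞, ω = volume (Metric.ball (0 : F1 d j) 1) * volume (Metric.ball (0 : F2 d j) 1) := ⟨_, rfl⟩
  have hω0 : ω ≠ 0 := by
    rw [hω]; exact mul_ne_zero (Metric.measure_ball_pos _ _ one_pos).ne' (Metric.measure_ball_pos _ _ one_pos).ne'
  have hωt : ω ≠ ∞ := by
    rw [hω]; exact ENNReal.mul_ne_top measure_ball_lt_top.ne measure_ball_lt_top.ne
  obtain ⟨w, hw⟩ : ∃ w : ℝ, w = ω.toReal := ⟨_, rfl⟩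
  have hw0 : 0 < w := by rw [hw]; exact ENNReal.toReal_pos hω0 hωt
  have hωw : ω = ENNReal.ofReal w := by rw [hw, ENNReal.ofReal_toReal hωt]
  obtain ⟨q, hq⟩ : ∃ q : ℝ, q = p / (p - 2) := ⟨_, rfl⟩
  have hq0 : 0 < q := by rw [hq]; apply div_pos <;> linarith
  obtain ⟨A, hA⟩ : ∃ A : ℝ, A = (2 ^ (d - j) * (2 * (j * 2 ^ j)) : ℝ) := ⟨_, rfl⟩
  have hj0 : (0:ℝ) < j := by exact_mod_cast hj1
  have hA0 : 0 < A := by rw [hA]; positivity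
  obtain ⟨Q, hQ⟩ : ∃ Q : ℝ, Q = (q ^ (-(((d : ℝ) - j) / 2)) * q ^ (-((j : ℝ) / 2))) ^ (1 - 2 / p) := ⟨_, rfl⟩
  have hQ0 : 0 < Q := by rw [hQ]; positivity
  refine ⟨A * (w * Real.exp (-(2 * π)))⁻¹ * Q, by positivity, fun δ h0 h1 => ?_⟩
  obtain ⟨τ, hτ⟩ : ∃ τ : ℝ, τ = √δ := ⟨_, rfl⟩
  have hτ0 : 0 < τ := by rw [hτ]; exact Real.sqrt_pos.2 h0
  have hτ2 : τ ^ 2 = δ := by rw [hτ]; exact Real.sq_sqrt h0.le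
  have hV := capS_vol hj (t := 2 * τ) (r := 2 * δ) (by linarith) (by linarith) (by linarith)
  have hV0 := capS_vol hj (t := τ) (r := δ) hτ0.le (by linarith) (by linarith)
  rw [← hω, hωw] at hV hV0
  have hpos : 0 < τ ^ (d - j) * ((1 + δ) ^ j - (1 - δ) ^ j) := by
    have := pow_diff_lower j hj1 h0 (by linarith)
    have : 0 < (1 + δ) ^ j - (1 - δ) ^ j := by linarith
    positivity
  have hpos2 : 0 < (2 * τ) ^ (d - j) * ((1 + 2 * δ) ^ j - (1 - 2 * δ) ^ j) := by
    have := pow_diff_lower j hj1 (by linarith : 0 < 2 * δ) (by linarith)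
    have : 0 < (1 + 2 * δ) ^ j - (1 - 2 * δ) ^ j := by linarith
    positivity
  have hfin : volume (capS d j (2 * τ) (2 * δ)) ≠ ∞ := by rw [hV]; exact ENNReal.mul_ne_top ENNReal.ofReal_ne_top ENNReal.ofReal_ne_top
  refine ⟨capS d j (2 * τ) (2 * δ), capS_meas _ _ _ _, hfin, ?_, ?_, ?_, ?_⟩
  · rw [hV]
    exact mul_ne_zero (by simpa using hpos2) (by simpa using hw0)
  · intro g hg x
    have e1 : ‖(spl d j (g x)).fst‖ = ‖(spl d j x).fst‖ := by
      rw [← sq_eq_sq₀ (norm_nonneg _) (norm_nonneg _), spl_fst_sq, spl_fst_sq, hg]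
    have e2 : ‖(spl d j (g x)).snd‖ = ‖(spl d j x).snd‖ := by
      rw [← sq_eq_sq₀ (norm_nonneg _) (norm_nonneg _)]
      have a1 := spl_snd_sq d j (g x)
      have a2 := spl_snd_sq d j x
      rw [LinearIsometryEquiv.norm_map, e1] at a1
      linarith
    simp only [capS, Set.mem_ofPred_eq, mem_closedBall_zero_iff, e1, e2]
  · intro ξ hξ
    simp only [capS, Set.mem_ofPred_eq, mem_closedBall_zero_iff] at hξ
    obtain ⟨b1, b2⟩ := hξ
    rw [abs_le] at b2
    have a2 := spl_snd_sq d j ξ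
    have b3 : ‖(spl d j ξ).fst‖ ^ 2 ≤ (2 * τ) ^ 2 := pow_le_pow_left₀ (norm_nonneg _) b1 2
    have b4 : 0 ≤ ‖(spl d j ξ).fst‖ ^ 2 := by positivity
    rw [mul_pow, hτ2] at b3
    have b5 := norm_nonneg ξ
    have b6 := norm_nonneg (spl d j ξ).snd
    rw [abs_le]
    constructor
    · nlinarith
    · nlinarith
  · have hT := prodvol d j (A := Metric.closedBall 0 τ) (B := Metric.closedBall 0 δ) measurableSet_closedBall measurableSet_closedBall
    rw [Measure.addHaar_closedBall _ _ hτ0.le, Measure.addHaar_closedBall _ _ h0.le, finrank_F1, finrank_F2 hj] at hT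
    obtain ⟨κ, hκ⟩ : ∃ κ : ℝ, κ = δ ^ (-(((d : ℝ) - j) / 2)) * Real.exp (-π) * ((δ ^ 2) ^ (-((j : ℝ) / 2)) * Real.exp (-π)) := ⟨_, rfl⟩
    have hκ0 : 0 < κ := by rw [hκ]; positivity
    have key := gram_lower (S := capS d j (2 * τ) (2 * δ)) (S0 := capS d j τ δ)
      (T := {x : Rd d | (spl d j x).fst ∈ Metric.closedBall 0 τ ∧ (spl d j x).snd ∈ Metric.closedBall 0 δ})
      (h := gh d j δ (δ ^ 2)) (κ := κ) (capS_meas _ _ _ _) hfin (capS_meas _ _ _ _)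
      (((cont_fst d j).measurable measurableSet_closedBall).inter ((cont_snd d j).measurable measurableSet_closedBall))
      (fun x => (gh_pos _ _ _ _ _).le) (gh_integrable d j h0 (by positivity))
      (K := fun ζ => δ ^ (-(((d : ℝ) - j) / 2)) * Real.exp (-π * ‖(spl d j ζ).fst‖ ^ 2 / δ)
      * ((δ ^ 2) ^ (-((j : ℝ) / 2)) * Real.exp (-π * ‖(spl d j ζ).snd‖ ^ 2 / δ ^ 2)))
      (by
        have := cont_fst d j
        have := cont_snd d j
        fun_prop) (fun ζ => by positivity) (fun ζ => gh_fourier hj h0 (by positivity) ζ)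
      (by
        rintro ζ ⟨z1, z2⟩
        rw [mem_closedBall_zero_iff] at z1 z2
        have b3 : ‖(spl d j ζ).fst‖ ^ 2 ≤ τ ^ 2 := pow_le_pow_left₀ (norm_nonneg _) z1 2
        have b4 : ‖(spl d j ζ).snd‖ ^ 2 ≤ δ ^ 2 := pow_le_pow_left₀ (norm_nonneg _) z2 2
        rw [hτ2] at b3
        have c1 : -π ≤ -π * ‖(spl d j ζ).fst‖ ^ 2 / δ := by
          rw [le_div_iff₀ h0]; nlinarith [pi_pos]
        have c2 : -π ≤ -π * ‖(spl d j ζ).snd‖ ^ 2 / δ ^ 2 := by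
          rw [le_div_iff₀ (by positivity)]; nlinarith [pi_pos]
        rw [hκ]
        gcongr)
      (by
        rintro ξ ⟨z1, z2⟩ ζ ⟨z3, z4⟩
        rw [mem_closedBall_zero_iff] at z1 z3 z4
        simp only [Set.mem_ofPred_eq] at z2
        refine ⟨?_, ?_⟩
        · rw [mem_closedBall_zero_iff, map_sub]
          have := norm_sub_le (spl d j ξ).fst (spl d j ζ).fst
          refine (le_trans (le_of_eq rfl) this).trans (by linarith)
        · simp only [Set.mem_ofPred_eq, map_sub]
          have f1 := abs_norm_sub_norm_le ((spl d j ξ).snd - (spl d j ζ).snd) (spl d j ξ).snd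
          rw [show (spl d j ξ).snd - (spl d j ζ).snd - (spl d j ξ).snd = -(spl d j ζ).snd by abel, norm_neg] at f1
          change |‖(spl d j ξ).snd - (spl d j ζ).snd‖ - 1| ≤ 2 * δ
          rw [abs_le] at *
          constructor <;> linarith)
      (by
        rintro ξ ⟨z1, z2⟩
        refine ⟨Metric.closedBall_subset_closedBall (by linarith) z1, ?_⟩
        simp only [Set.mem_ofPred_eq] at *
        linarith)
    have hkap : κ * (τ ^ (d - j) * δ ^ j) = Real.exp (-(2 * π)) := by
      have f1 : τ ^ (d - j) = δ ^ (((d : ℝ) - j) / 2) := by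
        rw [hτ, Real.sqrt_eq_rpow, ← Real.rpow_natCast, ← Real.rpow_mul h0.le, Nat.cast_sub hj]
        congr 1; ring
      have f2 : (δ ^ 2) ^ (-((j : ℝ) / 2)) = δ ^ (-(j : ℝ)) := by
        rw [← Real.rpow_natCast, ← Real.rpow_mul h0.le]
        congr 1; push_cast; ring
      have f3 : δ ^ j = δ ^ (j : ℝ) := (Real.rpow_natCast _ _).symm
      have f4 : δ ^ (-(((d : ℝ) - j) / 2)) * δ ^ (((d : ℝ) - j) / 2) = 1 := by
        rw [← Real.rpow_add h0]; simp
      have f5 : δ ^ (-(j : ℝ)) * δ ^ (j : ℝ) = 1 := by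
        rw [← Real.rpow_add h0]; simp
      rw [hκ, f1, f2, f3]
      calc _ = (δ ^ (-(((d : ℝ) - j) / 2)) * δ ^ (((d : ℝ) - j) / 2)) * (δ ^ (-(j : ℝ)) * δ ^ (j : ℝ)) * (Real.exp (-π) * Real.exp (-π)) := by ring
        _ = _ := by rw [f4, f5, ← Real.exp_add]; rw [one_mul, one_mul]; congr 1; ring
    have hkT : ENNReal.ofReal κ * volume {x : Rd d | (spl d j x).fst ∈ Metric.closedBall 0 τ ∧ (spl d j x).snd ∈ Metric.closedBall 0 δ}
        = ENNReal.ofReal (w * Real.exp (-(2 * π))) := by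
      rw [hT]
      calc _ = ENNReal.ofReal κ * (ENNReal.ofReal (τ ^ (d - j)) * ENNReal.ofReal (δ ^ j)) * (volume (Metric.ball (0 : F1 d j) 1) * volume (Metric.ball (0 : F2 d j) 1)) := by ring
        _ = _ := by
          rw [← hω, hωw, ← ENNReal.ofReal_mul (by positivity), ← ENNReal.ofReal_mul (by positivity), ← ENNReal.ofReal_mul (by positivity), hkap]
          congr 1; ring
    have hu1 : Integrable ((capS d j (2 * τ) (2 * δ)).indicator (fun _ => (1 : ℂ))) volume :=
      (integrable_indicator_iff (capS_meas _ _ _ _)).2 (integrableOn_const hfin)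
    have hol := holder_gh (μ := volume) (fourierInv_continuous hu1).aestronglyMeasurable
      (h := fun x => ENNReal.ofReal (gh d j δ (δ ^ 2) x)) (gh_cont d j δ (δ ^ 2)).measurable.ennreal_ofReal.aemeasurable hp
    have hgI : (∫⁻ x, ENNReal.ofReal (gh d j δ (δ ^ 2) x) ^ (p / (p - 2))) ^ (1 - 2 / p) =
        ENNReal.ofReal (Q * δ ^ (-((d + j) * (1 / 2 - 1 / p)))) := by
      rw [← hq]
      have : ∀ x, ENNReal.ofReal (gh d j δ (δ ^ 2) x) ^ q = ENNReal.ofReal (gh d j (q * δ) (q * δ ^ 2) x) := by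
        intro x
        rw [ENNReal.ofReal_rpow_of_nonneg (gh_pos _ _ _ _ _).le hq0.le, gh_rpow]
      simp_rw [this]
      rw [← ofReal_integral_eq_lintegral_ofReal (gh_integrable d j (by positivity) (by positivity)) (Eventually.of_forall fun x => (gh_pos _ _ _ _ _).le),
        gh_integral hj (by positivity) (by positivity), ENNReal.ofReal_rpow_of_pos (by positivity)]
      congr 1
      rw [Real.mul_rpow hq0.le h0.le, Real.mul_rpow hq0.le (by positivity), hQ]
      rw [show q ^ (-(((d:ℝ) - j) / 2)) * δ ^ (-(((d:ℝ) - j) / 2)) * (q ^ (-((j:ℝ) / 2)) * (δ ^ 2) ^ (-((j:ℝ) / 2))) =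
        (q ^ (-(((d:ℝ) - j) / 2)) * q ^ (-((j:ℝ) / 2))) * (δ ^ (-(((d:ℝ) - j) / 2)) * (δ ^ 2) ^ (-((j:ℝ) / 2))) by ring]
      rw [Real.mul_rpow (by positivity) (by positivity)]
      congr 1
      rw [← Real.rpow_natCast, ← Real.rpow_mul h0.le, ← Real.rpow_add h0, ← Real.rpow_mul h0.le]
      congr 1
      push_cast
      ring
    rw [hgI] at hol
    have k2 := key.trans hol
    rw [mul_right_comm, hkT] at k2
    obtain ⟨N, hN⟩ : ∃ N : ℝ≥0∞, N = eLpNorm (𝓕⁻ ((capS d j (2 * τ) (2 * δ)).indicator (fun _ => (1 : ℂ)))) (ENNReal.ofReal p) volume := ⟨_, rfl⟩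
    rw [← hN] at k2 ⊢
    have k3 : volume (capS d j (2 * τ) (2 * δ)) ≤ ENNReal.ofReal A * volume (capS d j τ δ) := by
      rw [hV, hV0, ← mul_assoc, ← ENNReal.ofReal_mul hA0.le, hA]
      exact mul_le_mul_left (ENNReal.ofReal_le_ofReal (cap_ratio hj1 hτ0.le h0 (by linarith))) _
    have we0 : 0 < w * Real.exp (-(2 * π)) := by positivity
    calc _ ≤ _ := k3
      _ = ENNReal.ofReal A * ENNReal.ofReal ((w * Real.exp (-(2 * π)))⁻¹) * (ENNReal.ofReal (w * Real.exp (-(2 * π))) * volume (capS d j τ δ)) := by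
          rw [mul_assoc, ← mul_assoc (ENNReal.ofReal ((w * Real.exp (-(2 * π)))⁻¹)), ← ENNReal.ofReal_mul (by positivity), inv_mul_cancel₀ we0.ne']
          simp
      _ ≤ ENNReal.ofReal A * ENNReal.ofReal ((w * Real.exp (-(2 * π)))⁻¹) * (N ^ 2 * ENNReal.ofReal (Q * δ ^ (-((d + j) * (1 / 2 - 1 / p))))) :=
          mul_le_mul_right k2 _
      _ = _ := by
          rw [mul_comm (N ^ 2), ← mul_assoc, ← ENNReal.ofReal_mul hA0.le, ← ENNReal.ofReal_mul (by positivity)]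
          congr 2
          ring

/-- comparability of the symbol with the Sobolev weight -/
def Comp (s a b : ℝ) (g : ℝ → ℝ) : Prop :=
  Measurable g ∧ 0 < a ∧ 0 < b ∧ ∀ r, a * (1 + r ^ 2) ^ s ≤ g r ∧ g r ≤ b * (1 + r ^ 2) ^ s

theorem adm_comp {s γ c C ε : ℝ} {g : ℝ → ℝ → ℝ} (hs : 0 < s) (hγ : 1 < γ) (hc : 0 < c) (hcC : c ≤ C)
    (h : IsAdmissible s γ c C g) (h0 : 0 < ε) (h1 : ε < 1) : ∃ a b, Comp s a b (g ε) := by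
  obtain ⟨hm, hp, hf, hn⟩ := h
  have he : ε ∈ Set.Ioo (0:ℝ) 1 := ⟨h0, h1⟩
  have hC : 0 < C := by linarith
  refine ⟨c * ε * (4 ^ s)⁻¹ * (2 ^ s)⁻¹, 4 * C, hm ε he, by positivity, by positivity, fun r => ?_⟩
  have w1 : 1 ≤ (1 + r ^ 2) ^ s := Real.one_le_rpow (by nlinarith) hs.le
  have p4 : (1:ℝ) ≤ 4 ^ s := Real.one_le_rpow (by norm_num) hs.le
  have p2 : (1:ℝ) ≤ 2 ^ s := Real.one_le_rpow (by norm_num) hs.le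
  rcases le_total (1/2) |r - 1| with hr | hr
  · obtain ⟨q1, q2⟩ := hf ε he r hr
    have a1 := weight_cmp s hs |r| (abs_nonneg r)
    have a2 := weight_cmp' s hs |r| (abs_nonneg r)
    rw [sq_abs, abs_abs] at a1 a2
    constructor
    · refine le_trans ?_ q1
      have : (1 + r ^ 2) ^ s * (2 ^ s)⁻¹ ≤ 1 + |r| ^ (2 * s) := by
        rw [mul_inv_le_iff₀ (by positivity)]; linarith
      calc c * ε * (4 ^ s)⁻¹ * (2 ^ s)⁻¹ * (1 + r ^ 2) ^ s = c * (ε * (4 ^ s)⁻¹) * ((1 + r ^ 2) ^ s * (2 ^ s)⁻¹) := by ring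
        _ ≤ c * 1 * (1 + |r| ^ (2 * s)) := by
          have : ε * (4 ^ s)⁻¹ ≤ 1 := mul_le_one₀ h1.le (by positivity) (inv_le_one_of_one_le₀ p4)
          gcongr
        _ = _ := by ring
    · refine q2.trans ?_
      nlinarith
  · obtain ⟨q1, q2⟩ := hn ε he r hr
    have hr' := abs_le.1 hr
    have u1 : |r - 1| ^ γ ≤ 1 := Real.rpow_le_one (abs_nonneg _) (by linarith) (by linarith)
    have u0 : 0 ≤ |r - 1| ^ γ := by positivity
    have u2 : (1 + r ^ 2) ^ s ≤ 4 ^ s := Real.rpow_le_rpow (by positivity) (by nlinarith) hs.le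
    constructor
    · refine le_trans ?_ q1
      calc c * ε * (4 ^ s)⁻¹ * (2 ^ s)⁻¹ * (1 + r ^ 2) ^ s = c * ε * ((2 ^ s)⁻¹) * ((4 ^ s)⁻¹ * (1 + r ^ 2) ^ s) := by ring
        _ ≤ c * ε * 1 * 1 := by
          have e1 : (2 ^ s : ℝ)⁻¹ ≤ 1 := inv_le_one_of_one_le₀ p2
          have e2 : (4 ^ s : ℝ)⁻¹ * (1 + r ^ 2) ^ s ≤ 1 := by
            rw [inv_mul_le_iff₀ (by positivity)]; linarith
          gcongr
        _ ≤ _ := by nlinarith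
    · refine q2.trans ?_
      nlinarith

theorem Comp.pos {s a b : ℝ} {g : ℝ → ℝ} (h : Comp s a b g) (r : ℝ) : 0 < g r := by
  have := (h.2.2.2 r).1
  have h2 : 0 < a * (1 + r ^ 2) ^ s := mul_pos h.2.1 (by positivity)
  linarith

theorem q_int {d : ℕ} {s a b : ℝ} {g : ℝ → ℝ} (h : Comp s a b g) {U : Rd d → ℂ} (hU : MemLp U 2 volume)
    (hH : Integrable (fun ξ : Rd d => ‖U ξ‖ ^ 2 * (1 + ‖ξ‖ ^ 2) ^ s) volume) :
    Integrable (fun ξ : Rd d => ‖U ξ‖ ^ 2 * g ‖ξ‖) volume := by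
  refine (hH.const_mul b).mono' ?_ (Eventually.of_forall fun ξ => ?_)
  · exact (hU.1.norm.pow 2).mul (h.1.comp measurable_norm).aestronglyMeasurable
  · rw [Real.norm_of_nonneg (mul_nonneg (by positivity) (h.pos _).le)]
    have := (h.2.2.2 ‖ξ‖).2
    nlinarith [sq_nonneg ‖U ξ‖]

theorem QL_eq {d : ℕ} {s a b : ℝ} {g : ℝ → ℝ} (h : Comp s a b g) {U : Rd d → ℂ} (hU : MemLp U 2 volume)
    (hH : Integrable (fun ξ : Rd d => ‖U ξ‖ ^ 2 * (1 + ‖ξ‖ ^ 2) ^ s) volume) :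
    QL g U = ENNReal.ofReal (∫ ξ, ‖U ξ‖ ^ 2 * g ‖ξ‖) := by
  rw [ofReal_integral_eq_lintegral_ofReal (q_int h hU hH) (Eventually.of_forall fun ξ => mul_nonneg (by positivity) (h.pos _).le)]
  unfold QL
  congr 1
  ext ξ
  rw [ENNReal.ofReal_mul (by positivity), ENNReal.ofReal_pow (norm_nonneg _), ofReal_norm]

/-- Building an element of the Sobolev space. -/
def mkHs {d : ℕ} {s : ℝ} (U v : Rd d → ℂ) (hU : MemLp U 2 volume) (hv : v =ᵐ[volume] IF U)
    (hH : Integrable (fun ξ : Rd d => ‖U ξ‖ ^ 2 * (1 + ‖ξ‖ ^ 2) ^ s) volume) : HsFn d s where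
  toFun := v
  ft := U
  memL2 := (memLp_congr_ae hv).2 (IF_memLp hU)
  ft_memL2 := hU
  isFT := by
    intro φ
    rw [IF_pair hU φ]
    apply integral_congr_ae
    filter_upwards [hv] with x hx
    rw [hx]
  memHs := hH

theorem hs_IF {d : ℕ} {s : ℝ} (u : HsFn d s) : u.toFun =ᵐ[volume] IF u.ft :=
  IF_unique u.ft_memL2 u.memL2 u.isFT

theorem qeps_nonneg {d : ℕ} {s a b : ℝ} {g : ℝ → ℝ} (h : Comp s a b g) (u : HsFn d s) : 0 ≤ qeps g u :=
  integral_nonneg fun ξ => mul_nonneg (by positivity) (h.pos _).le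

theorem LpN_pos {d : ℕ} {p : ℝ} (hp : 2 < p) {f : Rd d → ℂ} (h0 : ¬ f =ᵐ[volume] (fun _ => (0 : ℂ)))
    (hm : MemLp f (ENNReal.ofReal p) volume) : 0 < LpN p f := by
  unfold LpN
  apply ENNReal.toReal_pos _ hm.2.ne
  intro h
  rw [eLpNorm_eq_zero_iff hm.1 (by simp; linarith)] at h
  exact h0 h

theorem ray_bdd {d : ℕ} {s a b p : ℝ} {g : ℝ → ℝ} (h : Comp s a b g) (P : (Rd d → ℂ) → Prop) :
    BddBelow (RayleighSet d s p g P) := by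
  refine ⟨0, ?_⟩
  rintro t ⟨u, _, _, _, rfl⟩
  exact div_nonneg (qeps_nonneg h u) (by positivity)

theorem ray_mono {d : ℕ} {s a b p : ℝ} {g : ℝ → ℝ} (h : Comp s a b g) {P Q : (Rd d → ℂ) → Prop} (hPQ : ∀ f, P f → Q f)
    (hne : (RayleighSet d s p g P).Nonempty) : Rayleigh d s p g Q ≤ Rayleigh d s p g P := by
  apply csInf_le_csInf (ray_bdd h Q) hne
  rintro t ⟨u, h1, h2, h3, h4⟩
  exact ⟨u, hPQ _ h1, h2, h3, h4⟩

theorem lower_ray {d : ℕ} {s a b p c γ β D ε : ℝ} {G : Set (Rd d ≃ₗᵢ[ℝ] Rd d)} {g : ℝ → ℝ} (h : Comp s a b g) (hp : 2 < p)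
    (hD : 0 < D) (hε : 0 < ε)
    (hL : ∀ U : Rd d → ℂ, MemLp U 2 volume → SymF G U → eLpNorm (IF U) (ENNReal.ofReal p) volume ≤ ENNReal.ofReal (D * ε ^ (β / γ - 1/2)) * QL g U ^ (1/2 : ℝ))
    {P : (Rd d → ℂ) → Prop} (hP : ∀ f, P f → InvG G f)
    (hne : (RayleighSet d s p g P).Nonempty) : (D ^ 2)⁻¹ * ε ^ (1 - 2 * β / γ) ≤ Rayleigh d s p g P := by
  apply le_csInf hne
  rintro t ⟨u, h1, h2, h3, rfl⟩
  have h4 := hL u.ft u.ft_memL2 (symF_of u.ft_memL2 (hs_IF u) (hP _ h1))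
  rw [QL_eq h u.ft_memL2 u.memHs, ← eLpNorm_congr_ae (hs_IF u)] at h4
  have h5 := LpN_pos hp h2 h3
  rw [le_div_iff₀ (by positivity)]
  have q0 := qeps_nonneg h u
  have e : (∫ ξ, ‖u.ft ξ‖ ^ 2 * g ‖ξ‖) = qeps g u := rfl
  rw [e, ENNReal.ofReal_rpow_of_nonneg q0 (by norm_num), ← ENNReal.ofReal_mul (by positivity)] at h4
  have h6 : LpN p u.toFun ≤ D * ε ^ (β / γ - 1/2) * qeps g u ^ (1/2 : ℝ) := by
    unfold LpN
    exact ENNReal.toReal_le_of_le_ofReal (by positivity) h4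
  have h7 : LpN p u.toFun ^ 2 ≤ (D * ε ^ (β / γ - 1/2) * qeps g u ^ (1/2 : ℝ)) ^ 2 := pow_le_pow_left₀ h5.le h6 2
  have e1 : (qeps g u ^ (1/2 : ℝ)) ^ 2 = qeps g u := by
    rw [← Real.rpow_natCast, ← Real.rpow_mul q0]; norm_num
  have e2 : (ε ^ (β / γ - 1/2)) ^ 2 * ε ^ (1 - 2 * β / γ) = 1 := by
    rw [← Real.rpow_natCast, ← Real.rpow_mul hε.le, ← Real.rpow_add hε]
    rw [show (β / γ - 1/2) * ((2:ℕ):ℝ) + (1 - 2 * β / γ) = 0 by push_cast; ring]; simp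
  rw [mul_pow, mul_pow, e1] at h7
  calc (D ^ 2)⁻¹ * ε ^ (1 - 2 * β / γ) * LpN p u.toFun ^ 2 ≤ (D ^ 2)⁻¹ * ε ^ (1 - 2 * β / γ) * (D ^ 2 * (ε ^ (β / γ - 1 / 2)) ^ 2 * qeps g u) := by gcongr
    _ = ((ε ^ (β / γ - 1 / 2)) ^ 2 * ε ^ (1 - 2 * β / γ)) * ((D ^ 2)⁻¹ * D ^ 2) * qeps g u := by ring
    _ = qeps g u := by rw [e2, inv_mul_cancel₀ (by positivity)]; ring
    _ ≤ _ := le_rfl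

theorem sob_comp {d : ℕ} {s a b p : ℝ} {g : ℝ → ℝ} (h : Comp s a b g) (hp : 2 < p) (hs : (d : ℝ) * (1/2 - 1/p) < s) :
    ∃ K : ℝ, 0 < K ∧ ∀ U : Rd d → ℂ, MemLp U 2 volume →
      eLpNorm (IF U) (ENNReal.ofReal p) volume ≤ ENNReal.ofReal K * QL g U ^ (1/2 : ℝ) := by
  obtain ⟨C, hC, hS⟩ := sobolev (Rd d) hp (s := s) (by simpa using hs)
  have ha := h.2.1
  refine ⟨C * a ^ (-(1/2) : ℝ), by positivity, fun U hU => ?_⟩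
  have h1 := wt_piece_le (U := U) (S := Set.univ) ha (fun ξ _ => (h.2.2.2 ‖ξ‖).1)
  rw [Set.indicator_univ] at h1
  refine (hS U hU).trans ?_
  rw [ENNReal.ofReal_mul hC.le, mul_assoc]
  exact mul_le_mul_right h1 _

theorem hs_memLp {d : ℕ} {s a b p : ℝ} {g : ℝ → ℝ} (h : Comp s a b g) (hp : 2 < p) (hs : (d : ℝ) * (1/2 - 1/p) < s)
    (u : HsFn d s) : MemLp u.toFun (ENNReal.ofReal p) volume := by
  obtain ⟨K, hK, hS⟩ := sob_comp h hp hs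
  refine ⟨u.memL2.1, ?_⟩
  rw [eLpNorm_congr_ae (hs_IF u)]
  refine (hS u.ft u.ft_memL2).trans_lt ?_
  rw [QL_eq h u.ft_memL2 u.memHs]
  refine ENNReal.mul_lt_top ENNReal.ofReal_lt_top (ENNReal.rpow_lt_top_of_nonneg (by norm_num) ENNReal.ofReal_ne_top)

/-- test function from an indicator -/
theorem test_ind {d : ℕ} {s a b p : ℝ} {g : ℝ → ℝ} (h : Comp s a b g) (hp : 2 < p) (hs : (d : ℝ) * (1/2 - 1/p) < s)
    {S : Set (Rd d)} (hS : MeasurableSet S) (hf : volume S ≠ ∞) (h0 : volume S ≠ 0) {R : ℝ} (hb : ∀ ξ ∈ S, ‖ξ‖ ≤ R)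
    {G : Set (Rd d ≃ₗᵢ[ℝ] Rd d)} (hG : ∀ g ∈ G, ∀ x, g x ∈ S ↔ x ∈ S) :
    InvG G (𝓕⁻ (S.indicator (fun _ => (1 : ℂ)))) ∧ ¬ 𝓕⁻ (S.indicator (fun _ => (1 : ℂ))) =ᵐ[volume] (fun _ => (0 : ℂ)) ∧
    MemLp (𝓕⁻ (S.indicator (fun _ => (1 : ℂ)))) (ENNReal.ofReal p) volume ∧
    ∃ u : HsFn d s, u.toFun = 𝓕⁻ (S.indicator (fun _ => (1 : ℂ))) ∧ u.ft = S.indicator (fun _ => (1 : ℂ)) := by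
  have hs0 : 0 ≤ s := by
    have : 0 ≤ (d : ℝ) * (1/2 - 1/p) := by
      have : 0 ≤ 1/2 - 1/p := by
        rw [sub_nonneg]; apply one_div_le_one_div_of_le <;> linarith
      positivity
    linarith
  have hu2 : MemLp (S.indicator (fun _ => (1 : ℂ))) 2 volume := memLp_indicator_const 2 hS 1 (Or.inr hf)
  have hu1 : Integrable (S.indicator (fun _ => (1 : ℂ))) volume := (integrable_indicator_iff hS).2 (integrableOn_const hf)
  have hIF := IF_eq_integral hu2 hu1
  have hH : Integrable (fun ξ : Rd d => ‖S.indicator (fun _ => (1 : ℂ)) ξ‖ ^ 2 * (1 + ‖ξ‖ ^ 2) ^ s) volume := by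
    refine Integrable.mono' (g := S.indicator fun _ => (1 + R ^ 2) ^ s) ((integrable_indicator_iff hS).2 (integrableOn_const hf)) ?_ (Eventually.of_forall fun ξ => ?_)
    · exact (hu2.1.norm.pow 2).mul (by fun_prop)
    · by_cases hξ : ξ ∈ S
      · simp only [Set.indicator_of_mem hξ]
        rw [norm_one, one_pow, one_mul, Real.norm_of_nonneg (by positivity)]
        have := hb ξ hξ
        gcongr
      · simp [Set.indicator_of_notMem hξ]
  have hsym : SymF G (S.indicator (fun _ => (1 : ℂ))) := by
    intro g hg
    refine Eventually.of_forall fun x => ?_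
    have := hG g hg x
    by_cases hx : x ∈ S
    · simp [hx, this.2 hx]
    · simp [hx, this]
  let u : HsFn d s := mkHs _ _ hu2 hIF.symm hH
  refine ⟨symF_inv hsym, ?_, hs_memLp h hp hs u, u, rfl, rfl⟩
  intro hz
  have h1 : eLpNorm (IF (S.indicator (fun _ => (1 : ℂ)))) 2 volume = 0 := by
    rw [eLpNorm_congr_ae (hIF.trans hz)]; simp
  rw [IF_norm hu2, eLpNorm_indicator_const hS (by norm_num) (by norm_num)] at h1
  rw [mul_eq_zero, ENNReal.rpow_eq_zero_iff] at h1
  rcases h1 with h1 | h1 | h1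
  · simp at h1
  · exact h0 h1.1
  · exact hf h1.1

theorem ray_rad_ne {d : ℕ} {s a b p : ℝ} {g : ℝ → ℝ} (h : Comp s a b g) (hp : 2 < p) (hs : (d : ℝ) * (1/2 - 1/p) < s) :
    (RayleighSet d s p g Radial).Nonempty := by
  obtain ⟨h1, h2, h3, u, h4, h5⟩ := test_ind h hp hs (S := Metric.ball (0 : Rd d) 1) measurableSet_ball measure_ball_lt_top.ne
    (Metric.measure_ball_pos _ _ one_pos).ne' (R := 1) (fun ξ hξ => by simpa using (mem_ball_zero_iff.1 hξ).le) (G := Gm d 0)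
    (fun g _ x => by simp)
  refine ⟨_, u, ?_, ?_, ?_, rfl⟩
  · rw [h4, radial_iff, gk_iff]; exact h1
  · rw [h4]; exact h2
  · rw [h4]; exact h3

theorem radial_gk {d : ℕ} (j : ℕ) (f : Rd d → ℂ) (h : Radial f) : GkSymmetric d j f := fun x y _ h2 => h x y h2

theorem ray_ne {d : ℕ} {s a b p : ℝ} {g : ℝ → ℝ} (h : Comp s a b g) (hp : 2 < p) (hs : (d : ℝ) * (1/2 - 1/p) < s)
    {P : (Rd d → ℂ) → Prop} (hP : ∀ f, Radial f → P f) :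
    (RayleighSet d s p g P).Nonempty := by
  obtain ⟨t, u, h1, h2⟩ := ray_rad_ne (g := g) h hp hs
  exact ⟨t, u, hP _ h1, h2⟩

theorem upper_ray {d j : ℕ} (hj1 : 1 ≤ j) (hj : j ≤ d) {p s γ c C : ℝ} (hp : 2 < p) (hs : (d : ℝ) * (1/2 - 1/p) < s) (hs0 : 0 < s)
    (hγ : 1 < γ) (hc : 0 < c) (hcC : c ≤ C) :
    ∃ D : ℝ, 0 < D ∧ ∀ (g : ℝ → ℝ → ℝ) (ε : ℝ), IsAdmissible s γ c C g → 0 < ε → ε < 1 →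
      Rayleigh d s p (g ε) (GkSymmetric d j) ≤ D * ε ^ (1 - (d + j) * (1 / 2 - 1 / p) / γ) := by
  obtain ⟨D, hD, hT⟩ := upper_test hj1 hj hp
  have hC : 0 < C := by linarith
  refine ⟨2 * C * D * (1/24) ^ (-((d + j) * (1 / 2 - 1 / p))), by positivity, fun g ε hg h0 h1 => ?_⟩
  obtain ⟨a, b, hcmp⟩ := adm_comp hs0 hγ hc hcC hg h0 h1
  have hεγ : ε ^ (1/γ) ≤ 1 := Real.rpow_le_one h0.le h1.le (by positivity)
  have hεγ0 : 0 < ε ^ (1/γ) := by positivity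
  obtain ⟨S, hS, hf, hn, hG, hb, hv⟩ := hT (1/24 * ε ^ (1/γ)) (by positivity) (by linarith)
  obtain ⟨t1, t2, t3, u, t4, t5⟩ := test_ind hcmp hp hs hS hf hn (R := 2) (fun ξ hξ => by
    have := (abs_le.1 (hb ξ hξ)).2; linarith) hG
  refine (csInf_le (ray_bdd hcmp _) ⟨u, ?_, ?_, ?_, rfl⟩).trans ?_
  · rw [t4, gk_iff]; exact t1
  · rw [t4]; exact t2
  · rw [t4]; exact t3
  have hN := LpN_pos hp t2 t3
  rw [t4, div_le_iff₀ (by positivity)]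
  have hv2 : (volume S).toReal ≤ D * (1/24 * ε ^ (1/γ)) ^ (-((d + j) * (1 / 2 - 1 / p))) * LpN p (𝓕⁻ (S.indicator (fun _ => (1 : ℂ)))) ^ 2 := by
    have := ENNReal.toReal_mono (ENNReal.mul_ne_top ENNReal.ofReal_ne_top (ENNReal.pow_ne_top t3.2.ne)) hv
    rw [ENNReal.toReal_mul, ENNReal.toReal_ofReal (by positivity), ENNReal.toReal_pow] at this
    exact this
  have hq : qeps (g ε) u ≤ 2 * C * ε * (volume S).toReal := by
    unfold qeps
    rw [t5]
    have e : ∫ ξ in S, 2 * C * ε = 2 * C * ε * (volume S).toReal := by simp [Measure.real, mul_comm]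
    rw [← e, ← integral_indicator hS]
    refine integral_mono_of_nonneg (Eventually.of_forall fun ξ => mul_nonneg (by positivity) (hcmp.pos _).le) ((integrable_indicator_iff hS).2 (integrableOn_const hf)) (Eventually.of_forall fun ξ => ?_)
    by_cases hξ : ξ ∈ S
    · simp only [Set.indicator_of_mem hξ]
      rw [norm_one, one_pow, one_mul]
      have h2 := hb ξ hξ
      have h3 := (hg.2.2.2 ε ⟨h0, h1⟩ ‖ξ‖ (by linarith)).2
      have h4 : |‖ξ‖ - 1| ^ γ ≤ ε := by
        calc |‖ξ‖ - 1| ^ γ ≤ (ε ^ (1/γ)) ^ γ := Real.rpow_le_rpow (abs_nonneg _) (by linarith) (by linarith)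
          _ = ε := by rw [← Real.rpow_mul h0.le]; rw [one_div_mul_cancel (by linarith)]; simp
      nlinarith
    · simp [Set.indicator_of_notMem hξ]
  have hfin : ε * (1/24 * ε ^ (1/γ)) ^ (-((d + j) * (1 / 2 - 1 / p))) = (1/24) ^ (-((d + j) * (1 / 2 - 1 / p))) * ε ^ (1 - (d + j) * (1 / 2 - 1 / p) / γ) := by
    rw [Real.mul_rpow (by norm_num) (by positivity), ← Real.rpow_mul h0.le, Real.rpow_sub h0, Real.rpow_one]
    rw [show 1 / γ * (-((d + j) * (1 / 2 - 1 / p))) = -((d + j) * (1 / 2 - 1 / p) / γ) by ring, Real.rpow_neg h0.le]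
    ring
  calc qeps (g ε) u ≤ 2 * C * ε * (volume S).toReal := hq
    _ ≤ 2 * C * ε * (D * (1/24 * ε ^ (1/γ)) ^ (-((d + j) * (1 / 2 - 1 / p))) * LpN p (𝓕⁻ (S.indicator (fun _ => (1 : ℂ)))) ^ 2) := by gcongr
    _ = 2 * C * D * (ε * (1/24 * ε ^ (1/γ)) ^ (-((d + j) * (1 / 2 - 1 / p)))) * LpN p (𝓕⁻ (S.indicator (fun _ => (1 : ℂ)))) ^ 2 := by ring
    _ = _ := by rw [hfin]; ring

theorem small_eps {A B D1 D2 : ℝ} (hAB : B < A) (h1 : 0 < D1) (h2 : 0 < D2) :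
    ∃ e0 : ℝ, 0 < e0 ∧ e0 < 1 ∧ ∀ ε, 0 < ε → ε < e0 → D1 * ε ^ A < D2 * ε ^ B := by
  have t : 0 < A - B := by linarith
  refine ⟨min (1/2) ((D2 / D1) ^ (1 / (A - B))), by positivity, lt_of_le_of_lt (min_le_left _ _) (by norm_num), fun ε h0 hε => ?_⟩
  have h3 : ε < (D2 / D1) ^ (1 / (A - B)) := lt_of_lt_of_le hε (min_le_right _ _)
  have h4 : ε ^ (A - B) < D2 / D1 := by
    have := Real.rpow_lt_rpow h0.le h3 t
    rwa [← Real.rpow_mul (by positivity), one_div_mul_cancel t.ne', Real.rpow_one] at this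
  have h5 : ε ^ A = ε ^ (A - B) * ε ^ B := by rw [← Real.rpow_add h0]; ring_nf
  rw [h5, ← mul_assoc]
  apply mul_lt_mul_of_pos_right _ (by positivity)
  rw [lt_div_iff₀ h1] at h4
  linarith

theorem strict_gen {d k j : ℕ} (hd : 2 ≤ d) (hk1 : 1 ≤ k) (hk2 : k ≤ d / 2) {p s c C γ : ℝ} (hp : 2 < p) (hpk : p < twoStarK d k)
    (hs : (d : ℝ) / ((d : ℝ) + 1) < s) (hγ : 1 < γ) (hc : 0 < c) (hcC : c ≤ C) (hj : 1 ≤ j) (hjk : j ≤ k)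
    {G : Set (Rd d ≃ₗᵢ[ℝ] Rd d)} {P : (Rd d → ℂ) → Prop} (hP : ∀ f, P f → InvG G f) (hPr : ∀ f, Radial f → P f)
    (hb : ∃ b, (1/2 - 1/p) * (((d:ℝ) + j) / 2) < b ∧ LowerBd d G p s c γ b) :
    ∃ e0 : ℝ, 0 < e0 ∧ e0 < 1 ∧ ∀ (g : ℝ → ℝ → ℝ), IsAdmissible s γ c C g → ∀ ε, 0 < ε → ε < e0 →
      Rayleigh d s p (g ε) (GkSymmetric d j) < Rayleigh d s p (g ε) P := by
  have hs0 : 0 < s := lt_of_le_of_lt (by positivity) hs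
  have hsob := sob_ok hd hk1 hk2 hp hpk hs
  obtain ⟨b, hb, D2, hD2, hL⟩ := hb
  obtain ⟨D1, hD1, hU⟩ := upper_ray (s := s) (C := C) hj (by omega : j ≤ d) hp hsob hs0 hγ hc hcC
  have hAB : 1 - 2 * b / γ < 1 - (d + j) * (1 / 2 - 1 / p) / γ := by
    have : (d + j) * (1 / 2 - 1 / p) / γ < 2 * b / γ := by
      apply div_lt_div_of_pos_right _ (by linarith)
      nlinarith
    linarith
  obtain ⟨e0, h0, h1, he⟩ := small_eps hAB hD1 (by positivity : 0 < (D2 ^ 2)⁻¹)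
  refine ⟨e0, h0, h1, fun g hg ε hε hε0 => ?_⟩
  have hε1 : ε < 1 := hε0.trans h1
  obtain ⟨a, a', hcomp⟩ := adm_comp hs0 hγ hc hcC hg hε hε1
  have he1 : ε ∈ Set.Ioo (0:ℝ) 1 := ⟨hε, hε1⟩
  refine (hU g ε hg hε hε1).trans_lt ((he ε hε hε0).trans_le ?_)
  exact lower_ray (c := c) (D := D2) (G := G) hcomp hp hD2 hε (fun U h3 h4 => hL (g ε) ε U hε hε1 h3 h4
    (fun r hr => (hg.2.2.1 ε he1 r hr).1) (fun r hr => (hg.2.2.2 ε he1 r hr).1)) hP (ray_ne hcomp hp hsob hPr)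

theorem strict_ray {d k j m : ℕ} (hd : 2 ≤ d) (hk1 : 1 ≤ k) (hk2 : k ≤ d / 2) {p s c C γ : ℝ} (hp : 2 < p) (hpk : p < twoStarK d k)
    (hs : (d : ℝ) / ((d : ℝ) + 1) < s) (hγ : 1 < γ) (hc : 0 < c) (hcC : c ≤ C) (hj : 1 ≤ j) (hjk : j ≤ k) (hjm : j < m) (hm : m ≤ d / 2) :
    ∃ e0 : ℝ, 0 < e0 ∧ e0 < 1 ∧ ∀ (g : ℝ → ℝ → ℝ), IsAdmissible s γ c C g → ∀ ε, 0 < ε → ε < e0 →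
      Rayleigh d s p (g ε) (GkSymmetric d j) < Rayleigh d s p (g ε) (GkSymmetric d m) :=
  strict_gen hd hk1 hk2 hp hpk hs hγ hc hcC hj hjk (fun f hf => (gk_iff f).1 hf) (radial_gk m)
    (lower_G hd hk1 hk2 hp hpk hs hγ hc hj hjk hjm hm)

theorem strict_rad {d k : ℕ} (hd : 2 ≤ d) (hk1 : 1 ≤ k) (hk2 : k ≤ d / 2) {p s c C γ : ℝ} (hp : 2 < p) (hpk : p < twoStarK d k)
    (hs : (d : ℝ) / ((d : ℝ) + 1) < s) (hγ : 1 < γ) (hc : 0 < c) (hcC : c ≤ C) :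
    ∃ e0 : ℝ, 0 < e0 ∧ e0 < 1 ∧ ∀ (g : ℝ → ℝ → ℝ), IsAdmissible s γ c C g → ∀ ε, 0 < ε → ε < e0 →
      Rayleigh d s p (g ε) (GkSymmetric d k) < Rayleigh d s p (g ε) Radial :=
  strict_gen hd hk1 hk2 hp hpk hs hγ hc hcC hk1 le_rfl (fun f hf => (gk_iff f).1 ((radial_iff f).1 hf)) (fun _ h => h)
    (lower_rad hd hk1 hk2 hp hpk hs hγ hc)

theorem weak_sub {H : Type*} [NormedAddCommGroup H] [InnerProductSpace ℂ H] [CompleteSpace H] [TopologicalSpace.SeparableSpace H]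
    (w : ℕ → H) (hw : ∀ n, ‖w n‖ ≤ 1) : ∃ φ : ℕ → ℕ, StrictMono φ ∧ ∃ w0 : H, ∀ L : H →L[ℂ] ℂ,
      Tendsto (fun n => L (w (φ n))) atTop (𝓝 (L w0)) := by
  have hc := WeakDual.isSeqCompact_closedBall (𝕜 := ℂ) (E := H) 0 1
  have hm : ∀ n, StrongDual.toWeakDual (InnerProductSpace.toDual ℂ H (w n)) ∈ WeakDual.toStrongDual ⁻¹' Metric.closedBall (0 : StrongDual ℂ H) 1 := by
    intro n
    simp only [Set.mem_preimage, Metric.mem_closedBall, dist_zero_right]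
    have : WeakDual.toStrongDual (StrongDual.toWeakDual (InnerProductSpace.toDual ℂ H (w n))) = InnerProductSpace.toDual ℂ H (w n) := rfl
    rw [this, LinearIsometryEquiv.norm_map]
    exact hw n
  obtain ⟨a, ha, φ, hφ, ht⟩ := hc hm
  refine ⟨φ, hφ, (InnerProductSpace.toDual ℂ H).symm (WeakDual.toStrongDual a), fun L => ?_⟩
  obtain ⟨v, rfl⟩ := (InnerProductSpace.toDual ℂ H).surjective L
  have h1 : Tendsto (fun n => inner ℂ (w (φ n)) v) atTop (𝓝 (a v)) := by
    have := (WeakDual.eval_continuous (𝕜 := ℂ) v).continuousAt.tendsto.comp ht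
    exact this
  have h2 : inner ℂ ((InnerProductSpace.toDual ℂ H).symm (WeakDual.toStrongDual a)) v = a v :=
    InnerProductSpace.toDual_symm_apply
  simp only [InnerProductSpace.toDual_apply_apply]
  rw [← h2] at h1
  have h3 := (Complex.continuous_conj.tendsto _).comp h1
  simp only [Function.comp_def, inner_conj_symm] at h3
  exact h3

theorem weak_norm {H : Type*} [NormedAddCommGroup H] [InnerProductSpace ℂ H] (w : ℕ → H) (w0 : H) (hw : ∀ n, ‖w n‖ = 1)
    (h : ∀ L : H →L[ℂ] ℂ, Tendsto (fun n => L (w n)) atTop (𝓝 (L w0))) :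
    Tendsto (fun n => ‖w n - w0‖ ^ 2) atTop (𝓝 (1 - ‖w0‖ ^ 2)) := by
  have h1 := h (innerSL ℂ w0)
  have h2 := (Complex.continuous_re.tendsto _).comp h1
  simp only [Function.comp_def, innerSL_apply_apply] at h2
  have e : ∀ n, ‖w n - w0‖ ^ 2 = 1 - 2 * (inner ℂ w0 (w n)).re + ‖w0‖ ^ 2 := by
    intro n
    have e1 : RCLike.re (inner ℂ (w n) w0) = (inner ℂ w0 (w n)).re := by
      rw [← inner_conj_symm]
      exact Complex.conj_re _
    rw [@norm_sub_sq ℂ, hw n, e1]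
    simp
  simp only [e]
  have e2 : (inner ℂ w0 w0).re = ‖w0‖ ^ 2 := by
    rw [inner_self_eq_norm_sq_to_K]; norm_cast
  have h3 := (h2.const_mul 2).const_sub 1 |>.add_const (‖w0‖ ^ 2)
  rw [e2] at h3
  convert h3 using 2
  ring

theorem eLp_split {d : ℕ} {p : ℝ} (hp : 2 < p) (f : Rd d → ℂ) {B : Set (Rd d)} (hB : MeasurableSet B) :
    eLpNorm f (ENNReal.ofReal p) volume ^ p = eLpNorm f (ENNReal.ofReal p) (volume.restrict B) ^ p
      + eLpNorm f (ENNReal.ofReal p) (volume.restrict Bᶜ) ^ p := by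
  have e : ∀ μ : Measure (Rd d), eLpNorm f (ENNReal.ofReal p) μ ^ p = ∫⁻ x, ‖f x‖ₑ ^ p ∂μ := by
    intro μ
    rw [eLpNorm_eq_lintegral_rpow_enorm_toReal (by simp; linarith) (by simp), ENNReal.toReal_ofReal (by linarith), ← ENNReal.rpow_mul,
      one_div_mul_cancel (by linarith), ENNReal.rpow_one]
  rw [e, e, e, lintegral_add_compl _ hB]

theorem compact_mass {p a t : ℝ} (hp : 2 < p) (ht : 0 ≤ t) (ht1 : t ≤ 1) (ha : 0 ≤ a) (hat : a ≤ t)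
    (h : 1 ≤ a ^ p + (1 - t ^ 2) ^ (p / 2)) : a = t := by
  have h1 : (1 - t ^ 2) ^ (p/2) ≤ 1 - t ^ 2 := by
    have := Real.rpow_le_rpow_of_exponent_ge' (x := 1 - t ^ 2) (by nlinarith) (by nlinarith) (by norm_num : (0:ℝ) ≤ 1) (by linarith : 1 ≤ p / 2)
    simpa using this
  have h2 : a ^ p ≤ a ^ 2 := by
    have := Real.rpow_le_rpow_of_exponent_ge' (x := a) ha (by linarith) (by norm_num : (0:ℝ) ≤ 2) (by linarith : 2 ≤ p)
    simpa using this
  nlinarith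

theorem loc_dct {d : ℕ} {p : ℝ} (hp : 2 < p) (f : ℕ → Rd d → ℂ) (hc : ∀ n, Continuous (f n)) {K : ℝ} (hK : ∀ n x, ‖f n x‖ ≤ K)
    (h0 : ∀ x, Tendsto (fun n => f n x) atTop (𝓝 0)) {B : Set (Rd d)} (hB : volume B < ∞) :
    Tendsto (fun n => eLpNorm (f n) (ENNReal.ofReal p) (volume.restrict B)) atTop (𝓝 0) := by
  have hp0 : 0 < p := by linarith
  have e : ∀ n, eLpNorm (f n) (ENNReal.ofReal p) (volume.restrict B) = (∫⁻ x, ‖f n x‖ₑ ^ p ∂(volume.restrict B)) ^ (1 / p) := by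
    intro n
    rw [eLpNorm_eq_lintegral_rpow_enorm_toReal (by simp; linarith) (by simp), ENNReal.toReal_ofReal (by linarith)]
  simp only [e]
  have h1 : Tendsto (fun n => ∫⁻ x, ‖f n x‖ₑ ^ p ∂(volume.restrict B)) atTop (𝓝 (∫⁻ x, (0:ℝ≥0∞) ∂(volume.restrict B))) := by
    apply tendsto_lintegral_of_dominated_convergence (fun _ => ENNReal.ofReal K ^ p)
    · intro n
      exact ((hc n).enorm.measurable.pow_const p)
    · intro n
      refine Eventually.of_forall fun x => ?_
      apply ENNReal.rpow_le_rpow _ hp0.le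
      rw [← ofReal_norm]
      exact ENNReal.ofReal_le_ofReal (hK n x)
    · rw [lintegral_const]
      apply ENNReal.mul_ne_top
      · exact ENNReal.rpow_ne_top_of_nonneg hp0.le (by simp)
      · rw [Measure.restrict_apply_univ]; exact hB.ne
    · refine Eventually.of_forall fun x => ?_
      have h2 := (h0 x).enorm
      have h3 := (ENNReal.continuous_rpow_const (y := p)).tendsto (‖(0:ℂ)‖ₑ) |>.comp h2
      simpa [Function.comp_def, ENNReal.zero_rpow_of_pos hp0] using h3
  have h4 := (ENNReal.continuous_rpow_const (y := 1/p)).tendsto _ |>.comp h1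
  simpa [Function.comp_def, ENNReal.zero_rpow_of_pos (inv_pos.2 hp0)] using h4

section Abs
variable {H : Type*} [NormedAddCommGroup H] [InnerProductSpace ℂ H] {d : ℕ} {p : ℝ} [Fact (1 ≤ ENNReal.ofReal p)]

theorem loc_conv (hp : 2 < p) (T : H →L[ℂ] Lp ℂ (ENNReal.ofReal p) (volume : Measure (Rd d)))
    (l : ℕ → Rd d → H →L[ℂ] ℂ) (hl : ∀ n, Continuous (l n)) {Cb : ℕ → ℝ} (hCb : ∀ n x, ‖l n x‖ ≤ Cb n)
    (hAp : ∀ η : ℝ, 0 < η → ∃ n, ∀ w, eLpNorm (fun x => T w x - l n x w) (ENNReal.ofReal p) volume ≤ ENNReal.ofReal (η * ‖w‖))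
    (v : ℕ → H) (hv : ∀ n, ‖v n‖ ≤ 2) (h0 : ∀ L : H →L[ℂ] ℂ, Tendsto (fun n => L (v n)) atTop (𝓝 0))
    {B : Set (Rd d)} (hB : volume B < ∞) :
    Tendsto (fun n => eLpNorm (T (v n)) (ENNReal.ofReal p) (volume.restrict B)) atTop (𝓝 0) := by
  have hq : 1 ≤ ENNReal.ofReal p := Fact.out
  rw [ENNReal.tendsto_nhds_zero]
  intro ε hε
  rcases eq_or_ne ε ⊤ with rfl | hεt
  · exact Eventually.of_forall fun _ => le_top
  have hε' : 0 < ε.toReal := ENNReal.toReal_pos hε.ne' hεt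
  obtain ⟨m, hm⟩ := hAp (ε.toReal / 4) (by positivity)
  have h1 := loc_dct hp (fun n x => l m x (v n)) (fun n => (hl m).clm_apply continuous_const) (K := Cb m * 2) (fun n x => by
    refine ((l m x).le_opNorm _).trans ?_
    have := hCb m x
    have h3 := hv n
    have h4 : 0 ≤ Cb m := (norm_nonneg _).trans this
    gcongr) (fun x => h0 (l m x)) hB
  rw [ENNReal.tendsto_nhds_zero] at h1
  filter_upwards [h1 (ε / 2) (ENNReal.half_pos hε.ne')] with n hn
  have h2 : eLpNorm (fun x => T (v n) x - l m x (v n)) (ENNReal.ofReal p) (volume.restrict B) ≤ ε / 2 := by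
    refine (eLpNorm_mono_measure _ Measure.restrict_le_self).trans ((hm (v n)).trans ?_)
    have : ε / 2 = ENNReal.ofReal (ε.toReal / 2) := by
      rw [ENNReal.ofReal_div_of_pos (by norm_num), ENNReal.ofReal_toReal hεt]; simp
    rw [this]
    apply ENNReal.ofReal_le_ofReal
    have := hv n
    nlinarith
  have e : (⇑(T (v n)) : Rd d → ℂ) = (fun x => T (v n) x - l m x (v n)) + (fun x => l m x (v n)) := by
    ext x; simp
  have hm1 : Continuous (fun x => l m x (v n)) := (hl m).clm_apply continuous_const
  calc eLpNorm (T (v n)) (ENNReal.ofReal p) (volume.restrict B) = eLpNorm ((fun x => T (v n) x - l m x (v n)) + (fun x => l m x (v n))) (ENNReal.ofReal p) (volume.restrict B) := by rw [← e]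
    _ ≤ _ := eLpNorm_add_le (((Lp.aestronglyMeasurable _).restrict).sub hm1.aestronglyMeasurable) hm1.aestronglyMeasurable hq
    _ ≤ ε / 2 + ε / 2 := add_le_add h2 hn
    _ = ε := ENNReal.add_halves ε

/-- splitting inequality along a weakly convergent sequence. -/
theorem mass_split (hp : 2 < p) (T : H →L[ℂ] Lp ℂ (ENNReal.ofReal p) (volume : Measure (Rd d)))
    (l : ℕ → Rd d → H →L[ℂ] ℂ) (hl : ∀ n, Continuous (l n)) {Cb : ℕ → ℝ} (hCb : ∀ n x, ‖l n x‖ ≤ Cb n)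
    (hAp : ∀ η : ℝ, 0 < η → ∃ n, ∀ w, eLpNorm (fun x => T w x - l n x w) (ENNReal.ofReal p) volume ≤ ENNReal.ofReal (η * ‖w‖))
    (w : ℕ → H) (w0 : H) (hw : ∀ n, ‖w n‖ = 1) (hw0 : ‖w0‖ ≤ 1) (h : ∀ L : H →L[ℂ] ℂ, Tendsto (fun n => L (w n)) atTop (𝓝 (L w0)))
    (hT : Tendsto (fun n => ‖T (w n)‖) atTop (𝓝 ‖T‖)) {β : ℝ} (hβ : 0 < β) :
    ‖T‖ ^ p ≤ ‖T w0‖ ^ p + (‖T‖ * √(1 - ‖w0‖ ^ 2) + β) ^ p := by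
  have hq : 1 ≤ ENNReal.ofReal p := Fact.out
  have hp0 : 0 < p := by linarith
  obtain ⟨B, hBm, hB, hBβ⟩ := (Lp.memLp (T w0)).exists_eLpNorm_indicator_compl_lt (by simp) (ε := ENNReal.ofReal β) (by simpa using hβ)
  rw [eLpNorm_indicator_eq_eLpNorm_restrict hBm.compl] at hBβ
  have hv0 : ∀ L : H →L[ℂ] ℂ, Tendsto (fun n => L (w n - w0)) atTop (𝓝 0) := by
    intro L
    have := (h L).sub_const (L w0)
    simpa using this
  have hv : ∀ n, ‖w n - w0‖ ≤ 2 := fun n => (norm_sub_le _ _).trans (by rw [hw n]; linarith)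
  have h1 := loc_conv hp T l hl hCb hAp (fun n => w n - w0) hv hv0 hB
  have nt : ∀ f : Lp ℂ (ENNReal.ofReal p) (volume : Measure (Rd d)), ∀ A : Set (Rd d), eLpNorm f (ENNReal.ofReal p) (volume.restrict A) ≠ ⊤ := by
    intro f A
    exact ne_top_of_le_ne_top (Lp.eLpNorm_ne_top f) (eLpNorm_mono_measure _ Measure.restrict_le_self)
  obtain ⟨δ, hδ⟩ : ∃ δ : ℕ → ℝ, δ = fun n => (eLpNorm (T (w n - w0)) (ENNReal.ofReal p) (volume.restrict B)).toReal := ⟨_, rfl⟩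
  have hδ0 : Tendsto δ atTop (𝓝 0) := by
    rw [hδ]
    have := (ENNReal.tendsto_toReal (by simp : (0:ℝ≥0∞) ≠ ⊤)).comp h1
    simpa [Function.comp_def] using this
  have hnn : ∀ f : Lp ℂ (ENNReal.ofReal p) (volume : Measure (Rd d)), ‖f‖ = (eLpNorm f (ENNReal.ofReal p) volume).toReal := fun f => Lp.norm_def f
  have sub : ∀ n, ∀ A : Set (Rd d), (eLpNorm (T (w n)) (ENNReal.ofReal p) (volume.restrict A)).toReal ≤
      (eLpNorm (T (w n - w0)) (ENNReal.ofReal p) (volume.restrict A)).toReal + (eLpNorm (T w0) (ENNReal.ofReal p) (volume.restrict A)).toReal := by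
    intro n A
    rw [← ENNReal.toReal_add (nt _ _) (nt _ _)]
    apply ENNReal.toReal_mono (ENNReal.add_ne_top.2 ⟨nt _ _, nt _ _⟩)
    have e : (⇑(T (w n)) : Rd d → ℂ) =ᵐ[volume.restrict A] ⇑(T (w n - w0)) + ⇑(T w0) := by
      apply ae_restrict_of_ae
      have : T (w n) = T (w n - w0) + T w0 := by rw [← map_add]; congr 1; abel
      conv_lhs => rw [this]
      exact Lp.coeFn_add _ _
    rw [eLpNorm_congr_ae e]
    exact eLpNorm_add_le (Lp.aestronglyMeasurable _).restrict (Lp.aestronglyMeasurable _).restrict hq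
  have mono : ∀ f : Lp ℂ (ENNReal.ofReal p) (volume : Measure (Rd d)), ∀ A : Set (Rd d), (eLpNorm f (ENNReal.ofReal p) (volume.restrict A)).toReal ≤ ‖f‖ := by
    intro f A
    rw [hnn]
    exact ENNReal.toReal_mono (Lp.eLpNorm_ne_top f) (eLpNorm_mono_measure _ Measure.restrict_le_self)
  have key : ∀ n, ‖T (w n)‖ ^ p ≤ (δ n + ‖T w0‖) ^ p + (‖T‖ * √(‖w n - w0‖ ^ 2) + β) ^ p := by
    intro n
    have e := eLp_split hp (T (w n)) hBm
    have e2 := congrArg ENNReal.toReal e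
    rw [ENNReal.toReal_add (ENNReal.rpow_ne_top_of_nonneg hp0.le (nt _ _)) (ENNReal.rpow_ne_top_of_nonneg hp0.le (nt _ _)),
      ← ENNReal.toReal_rpow, ← ENNReal.toReal_rpow, ← ENNReal.toReal_rpow, ← hnn] at e2
    rw [e2]
    apply add_le_add
    · apply Real.rpow_le_rpow ENNReal.toReal_nonneg _ hp0.le
      have s1 := sub n B
      have s2 := mono (T w0) B
      have s3 : (eLpNorm (T (w n - w0)) (ENNReal.ofReal p) (volume.restrict B)).toReal = δ n := by rw [hδ]
      linarith
    · apply Real.rpow_le_rpow ENNReal.toReal_nonneg _ hp0.le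
      rw [Real.sqrt_sq (norm_nonneg _)]
      have s1 := sub n Bᶜ
      have s2 := (mono (T (w n - w0)) Bᶜ).trans (T.le_opNorm _)
      have s3 : (eLpNorm (T w0) (ENNReal.ofReal p) (volume.restrict Bᶜ)).toReal ≤ β :=
        ENNReal.toReal_le_of_le_ofReal hβ.le hBβ.le
      linarith
  have l1 : Tendsto (fun n => ‖T (w n)‖ ^ p) atTop (𝓝 (‖T‖ ^ p)) := hT.rpow_const (Or.inr hp0.le)
  have l2 : Tendsto (fun n => (δ n + ‖T w0‖) ^ p) atTop (𝓝 (‖T w0‖ ^ p)) := by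
    have := (hδ0.add_const ‖T w0‖).rpow_const (p := p) (Or.inr hp0.le)
    simpa using this
  have l3 := ((((weak_norm w w0 hw h).sqrt).const_mul ‖T‖).add_const β).rpow_const (p := p) (Or.inr hp0.le)
  exact le_of_tendsto_of_tendsto' l1 (l2.add l3) key

theorem attain_abs [CompleteSpace H] [TopologicalSpace.SeparableSpace H] (hp : 2 < p) (T : H →L[ℂ] Lp ℂ (ENNReal.ofReal p) (volume : Measure (Rd d)))
    (l : ℕ → Rd d → H →L[ℂ] ℂ) (hl : ∀ n, Continuous (l n)) {Cb : ℕ → ℝ} (hCb : ∀ n x, ‖l n x‖ ≤ Cb n)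
    (hAp : ∀ η : ℝ, 0 < η → ∃ n, ∀ w, eLpNorm (fun x => T w x - l n x w) (ENNReal.ofReal p) volume ≤ ENNReal.ofReal (η * ‖w‖))
    (hT0 : T ≠ 0)
    (hNV : ∀ a : ℝ, 0 < a → ∃ c : ℝ, 0 < c ∧ ∃ (R : ℝ) (n : ℕ), ∀ w, ‖w‖ = 1 → a ≤ ‖T w‖ →
      ∃ w', ‖w'‖ = 1 ∧ ‖T w'‖ = ‖T w‖ ∧ ∃ y, ‖y‖ ≤ R ∧ c ≤ ‖l n y w'‖) :
    ∃ w, w ≠ 0 ∧ ‖T w‖ = ‖T‖ * ‖w‖ := by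
  have hK : 0 < ‖T‖ := norm_pos_iff.2 hT0
  obtain ⟨c, hc, R, m, hNV⟩ := hNV (‖T‖ / 2) (by positivity)
  have hseq : ∀ n : ℕ, ∃ w : H, ‖w‖ = 1 ∧ max (‖T‖ / 2) (‖T‖ - 1 / ((n:ℝ) + 1)) ≤ ‖T w‖ := by
    intro n
    have : max (‖T‖ / 2) (‖T‖ - 1 / ((n:ℝ) + 1)) < ‖T‖ := by
      apply max_lt (by linarith)
      have : 0 < 1 / ((n:ℝ) + 1) := by positivity
      linarith
    obtain ⟨x, hx1, hx2⟩ := T.exists_lt_apply_of_lt_opNorm this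
    have hm0 : 0 < max (‖T‖ / 2) (‖T‖ - 1 / ((n:ℝ) + 1)) := lt_of_lt_of_le (by positivity) (le_max_left _ _)
    have hx0 : x ≠ 0 := by
      rintro rfl
      simp at hx2
      rcases hx2 with ⟨h, _⟩
      linarith
    have hxp : 0 < ‖x‖ := norm_pos_iff.2 hx0
    refine ⟨((‖x‖⁻¹ : ℝ) : ℂ) • x, ?_, ?_⟩
    · rw [norm_smul, Complex.norm_real, norm_inv, norm_norm, inv_mul_cancel₀ hxp.ne']
    · rw [map_smul, norm_smul, Complex.norm_real, norm_inv, norm_norm]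
      have : 1 ≤ ‖x‖⁻¹ := (one_le_inv₀ hxp).2 hx1.le
      nlinarith
  choose u hu1 hu2 using hseq
  have hseq2 := fun n => hNV (u n) (hu1 n) ((le_max_left _ _).trans (hu2 n))
  choose w hw1 hw2 y hy1 hy2 using hseq2
  obtain ⟨φ, hφ, w0, hlim⟩ := weak_sub w (fun n => (hw1 n).le)
  obtain ⟨y0, -, ψ, hψ, hy0⟩ := (isCompact_closedBall (0 : Rd d) R).tendsto_subseq (x := fun n => y (φ n)) (fun n => by simpa using hy1 (φ n))
  have hlim2 : ∀ L : H →L[ℂ] ℂ, Tendsto (fun n => L (w (φ (ψ n)))) atTop (𝓝 (L w0)) := fun L => (hlim L).comp hψ.tendsto_atTop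
  have hT : Tendsto (fun n => ‖T (w (φ (ψ n)))‖) atTop (𝓝 ‖T‖) := by
    have : Tendsto (fun n => ‖T (w n)‖) atTop (𝓝 ‖T‖) := by
      have l1 : Tendsto (fun n : ℕ => ‖T‖ - 1 / ((n:ℝ) + 1)) atTop (𝓝 ‖T‖) := by
        simpa using tendsto_one_div_add_atTop_nhds_zero_nat.const_sub ‖T‖
      refine tendsto_of_tendsto_of_tendsto_of_le_of_le l1 tendsto_const_nhds (fun n => ?_) (fun n => ?_)
      · change _ ≤ ‖T (w n)‖
        rw [hw2]; exact (le_max_right _ _).trans (hu2 n)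
      · change ‖T (w n)‖ ≤ _
        have := T.le_opNorm (w n)
        rwa [hw1, mul_one] at this
    exact this.comp (hφ.tendsto_atTop.comp hψ.tendsto_atTop)
  have hne : w0 ≠ 0 := by
    intro h0
    have l1 := hlim2 (l m y0)
    rw [h0, map_zero] at l1
    have l2 : Tendsto (fun n => ‖l m (y (φ (ψ n))) - l m y0‖) atTop (𝓝 0) := by
      have := ((hl m).tendsto y0).comp hy0
      exact tendsto_iff_norm_sub_tendsto_zero.1 this
    have l3 := l2.add l1.norm
    simp only [norm_zero, add_zero] at l3
    have : c ≤ 0 := by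
      refine ge_of_tendsto' l3 fun n => ?_
      refine (hy2 (φ (ψ n))).trans ?_
      have e : l m (y (φ (ψ n))) (w (φ (ψ n))) = (l m (y (φ (ψ n))) - l m y0) (w (φ (ψ n))) + l m y0 (w (φ (ψ n))) := by simp
      rw [e]
      refine (norm_add_le _ _).trans ?_
      gcongr
      refine (ContinuousLinearMap.le_opNorm _ _).trans ?_
      rw [hw1, mul_one]
    linarith
  have hw0 : ‖w0‖ ≤ 1 := by
    have := ge_of_tendsto' (weak_norm _ w0 (fun n => hw1 (φ (ψ n))) hlim2) (fun n => by positivity)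
    nlinarith [norm_nonneg w0]
  refine ⟨w0, hne, ?_⟩
  have hβ := fun β (hβ : 0 < β) => mass_split hp T l hl hCb hAp _ w0 (fun n => hw1 (φ (ψ n))) hw0 hlim2 hT (β := β) hβ
  have hp0 : 0 < p := by linarith
  have hfin : ‖T‖ ^ p ≤ ‖T w0‖ ^ p + (‖T‖ * √(1 - ‖w0‖ ^ 2) + 0) ^ p := by
    have c1 : Tendsto (fun β : ℝ => ‖T w0‖ ^ p + (‖T‖ * √(1 - ‖w0‖ ^ 2) + β) ^ p) (𝓝[>] 0) (𝓝 (‖T w0‖ ^ p + (‖T‖ * √(1 - ‖w0‖ ^ 2) + 0) ^ p)) := by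
      apply Tendsto.mono_left _ nhdsWithin_le_nhds
      exact ((tendsto_id.const_add _).rpow_const (Or.inr hp0.le)).const_add _
    refine ge_of_tendsto c1 ?_
    filter_upwards [self_mem_nhdsWithin] with β h using hβ β h
  have ht2 : 0 ≤ 1 - ‖w0‖ ^ 2 := by nlinarith [norm_nonneg w0]
  rw [add_zero, Real.mul_rpow hK.le (Real.sqrt_nonneg _), Real.sqrt_eq_rpow, ← Real.rpow_mul ht2] at hfin
  have hle := T.le_opNorm w0
  have := compact_mass (p := p) (a := ‖T w0‖ / ‖T‖) (t := ‖w0‖) hp (norm_nonneg _) hw0 (by positivity) (by rw [div_le_iff₀ hK]; linarith) (by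
    rw [Real.div_rpow (norm_nonneg _) hK.le]
    have kp : 0 < ‖T‖ ^ p := by positivity
    have e : 1/2 * p = p / 2 := by ring
    rw [e] at hfin
    rw [div_add' _ _ _ kp.ne', le_div_iff₀ kp]
    linarith)
  rw [div_eq_iff hK.ne'] at this
  linarith
end Abs

/-- multiplier of the symbol -/
def gm (g : ℝ → ℝ) {d : ℕ} (ξ : Rd d) : ℝ := g ‖ξ‖ ^ (-(1/2) : ℝ)

/-- frequency side function from the Hilbert space variable -/
def Um (g : ℝ → ℝ) {d : ℕ} (W : Rd d → ℂ) : Rd d → ℂ := fun ξ => (gm g ξ : ℂ) * W ξ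

section UmS
variable {d : ℕ} {s a b : ℝ} {g : ℝ → ℝ}

theorem gm_pos (h : Comp s a b g) (ξ : Rd d) : 0 < gm g ξ := Real.rpow_pos_of_pos (h.pos _) _

theorem gm_meas (h : Comp s a b g) : Measurable (gm g : Rd d → ℝ) := (h.1.comp measurable_norm).pow_const _

theorem gm_sq (h : Comp s a b g) (ξ : Rd d) : gm g ξ ^ 2 * g ‖ξ‖ = 1 := by
  have hg := h.pos ‖ξ‖
  unfold gm
  rw [← Real.rpow_natCast, ← Real.rpow_mul hg.le]
  norm_num
  rw [Real.rpow_neg_one, inv_mul_cancel₀ hg.ne']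

theorem gm_bd (h : Comp s a b g) (hs : 0 ≤ s) (ξ : Rd d) : gm g ξ ≤ a ^ (-(1/2) : ℝ) := by
  have h1 := (h.2.2.2 ‖ξ‖).1
  have h2 : 1 ≤ (1 + ‖ξ‖ ^ 2) ^ s := Real.one_le_rpow (by nlinarith [norm_nonneg ξ]) hs
  have ha := h.2.1
  exact Real.rpow_le_rpow_of_nonpos ha (by nlinarith) (by norm_num)

theorem Um_memLp (h : Comp s a b g) (hs : 0 ≤ s) {W : Rd d → ℂ} (hW : MemLp W 2 volume) : MemLp (Um g W) 2 volume := by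
  refine (hW.const_mul ((a ^ (-(1/2) : ℝ) : ℝ) : ℂ)).mono ?_ (Eventually.of_forall fun ξ => ?_)
  · exact (Complex.measurable_ofReal.comp (gm_meas h)).aestronglyMeasurable.mul hW.1
  · unfold Um
    rw [norm_mul, norm_mul, Complex.norm_real, Complex.norm_real, Real.norm_of_nonneg (gm_pos h ξ).le]
    have := gm_bd h hs ξ
    have h3 := Real.rpow_pos_of_pos h.2.1 (-(1/2))
    rw [Real.norm_of_nonneg h3.le]
    gcongr

theorem Um_bd (h : Comp s a b g) (hs : 0 ≤ s) (W : Rd d → ℂ) :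
    eLpNorm (Um g W) 2 volume ≤ ENNReal.ofReal (a ^ (-(1/2) : ℝ)) * eLpNorm W 2 volume := by
  apply eLpNorm_le_mul_eLpNorm_of_ae_le_mul
  refine Eventually.of_forall fun ξ => ?_
  unfold Um
  rw [norm_mul, Complex.norm_real, Real.norm_of_nonneg (gm_pos h ξ).le]
  have := gm_bd h hs ξ
  gcongr

theorem Um_sq (h : Comp s a b g) (W : Rd d → ℂ) (ξ : Rd d) : ‖Um g W ξ‖ ^ 2 * g ‖ξ‖ = ‖W ξ‖ ^ 2 := by
  unfold Um
  rw [norm_mul, Complex.norm_real, Real.norm_of_nonneg (gm_pos h ξ).le, mul_pow]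
  have := gm_sq h ξ
  linear_combination ‖W ξ‖ ^ 2 * this

theorem Um_QL (h : Comp s a b g) (W : Rd d → ℂ) : QL g (Um g W) = eLpNorm W 2 volume ^ 2 := by
  rw [eLpNorm_two_sq]
  unfold QL
  congr 1
  ext ξ
  rw [← ofReal_norm, ← ofReal_norm, ← ENNReal.ofReal_pow (norm_nonneg _), ← ENNReal.ofReal_pow (norm_nonneg _), ← ENNReal.ofReal_mul (by positivity), Um_sq h]

theorem Um_Hs (h : Comp s a b g) (hs : 0 ≤ s) {W : Rd d → ℂ} (hW : MemLp W 2 volume) :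
    Integrable (fun ξ : Rd d => ‖Um g W ξ‖ ^ 2 * (1 + ‖ξ‖ ^ 2) ^ s) volume := by
  have h1 : Integrable (fun ξ => ‖W ξ‖ ^ 2) volume := (memLp_two_iff_integrable_sq_norm hW.1).1 hW
  refine (h1.const_mul a⁻¹).mono' ?_ (Eventually.of_forall fun ξ => ?_)
  · refine ((Um_memLp h hs hW).1.norm.pow 2).mul (Measurable.aestronglyMeasurable ?_)
    fun_prop
  · have ha := h.2.1
    rw [Real.norm_of_nonneg (by positivity), ← Um_sq h W ξ, inv_mul_eq_div, le_div_iff₀ ha]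
    have := mul_le_mul_of_nonneg_left (h.2.2.2 ‖ξ‖).1 (sq_nonneg ‖Um g W ξ‖)
    linarith

theorem Um_add (V W : Rd d → ℂ) : Um g (V + W) = Um g V + Um g W := by
  ext ξ; simp [Um, mul_add]

theorem Um_smul (c : ℂ) (W : Rd d → ℂ) : Um g (c • W) = c • Um g W := by
  ext ξ; simp [Um]; ring

theorem Um_congr {V W : Rd d → ℂ} (e : V =ᵐ[volume] W) : Um g V =ᵐ[volume] Um g W := by
  filter_upwards [e] with ξ hξ
  simp [Um, hξ]

theorem Um_sym {G : Set (Rd d ≃ₗᵢ[ℝ] Rd d)} {W : Rd d → ℂ} (h : SymF G W) : SymF G (Um g W) :=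
  h.mul (w := fun ξ => (gm g ξ : ℂ)) (fun e _ x => by unfold gm; rw [e.norm_map])

/-- high frequencies are small -/
theorem Um_high {p : ℝ} (h : Comp s a b g) (hs : 0 < s) (hp : 2 < p) (hsd : (d : ℝ) * (1/2 - 1/p) < s) {η : ℝ} (hη : 0 < η) :
    ∃ n : ℕ, ∀ W : Rd d → ℂ, MemLp W 2 volume →
      eLpNorm (IF ((Metric.ball (0 : Rd d) n)ᶜ.indicator (Um g W))) (ENNReal.ofReal p) volume ≤ ENNReal.ofReal η * eLpNorm W 2 volume := by
  obtain ⟨s', h1, h2⟩ := exists_between hsd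
  obtain ⟨C, hC, hS⟩ := sobolev (Rd d) hp (s := s') (by simpa using h1)
  have ha := h.2.1
  have hlim : Tendsto (fun n : ℕ => C * (a ^ (-(1/2) : ℝ) * (1 + (n:ℝ) ^ 2) ^ (-((s - s') / 2)))) atTop (𝓝 (C * (a ^ (-(1/2) : ℝ) * 0))) := by
    apply Tendsto.const_mul
    apply Tendsto.const_mul
    refine (tendsto_rpow_neg_atTop (by linarith : 0 < (s - s') / 2)).comp ?_
    apply tendsto_atTop_add_const_left
    exact (tendsto_pow_atTop (by norm_num)).comp tendsto_natCast_atTop_atTop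
  rw [mul_zero, mul_zero] at hlim
  obtain ⟨n, hn⟩ := (hlim.eventually (gt_mem_nhds hη)).exists
  refine ⟨n, fun W hW => ?_⟩
  have hm : MemLp ((Metric.ball (0 : Rd d) n)ᶜ.indicator (Um g W)) 2 volume := (Um_memLp h hs.le hW).indicator Metric.isOpen_ball.measurableSet.compl
  refine (hS _ hm).trans ?_
  have hb : eLpNorm (wt s' ((Metric.ball (0 : Rd d) n)ᶜ.indicator (Um g W))) 2 volume ≤
      ENNReal.ofReal (a ^ (-(1/2) : ℝ) * (1 + (n:ℝ) ^ 2) ^ (-((s - s') / 2))) * eLpNorm W 2 volume := by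
    apply eLpNorm_le_mul_eLpNorm_of_ae_le_mul
    refine Eventually.of_forall fun ξ => ?_
    unfold wt
    by_cases hξ : ξ ∈ (Metric.ball (0 : Rd d) n)ᶜ
    · rw [Set.indicator_of_mem hξ, norm_smul, Real.norm_of_nonneg (by positivity)]
      unfold Um
      rw [norm_mul, Complex.norm_real, Real.norm_of_nonneg (gm_pos h ξ).le, ← mul_assoc]
      apply mul_le_mul_of_nonneg_right _ (norm_nonneg _)
      have hn2 : (n:ℝ) ≤ ‖ξ‖ := by simpa using hξ
      have e1 : gm g ξ ≤ (a * (1 + ‖ξ‖ ^ 2) ^ s) ^ (-(1/2) : ℝ) :=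
        Real.rpow_le_rpow_of_nonpos (by positivity) (h.2.2.2 ‖ξ‖).1 (by norm_num)
      rw [Real.mul_rpow ha.le (by positivity), ← Real.rpow_mul (by positivity)] at e1
      calc (1 + ‖ξ‖ ^ 2) ^ (s' / 2) * gm g ξ ≤ (1 + ‖ξ‖ ^ 2) ^ (s' / 2) * (a ^ (-(1/2) : ℝ) * (1 + ‖ξ‖ ^ 2) ^ (s * -(1/2))) := by gcongr
        _ = a ^ (-(1/2) : ℝ) * ((1 + ‖ξ‖ ^ 2) ^ (s' / 2) * (1 + ‖ξ‖ ^ 2) ^ (s * -(1/2))) := by ring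
        _ = a ^ (-(1/2) : ℝ) * ((1 + ‖ξ‖ ^ 2) ^ (-((s - s') / 2))) := by
          rw [← Real.rpow_add (by positivity)]; congr 2; ring
        _ ≤ _ := by
          apply mul_le_mul_of_nonneg_left _ (by positivity)
          apply Real.rpow_le_rpow_of_nonpos (by positivity) _ (by linarith)
          gcongr
    · rw [Set.indicator_of_notMem hξ, smul_zero, norm_zero]; positivity
  refine (mul_le_mul_right hb _).trans ?_
  rw [← mul_assoc, ← ENNReal.ofReal_mul hC.le]
  exact mul_le_mul_left (ENNReal.ofReal_le_ofReal hn.le) _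
end UmS

/-- the symmetric subspace of `L²` -/
def HG (d : ℕ) (G : Set (Rd d ≃ₗᵢ[ℝ] Rd d)) : Submodule ℂ (Lp ℂ 2 (volume : Measure (Rd d))) where
  carrier := {w | SymF G w}
  add_mem' := by
    intro v w hv hw e he
    have h1 : ⇑(v + w) =ᵐ[volume] ⇑v + ⇑w := Lp.coeFn_add v w
    have h2 := e.measurePreserving.quasiMeasurePreserving.ae_eq_comp h1
    refine h2.trans (EventuallyEq.trans ?_ h1.symm)
    filter_upwards [hv e he, hw e he] with x hx hy
    simp only [Function.comp_apply, Pi.add_apply] at hx hy ⊢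
    rw [hx, hy]
  zero_mem' := by
    intro e he
    have h1 : ⇑(0 : Lp ℂ 2 (volume : Measure (Rd d))) =ᵐ[volume] 0 := Lp.coeFn_zero _ _ _
    have h2 := e.measurePreserving.quasiMeasurePreserving.ae_eq_comp h1
    exact h2.trans h1.symm
  smul_mem' := by
    intro c w hw e he
    have h1 : ⇑(c • w) =ᵐ[volume] c • ⇑w := Lp.coeFn_smul c w
    have h2 := e.measurePreserving.quasiMeasurePreserving.ae_eq_comp h1
    refine h2.trans (EventuallyEq.trans ?_ h1.symm)
    filter_upwards [hw e he] with x hx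
    simp only [Function.comp_apply, Pi.smul_apply] at hx ⊢
    rw [hx]

theorem HG_mem {d : ℕ} {G : Set (Rd d ≃ₗᵢ[ℝ] Rd d)} (w : Lp ℂ 2 (volume : Measure (Rd d))) : w ∈ HG d G ↔ SymF G w := Iff.rfl

theorem HG_closed (d : ℕ) (G : Set (Rd d ≃ₗᵢ[ℝ] Rd d)) : IsClosed (HG d G : Set (Lp ℂ 2 (volume : Measure (Rd d)))) := by
  have e : (HG d G : Set (Lp ℂ 2 (volume : Measure (Rd d)))) =
      ⋂ e ∈ G, {w | Lp.compMeasurePreservingₗᵢ ℂ (e : Rd d → Rd d) e.measurePreserving w = w} := by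
    ext w
    simp only [SetLike.mem_coe, HG_mem, Set.mem_iInter, Set.mem_ofPred_eq]
    refine forall₂_congr fun e he => ?_
    have h1 : ⇑(Lp.compMeasurePreservingₗᵢ ℂ (e : Rd d → Rd d) e.measurePreserving w) =ᵐ[volume] w ∘ e :=
      Lp.coeFn_compMeasurePreserving w e.measurePreserving
    constructor
    · intro h
      exact Lp.ext (h1.trans h)
    · intro h
      rw [h] at h1
      exact h1.symm
  rw [e]
  refine isClosed_biInter fun e he => ?_
  exact isClosed_eq (LinearIsometry.continuous _) continuous_id

theorem HG_complete (d : ℕ) (G : Set (Rd d ≃ₗᵢ[ℝ] Rd d)) : CompleteSpace (HG d G) :=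
  (HG_closed d G).completeSpace_coe

theorem HG_sep (d : ℕ) (G : Set (Rd d ≃ₗᵢ[ℝ] Rd d)) : TopologicalSpace.SeparableSpace (HG d G) := by
  have : Fact ((2:ℝ≥0∞) ≠ ∞) := ⟨by norm_num⟩
  have h1 : SecondCountableTopology (Lp ℂ 2 (volume : Measure (Rd d))) := inferInstance
  infer_instance

theorem ind_bd {d : ℕ} {f : Rd d → ℂ} (hf : Measurable f) {M : ℝ} {S : Set (Rd d)} (hS : MeasurableSet S) (hSf : volume S ≠ ∞)
    (h : ∀ ξ ∈ S, ‖f ξ‖ ≤ M) : MemLp (S.indicator f) 2 volume ∧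
      eLpNorm (S.indicator f) 2 volume ≤ volume S ^ (1/2 : ℝ) * ENNReal.ofReal M := by
  have h1 : eLpNorm (S.indicator f) 2 volume ≤ volume S ^ (1/2 : ℝ) * ENNReal.ofReal M := by
    rw [eLpNorm_indicator_eq_eLpNorm_restrict hS]
    have := eLpNorm_le_of_ae_bound (p := 2) (μ := volume.restrict S) (f := f) (C := M) ((ae_restrict_iff' hS).2 (Eventually.of_forall h))
    simpa using this
  exact ⟨⟨(hf.indicator hS).aestronglyMeasurable, h1.trans_lt (ENNReal.mul_lt_top (ENNReal.rpow_lt_top_of_nonneg (by norm_num) hSf) (by simp))⟩, h1⟩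

theorem ch_lip (s t : ℝ) : ‖ch s - ch t‖ ≤ 2 * π * |s - t| := by
  have e : ch s - ch t = ch t * (Complex.exp (Complex.I * ((2 * π * (s - t) : ℝ) : ℂ)) - 1) := by
    have : ch s = ch t * ch (s - t) := by rw [← ch_add]; ring_nf
    rw [this]
    unfold ch
    rw [mul_comm Complex.I]
    ring
  rw [e, norm_mul, ch_norm, one_mul]
  refine norm_exp_I_mul_ofReal_sub_one_le.trans ?_
  rw [Real.norm_eq_abs, abs_mul, abs_of_nonneg (by positivity : 0 ≤ 2 * π)]

/-- kernel of the low frequency evaluation functional -/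
def kk (g : ℝ → ℝ) {d : ℕ} (n : ℕ) (x : Rd d) : Rd d → ℂ :=
  (Metric.ball (0 : Rd d) n).indicator (fun ξ => ch (-⟪ξ, x⟫) * gm g ξ)

section KK
variable {d : ℕ} {s a b : ℝ} {g : ℝ → ℝ}

theorem kk_meas (h : Comp s a b g) (x : Rd d) : Measurable (fun ξ : Rd d => ch (-⟪ξ, x⟫) * (gm g ξ : ℂ)) :=
  Measurable.mul (ch_cont.comp (by fun_prop : Continuous fun ξ : Rd d => -⟪ξ, x⟫)).measurable (Complex.measurable_ofReal.comp (gm_meas h))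

theorem kk_bd (h : Comp s a b g) (hs : 0 ≤ s) (n : ℕ) (x : Rd d) : MemLp (kk g n x) 2 volume ∧
    eLpNorm (kk g n x) 2 volume ≤ volume (Metric.ball (0 : Rd d) n) ^ (1/2 : ℝ) * ENNReal.ofReal (a ^ (-(1/2) : ℝ)) := by
  apply ind_bd (kk_meas h x) Metric.isOpen_ball.measurableSet measure_ball_lt_top.ne
  intro ξ _
  rw [norm_mul, ch_norm, one_mul, Complex.norm_real, Real.norm_of_nonneg (gm_pos h ξ).le]
  exact gm_bd h hs ξ

theorem kk_lip (h : Comp s a b g) (hs : 0 ≤ s) (n : ℕ) (x y : Rd d) :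
    eLpNorm (kk g n x - kk g n y) 2 volume ≤ volume (Metric.ball (0 : Rd d) n) ^ (1/2 : ℝ) * ENNReal.ofReal (2 * π * n * a ^ (-(1/2) : ℝ) * ‖x - y‖) := by
  have e : kk g n x - kk g n y = (Metric.ball (0 : Rd d) n).indicator ((fun ξ => ch (-⟪ξ, x⟫) * (gm g ξ : ℂ)) - (fun ξ => ch (-⟪ξ, y⟫) * (gm g ξ : ℂ))) := by
    unfold kk
    rw [Set.indicator_sub']
  rw [e]
  refine (ind_bd ((kk_meas h x).sub (kk_meas h y)) Metric.isOpen_ball.measurableSet measure_ball_lt_top.ne ?_).2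
  intro ξ hξ
  have hξ' : ‖ξ‖ ≤ n := by simpa using (Metric.mem_ball.1 hξ).le
  rw [Pi.sub_apply, ← sub_mul, norm_mul, Complex.norm_real, Real.norm_of_nonneg (gm_pos h ξ).le]
  have h1 := ch_lip (-⟪ξ, x⟫) (-⟪ξ, y⟫)
  have h2 : |-⟪ξ, x⟫ - -⟪ξ, y⟫| ≤ n * ‖x - y‖ := by
    have : -⟪ξ, x⟫ - -⟪ξ, y⟫ = -⟪ξ, x - y⟫ := by rw [inner_sub_right]; ring
    rw [this, abs_neg]
    exact (abs_real_inner_le_norm _ _).trans (by gcongr)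
  have h3 := gm_bd h hs ξ
  have h4 := (gm_pos h ξ).le
  calc _ ≤ (2 * π * (n * ‖x - y‖)) * a ^ (-(1/2) : ℝ) := by
        apply mul_le_mul (h1.trans _) h3 h4 (by positivity)
        gcongr
    _ = _ := by ring

/-- the low-frequency evaluation functional -/
def lfun (h : Comp s a b g) (hs : 0 ≤ s) (n : ℕ) (x : Rd d) : Lp ℂ 2 (volume : Measure (Rd d)) →L[ℂ] ℂ :=
  innerSL ℂ ((kk_bd h hs n x).1.toLp (kk g n x))

theorem lfun_apply (h : Comp s a b g) (hs : 0 ≤ s) (n : ℕ) (x : Rd d) (w : Lp ℂ 2 (volume : Measure (Rd d))) :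
    lfun h hs n x w = 𝓕⁻ ((Metric.ball (0 : Rd d) n).indicator (Um g w)) x := by
  unfold lfun
  rw [innerSL_apply_apply, L2.inner_def, fourierInv_ch]
  apply integral_congr_ae
  filter_upwards [(kk_bd h hs n x).1.coeFn_toLp] with ξ hξ
  rw [hξ, RCLike.inner_apply]
  unfold kk Um
  by_cases hm : ξ ∈ Metric.ball (0 : Rd d) n
  · rw [Set.indicator_of_mem hm, Set.indicator_of_mem hm, map_mul, ch_neg_conj, Complex.conj_conj, Complex.conj_ofReal]
    ring
  · rw [Set.indicator_of_notMem hm, Set.indicator_of_notMem hm]; simp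

/-- constant bounding the functional -/
def Vn (d n : ℕ) : ℝ := (volume (Metric.ball (0 : Rd d) n) ^ (1/2 : ℝ)).toReal

theorem Vn_nonneg (d n : ℕ) : 0 ≤ Vn d n := ENNReal.toReal_nonneg

theorem lfun_norm (h : Comp s a b g) (hs : 0 ≤ s) (n : ℕ) (x : Rd d) : ‖lfun h hs n x‖ ≤ Vn d n * a ^ (-(1/2) : ℝ) := by
  unfold lfun
  rw [innerSL_apply_norm, Lp.norm_toLp]
  have h1 := (kk_bd h hs n x).2
  have ha := h.2.1
  have h2 : volume (Metric.ball (0 : Rd d) n) ^ (1/2 : ℝ) ≠ ⊤ := ENNReal.rpow_ne_top_of_nonneg (by norm_num) measure_ball_lt_top.ne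
  have := ENNReal.toReal_mono (ENNReal.mul_ne_top h2 (by simp)) h1
  rwa [ENNReal.toReal_mul, ENNReal.toReal_ofReal (by positivity)] at this

theorem lfun_lip (h : Comp s a b g) (hs : 0 ≤ s) (n : ℕ) (x y : Rd d) :
    ‖lfun h hs n x - lfun h hs n y‖ ≤ Vn d n * (2 * π * n * a ^ (-(1/2) : ℝ)) * ‖x - y‖ := by
  unfold lfun
  rw [← map_sub, innerSL_apply_norm, ← MemLp.toLp_sub, Lp.norm_toLp]
  have h1 := kk_lip h hs n x y
  have ha := h.2.1
  have h2 : volume (Metric.ball (0 : Rd d) n) ^ (1/2 : ℝ) ≠ ⊤ := ENNReal.rpow_ne_top_of_nonneg (by norm_num) measure_ball_lt_top.ne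
  have := ENNReal.toReal_mono (ENNReal.mul_ne_top h2 (by simp)) h1
  rw [ENNReal.toReal_mul, ENNReal.toReal_ofReal (by positivity)] at this
  rw [mul_assoc]
  exact this

theorem lfun_cont (h : Comp s a b g) (hs : 0 ≤ s) (n : ℕ) : Continuous (lfun h hs n : Rd d → _) := by
  have hK : 0 ≤ Vn d n * (2 * π * n * a ^ (-(1/2) : ℝ)) := by
    have := Vn_nonneg d n
    have := h.2.1
    positivity
  refine LipschitzWith.continuous (K := ⟨_, hK⟩) (LipschitzWith.of_dist_le_mul fun x y => ?_)
  rw [dist_eq_norm, dist_eq_norm]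
  exact lfun_lip h hs n x y
end KK

section TT
variable {d : ℕ} {s a b p : ℝ} {g : ℝ → ℝ}

theorem IF_Um_Lp (h : Comp s a b g) (hs : 0 < s) (hp : 2 < p) (hsd : (d : ℝ) * (1/2 - 1/p) < s) :
    ∃ K : ℝ, 0 < K ∧ ∀ W : Rd d → ℂ, MemLp W 2 volume →
      MemLp (IF (Um g W)) (ENNReal.ofReal p) volume ∧ eLpNorm (IF (Um g W)) (ENNReal.ofReal p) volume ≤ ENNReal.ofReal K * eLpNorm W 2 volume := by
  obtain ⟨K, hK, hS⟩ := sob_comp h hp hsd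
  refine ⟨K, hK, fun W hW => ?_⟩
  have h1 := hS _ (Um_memLp h hs.le hW)
  rw [Um_QL h, ← ENNReal.rpow_natCast, ← ENNReal.rpow_mul] at h1
  norm_num at h1
  exact ⟨⟨(IF_memLp (Um_memLp h hs.le hW)).1, h1.trans_lt (ENNReal.mul_lt_top (by simp) hW.2)⟩, h1⟩

theorem exists_T [Fact (1 ≤ ENNReal.ofReal p)] (h : Comp s a b g) (hs : 0 < s) (hp : 2 < p) (hsd : (d : ℝ) * (1/2 - 1/p) < s) :
    ∃ T : Lp ℂ 2 (volume : Measure (Rd d)) →L[ℂ] Lp ℂ (ENNReal.ofReal p) (volume : Measure (Rd d)),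
      ∀ w, ⇑(T w) =ᵐ[volume] IF (Um g w) := by
  obtain ⟨K, hK, hS⟩ := IF_Um_Lp (d := d) h hs hp hsd
  have um := fun w : Lp ℂ 2 (volume : Measure (Rd d)) => Um_memLp h hs.le (Lp.memLp w)
  let L : Lp ℂ 2 (volume : Measure (Rd d)) →ₗ[ℂ] Lp ℂ (ENNReal.ofReal p) (volume : Measure (Rd d)) :=
    { toFun := fun w => (hS w (Lp.memLp w)).1.toLp _
      map_add' := by
        intro v w
        apply Lp.ext
        refine ((hS _ (Lp.memLp (v + w))).1.coeFn_toLp).trans (EventuallyEq.trans ?_ (Lp.coeFn_add _ _).symm)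
        have e1 : IF (Um g ⇑(v + w)) =ᵐ[volume] IF (Um g v) + IF (Um g w) := by
          refine (IF_congr (Um_congr (Lp.coeFn_add v w))).trans ?_
          rw [Um_add]
          exact IF_add (um v) (um w)
        filter_upwards [e1, (hS _ (Lp.memLp v)).1.coeFn_toLp, (hS _ (Lp.memLp w)).1.coeFn_toLp] with x h1 h2 h3
        rw [h1, Pi.add_apply, Pi.add_apply, h2, h3]
      map_smul' := by
        intro c w
        apply Lp.ext
        refine ((hS _ (Lp.memLp (c • w))).1.coeFn_toLp).trans (EventuallyEq.trans ?_ (Lp.coeFn_smul _ _).symm)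
        have e1 : IF (Um g ⇑(c • w)) =ᵐ[volume] c • IF (Um g w) := by
          refine (IF_congr (Um_congr (Lp.coeFn_smul c w))).trans ?_
          rw [Um_smul]
          exact IF_smul (um w) c
        filter_upwards [e1, (hS _ (Lp.memLp w)).1.coeFn_toLp] with x h1 h2
        rw [h1, Pi.smul_apply, Pi.smul_apply, h2]
        rfl }
  refine ⟨L.mkContinuous K ?_, ?_⟩
  · intro w
    change ‖(hS w (Lp.memLp w)).1.toLp _‖ ≤ _
    rw [Lp.norm_toLp, Lp.norm_def]
    have := ENNReal.toReal_mono (ENNReal.mul_ne_top (by simp) (Lp.eLpNorm_ne_top w)) (hS w (Lp.memLp w)).2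
    rwa [ENNReal.toReal_mul, ENNReal.toReal_ofReal hK.le] at this
  · intro w
    exact (hS w (Lp.memLp w)).1.coeFn_toLp

theorem lfun_ae (h : Comp s a b g) (hs : 0 ≤ s) (n : ℕ) (w : Lp ℂ 2 (volume : Measure (Rd d))) :
    (fun x => lfun h hs n x w) =ᵐ[volume] IF ((Metric.ball (0 : Rd d) n).indicator (Um g w)) := by
  have hm := (Um_memLp h hs (Lp.memLp w)).indicator (Metric.isOpen_ball (x := (0 : Rd d)) (ε := n)).measurableSet
  have hi := (sup_bound hm (S := Metric.ball (0 : Rd d) n) Metric.isOpen_ball.measurableSet measure_ball_lt_top.ne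
    (fun ξ hξ => Set.indicator_of_notMem hξ _)).1
  filter_upwards [IF_eq_integral hm hi] with x hx
  rw [hx, lfun_apply]

theorem T_Ap [Fact (1 ≤ ENNReal.ofReal p)] (h : Comp s a b g) (hs : 0 < s) (hp : 2 < p) (hsd : (d : ℝ) * (1/2 - 1/p) < s)
    (T : Lp ℂ 2 (volume : Measure (Rd d)) →L[ℂ] Lp ℂ (ENNReal.ofReal p) (volume : Measure (Rd d)))
    (hT : ∀ w, ⇑(T w) =ᵐ[volume] IF (Um g w)) (η : ℝ) (hη : 0 < η) :
    ∃ n, ∀ w, eLpNorm (fun x => T w x - lfun h hs.le n x w) (ENNReal.ofReal p) volume ≤ ENNReal.ofReal (η * ‖w‖) := by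
  obtain ⟨n, hn⟩ := Um_high (d := d) h hs hp hsd hη
  refine ⟨n, fun w => ?_⟩
  have hu := Um_memLp h hs.le (Lp.memLp w)
  have hm := hu.indicator (Metric.isOpen_ball (x := (0 : Rd d)) (ε := n)).measurableSet
  have e : (fun x => T w x - lfun h hs.le n x w) =ᵐ[volume] IF ((Metric.ball (0 : Rd d) n)ᶜ.indicator (Um g w)) := by
    have e1 : (Metric.ball (0 : Rd d) n)ᶜ.indicator (Um g w) = Um g w - (Metric.ball (0 : Rd d) n).indicator (Um g w) := by
      rw [Set.indicator_compl]
    rw [e1]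
    filter_upwards [hT w, lfun_ae h hs.le n w, IF_sub hu hm] with x h1 h2 h3
    rw [h1, h2, h3, Pi.sub_apply]
  rw [eLpNorm_congr_ae e]
  refine (hn w (Lp.memLp w)).trans ?_
  rw [ENNReal.ofReal_mul hη.le, Lp.norm_def, ENNReal.ofReal_toReal (Lp.eLpNorm_ne_top w)]

/-- modulation becomes translation -/
theorem IF_translate {U : Rd d → ℂ} (hU : MemLp U 2 volume) (y : Rd d) :
    IF (fun ξ => ch ⟪ξ, y⟫ * U ξ) =ᵐ[volume] fun x => IF U (x + y) := by
  have cm : Continuous fun ξ : Rd d => ch ⟪ξ, y⟫ := ch_cont.comp (by fun_prop)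
  have mod : ∀ V : Rd d → ℂ, MemLp V 2 volume → MemLp (fun ξ => ch ⟪ξ, y⟫ * V ξ) 2 volume := fun V hV =>
    hV.mono (cm.aestronglyMeasurable.mul hV.1) (Eventually.of_forall fun ξ => by rw [norm_mul, ch_norm, one_mul])
  have mp : MeasurePreserving (fun x : Rd d => x + y) volume volume := measurePreserving_add_right volume y
  have hV := mod U hU
  have hA := IF_memLp hV
  have hB : MemLp (fun x => IF U (x + y)) 2 volume := (IF_memLp hU).comp_measurePreserving mp
  have hbound : ∀ n : ℕ, eLpNorm (IF (fun ξ => ch ⟪ξ, y⟫ * U ξ) - fun x => IF U (x + y)) 2 volume ≤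
      2 * eLpNorm ((Metric.ball (0 : Rd d) n).indicator U - U) 2 volume := by
    intro n
    have hm := hU.indicator (Metric.isOpen_ball (x := (0 : Rd d)) (ε := n)).measurableSet
    obtain ⟨Un, hUn⟩ : ∃ Un, Un = (Metric.ball (0 : Rd d) n).indicator U := ⟨_, rfl⟩
    rw [← hUn] at hm ⊢
    have z : ∀ ξ, ξ ∉ Metric.ball (0 : Rd d) n → Un ξ = 0 := fun ξ hξ => by rw [hUn]; exact Set.indicator_of_notMem hξ _
    have hi := (sup_bound hm (S := Metric.ball (0 : Rd d) n) Metric.isOpen_ball.measurableSet measure_ball_lt_top.ne z).1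
    have hi2 := (sup_bound (mod Un hm) (S := Metric.ball (0 : Rd d) n) Metric.isOpen_ball.measurableSet measure_ball_lt_top.ne
      (fun ξ hξ => by rw [z ξ hξ, mul_zero])).1
    have e1 : IF (fun ξ => ch ⟪ξ, y⟫ * Un ξ) =ᵐ[volume] fun x => IF Un (x + y) := by
      have q := mp.quasiMeasurePreserving.ae_eq_comp (IF_eq_integral hm hi)
      refine (IF_eq_integral (mod Un hm) hi2).trans (EventuallyEq.trans ?_ q.symm)
      refine Eventually.of_forall fun x => ?_
      simp only [Function.comp_apply]
      rw [fourierInv_ch, fourierInv_ch]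
      congr 1
      ext ξ
      rw [inner_add_right, ch_add]
      ring
    have e2 : IF (fun ξ => ch ⟪ξ, y⟫ * U ξ) - (fun x => IF U (x + y)) =ᵐ[volume]
        (IF ((fun ξ => ch ⟪ξ, y⟫ * U ξ) - fun ξ => ch ⟪ξ, y⟫ * Un ξ)) + ((fun x => IF (Un - U) (x + y))) := by
      have q := mp.quasiMeasurePreserving.ae_eq_comp (IF_sub hm hU)
      filter_upwards [e1, q, IF_sub (mod U hU) (mod Un hm)] with x h1 h2 h3
      simp only [Function.comp_apply, Pi.sub_apply, Pi.add_apply] at h1 h2 h3 ⊢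
      rw [h2, h3, h1]
      ring
    rw [eLpNorm_congr_ae e2, two_mul]
    have hd := hm.sub hU
    refine (eLpNorm_add_le (IF_memLp ((mod U hU).sub (mod Un hm))).1 ((IF_memLp hd).comp_measurePreserving mp).1 (by norm_num)).trans ?_
    apply add_le_add
    · rw [IF_norm ((mod U hU).sub (mod Un hm))]
      apply eLpNorm_mono
      intro ξ
      simp only [Pi.sub_apply]
      rw [← mul_sub, norm_mul, ch_norm, one_mul, norm_sub_rev]
    · rw [← IF_norm hd]
      exact (eLpNorm_comp_measurePreserving (IF_memLp hd).1 mp).le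
  have hl : Tendsto (fun n : ℕ => 2 * eLpNorm ((Metric.ball (0 : Rd d) n).indicator U - U) 2 volume) atTop (𝓝 (2 * 0)) :=
    ENNReal.Tendsto.const_mul (trunc_tendsto hU) (Or.inr (by norm_num))
  rw [mul_zero] at hl
  have h0 : eLpNorm (IF (fun ξ => ch ⟪ξ, y⟫ * U ξ) - fun x => IF U (x + y)) 2 volume = 0 :=
    le_antisymm (ge_of_tendsto' hl hbound) bot_le
  rw [eLpNorm_eq_zero_iff (hA.sub hB).1 (by norm_num)] at h0
  filter_upwards [h0] with x hx
  exact sub_eq_zero.1 hx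

/-- every symmetric frequency function has an exactly symmetric inverse transform -/
theorem exists_rep {G : Set (Rd d ≃ₗᵢ[ℝ] Rd d)} {U : Rd d → ℂ} (hU : MemLp U 2 volume) (hG : SymF G U) :
    ∃ v : Rd d → ℂ, v =ᵐ[volume] IF U ∧ InvG G v := by
  obtain ⟨ns, -, hns⟩ := trunc_ae hU
  classical
  obtain ⟨f, hf⟩ : ∃ f : ℕ → Rd d → ℂ, f = fun i => 𝓕⁻ ((Metric.ball (0 : Rd d) (ns i)).indicator U) := ⟨_, rfl⟩
  have hm := fun i => hU.indicator (Metric.isOpen_ball (x := (0 : Rd d)) (ε := ns i)).measurableSet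
  have hi := fun i => (sup_bound (hm i) (S := Metric.ball (0 : Rd d) (ns i)) Metric.isOpen_ball.measurableSet measure_ball_lt_top.ne
    (fun ξ hξ => Set.indicator_of_notMem hξ _)).1
  refine ⟨fun x => limUnder atTop (fun i => f i x), ?_, ?_⟩
  · have h2 : ∀ᵐ x, ∀ i, IF ((Metric.ball (0 : Rd d) (ns i)).indicator U) x = f i x := by
      rw [ae_all_iff]
      intro i
      rw [hf]
      exact IF_eq_integral (hm i) (hi i)
    filter_upwards [hns, h2] with x h1 h2
    simp only [h2] at h1
    exact h1.limUnder_eq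
  · intro e he x
    have : ∀ i, f i (e x) = f i x := by
      intro i
      rw [hf]
      exact symF_inv (hG.indicator (fun e _ x => by simp)) e he x
    simp only [this]
end TT

section NV
variable {d : ℕ} {s a b p : ℝ} {g : ℝ → ℝ}

theorem lfun_L2 (h : Comp s a b g) (hs : 0 ≤ s) (n : ℕ) (w : Lp ℂ 2 (volume : Measure (Rd d))) (hw : ‖w‖ = 1) :
    eLpNorm (fun x => lfun h hs n x w) 2 volume ≤ ENNReal.ofReal (a ^ (-(1/2) : ℝ)) := by
  have hu := Um_memLp h hs (Lp.memLp w)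
  have hm := hu.indicator (Metric.isOpen_ball (x := (0 : Rd d)) (ε := n)).measurableSet
  rw [eLpNorm_congr_ae (lfun_ae h hs n w), IF_norm hm]
  refine (eLpNorm_indicator_le _).trans ((Um_bd h hs _).trans ?_)
  have : eLpNorm w 2 volume = 1 := by
    rw [Lp.norm_def] at hw
    rw [← ENNReal.ofReal_toReal (Lp.eLpNorm_ne_top w), hw, ENNReal.ofReal_one]
  rw [this, mul_one]

theorem big_val [Fact (1 ≤ ENNReal.ofReal p)] (h : Comp s a b g) (hs : 0 < s) (hp : 2 < p) (hsd : (d : ℝ) * (1/2 - 1/p) < s)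
    (T : Lp ℂ 2 (volume : Measure (Rd d)) →L[ℂ] Lp ℂ (ENNReal.ofReal p) (volume : Measure (Rd d)))
    (hT : ∀ w, ⇑(T w) =ᵐ[volume] IF (Um g w)) (a0 : ℝ) (ha0 : 0 < a0) :
    ∃ c : ℝ, 0 < c ∧ ∃ n : ℕ, ∀ w, ‖w‖ = 1 → a0 ≤ ‖T w‖ → ∃ y, c ≤ ‖lfun h hs.le n y w‖ := by
  obtain ⟨n, hn⟩ := T_Ap h hs hp hsd T hT (a0 / 2) (by positivity)
  have ha := h.2.1
  have hq : 1 ≤ ENNReal.ofReal p := Fact.out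
  have hθ : 0 < 1 - 2 / p := by
    have : 2 / p < 1 := by rw [div_lt_one (by linarith)]; exact hp
    linarith
  obtain ⟨M, hM⟩ : ∃ M : ℝ, M = (a ^ (-(1/2) : ℝ)) ^ (2/p) := ⟨_, rfl⟩
  have hM0 : 0 < M := by rw [hM]; positivity
  refine ⟨(a0 / 4 / M) ^ (1 / (1 - 2/p)), by positivity, n, fun w hw hTw => ?_⟩
  by_contra! hcon
  have h1 := interp_bound (f := fun x => lfun h hs.le n x w) (μ := volume) hp (A := ENNReal.ofReal ((a0 / 4 / M) ^ (1 / (1 - 2/p)))) (by simp)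
    (Eventually.of_forall fun x => by rw [← ofReal_norm]; exact ENNReal.ofReal_le_ofReal (hcon x).le)
  have h2 := lfun_L2 h hs.le n w hw
  have h3 : eLpNorm (fun x => lfun h hs.le n x w) (ENNReal.ofReal p) volume ≤ ENNReal.ofReal (a0 / 4) := by
    refine h1.trans ((mul_le_mul_right (ENNReal.rpow_le_rpow h2 (by positivity)) _).trans ?_)
    rw [ENNReal.ofReal_rpow_of_pos (by positivity), ENNReal.ofReal_rpow_of_pos (by positivity), ← hM, ← Real.rpow_mul (by positivity),
      one_div_mul_cancel hθ.ne', Real.rpow_one, ← ENNReal.ofReal_mul (by positivity), div_mul_cancel₀ _ hM0.ne']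
  have h4 := hn w
  rw [hw, mul_one] at h4
  have hc : Continuous fun x => lfun h hs.le n x w := (lfun_cont h hs.le n).clm_apply continuous_const
  have e : (⇑(T w) : Rd d → ℂ) = (fun x => T w x - lfun h hs.le n x w) + (fun x => lfun h hs.le n x w) := by
    ext x; simp
  have h5 : eLpNorm (T w) (ENNReal.ofReal p) volume ≤ ENNReal.ofReal (a0 / 2 + a0 / 4) := by
    calc eLpNorm (T w) (ENNReal.ofReal p) volume = eLpNorm ((fun x => T w x - lfun h hs.le n x w) + (fun x => lfun h hs.le n x w)) (ENNReal.ofReal p) volume := by rw [← e]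
      _ ≤ _ := eLpNorm_add_le ((Lp.aestronglyMeasurable _).sub hc.aestronglyMeasurable) hc.aestronglyMeasurable hq
      _ ≤ ENNReal.ofReal (a0 / 2) + ENNReal.ofReal (a0 / 4) := add_le_add h4 h3
      _ = _ := (ENNReal.ofReal_add (by positivity) (by positivity)).symm
  have h6 : ‖T w‖ ≤ a0 / 2 + a0 / 4 := by
    rw [Lp.norm_def]; exact ENNReal.toReal_le_of_le_ofReal (by positivity) h5
  linarith

/-- separated orbit points far away -/
theorem orbit_pts {m : ℕ} (hd : 2 ≤ d) (hm : m = 0 ∨ (2 ≤ m ∧ m ≤ d / 2)) {ρ : ℝ} (hρ : 0 < ρ) (N : ℕ) :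
    ∃ R : ℝ, ∀ y : Rd d, R < ‖y‖ → ∃ z : Fin N → Rd d, (∀ l, blockSq d m (z l) = blockSq d m y ∧ ‖z l‖ = ‖y‖) ∧
      ∀ l l', l ≠ l' → 2 * ρ ≤ dist (z l) (z l') := by
  refine ⟨4 * ρ * N, fun y hy => ?_⟩
  -- choose the block
  have hnorm : ∀ x : Rd d, ‖x‖ ^ 2 = ∑ i, x i ^ 2 := fun x => by
    rw [EuclideanSpace.norm_sq_eq]; simp
  have hblock : ∃ B : Finset (Fin d), (∃ i1 ∈ B, ∃ i2 ∈ B, i1 ≠ i2) ∧ ((4 * ρ * N) ^ 2 / 2 ≤ ∑ i ∈ B, y i ^ 2) ∧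
      (∀ z : Rd d, (∀ i ∉ B, z i = y i) → ∑ i ∈ B, z i ^ 2 = ∑ i ∈ B, y i ^ 2 → blockSq d m z = blockSq d m y) := by
    have hy2 : (4 * ρ * N) ^ 2 ≤ ‖y‖ ^ 2 := by gcongr
    have hsp : ∀ x : Rd d, ∑ i ∈ Finset.univ.filter (fun i : Fin d => (i:ℕ) < d - m), x i ^ 2 + ∑ i ∈ Finset.univ.filter (fun i : Fin d => ¬ (i:ℕ) < d - m), x i ^ 2 = ‖x‖ ^ 2 := by
      intro x
      rw [hnorm, Finset.sum_filter_add_sum_filter_not]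
    have hbs : ∀ x : Rd d, blockSq d m x = ∑ i ∈ Finset.univ.filter (fun i : Fin d => (i:ℕ) < d - m), x i ^ 2 := by
      intro x
      unfold blockSq
      rw [Finset.sum_filter]
    by_cases hc : (4 * ρ * N) ^ 2 / 2 ≤ ∑ i ∈ Finset.univ.filter (fun i : Fin d => (i:ℕ) < d - m), y i ^ 2
    · refine ⟨_, ⟨⟨0, by omega⟩, ?_, ⟨1, by omega⟩, ?_, ?_⟩, hc, ?_⟩
      · simp; omega
      · simp; omega
      · simp
      · intro z _ hz
        rw [hbs, hbs, hz]
    · have hm2 : 2 ≤ m ∧ m ≤ d / 2 := by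
        rcases hm with rfl | h
        · exfalso
          apply hc
          have e0 : Finset.univ.filter (fun i : Fin d => (i:ℕ) < d - 0) = Finset.univ := by
            ext i; simp
          rw [e0, ← hnorm]
          nlinarith [sq_nonneg (4 * ρ * N)]
        · exact h
      refine ⟨Finset.univ.filter (fun i : Fin d => ¬ (i:ℕ) < d - m), ⟨⟨d - 1, by omega⟩, ?_, ⟨d - 2, by omega⟩, ?_, ?_⟩, ?_, ?_⟩
      · simp; omega
      · simp; omega
      · simp; omega
      · have := hsp y
        linarith
      · intro z hz _
        rw [hbs, hbs]
        apply Finset.sum_congr rfl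
        intro i hi
        rw [hz i]
        have h3 := (Finset.mem_filter.1 hi).2
        simp
        omega
  obtain ⟨B, ⟨i1, hi1, i2, hi2, hne⟩, hB, hBs⟩ := hblock
  obtain ⟨r, hr⟩ : ∃ r, r = ∑ i ∈ B, y i ^ 2 := ⟨_, rfl⟩
  let z : Fin N → Rd d := fun l => WithLp.toLp 2 (fun i => if i ∈ B then (if i = i1 then √(r - (2 * ρ * (l:ℕ)) ^ 2) else if i = i2 then 2 * ρ * (l:ℕ) else 0) else y i)
  have hz : ∀ l i, z l i = if i ∈ B then (if i = i1 then √(r - (2 * ρ * (l:ℕ)) ^ 2) else if i = i2 then 2 * ρ * (l:ℕ) else 0) else y i := fun l i => rfl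
  have hsum : ∀ l, ∑ i ∈ B, z l i ^ 2 = r := by
    intro l
    have hl : (2 * ρ * ((l:ℕ):ℝ)) ^ 2 ≤ r := by
      have : ((l:ℕ):ℝ) ≤ N := by exact_mod_cast l.2.le
      have h2 : (2 * ρ * ((l:ℕ):ℝ)) ^ 2 ≤ (2 * ρ * N) ^ 2 := by gcongr
      rw [← hr] at hB
      nlinarith [sq_nonneg (ρ * N)]
    have e : ∀ i ∈ B, z l i ^ 2 = (if i = i1 then r - (2 * ρ * ((l:ℕ):ℝ)) ^ 2 else 0) + (if i = i2 then (2 * ρ * ((l:ℕ):ℝ)) ^ 2 else 0) := by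
      intro i hi
      rw [hz, if_pos hi]
      by_cases h1 : i = i1
      · have h2 : i ≠ i2 := fun h => hne (h1.symm.trans h)
        rw [if_pos h1, if_pos h1, if_neg h2, Real.sq_sqrt (by linarith)]
        ring
      · rw [if_neg h1, if_neg h1]
        by_cases h2 : i = i2
        · rw [if_pos h2, if_pos h2]; ring
        · rw [if_neg h2, if_neg h2]; ring
    rw [Finset.sum_congr rfl e, Finset.sum_add_distrib, Finset.sum_ite_eq' B i1, Finset.sum_ite_eq' B i2, if_pos hi1, if_pos hi2]
    ring
  have hout : ∀ l, ∀ i ∉ B, z l i = y i := fun l i hi => by rw [hz, if_neg hi]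
  refine ⟨z, fun l => ⟨hBs _ (hout l) ((hsum l).trans hr), ?_⟩, ?_⟩
  · have e : ‖z l‖ ^ 2 = ‖y‖ ^ 2 := by
      rw [hnorm, hnorm, ← Finset.sum_add_sum_compl B, ← Finset.sum_add_sum_compl B (fun i => y i ^ 2), hsum l, hr]
      congr 1
      apply Finset.sum_congr rfl
      intro i hi
      rw [hout l i (by simpa using hi)]
    exact (sq_eq_sq₀ (norm_nonneg _) (norm_nonneg _)).1 e
  · intro l l' hll
    have e1 : |z l i2 - z l' i2| ≤ dist (z l) (z l') := by
      rw [dist_eq_norm]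
      have := PiLp.norm_apply_le (z l - z l') i2
      simpa using this
    refine le_trans ?_ e1
    rw [hz, hz, if_pos hi2, if_pos hi2, if_neg hne.symm, if_neg hne.symm, if_pos rfl, if_pos rfl, ← mul_sub, abs_mul, abs_of_pos (by positivity)]
    have h1 : (1:ℝ) ≤ |((l:ℕ):ℝ) - ((l':ℕ):ℝ)| := by
      have h2 : ((l:ℕ):ℤ) - ((l':ℕ):ℤ) ≠ 0 := by
        intro h; apply hll; ext; omega
      have h3 := Int.one_le_abs h2
      exact_mod_cast h3
    nlinarith
end NV

section SB
variable {d : ℕ} {s a b p : ℝ} {g : ℝ → ℝ}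

theorem sym_bdd (h : Comp s a b g) (hs : 0 ≤ s) {m : ℕ} (hd : 2 ≤ d) (hm : m = 0 ∨ (2 ≤ m ∧ m ≤ d / 2)) {c : ℝ} (hc : 0 < c) (n : ℕ) :
    ∃ R : ℝ, ∀ w : Lp ℂ 2 (volume : Measure (Rd d)), SymF (Gm d m) w → ‖w‖ = 1 → ∀ y, c ≤ ‖lfun h hs n y w‖ → ‖y‖ ≤ R := by
  have ha := h.2.1
  have hV := Vn_nonneg d n
  obtain ⟨Λ, hΛ⟩ : ∃ Λ, Λ = Vn d n * (2 * π * n * a ^ (-(1/2) : ℝ)) + 1 := ⟨_, rfl⟩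
  have hΛ0 : 0 < Λ := by rw [hΛ]; positivity
  obtain ⟨ρ, hρ⟩ : ∃ ρ, ρ = c / (2 * Λ) := ⟨_, rfl⟩
  have hρ0 : 0 < ρ := by rw [hρ]; positivity
  obtain ⟨v, hv⟩ : ∃ v, v = (volume (Metric.ball (0 : Rd d) ρ)).toReal := ⟨_, rfl⟩
  have hv0 : 0 < v := by
    rw [hv]
    exact ENNReal.toReal_pos (Metric.measure_ball_pos _ _ hρ0).ne' measure_ball_lt_top.ne
  obtain ⟨N, hN⟩ := exists_nat_gt ((a ^ (-(1/2) : ℝ)) ^ 2 / ((c / 2) ^ 2 * v))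
  obtain ⟨R, hR⟩ := orbit_pts hd hm hρ0 N
  refine ⟨R, fun w hw hw1 y hy => ?_⟩
  by_contra! hcon
  obtain ⟨z, hz1, hz2⟩ := hR y hcon
  have hgk : GkSymmetric d m (fun x => lfun h hs n x w) := by
    rw [gk_iff]
    have : (fun x => lfun h hs n x w) = 𝓕⁻ ((Metric.ball (0 : Rd d) n).indicator (Um g w)) := by
      ext x; exact lfun_apply h hs n x w
    rw [this]
    exact symF_inv ((Um_sym hw).indicator (fun e _ x => by simp))
  have hlow : ∀ l, ∀ x ∈ Metric.ball (z l) ρ, c / 2 ≤ ‖lfun h hs n x w‖ := by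
    intro l x hx
    have e1 : lfun h hs n (z l) w = lfun h hs n y w := hgk _ _ (hz1 l).1 (hz1 l).2
    have e2 : ‖lfun h hs n (z l) w - lfun h hs n x w‖ ≤ Λ * ρ := by
      rw [← ContinuousLinearMap.sub_apply]
      refine (ContinuousLinearMap.le_opNorm _ _).trans ?_
      rw [hw1, mul_one]
      refine (lfun_lip h hs n _ _).trans ?_
      have h3 : ‖z l - x‖ ≤ ρ := by
        rw [← dist_eq_norm, dist_comm]; exact (Metric.mem_ball.1 hx).le
      apply mul_le_mul _ h3 (norm_nonneg _) hΛ0.le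
      rw [hΛ]; linarith
    have e3 : Λ * ρ = c / 2 := by rw [hρ]; field_simp
    rw [e1, e3] at e2
    have e4 := norm_sub_norm_le (lfun h hs n y w) (lfun h hs n x w)
    linarith
  have hdisj : Pairwise (Function.onFun Disjoint fun l => Metric.ball (z l) ρ) := by
    intro l l' hll
    apply Metric.ball_disjoint_ball
    have := hz2 l l' hll
    linarith
  have hL2 := lfun_L2 h hs n w hw1
  have h5 : eLpNorm (fun x => lfun h hs n x w) 2 volume ^ 2 ≤ ENNReal.ofReal ((a ^ (-(1/2) : ℝ)) ^ 2) := by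
    rw [ENNReal.ofReal_pow (by positivity)]
    exact pow_le_pow_left' hL2 2
  rw [eLpNorm_two_sq] at h5
  have h6 : ENNReal.ofReal (N * ((c / 2) ^ 2 * v)) ≤ ∫⁻ x, ‖lfun h hs n x w‖ₑ ^ 2 := by
    refine le_trans ?_ (setLIntegral_le_lintegral (⋃ l, Metric.ball (z l) ρ) _)
    rw [lintegral_iUnion (fun l => Metric.isOpen_ball.measurableSet) hdisj, tsum_fintype]
    have h7 : ∀ l ∈ Finset.univ, ENNReal.ofReal ((c / 2) ^ 2 * v) ≤ ∫⁻ x in Metric.ball (z l) ρ, ‖lfun h hs n x w‖ₑ ^ 2 := by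
      intro l _
      have h8 : ∫⁻ x in Metric.ball (z l) ρ, ENNReal.ofReal ((c / 2) ^ 2) ≤ ∫⁻ x in Metric.ball (z l) ρ, ‖lfun h hs n x w‖ₑ ^ 2 := by
        apply setLIntegral_mono' Metric.isOpen_ball.measurableSet
        intro x hx
        rw [← ofReal_norm, ← ENNReal.ofReal_pow (norm_nonneg _)]
        apply ENNReal.ofReal_le_ofReal
        have := hlow l x hx
        gcongr
      rw [setLIntegral_const, Measure.addHaar_ball_center, ← ENNReal.ofReal_toReal (measure_ball_lt_top (x := (0 : Rd d)) (r := ρ)).ne, ← hv, ← ENNReal.ofReal_mul (by positivity)] at h8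
      exact h8
    refine le_trans ?_ (Finset.sum_le_sum h7)
    rw [Finset.sum_const, Finset.card_univ, Fintype.card_fin, nsmul_eq_mul, ENNReal.ofReal_mul (by positivity)]
    simp
  have h9 := (ENNReal.ofReal_le_ofReal_iff (by positivity)).1 (h6.trans h5)
  rw [div_lt_iff₀ (by positivity)] at hN
  linarith

/-- Non-vanishing along normalised functions in the symmetric class. -/
theorem NV_sym [Fact (1 ≤ ENNReal.ofReal p)] (h : Comp s a b g) (hs : 0 < s) (hp : 2 < p) (hsd : (d : ℝ) * (1/2 - 1/p) < s)
    (T : Lp ℂ 2 (volume : Measure (Rd d)) →L[ℂ] Lp ℂ (ENNReal.ofReal p) (volume : Measure (Rd d)))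
    (hT : ∀ w, ⇑(T w) =ᵐ[volume] IF (Um g w)) {m : ℕ} (hd : 2 ≤ d) (hm : m = 0 ∨ (2 ≤ m ∧ m ≤ d / 2)) (a0 : ℝ) (ha0 : 0 < a0) :
    ∃ c : ℝ, 0 < c ∧ ∃ (R : ℝ) (n : ℕ), ∀ w ∈ HG d (Gm d m), ‖w‖ = 1 → a0 ≤ ‖T w‖ →
      ∃ w' ∈ HG d (Gm d m), ‖w'‖ = 1 ∧ ‖T w'‖ = ‖T w‖ ∧ ∃ y, ‖y‖ ≤ R ∧ c ≤ ‖lfun h hs.le n y w'‖ := by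
  obtain ⟨c, hc, n, hn⟩ := big_val h hs hp hsd T hT a0 ha0
  obtain ⟨R, hR⟩ := sym_bdd h hs.le hd hm hc n
  refine ⟨c, hc, R, n, fun w hw hw1 hTw => ?_⟩
  obtain ⟨y, hy⟩ := hn w hw1 hTw
  exact ⟨w, hw, hw1, rfl, y, hR w hw hw1 y hy, hy⟩

theorem NV_triv [Fact (1 ≤ ENNReal.ofReal p)] (h : Comp s a b g) (hs : 0 < s) (hp : 2 < p) (hsd : (d : ℝ) * (1/2 - 1/p) < s)
    (T : Lp ℂ 2 (volume : Measure (Rd d)) →L[ℂ] Lp ℂ (ENNReal.ofReal p) (volume : Measure (Rd d)))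
    (hT : ∀ w, ⇑(T w) =ᵐ[volume] IF (Um g w)) (a0 : ℝ) (ha0 : 0 < a0) :
    ∃ c : ℝ, 0 < c ∧ ∃ (R : ℝ) (n : ℕ), ∀ w ∈ HG d ∅, ‖w‖ = 1 → a0 ≤ ‖T w‖ →
      ∃ w' ∈ HG d ∅, ‖w'‖ = 1 ∧ ‖T w'‖ = ‖T w‖ ∧ ∃ y, ‖y‖ ≤ R ∧ c ≤ ‖lfun h hs.le n y w'‖ := by
  obtain ⟨c, hc, n, hn⟩ := big_val h hs hp hsd T hT a0 ha0
  refine ⟨c, hc, 0, n, fun w _ hw1 hTw => ?_⟩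
  obtain ⟨y, hy⟩ := hn w hw1 hTw
  have cm : Continuous fun ξ : Rd d => ch ⟪ξ, y⟫ := ch_cont.comp (by fun_prop)
  have hW : MemLp (fun ξ => ch ⟪ξ, y⟫ * w ξ) 2 volume :=
    (Lp.memLp w).mono (cm.aestronglyMeasurable.mul (Lp.aestronglyMeasurable w)) (Eventually.of_forall fun ξ => by rw [norm_mul, ch_norm, one_mul])
  have hco := hW.coeFn_toLp
  have hU : Um g (hW.toLp _) =ᵐ[volume] fun ξ => ch ⟪ξ, y⟫ * Um g w ξ := by
    refine (Um_congr hco).trans (Eventually.of_forall fun ξ => ?_)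
    simp only [Um]
    ring
  refine ⟨hW.toLp _, fun e he => absurd he (Set.notMem_empty e), ?_, ?_, 0, by simp, ?_⟩
  · rw [← hw1, Lp.norm_toLp, Lp.norm_def]
    congr 1
    apply eLpNorm_congr_norm_ae
    exact Eventually.of_forall fun ξ => by rw [norm_mul, ch_norm, one_mul]
  · rw [Lp.norm_def, Lp.norm_def]
    congr 1
    have mp : MeasurePreserving (fun x : Rd d => x + y) volume volume := measurePreserving_add_right volume y
    have hu := Um_memLp h hs.le (Lp.memLp w)
    rw [eLpNorm_congr_ae ((hT _).trans ((IF_congr hU).trans (IF_translate hu y))), eLpNorm_congr_ae (hT w)]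
    exact eLpNorm_comp_measurePreserving (IF_memLp hu).1 mp
  · refine hy.trans (le_of_eq ?_)
    rw [lfun_apply, lfun_apply, fourierInv_ch, fourierInv_ch]
    congr 1
    apply integral_congr_ae
    filter_upwards [hU] with ξ hξ
    have c0 : ch 0 = 1 := by simp [ch]
    rw [inner_zero_right, c0, one_mul]
    by_cases hm : ξ ∈ Metric.ball (0 : Rd d) n
    · rw [Set.indicator_of_mem hm, Set.indicator_of_mem hm, hξ]
    · rw [Set.indicator_of_notMem hm, Set.indicator_of_notMem hm, mul_zero]
end SB

section AM
variable {d : ℕ} {s a b p : ℝ} {g : ℝ → ℝ}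

theorem q_um (h : Comp s a b g) (hs : 0 ≤ s) {W : Rd d → ℂ} (hW : MemLp W 2 volume) :
    ∫ ξ, ‖Um g W ξ‖ ^ 2 * g ‖ξ‖ = (eLpNorm W 2 volume).toReal ^ 2 := by
  have h1 := QL_eq h (Um_memLp h hs hW) (Um_Hs h hs hW)
  rw [Um_QL h] at h1
  rw [← ENNReal.toReal_pow, h1, ENNReal.toReal_ofReal]
  exact integral_nonneg fun ξ => mul_nonneg (by positivity) (h.pos _).le

theorem exists_W (h : Comp s a b g) {G : Set (Rd d ≃ₗᵢ[ℝ] Rd d)} (u : HsFn d s) (hu : InvG G u.toFun) :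
    ∃ W : Rd d → ℂ, MemLp W 2 volume ∧ SymF G W ∧ Um g W = u.ft := by
  have hU : Um g (fun ξ => ((gm g ξ)⁻¹ : ℂ) * u.ft ξ) = u.ft := by
    ext ξ
    unfold Um
    have : (gm g ξ : ℂ) ≠ 0 := by exact_mod_cast (gm_pos h ξ).ne'
    field_simp
  refine ⟨fun ξ => ((gm g ξ)⁻¹ : ℂ) * u.ft ξ, ?_, ?_, hU⟩
  · have hm : AEStronglyMeasurable (fun ξ => ((gm g ξ)⁻¹ : ℂ) * u.ft ξ) volume :=
      (Complex.measurable_ofReal.comp (gm_meas h)).inv.aestronglyMeasurable.mul u.ft_memL2.1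
    rw [memLp_two_iff_integrable_sq_norm hm]
    refine (q_int h u.ft_memL2 u.memHs).congr (Eventually.of_forall fun ξ => ?_)
    have := Um_sq h (fun ξ => ((gm g ξ)⁻¹ : ℂ) * u.ft ξ) ξ
    rw [hU] at this
    exact this
  · exact (symF_of u.ft_memL2 (hs_IF u) hu).mul (w := fun ξ => ((gm g ξ)⁻¹ : ℂ)) (fun e _ x => by unfold gm; rw [e.norm_map])

set_option maxHeartbeats 1000000 in
theorem attain_main (h : Comp s a b g) (hs : 0 < s) (hp : 2 < p) (hsd : (d : ℝ) * (1/2 - 1/p) < s)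
    {G : Set (Rd d ≃ₗᵢ[ℝ] Rd d)} {P : (Rd d → ℂ) → Prop} (hP : ∀ f, P f ↔ InvG G f)
    (hne : (RayleighSet d s p g P).Nonempty) [Fact (1 ≤ ENNReal.ofReal p)]
    (hNV : ∀ T : Lp ℂ 2 (volume : Measure (Rd d)) →L[ℂ] Lp ℂ (ENNReal.ofReal p) (volume : Measure (Rd d)),
      (∀ w, ⇑(T w) =ᵐ[volume] IF (Um g w)) → ∀ a0 : ℝ, 0 < a0 →
      ∃ c : ℝ, 0 < c ∧ ∃ (R : ℝ) (n : ℕ), ∀ w ∈ HG d G, ‖w‖ = 1 → a0 ≤ ‖T w‖ →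
      ∃ w' ∈ HG d G, ‖w'‖ = 1 ∧ ‖T w'‖ = ‖T w‖ ∧ ∃ y, ‖y‖ ≤ R ∧ c ≤ ‖lfun h hs.le n y w'‖) :
    Attained d s p g P := by
  obtain ⟨T, hT⟩ := exists_T (d := d) h hs hp hsd
  have i1 := HG_complete d G
  have i2 := HG_sep d G
  obtain ⟨TH, hTH⟩ : ∃ TH : HG d G →L[ℂ] Lp ℂ (ENNReal.ofReal p) (volume : Measure (Rd d)), ∀ w : HG d G, TH w = T w :=
    ⟨T.comp (HG d G).subtypeL, fun w => rfl⟩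
  -- every admissible function comes from an element of the Hilbert space
  have key : ∀ u : HsFn d s, P u.toFun → ∃ w : HG d G, ‖w‖ ^ 2 = qeps g u ∧ ‖T w‖ = LpN p u.toFun := by
    intro u hu
    obtain ⟨W, hW, hG, hU⟩ := exists_W h u ((hP _).1 hu)
    have hm : hW.toLp W ∈ HG d G := (HG_mem _).2 (hG.congr hW.coeFn_toLp.symm)
    refine ⟨⟨_, hm⟩, ?_, ?_⟩
    · unfold qeps
      rw [← hU, q_um h hs.le hW, Submodule.coe_norm, Lp.norm_toLp]
    · rw [Lp.norm_def]
      unfold LpN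
      congr 1
      apply eLpNorm_congr_ae
      refine (hT _).trans ((IF_congr (Um_congr hW.coeFn_toLp)).trans ?_)
      rw [hU]
      exact (hs_IF u).symm
  have hT0 : TH ≠ 0 := by
    intro e
    obtain ⟨t, u, hu, h0, hm, -⟩ := hne
    obtain ⟨w, -, h2⟩ := key u hu
    have := LpN_pos hp h0 hm
    rw [← h2, ← hTH, e] at this
    simp at this
  have hN : 0 < ‖TH‖ := by
    refine lt_of_le_of_ne (ContinuousLinearMap.opNorm_nonneg TH) fun e => hT0 ?_
    ext1 w
    have := ContinuousLinearMap.le_opNorm TH w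
    rw [← e, zero_mul] at this
    exact norm_le_zero_iff.1 this
  have hsub : ‖(HG d G).subtypeL‖ ≤ 1 := ContinuousLinearMap.opNorm_le_bound _ zero_le_one (fun x => by simp)
  obtain ⟨w, hw0, hw⟩ := attain_abs hp TH (fun n x => (lfun h hs.le n x).comp (HG d G).subtypeL)
    (fun n => (lfun_cont h hs.le n).clm_comp continuous_const) (Cb := fun n => Vn d n * a ^ (-(1/2) : ℝ))
    (fun n x => by
      refine (ContinuousLinearMap.opNorm_comp_le _ _).trans ?_
      refine (mul_le_of_le_one_right (norm_nonneg _) hsub).trans (lfun_norm h hs.le n x))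
    (fun η hη => by
      obtain ⟨n, hn⟩ := T_Ap h hs hp hsd T hT η hη
      exact ⟨n, fun w => by rw [hTH]; exact hn w⟩) hT0
    (fun a0 ha0 => by
      obtain ⟨c, hc, R, n, hh⟩ := hNV T hT a0 ha0
      refine ⟨c, hc, R, n, fun w h1 h2 => ?_⟩
      obtain ⟨w', m', h3, h4, y, h5, h6⟩ := hh w w.2 h1 (by rw [← hTH]; exact h2)
      exact ⟨⟨w', m'⟩, h3, by rw [hTH, hTH]; exact h4, y, h5, h6⟩)
  rw [hTH] at hw
  have hwp : 0 < ‖w‖ := norm_pos_iff.2 hw0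
  have hU := Um_memLp h hs.le (Lp.memLp (w : Lp ℂ 2 (volume : Measure (Rd d))))
  have hsy : SymF G (w : Lp ℂ 2 (volume : Measure (Rd d))) := (HG_mem _).1 w.2
  obtain ⟨v, hv, hvG⟩ := exists_rep hU (Um_sym (g := g) hsy)
  have hH := Um_Hs h hs.le (Lp.memLp (w : Lp ℂ 2 (volume : Measure (Rd d))))
  have hvT : v =ᵐ[volume] ⇑(T w) := hv.trans (hT w).symm
  have e1 : qeps g (mkHs _ v hU hv hH) = ‖w‖ ^ 2 := by
    have := q_um h hs.le (Lp.memLp (w : Lp ℂ 2 (volume : Measure (Rd d))))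
    unfold qeps
    rw [Submodule.coe_norm, Lp.norm_def]
    exact this
  have e2 : LpN p v = ‖TH‖ * ‖w‖ := by
    rw [← hw, Lp.norm_def]
    unfold LpN
    rw [eLpNorm_congr_ae hvT]
  have hPv : P v := (hP v).2 hvG
  have hmv : MemLp v (ENNReal.ofReal p) volume := (memLp_congr_ae hvT).2 (Lp.memLp _)
  have hv0 : ¬ v =ᵐ[volume] (fun _ => (0 : ℂ)) := by
    intro e
    have : LpN p v = 0 := by
      unfold LpN
      rw [eLpNorm_congr_ae e]
      simp
    rw [e2] at this
    exact (mul_pos hN hwp).ne' this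
  refine ⟨mkHs _ v hU hv hH, hPv, hv0, hmv, ?_⟩
  apply le_antisymm
  · refine le_csInf hne ?_
    rintro t ⟨u, hu, h0, hm, rfl⟩
    obtain ⟨w2, h1, h2⟩ := key u hu
    have h3 := LpN_pos hp h0 hm
    have h4 : LpN p u.toFun ≤ ‖TH‖ * ‖w2‖ := by
      rw [← h2, ← hTH]
      exact ContinuousLinearMap.le_opNorm _ _
    rw [e1, ← h1]
    change ‖w‖ ^ 2 / LpN p v ^ 2 ≤ _
    rw [e2, div_le_div_iff₀ (by positivity) (by positivity)]
    have h5 : LpN p u.toFun ^ 2 ≤ (‖TH‖ * ‖w2‖) ^ 2 := pow_le_pow_left₀ h3.le h4 2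
    calc ‖w‖ ^ 2 * LpN p u.toFun ^ 2 ≤ ‖w‖ ^ 2 * (‖TH‖ * ‖w2‖) ^ 2 := by gcongr
      _ = _ := by ring
  · exact csInf_le (ray_bdd h P) ⟨mkHs _ v hU hv hH, hPv, hv0, hmv, rfl⟩

end AM

theorem finite_min (n : ℕ) (Q : ℕ → ℕ → Prop) (F : ℕ → ℕ → ℝ → Prop) (hmono : ∀ i j e e', e' ≤ e → F i j e → F i j e')
    (h : ∀ i j, Q i j → ∃ e : ℝ, 0 < e ∧ F i j e) : ∃ e : ℝ, 0 < e ∧ ∀ i ≤ n, ∀ j ≤ n, Q i j → F i j e := by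
  have h' : ∀ i j, ∃ e : ℝ, 0 < e ∧ (Q i j → F i j e) := fun i j => by
    by_cases hq : Q i j
    · obtain ⟨e, h1, h2⟩ := h i j hq
      exact ⟨e, h1, fun _ => h2⟩
    · exact ⟨1, one_pos, fun hh => absurd hh hq⟩
  choose e he hF using h'
  obtain ⟨S, hS⟩ : ∃ S : Finset (ℕ × ℕ), S = Finset.range (n+1) ×ˢ Finset.range (n+1) := ⟨_, rfl⟩
  have hne : S.Nonempty := ⟨(0,0), by simp [hS]⟩
  refine ⟨S.inf' hne (fun x => e x.1 x.2), ?_, ?_⟩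
  · rw [Finset.lt_inf'_iff]
    intro x _
    exact he _ _
  · intro i hi j hj hq
    refine hmono i j _ _ ?_ (hF i j hq)
    exact Finset.inf'_le (f := fun x : ℕ × ℕ => e x.1 x.2) (b := (i, j)) (by simp [hS]; omega)

/-- Theorem 1.1: the chain of strict inequalities between the Rayleigh
quotients `R^∘_ε(p) ∨ R^1_ε(p) < R^2_ε(p) < ⋯ < R^k_ε(p) < R^j_ε(p) (k < j ≤ ⌊d/2⌋)`,
`R^j_ε(p) ≤ R^rad_ε(p)`, `R^k_ε(p) < R^rad_ε(p) < ∞`, together with the attainment of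
`R^∘_ε(p)`, `R^rad_ε(p)` and of every `R^j_ε(p)`, `2 ≤ j ≤ ⌊d/2⌋`. -/
theorem stmt4 (d k : ℕ) (hd : 2 ≤ d) (hk1 : 1 ≤ k) (hk2 : k ≤ d / 2)
    (s γ p c C : ℝ)
    (hs : (d : ℝ) / ((d : ℝ) + 1) < s) (hγ : 1 < γ)
    (hp : 2 < p) (hpk : p < twoStarK d k)
    (hc : 0 < c) (hcC : c ≤ C) :
    ∃ ε₀ : ℝ, 0 < ε₀ ∧ ε₀ < 1 ∧
      ∀ g : ℝ → ℝ → ℝ, IsAdmissible s γ c C g →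
        ∀ ε : ℝ, 0 < ε → ε < ε₀ →
          (2 ≤ k →
            max (Rayleigh d s p (g ε) (fun _ => True))
                (Rayleigh d s p (g ε) (GkSymmetric d 1))
              < Rayleigh d s p (g ε) (GkSymmetric d 2)) ∧
          (∀ j : ℕ, 2 ≤ j → j < k →
            Rayleigh d s p (g ε) (GkSymmetric d j)
              < Rayleigh d s p (g ε) (GkSymmetric d (j + 1))) ∧
          (∀ j : ℕ, k < j → j ≤ d / 2 →
            Rayleigh d s p (g ε) (GkSymmetric d k)
              < Rayleigh d s p (g ε) (GkSymmetric d j)) ∧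
          (∀ j : ℕ, k < j → j ≤ d / 2 →
            Rayleigh d s p (g ε) (GkSymmetric d j) ≤ Rayleigh d s p (g ε) Radial) ∧
          Rayleigh d s p (g ε) (GkSymmetric d k) < Rayleigh d s p (g ε) Radial ∧
          (RayleighSet d s p (g ε) Radial).Nonempty ∧
          Attained d s p (g ε) (fun _ => True) ∧
          Attained d s p (g ε) Radial ∧
          (∀ j : ℕ, 2 ≤ j → j ≤ d / 2 → Attained d s p (g ε) (GkSymmetric d j)) := by
  have hd0 : (0:ℝ) < d := by exact_mod_cast (by omega : 0 < d)
  have hs0 : 0 < s := lt_trans (by positivity) hs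
  have hsd := sob_ok hd hk1 hk2 hp hpk hs
  obtain ⟨e2, h2, hm⟩ := finite_min d (fun j m => 1 ≤ j ∧ j ≤ k ∧ j < m ∧ m ≤ d / 2)
    (fun j m e => ∀ g, IsAdmissible s γ c C g → ∀ ε, 0 < ε → ε < e →
      Rayleigh d s p (g ε) (GkSymmetric d j) < Rayleigh d s p (g ε) (GkSymmetric d m))
    (fun i j e e' hee hF g hg ε h0 h1 => hF g hg ε h0 (h1.trans_le hee))
    (fun j m ⟨q1, q2, q3, q4⟩ => by
      obtain ⟨e, h1, -, h3⟩ := strict_ray hd hk1 hk2 hp hpk hs hγ hc hcC q1 q2 q3 q4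
      exact ⟨e, h1, h3⟩)
  obtain ⟨e1, h1, h1', hr⟩ := strict_rad hd hk1 hk2 hp hpk hs hγ hc hcC
  refine ⟨min e1 e2, lt_min h1 h2, (min_le_left _ _).trans_lt h1', ?_⟩
  intro g hg ε h0 hε
  have hε1 : ε < e1 := hε.trans_le (min_le_left _ _)
  have hε2 : ε < e2 := hε.trans_le (min_le_right _ _)
  have hmm : ∀ j m, 1 ≤ j → j ≤ k → j < m → m ≤ d / 2 →
      Rayleigh d s p (g ε) (GkSymmetric d j) < Rayleigh d s p (g ε) (GkSymmetric d m) :=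
    fun j m q1 q2 q3 q4 => hm j (by omega) m (by omega) ⟨q1, q2, q3, q4⟩ g hg ε h0 hε2
  obtain ⟨a, b, h⟩ := adm_comp hs0 hγ hc hcC hg h0 (hε1.trans h1')
  have hfact : Fact (1 ≤ ENNReal.ofReal p) := ⟨by
    rw [← ENNReal.ofReal_one]; exact ENNReal.ofReal_le_ofReal (by linarith)⟩
  have hne : ∀ P : (Rd d → ℂ) → Prop, (∀ f, Radial f → P f) → (RayleighSet d s p (g ε) P).Nonempty :=
    fun P hP => ray_ne h hp hsd hP
  refine ⟨fun hk => ?_, fun j hj1 hj2 => ?_, fun j hj1 hj2 => ?_, fun j hj1 hj2 => ?_, ?_, ?_, ?_, ?_, fun j hj1 hj2 => ?_⟩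
  · have hA := hmm 1 2 le_rfl hk1 (by omega) (by omega)
    refine max_lt (lt_of_le_of_lt ?_ hA) hA
    exact ray_mono h (fun _ _ => trivial) (hne _ (radial_gk 1))
  · exact hmm _ _ (by omega) (by omega) (by omega) (by omega)
  · exact hmm _ _ hk1 le_rfl hj1 hj2
  · exact ray_mono h (radial_gk j) (hne _ fun _ hf => hf)
  · exact hr g hg ε h0 hε1
  · exact hne _ fun _ hf => hf
  · exact attain_main h hs0 hp hsd (G := ∅) (fun f => ⟨fun _ e he => absurd he (Set.notMem_empty e), fun _ => trivial⟩)
      (hne _ fun _ _ => trivial) (fun T hT a0 ha0 => NV_triv h hs0 hp hsd T hT a0 ha0)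
  · exact attain_main h hs0 hp hsd (G := Gm d 0) (fun f => (radial_iff f).trans (gk_iff f))
      (hne _ fun _ hf => hf) (fun T hT a0 ha0 => NV_sym h hs0 hp hsd T hT hd (Or.inl rfl) a0 ha0)
  · exact attain_main h hs0 hp hsd (G := Gm d j) (fun f => gk_iff f)
      (hne _ (radial_gk j)) (fun T hT a0 ha0 => NV_sym h hs0 hp hsd T hT hd (Or.inr ⟨hj1, hj2⟩) a0 ha0)
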